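/- For every fixed odd κ ≥ 3, with H the cycle of length κ: max over p ∈ [0,1] of P(G_{n,p} ∈ Q_H ∖ T_H) tends to 0 as n → ∞. -/

import Mathlib

open Finset SimpleGraph Filter Topology

noncomputable section
open scoped Classical

namespace RG

variable {α β V : Type*}

/-- The number of edges of a graph. -/
def eCount (H : SimpleGraph α) : ℕ := Nat.card ↥H.edgeSet

/-- The number of automorphisms of a graph. -/
def autCount (H : SimpleGraph α) : ℕ := Nat.card (H ≃g H)

/-- Every vertex has even degree. -/
def IsEulerianGraph (H : SimpleGraph α) : Prop :=
  ∀ v, Even (Nat.card ↥(H.neighborSet v))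

/-- Vectors in the ambient 𝔽₂ edge space on the vertex type `V`. -/
abbrev EdgeVec (V : Type*) := Sym2 V → ZMod 2

/-- Indicator vector of a set of edges. -/
def setVec (s : Set (Sym2 V)) : EdgeVec V := fun e => if e ∈ s then 1 else 0

/-- The support (set of edges) of an edge-space vector. -/
def suppSet (f : EdgeVec V) : Set (Sym2 V) := {e | f e ≠ 0}

/-- The number of edges of an edge-space vector. -/
def wt (f : EdgeVec V) : ℕ := Nat.card ↥(suppSet f)

/-- The edge space `E(G)`: the span of the indicators of single edges of `G`,
i.e. all vectors supported on `E(G)`. -/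
def edgeSpace (G : SimpleGraph V) : Submodule (ZMod 2) (EdgeVec V) :=
  Submodule.span (ZMod 2) {f | ∃ e ∈ G.edgeSet, f = setVec {e}}

/-- The mod-2 degree of the vertex `v` in an edge-space vector. -/
def parityMap [Fintype V] [DecidableEq V] (v : V) : EdgeVec V →ₗ[ZMod 2] ZMod 2 where
  toFun f := ∑ w ∈ Finset.univ.erase v, f s(v, w)
  map_add' f g := by simp [Finset.sum_add_distrib]
  map_smul' c f := by simp [Finset.mul_sum, mul_sub]

/-- The cycle space `C(G)`: members of `E(G)` in which every vertex has even degree. -/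
def cycleSpace [Fintype V] [DecidableEq V] (G : SimpleGraph V) :
    Submodule (ZMod 2) (EdgeVec V) :=
  edgeSpace G ⊓ ⨅ v : V, LinearMap.ker (parityMap v)

/-- The mod-2 total number of edges of an edge-space vector. -/
def totalMap [Fintype V] [DecidableEq V] : EdgeVec V →ₗ[ZMod 2] ZMod 2 where
  toFun f := ∑ e, f e
  map_add' f g := by simp [Finset.sum_add_distrib]
  map_smul' c f := by simp [Finset.mul_sum, mul_sub]

/-- The space `D(G)` of even-size members of `E(G)`. -/
def dSpace [Fintype V] [DecidableEq V] (G : SimpleGraph V) :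
    Submodule (ZMod 2) (EdgeVec V) :=
  edgeSpace G ⊓ LinearMap.ker (totalMap (V := V))

/-- The `H`-space `C_H(G)`: the span of the (indicators of the edge sets of) copies of `H`
in `G`. -/
def hSpace (H : SimpleGraph α) (G : SimpleGraph V) : Submodule (ZMod 2) (EdgeVec V) :=
  Submodule.span (ZMod 2)
    {f | ∃ K : G.Subgraph, Nonempty (H ≃g K.coe) ∧ f = setVec K.edgeSet}

/-- `W_H(G)`, the natural candidate value of `C_H(G)`. -/
def wSpace [Fintype V] [DecidableEq V] (H : SimpleGraph α) (G : SimpleGraph V) :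
    Submodule (ZMod 2) (EdgeVec V) :=
  if IsEulerianGraph H then
    if Odd (eCount H) then cycleSpace G else cycleSpace G ⊓ dSpace G
  else
    if Odd (eCount H) then edgeSpace G else dSpace G

/-- `G ∈ T_H` : the `H`-space equals its natural value. -/
def memT [Fintype V] [DecidableEq V] (H : SimpleGraph α) (G : SimpleGraph V) : Prop :=
  hSpace H G = wSpace H G

/-- `G ∈ Q_H` : every edge of `G` lies in a copy of `H`. -/
def memQ (H : SimpleGraph α) (G : SimpleGraph V) : Prop :=
  ∀ e ∈ G.edgeSet, ∃ K : G.Subgraph, Nonempty (H ≃g K.coe) ∧ e ∈ K.edgeSet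

/-- The standard 𝔽₂ inner product `⟨f,g⟩ = |f ∩ g| mod 2`. -/
def ip [Fintype V] [DecidableEq V] (f g : EdgeVec V) : ZMod 2 := ∑ e, f e * g e

/-- The orthogonal complement of `S` inside the edge space of `G`. -/
def perpIn [Fintype V] [DecidableEq V] (G : SimpleGraph V)
    (S : Submodule (ZMod 2) (EdgeVec V)) : Set (EdgeVec V) :=
  {f | f ∈ edgeSpace G ∧ ∀ g ∈ S, ip f g = 0}

/-- The probability that the Erdős–Rényi random graph `G_{n,p}` lies in the set `A`. -/
def erProb (n : ℕ) (p : ℝ) (A : Set (SimpleGraph (Fin n))) : ℝ :=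
  ∑ s ∈ (⊤ : SimpleGraph (Fin n)).edgeFinset.powerset,
    if SimpleGraph.fromEdgeSet (↑s) ∈ A then
      p ^ s.card * (1 - p) ^ ((⊤ : SimpleGraph (Fin n)).edgeFinset.card - s.card)
    else 0

/-- `(e-1)/(v-2)` when `v ≥ 3`, and `0` otherwise. -/
def density2 (v e : ℕ) : ℝ := if 3 ≤ v then ((e : ℝ) - 1) / ((v : ℝ) - 2) else 0

/-- The 2-density `d₂(H)`. -/
def d2 (H : SimpleGraph α) : ℝ := density2 (Nat.card α) (eCount H)

/-- The 2-density of a subgraph. -/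
def subDensity2 {H : SimpleGraph α} (K : H.Subgraph) : ℝ :=
  density2 (Nat.card ↥K.verts) (Nat.card ↥K.edgeSet)

/-- The maximum 2-density `m₂(H)`. -/
def m2 (H : SimpleGraph α) : ℝ := sSup {x : ℝ | ∃ K : H.Subgraph, x = subDensity2 K}

/-- `H` is strictly 2-balanced. -/
def Strictly2Balanced (H : SimpleGraph α) : Prop :=
  3 ≤ Nat.card α ∧ ∀ K : H.Subgraph, K ≠ ⊤ → subDensity2 K < d2 H

/-- `ϱ(H) = Σ_{(a,b)} 1/aut(H;a,b) = 2·e_H/aut(H)`. -/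
def rho (H : SimpleGraph α) : ℝ := 2 * (eCount H : ℝ) / (autCount H : ℝ)

/-- The sharp threshold `p*_H(n)` for `Q_H`. -/
def pStar (H : SimpleGraph α) (n : ℕ) : ℝ :=
  (n : ℝ) ^ (-(1 / m2 H)) *
    ((2 - 1 / m2 H) * (rho H)⁻¹ * Real.log n) ^ (1 / ((eCount H : ℝ) - 1))

/-- `Λ^p = ϱ(H)·(n-2)_{v_H-2}·p^{e_H-1}`, the expected number of copies of `H` on a
fixed edge. -/
def Lambda (H : SimpleGraph α) (n : ℕ) (p : ℝ) : ℝ :=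
  rho H * ((n - 2).descFactorial (Nat.card α - 2) : ℝ) * p ^ (eCount H - 1)

/-- `H` is isomorphic neither to the two-edge path nor to the triangle. -/
def NotPathOrTriangle (H : SimpleGraph α) : Prop :=
  ¬ Nonempty (H ≃g SimpleGraph.pathGraph 3) ∧ ¬ Nonempty (H ≃g (⊤ : SimpleGraph (Fin 3)))

/-! ### Bridges -/

/-- `G` together with the edge `xy`. -/
def bridgeHost (G : SimpleGraph V) (x y : V) : SimpleGraph V :=
  G ⊔ SimpleGraph.fromEdgeSet {s(x, y)}

/-- A copy of `H` in `G ∪ {xy}` containing the edge `xy`; such copies correspond to the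
`xy`-bridges `K - xy` of `G`. -/
def IsBridgeCopy (H : SimpleGraph α) (G : SimpleGraph V) (x y : V)
    (K : (bridgeHost G x y).Subgraph) : Prop :=
  Nonempty (H ≃g K.coe) ∧ s(x, y) ∈ K.edgeSet

/-- `τ_G(x,y)`: the number of `xy`-bridges in `G`. -/
def tauB (H : SimpleGraph α) (G : SimpleGraph V) (x y : V) : ℕ :=
  Nat.card {K : (bridgeHost G x y).Subgraph // IsBridgeCopy H G x y K}

/-- `σ_G(x,y)`: the maximum size of a family of internally disjoint `xy`-bridges in `G`. -/
def sigmaB (H : SimpleGraph α) (G : SimpleGraph V) (x y : V) : ℕ :=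
  sSup {m | ∃ T : Finset ((bridgeHost G x y).Subgraph),
    (∀ K ∈ T, IsBridgeCopy H G x y K) ∧
    (∀ K ∈ T, ∀ K' ∈ T, K ≠ K' → (K.verts ∩ K'.verts : Set V) ⊆ {x, y}) ∧ T.card = m}

/-- An `S`-central `xy`-bridge: the bridge contains an odd number of edges of `S`, at
least one of which misses `{x,y}`. -/
def IsCentralBridge (H : SimpleGraph α) (G : SimpleGraph V) (S : Set (Sym2 V)) (x y : V)
    (K : (bridgeHost G x y).Subgraph) : Prop :=
  IsBridgeCopy H G x y K ∧
  Odd (Nat.card {e : Sym2 V // e ∈ K.edgeSet ∧ e ≠ s(x, y) ∧ e ∈ S}) ∧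
  ∃ e ∈ K.edgeSet, e ∈ S ∧ x ∉ e ∧ y ∉ e

/-- `σ_G(xy; S)`: the maximum size of a family of internally disjoint `S`-central
`xy`-bridges in `G`. -/
def sigmaCentral (H : SimpleGraph α) (G : SimpleGraph V) (S : Set (Sym2 V)) (x y : V) : ℕ :=
  sSup {m | ∃ T : Finset ((bridgeHost G x y).Subgraph),
    (∀ K ∈ T, IsCentralBridge H G S x y K) ∧
    (∀ K ∈ T, ∀ K' ∈ T, K ≠ K' → (K.verts ∩ K'.verts : Set V) ⊆ {x, y}) ∧ T.card = m}

/-! ### Extensions `[W,Z]` -/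

/-- The adjacency relation of the pair `[W,Z]` in `F`: edges of `F[Z]` which do not lie
inside `W`. -/
def PairAdj (F : SimpleGraph β) (W Z : Set β) (a b : ↥Z) : Prop :=
  F.Adj (a : β) (b : β) ∧ ¬((a : β) ∈ W ∧ (b : β) ∈ W)

/-- `v(W,Z)`: the number of internal vertices of `[W,Z]`. -/
def vWZ (W Z : Set β) : ℕ := Nat.card ↥(Z \ W)

/-- `e(W,Z)`: the number of edges of `[W,Z]`. -/
def eWZ (F : SimpleGraph β) (W Z : Set β) : ℕ :=
  Nat.card {q : Sym2 β // q ∈ F.edgeSet ∧ (∀ a ∈ q, a ∈ Z) ∧ ¬(∀ a ∈ q, a ∈ W)}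

/-- `d(W,Z) = e(W,Z)/v(W,Z)`. -/
def dWZ (F : SimpleGraph β) (W Z : Set β) : ℝ := (eWZ F W Z : ℝ) / (vWZ W Z : ℝ)

/-- `[W,Z]` is strictly balanced. -/
def StrictlyBalancedWZ (F : SimpleGraph β) (W Z : Set β) : Prop :=
  ∀ Y : Set β, W ⊂ Y → Y ⊂ Z → dWZ F W Y < dWZ F W Z

/-- `m(W,Z) = max{d(W,Y) : W ⊊ Y ⊆ Z}`. -/
def mWZ (F : SimpleGraph β) (W Z : Set β) : ℝ :=
  sSup {x : ℝ | ∃ Y : Set β, W ⊂ Y ∧ Y ⊆ Z ∧ x = dWZ F W Y}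

/-- `aut[W,Z]`: the number of automorphisms of `[W,Z]` fixing `W` pointwise. -/
def autWZ (F : SimpleGraph β) (W Z : Set β) : ℕ :=
  Nat.card {γ : ↥Z ≃ ↥Z // (∀ w : ↥Z, (w : β) ∈ W → γ w = w) ∧
    ∀ a b : ↥Z, PairAdj F W Z a b ↔ PairAdj F W Z (γ a) (γ b)}

/-- `μ_p(W,Z) = n^{v(W,Z)}·p^{e(W,Z)}/aut[W,Z]`. -/
def muWZ (F : SimpleGraph β) (W Z : Set β) (n : ℕ) (p : ℝ) : ℝ :=
  (n : ℝ) ^ (vWZ W Z) * p ^ (eWZ F W Z) / (autWZ F W Z : ℝ)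

/-- A `[W,Z]`-extension on the tuple `x` in `G`. -/
def IsExt (F : SimpleGraph β) (W Z : Set β) (G : SimpleGraph V) (x : ↥W → V)
    (ψ : ↥Z → V) : Prop :=
  Function.Injective ψ ∧
  (∀ (w : ↥Z) (hw : (w : β) ∈ W), ψ w = x ⟨(w : β), hw⟩) ∧
  ∀ a b : ↥Z, PairAdj F W Z a b → G.Adj (ψ a) (ψ b)

/-- The data (internal vertex image, edge image) of an extension; two extensions are
equivalent (give the same copy) iff they have the same data. -/
def extData (F : SimpleGraph β) (W Z : Set β) (ψ : ↥Z → V) : Set V × Set (Sym2 V) :=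
  (ψ '' {z : ↥Z | (z : β) ∉ W},
   {q | ∃ a b : ↥Z, PairAdj F W Z a b ∧ q = s(ψ a, ψ b)})

/-- The set of copies of `[W,Z]` on `x` in `G`. -/
def copySet (F : SimpleGraph β) (W Z : Set β) (G : SimpleGraph V) (x : ↥W → V) :
    Set (Set V × Set (Sym2 V)) :=
  {d | ∃ ψ : ↥Z → V, IsExt F W Z G x ψ ∧ extData F W Z ψ = d}

/-- `τ_{[W,Z]}(G,X)`: the number of copies of `[W,Z]` on `x` in `G`. -/
def tauExt (F : SimpleGraph β) (W Z : Set β) (G : SimpleGraph V) (x : ↥W → V) : ℕ :=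
  Nat.card ↥(copySet F W Z G x)

/-- `σ_{[W,Z]}(G,X)`: the maximum size of a family of internally disjoint copies of
`[W,Z]` on `x` in `G`. -/
def sigmaExt (F : SimpleGraph β) (W Z : Set β) (G : SimpleGraph V) (x : ↥W → V) : ℕ :=
  sSup {m | ∃ T : Finset (Set V × Set (Sym2 V)),
    (↑T : Set (Set V × Set (Sym2 V))) ⊆ copySet F W Z G x ∧
    (∀ d ∈ T, ∀ d' ∈ T, d ≠ d' → d.1 ∩ d'.1 = ∅) ∧ T.card = m}

/-- `φ(x) = (1+x)log(1+x) - x` for `x > -1`, with `φ(-1) = 1`. -/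
def phiFn (x : ℝ) : ℝ := if x = -1 then 1 else (1 + x) * Real.log (1 + x) - x

set_option linter.all false

/-! ### Finite product probability -/

/-- Indicator of a proposition. -/
def ind (P : Prop) : ℝ := if P then 1 else 0

lemma ind_true {P : Prop} (h : P) : ind P = 1 := by simp [ind, h]
lemma ind_false {P : Prop} (h : ¬ P) : ind P = 0 := by simp [ind, h]
lemma ind_nonneg (P : Prop) : 0 ≤ ind P := by unfold ind; split_ifs <;> norm_num
lemma ind_le_one (P : Prop) : ind P ≤ 1 := by unfold ind; split_ifs <;> norm_num
lemma ind_mono {P Q : Prop} (h : P → Q) : ind P ≤ ind Q := by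
  by_cases hP : P
  · rw [ind_true hP, ind_true (h hP)]
  · rw [ind_false hP]; exact ind_nonneg _
lemma ind_and (P Q : Prop) : ind (P ∧ Q) = ind P * ind Q := by
  unfold ind; by_cases hP : P <;> by_cases hQ : Q <;> simp [hP, hQ]
lemma ind_not (P : Prop) : ind (¬ P) = 1 - ind P := by
  unfold ind; by_cases hP : P <;> simp [hP]

section
variable [DecidableEq α]

/-- Expectation over the random subset of `E` of density `p`. -/
def ex (E : Finset α) (p : ℝ) (f : Finset α → ℝ) : ℝ :=
  ∑ s ∈ E.powerset, p ^ s.card * (1 - p) ^ (E.card - s.card) * f s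

/-- Probability. -/
def pr (E : Finset α) (p : ℝ) (A : Finset α → Prop) : ℝ := ex E p (fun s => ind (A s))

lemma ex_empty (p : ℝ) (f : Finset α → ℝ) : ex ∅ p f = f ∅ := by simp [ex]

lemma ex_congr {E : Finset α} {p : ℝ} {f g : Finset α → ℝ} (h : ∀ s ⊆ E, f s = g s) :
    ex E p f = ex E p g := by
  unfold ex
  exact Finset.sum_congr rfl (fun s hs => by rw [h s (Finset.mem_powerset.1 hs)])

lemma ex_insert {E : Finset α} {a : α} (ha : a ∉ E) (p : ℝ) (f : Finset α → ℝ) :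
    ex (insert a E) p f = (1 - p) * ex E p f + p * ex E p (fun s => f (insert a s)) := by
  unfold ex
  rw [Finset.sum_powerset_insert ha, Finset.mul_sum, Finset.mul_sum]
  congr 1
  · refine Finset.sum_congr rfl (fun s hs => ?_)
    have hs' := Finset.mem_powerset.1 hs
    have := Finset.card_le_card hs'
    rw [Finset.card_insert_of_notMem ha, show E.card + 1 - s.card = (E.card - s.card) + 1 by omega,
      pow_succ]
    ring
  · refine Finset.sum_congr rfl (fun s hs => ?_)
    have hs' := Finset.mem_powerset.1 hs
    rw [Finset.card_insert_of_notMem ha, Finset.card_insert_of_notMem (fun h => ha (hs' h)),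
      show E.card + 1 - (s.card + 1) = (E.card - s.card) by omega, pow_succ]
    ring

lemma ex_add (E : Finset α) (p : ℝ) (f g : Finset α → ℝ) :
    ex E p (fun s => f s + g s) = ex E p f + ex E p g := by
  unfold ex; rw [← Finset.sum_add_distrib]; exact Finset.sum_congr rfl (fun s _ => by ring)

lemma ex_sub (E : Finset α) (p : ℝ) (f g : Finset α → ℝ) :
    ex E p (fun s => f s - g s) = ex E p f - ex E p g := by
  unfold ex; rw [← Finset.sum_sub_distrib]; exact Finset.sum_congr rfl (fun s _ => by ring)

lemma ex_mul_left (E : Finset α) (p c : ℝ) (f : Finset α → ℝ) :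
    ex E p (fun s => c * f s) = c * ex E p f := by
  unfold ex; rw [Finset.mul_sum]; exact Finset.sum_congr rfl (fun s _ => by ring)

lemma ex_mul_right (E : Finset α) (p c : ℝ) (f : Finset α → ℝ) :
    ex E p (fun s => f s * c) = ex E p f * c := by
  unfold ex; rw [Finset.sum_mul]; exact Finset.sum_congr rfl (fun s _ => by ring)

lemma ex_sum {ι : Type*} (E : Finset α) (p : ℝ) (I : Finset ι) (f : ι → Finset α → ℝ) :
    ex E p (fun s => ∑ i ∈ I, f i s) = ∑ i ∈ I, ex E p (f i) := by
  unfold ex; rw [Finset.sum_comm]; exact Finset.sum_congr rfl (fun s _ => by rw [Finset.mul_sum])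

lemma ex_const (E : Finset α) (p c : ℝ) : ex E p (fun _ => c) = c := by
  induction E using Finset.induction_on with
  | empty => simp [ex]
  | insert a E ha ih => rw [ex_insert ha, ih]; ring

lemma ex_mono {E : Finset α} {p : ℝ} (h0 : 0 ≤ p) (h1 : p ≤ 1) {f g : Finset α → ℝ}
    (h : ∀ s ⊆ E, f s ≤ g s) : ex E p f ≤ ex E p g := by
  unfold ex
  refine Finset.sum_le_sum (fun s hs => ?_)
  have : 0 ≤ 1 - p := by linarith
  exact mul_le_mul_of_nonneg_left (h s (Finset.mem_powerset.1 hs)) (by positivity)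

lemma ex_nonneg {E : Finset α} {p : ℝ} (h0 : 0 ≤ p) (h1 : p ≤ 1) {f : Finset α → ℝ}
    (h : ∀ s ⊆ E, 0 ≤ f s) : 0 ≤ ex E p f := by
  have := ex_mono (E := E) h0 h1 h
  rwa [ex_const] at this

lemma ex_le_const {E : Finset α} {p : ℝ} (h0 : 0 ≤ p) (h1 : p ≤ 1) {f : Finset α → ℝ} {c : ℝ}
    (h : ∀ s ⊆ E, f s ≤ c) : ex E p f ≤ c := by
  have := ex_mono (E := E) h0 h1 h
  rwa [ex_const] at this

lemma exists_of_le_ex {E : Finset α} {p : ℝ} (h0 : 0 ≤ p) (h1 : p ≤ 1) {f : Finset α → ℝ} {c : ℝ}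
    (h : c ≤ ex E p f) : ∃ s ⊆ E, c ≤ f s := by
  obtain ⟨s, hs, hm⟩ := Finset.exists_max_image E.powerset f ⟨∅, by simp⟩
  refine ⟨s, Finset.mem_powerset.1 hs, h.trans (ex_le_const h0 h1 fun t ht => ?_)⟩
  exact hm t (Finset.mem_powerset.2 ht)

lemma ex_union {E₁ E₂ : Finset α} (h : Disjoint E₁ E₂) (p : ℝ) (f : Finset α → ℝ) :
    ex (E₁ ∪ E₂) p f = ex E₁ p (fun s => ex E₂ p (fun t => f (s ∪ t))) := by
  induction E₁ using Finset.induction_on generalizing f with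
  | empty => simp [ex_empty]
  | insert a E ha ih =>
    rw [Finset.disjoint_insert_left] at h
    rw [Finset.insert_union, ex_insert (by simp [ha, h.1]), ex_insert ha, ih h.2, ih h.2]
    simp only [Finset.insert_union]

lemma ex_split {E T : Finset α} (h : T ⊆ E) (p : ℝ) (f : Finset α → ℝ) :
    ex E p f = ex (E \ T) p (fun s => ex T p (fun t => f (s ∪ t))) := by
  rw [← ex_union Finset.sdiff_disjoint, Finset.sdiff_union_of_subset h]

lemma ex_local {E T : Finset α} (h : T ⊆ E) (p : ℝ) {f : Finset α → ℝ}
    (hf : ∀ s ⊆ E \ T, ∀ t ⊆ T, f (s ∪ t) = f s) : ex E p f = ex (E \ T) p f := by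
  rw [ex_split h]
  refine ex_congr fun s hs => ?_
  rw [ex_congr (fun t ht => hf s hs t ht), ex_const]

lemma ex_top (T : Finset α) (p : ℝ) (f : Finset α → ℝ) :
    ex T p (fun s => ind (T ⊆ s) * f s) = p ^ T.card * f T := by
  induction T using Finset.induction_on generalizing f with
  | empty => simp [ex_empty, ind]
  | insert a E ha ih =>
    rw [ex_insert ha]
    have h1 : ex E p (fun s => ind (insert a E ⊆ s) * f s) = 0 := by
      rw [ex_congr (g := fun _ => 0), ex_const]
      intro s hs
      rw [ind_false, zero_mul]
      exact fun h => ha (hs (h (Finset.mem_insert_self _ _)))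
    have h2 : ex E p (fun s => ind (insert a E ⊆ insert a s) * f (insert a s))
        = p ^ E.card * f (insert a E) := by
      rw [← ih (fun s => f (insert a s))]
      refine ex_congr fun s hs => ?_
      congr 2
      rw [eq_iff_iff]
      constructor
      · intro h x hx
        have := h (Finset.mem_insert_of_mem hx)
        rcases Finset.mem_insert.1 this with h | h
        · exact absurd (h ▸ hx) ha
        · exact h
      · exact fun h => Finset.insert_subset_insert a h
    rw [h1, h2, Finset.card_insert_of_notMem ha]; ring

lemma ex_superset {E T : Finset α} (h : T ⊆ E) (p : ℝ) (f : Finset α → ℝ) :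
    ex E p (fun s => ind (T ⊆ s) * f s) = p ^ T.card * ex (E \ T) p (fun s => f (s ∪ T)) := by
  rw [ex_split h, ← ex_mul_left]
  refine ex_congr fun s hs => ?_
  rw [← ex_top T p (fun t => f (s ∪ t))]
  refine ex_congr fun t ht => ?_
  congr 2
  rw [eq_iff_iff]
  constructor
  · intro h x hx
    rcases Finset.mem_union.1 (h hx) with h' | h'
    · exact absurd hx (Finset.mem_sdiff.1 (hs h')).2
    · exact h'
  · exact fun h => h.trans Finset.subset_union_right

lemma pr_superset {E T : Finset α} (h : T ⊆ E) (p : ℝ) : pr E p (fun s => T ⊆ s) = p ^ T.card := by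
  have := ex_superset h p (fun _ => 1)
  simpa [ex_const, pr] using this

lemma pr_nonneg {E : Finset α} {p : ℝ} (h0 : 0 ≤ p) (h1 : p ≤ 1) (A : Finset α → Prop) :
    0 ≤ pr E p A := ex_nonneg h0 h1 fun _ _ => ind_nonneg _

lemma pr_le_one {E : Finset α} {p : ℝ} (h0 : 0 ≤ p) (h1 : p ≤ 1) (A : Finset α → Prop) :
    pr E p A ≤ 1 := ex_le_const h0 h1 fun _ _ => ind_le_one _

lemma pr_mono {E : Finset α} {p : ℝ} (h0 : 0 ≤ p) (h1 : p ≤ 1) {A B : Finset α → Prop}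
    (h : ∀ s ⊆ E, A s → B s) : pr E p A ≤ pr E p B :=
  ex_mono h0 h1 fun s hs => ind_mono (h s hs)

lemma pr_exists_le {ι : Type*} {E : Finset α} {p : ℝ} (h0 : 0 ≤ p) (h1 : p ≤ 1) (I : Finset ι)
    (A : ι → Finset α → Prop) :
    pr E p (fun s => ∃ i ∈ I, A i s) ≤ ∑ i ∈ I, pr E p (A i) := by
  unfold pr
  rw [← ex_sum]
  refine ex_mono h0 h1 fun s _ => ?_
  by_cases h : ∃ i ∈ I, A i s
  · rw [ind_true h]
    obtain ⟨i, hi, hA⟩ := h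
    rw [← ind_true hA]
    exact Finset.single_le_sum (f := fun i => ind (A i s)) (fun _ _ => ind_nonneg _) hi
  · rw [ind_false h]; exact Finset.sum_nonneg fun _ _ => ind_nonneg _

lemma pr_or_le {E : Finset α} {p : ℝ} (h0 : 0 ≤ p) (h1 : p ≤ 1)
    (A B : Finset α → Prop) :
    pr E p (fun s => A s ∨ B s) ≤ pr E p A + pr E p B := by
  unfold pr
  rw [← ex_add]
  refine ex_mono h0 h1 fun s _ => ?_
  unfold ind; by_cases hA : A s <;> by_cases hB : B s <;> simp [hA, hB]

lemma pr_markov {E : Finset α} {p : ℝ} (h0 : 0 ≤ p) (h1 : p ≤ 1) {f : Finset α → ℝ} {c : ℝ}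
    (hf : ∀ s ⊆ E, 0 ≤ f s) (hc : 0 < c) : pr E p (fun s => c ≤ f s) ≤ ex E p f / c := by
  rw [le_div_iff₀ hc, pr, ← ex_mul_right]
  refine ex_mono h0 h1 fun s hs => ?_
  by_cases h : c ≤ f s
  · rw [ind_true h]; linarith
  · rw [ind_false h]; linarith [hf s hs]

lemma harris {E : Finset α} {p : ℝ} (h0 : 0 ≤ p) (h1 : p ≤ 1) {f g : Finset α → ℝ}
    (hf : Monotone f) (hg : Monotone g) :
    ex E p f * ex E p g ≤ ex E p (fun s => f s * g s) := by
  induction E using Finset.induction_on generalizing f g with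
  | empty => simp [ex_empty]
  | insert a E ha ih =>
    rw [ex_insert ha, ex_insert ha, ex_insert ha]
    have hf' : Monotone (fun s : Finset α => f (insert a s)) :=
      fun s t h => hf (Finset.insert_subset_insert a h)
    have hg' : Monotone (fun s : Finset α => g (insert a s)) :=
      fun s t h => hg (Finset.insert_subset_insert a h)
    have i1 := ih hf hg
    have i2 := ih hf' hg'
    have j1 : ex E p f ≤ ex E p (fun s => f (insert a s)) :=
      ex_mono h0 h1 fun s _ => hf (Finset.subset_insert _ _)
    have j2 : ex E p g ≤ ex E p (fun s => g (insert a s)) :=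
      ex_mono h0 h1 fun s _ => hg (Finset.subset_insert _ _)
    set a0 := ex E p f
    set b0 := ex E p g
    set a1 := ex E p (fun s => f (insert a s))
    set b1 := ex E p (fun s => g (insert a s))
    have : 0 ≤ p * (1 - p) * ((a1 - a0) * (b1 - b0)) :=
      mul_nonneg (mul_nonneg h0 (by linarith)) (mul_nonneg (by linarith) (by linarith))
    have k1 := mul_le_mul_of_nonneg_left i1 (show 0 ≤ 1 - p by linarith)
    have k2 := mul_le_mul_of_nonneg_left i2 h0
    nlinarith

lemma harris_anti {E : Finset α} {p : ℝ} (h0 : 0 ≤ p) (h1 : p ≤ 1) {f g : Finset α → ℝ}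
    (hf : Antitone f) (hg : Antitone g) :
    ex E p f * ex E p g ≤ ex E p (fun s => f s * g s) := by
  have := harris (E := E) h0 h1 (f := fun s => (-1) * f s) (g := fun s => (-1) * g s)
    (fun s t h => by have := hf h; simp only; linarith)
    (fun s t h => by have := hg h; simp only; linarith)
  rw [ex_mul_left, ex_mul_left] at this
  calc _ = _ := by ring
    _ ≤ _ := this
    _ = _ := ex_congr fun s _ => by ring

lemma harris_mono_anti {E : Finset α} {p : ℝ} (h0 : 0 ≤ p) (h1 : p ≤ 1) {f g : Finset α → ℝ}
    (hf : Monotone f) (hg : Antitone g) :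
    ex E p (fun s => f s * g s) ≤ ex E p f * ex E p g := by
  have := harris (E := E) h0 h1 (f := f) (g := fun s => (-1) * g s) hf
    (fun s t h => by have := hg h; simp only; linarith)
  rw [ex_mul_left, ex_congr (f := fun s => f s * (-1 * g s)) (g := fun s => (-1) * (f s * g s))
    (fun s _ => by ring), ex_mul_left] at this
  linarith

/-- No set of the family is contained in `s`. -/
def noneOf {ι : Type*} (I : Finset ι) (S : ι → Finset α) (s : Finset α) : Prop := ∀ i ∈ I, ¬ S i ⊆ s

lemma noneOf_anti {ι : Type*} (I : Finset ι) (S : ι → Finset α) :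
    Antitone (fun s => ind (noneOf I S s)) :=
  fun _ _ hst => ind_mono fun h i hi hS => h i hi (hS.trans hst)

lemma superset_mono (T : Finset α) : Monotone (fun s : Finset α => ind (T ⊆ s)) :=
  fun _ _ hst => ind_mono fun h => h.trans hst

/-- One step of Janson's inequality. -/
lemma janson_step {ι : Type*} [DecidableEq ι] {E : Finset α} {p : ℝ} (h0 : 0 ≤ p) (h1 : p ≤ 1)
    (I : Finset ι) (S : ι → Finset α) (i : ι) (hi : S i ⊆ E) (hS : ∀ j ∈ I, S j ⊆ E) :
    pr E p (noneOf (insert i I) S) ≤ pr E p (noneOf I S) *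
      Real.exp (-(p ^ (S i).card) +
        ∑ j ∈ I with ¬ Disjoint (S i) (S j), p ^ (S i ∪ S j).card) := by
  set N := I.filter (fun j => Disjoint (S i) (S j)) with hN
  set M := I.filter (fun j => ¬ Disjoint (S i) (S j)) with hM
  set B := pr E p (noneOf N S) with hB
  set c := -(p ^ (S i).card) + ∑ j ∈ M, p ^ (S i ∪ S j).card with hc
  have hind : ex E p (fun s => ind (S i ⊆ s) * ind (noneOf N S s)) = p ^ (S i).card * B := by
    rw [ex_superset hi, hB, pr, ex_local hi]
    · congr 1
      refine ex_congr fun s hs => ?_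
      congr 1
      rw [eq_iff_iff]
      refine forall_congr' fun j => forall_congr' fun hj => not_congr ⟨fun h => ?_, fun h => ?_⟩
      · intro x hx
        rcases Finset.mem_union.1 (h hx) with h' | h'
        · exact h'
        · exact absurd hx (Finset.disjoint_left.1 (Finset.mem_filter.1 hj).2 h')
      · exact h.trans Finset.subset_union_left
    · intro s hs t ht
      congr 1
      rw [eq_iff_iff]
      refine forall_congr' fun j => forall_congr' fun hj => not_congr ⟨fun h => ?_, fun h => ?_⟩
      · intro x hx
        rcases Finset.mem_union.1 (h hx) with h' | h'
        · exact h'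
        · exact absurd hx (Finset.disjoint_left.1 (Finset.mem_filter.1 hj).2 (ht h'))
      · exact h.trans Finset.subset_union_left
  have hharris : ∀ j ∈ M, ex E p (fun s => ind (S i ∪ S j ⊆ s) * ind (noneOf N S s)) ≤
      p ^ (S i ∪ S j).card * B := by
    intro j hj
    refine (harris_mono_anti h0 h1 (superset_mono _) (noneOf_anti N S)).trans ?_
    have := pr_superset (E := E) (Finset.union_subset hi (hS j (Finset.mem_filter.1 hj).1)) p
    rw [pr] at this
    rw [this]; rfl
  have hmain : pr E p (noneOf (insert i I) S) ≤ pr E p (noneOf I S) + c * B := by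
    have : pr E p (noneOf (insert i I) S) ≤ ex E p (fun s => ind (noneOf I S s) -
        (ind (S i ⊆ s) * ind (noneOf N S s) -
          ∑ j ∈ M, ind (S i ∪ S j ⊆ s) * ind (noneOf N S s))) := by
      refine ex_mono h0 h1 fun s _ => ?_
      have hsum0 : 0 ≤ ∑ j ∈ M, ind (S i ∪ S j ⊆ s) * ind (noneOf N S s) :=
        Finset.sum_nonneg fun _ _ => mul_nonneg (ind_nonneg _) (ind_nonneg _)
      have hle : ind (noneOf (insert i I) S s) ≤ ind (noneOf I S s) :=
        ind_mono fun h j hj => h j (Finset.mem_insert_of_mem hj)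
      by_cases h1 : S i ⊆ s
      · have : ind (noneOf (insert i I) S s) = 0 :=
          ind_false fun h => h i (Finset.mem_insert_self _ _) h1
        rw [this, ind_true h1]
        by_cases h2 : noneOf N S s
        · by_cases h3 : noneOf I S s
          · rw [ind_true h2, ind_true h3]; rw [ind_true h2] at hsum0; linarith
          · have : ∃ j ∈ M, S j ⊆ s := by
              unfold noneOf at h3; push Not at h3
              obtain ⟨j, hj, hjs⟩ := h3
              refine ⟨j, Finset.mem_filter.2 ⟨hj, fun hd => ?_⟩, hjs⟩
              exact h2 j (Finset.mem_filter.2 ⟨hj, hd⟩) hjs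
            obtain ⟨j, hj, hjs⟩ := this
            have := Finset.single_le_sum
              (f := fun j => ind (S i ∪ S j ⊆ s) * ind (noneOf N S s))
              (fun _ _ => mul_nonneg (ind_nonneg _) (ind_nonneg _)) hj
            rw [ind_true (Finset.union_subset h1 hjs), ind_true h2] at this
            rw [ind_true h2, ind_false h3]; linarith
        · rw [ind_false h2]
          have := ind_nonneg (noneOf I S s)
          simp only [mul_zero, Finset.sum_const_zero]; linarith
      · rw [ind_false h1]; linarith
    rw [ex_sub, ex_sub, ex_sum, hind] at this
    have h2 := Finset.sum_le_sum hharris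
    rw [← Finset.sum_mul] at h2
    have : pr E p (noneOf I S) = ex E p (fun s => ind (noneOf I S s)) := rfl
    rw [hc]; linarith
  have hBI : pr E p (noneOf I S) ≤ B :=
    pr_mono h0 h1 fun s _ h j hj => h j (Finset.mem_filter.1 hj).1
  have hPI : 0 ≤ pr E p (noneOf I S) := pr_nonneg h0 h1 _
  have hexp := Real.add_one_le_exp c
  by_cases hc0 : c ≤ 0
  · calc _ ≤ pr E p (noneOf I S) + c * B := hmain
      _ ≤ pr E p (noneOf I S) + c * pr E p (noneOf I S) := by nlinarith
      _ = pr E p (noneOf I S) * (c + 1) := by ring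
      _ ≤ _ := mul_le_mul_of_nonneg_left hexp hPI
  · have : 1 ≤ Real.exp c := by linarith
    calc _ ≤ pr E p (noneOf I S) :=
          pr_mono h0 h1 fun s _ h j hj => h j (Finset.mem_insert_of_mem hj)
      _ ≤ _ := le_mul_of_one_le_right hPI this

/-- Janson's inequality. -/
lemma janson_one {ι : Type*} [DecidableEq ι] {E : Finset α} {p : ℝ} (h0 : 0 ≤ p) (h1 : p ≤ 1)
    (I : Finset ι) (S : ι → Finset α) (hS : ∀ j ∈ I, S j ⊆ E) :
    pr E p (noneOf I S) ≤ Real.exp (-(∑ i ∈ I, p ^ (S i).card) +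
        ∑ i ∈ I, ∑ j ∈ I with j ≠ i ∧ ¬ Disjoint (S i) (S j), p ^ (S i ∪ S j).card) := by
  induction I using Finset.induction_on with
  | empty => simpa using pr_le_one h0 h1 _
  | insert i I hi ih =>
    have ih' := ih fun j hj => hS j (Finset.mem_insert_of_mem hj)
    refine (janson_step h0 h1 I S i (hS i (Finset.mem_insert_self _ _))
      fun j hj => hS j (Finset.mem_insert_of_mem hj)).trans ?_
    refine (mul_le_mul_of_nonneg_right ih' (Real.exp_pos _).le).trans ?_
    rw [← Real.exp_add, Real.exp_le_exp, Finset.sum_insert hi, Finset.sum_insert hi]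
    have hsub : ∑ j ∈ I with ¬ Disjoint (S i) (S j), p ^ (S i ∪ S j).card ≤
        ∑ j ∈ insert i I with j ≠ i ∧ ¬ Disjoint (S i) (S j), p ^ (S i ∪ S j).card := by
      refine Finset.sum_le_sum_of_subset_of_nonneg (fun j hj => ?_) fun _ _ _ => by positivity
      rw [Finset.mem_filter] at hj ⊢
      exact ⟨Finset.mem_insert_of_mem hj.1, fun h => hi (h ▸ hj.1), hj.2⟩
    have hsub2 : ∑ k ∈ I, ∑ j ∈ I with j ≠ k ∧ ¬ Disjoint (S k) (S j), p ^ (S k ∪ S j).card ≤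
        ∑ k ∈ I, ∑ j ∈ insert i I with j ≠ k ∧ ¬ Disjoint (S k) (S j), p ^ (S k ∪ S j).card := by
      refine Finset.sum_le_sum fun k _ => ?_
      refine Finset.sum_le_sum_of_subset_of_nonneg (fun j hj => ?_) fun _ _ _ => by positivity
      rw [Finset.mem_filter] at hj ⊢
      exact ⟨Finset.mem_insert_of_mem hj.1, hj.2⟩
    linarith

/-- Janson's inequality with subsampling of the family. -/
lemma janson {ι : Type*} [DecidableEq ι] {E : Finset α} {p : ℝ} (h0 : 0 ≤ p) (h1 : p ≤ 1)
    (I : Finset ι) (S : ι → Finset α) (hS : ∀ j ∈ I, S j ⊆ E) {w : ℝ} (hw0 : 0 ≤ w) (hw1 : w ≤ 1) :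
    pr E p (noneOf I S) ≤ Real.exp (-(w * ∑ i ∈ I, p ^ (S i).card) +
      w ^ 2 * ∑ i ∈ I, ∑ j ∈ I with j ≠ i ∧ ¬ Disjoint (S i) (S j), p ^ (S i ∪ S j).card) := by
  set g : Finset ι → ℝ := fun J => (∑ i ∈ I, ind ({i} ⊆ J) * p ^ (S i).card) -
    ∑ i ∈ I, ∑ j ∈ I with j ≠ i ∧ ¬ Disjoint (S i) (S j),
      ind ({i, j} ⊆ J) * p ^ (S i ∪ S j).card with hg
  have hex : ex I w g = w * ∑ i ∈ I, p ^ (S i).card -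
      w ^ 2 * ∑ i ∈ I, ∑ j ∈ I with j ≠ i ∧ ¬ Disjoint (S i) (S j), p ^ (S i ∪ S j).card := by
    rw [hg, ex_sub, ex_sum, ex_sum, Finset.mul_sum, Finset.mul_sum]
    congr 1
    · refine Finset.sum_congr rfl fun i hi => ?_
      rw [ex_mul_right]
      have := pr_superset (E := I) (T := {i}) (by simpa using hi) w
      rw [pr] at this
      rw [this]; simp
    · refine Finset.sum_congr rfl fun i hi => ?_
      rw [ex_sum, Finset.mul_sum]
      refine Finset.sum_congr rfl fun j hj => ?_
      rw [Finset.mem_filter] at hj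
      rw [ex_mul_right]
      have := pr_superset (E := I) (T := {i, j})
        (by rw [Finset.insert_subset_iff]; simp [hi, hj.1]) w
      rw [pr] at this
      rw [this, Finset.card_pair hj.2.1.symm]
  obtain ⟨J, hJ, hle⟩ := exists_of_le_ex (E := I) hw0 hw1 (f := g) (c := ex I w g) le_rfl
  have hJ1 := janson_one h0 h1 J S fun j hj => hS j (hJ hj)
  refine (pr_mono h0 h1 (B := noneOf J S) fun s _ h j hj => h j (hJ hj)).trans (hJ1.trans ?_)
  rw [Real.exp_le_exp]
  have e1 : ∑ i ∈ I, ind ({i} ⊆ J) * p ^ (S i).card = ∑ i ∈ J, p ^ (S i).card := by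
    rw [← Finset.sum_subset hJ]
    · exact Finset.sum_congr rfl fun i hi => by rw [ind_true (by simpa using hi), one_mul]
    · intro i _ hi; rw [ind_false (by simpa using hi), zero_mul]
  have e2 : ∑ i ∈ J, ∑ j ∈ J with j ≠ i ∧ ¬ Disjoint (S i) (S j), p ^ (S i ∪ S j).card ≤
     ∑ i ∈ I, ∑ j ∈ I with j ≠ i ∧ ¬ Disjoint (S i) (S j),
      ind ({i, j} ⊆ J) * p ^ (S i ∪ S j).card := by
    refine le_trans ?_ (Finset.sum_le_sum_of_subset_of_nonneg hJ fun _ _ _ =>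
      Finset.sum_nonneg fun _ _ => mul_nonneg (ind_nonneg _) (by positivity))
    refine Finset.sum_le_sum fun i hi => ?_
    refine le_trans (le_of_eq ?_) (Finset.sum_le_sum_of_subset_of_nonneg
      (Finset.filter_subset_filter _ hJ) fun _ _ _ => mul_nonneg (ind_nonneg _) (by positivity))
    refine Finset.sum_congr rfl fun j hj => ?_
    rw [ind_true, one_mul]
    rw [Finset.insert_subset_iff]; simp [hi, (Finset.mem_filter.1 hj).1]
  have e3 : g J ≤ _ := sub_le_sub_left e2 _
  rw [e1] at e3
  have e4 := hex ▸ hle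
  linarith
end

/-! ### Tail bounds -/

lemma choose_mul_pow_le (N r : ℕ) (hr : 1 ≤ r) (q : ℝ) (hq : 0 ≤ q) :
    (N.choose r : ℝ) * q ^ r ≤ (Real.exp 1 * N * q / r) ^ r := by
  have h1 : (N.choose r : ℝ) ≤ (N : ℝ) ^ r / r.factorial := Nat.choose_le_pow_div r N
  have h2 : (r : ℝ) ^ r / r.factorial ≤ Real.exp r := Real.pow_div_factorial_le_exp (r : ℝ) (by positivity) r
  have hr0 : (0 : ℝ) < r := by exact_mod_cast hr
  have h3 : Real.exp (r : ℝ) = Real.exp 1 ^ r := by rw [← Real.exp_nat_mul, mul_one]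
  calc (N.choose r : ℝ) * q ^ r ≤ (N : ℝ) ^ r / r.factorial * q ^ r := by gcongr
    _ = ((r : ℝ) ^ r / r.factorial) * (N * q / r) ^ r := by
        rw [div_pow, mul_pow]; field_simp
    _ ≤ Real.exp r * (N * q / r) ^ r := by gcongr
    _ = (Real.exp 1 * N * q / r) ^ r := by rw [h3, ← mul_pow]; congr 1; ring

section
variable [DecidableEq α]

/-- Upper tail for the number of sets of a disjoint family contained in the random set. -/
lemma upper_tail {ι : Type*} [DecidableEq ι] {E : Finset α} {p : ℝ} (h0 : 0 ≤ p) (h1 : p ≤ 1)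
    (I : Finset ι) (S : ι → Finset α) (hS : ∀ j ∈ I, S j ⊆ E) (b : ℕ)
    (hb : ∀ j ∈ I, (S j).card = b)
    (hd : ∀ i ∈ I, ∀ j ∈ I, i ≠ j → Disjoint (S i) (S j)) (x y : ℝ) (hx : 0 < x) (hy : 0 ≤ y)
    (hxy : Real.exp 1 * I.card * p ^ b ≤ x * Real.exp (-y)) :
    pr E p (fun s => x ≤ ((I.filter (fun i => S i ⊆ s)).card : ℝ)) ≤ Real.exp (-(x * y)) := by
  set r := ⌈x⌉₊ with hr
  have hr1 : 1 ≤ r := Nat.ceil_pos.2 hx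
  have hxr : x ≤ r := Nat.le_ceil x
  have hstep : pr E p (fun s => x ≤ ((I.filter (fun i => S i ⊆ s)).card : ℝ)) ≤
      pr E p (fun s => ∃ J ∈ I.powersetCard r, J.biUnion S ⊆ s) := by
    refine pr_mono h0 h1 fun s _ h => ?_
    have h' : r ≤ (I.filter (fun i => S i ⊆ s)).card := Nat.ceil_le.2 h
    obtain ⟨J, hJ, hJr⟩ := Finset.exists_subset_card_eq h'
    refine ⟨J, Finset.mem_powersetCard.2 ⟨hJ.trans (Finset.filter_subset _ _), hJr⟩, ?_⟩
    rw [Finset.biUnion_subset]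
    exact fun i hi => (Finset.mem_filter.1 (hJ hi)).2
  refine hstep.trans ((pr_exists_le h0 h1 _ _).trans ?_)
  have hterm : ∀ J ∈ I.powersetCard r, pr E p (fun s => J.biUnion S ⊆ s) = (p ^ b) ^ r := by
    intro J hJ
    rw [Finset.mem_powersetCard] at hJ
    rw [pr_superset]
    · rw [Finset.card_biUnion fun i hi j hj hij => hd i (hJ.1 hi) j (hJ.1 hj) hij,
        Finset.sum_congr rfl (fun i hi => hb i (hJ.1 hi)), Finset.sum_const, hJ.2, smul_eq_mul,
        mul_comm, pow_mul]
    · rw [Finset.biUnion_subset]; exact fun i hi => hS i (hJ.1 hi)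
  rw [Finset.sum_congr rfl hterm, Finset.sum_const, Finset.card_powersetCard, nsmul_eq_mul]
  refine (choose_mul_pow_le _ r hr1 _ (by positivity)).trans ?_
  have hr0 : (0 : ℝ) < r := by exact_mod_cast hr1
  have : Real.exp 1 * I.card * p ^ b / r ≤ Real.exp (-y) := by
    rw [div_le_iff₀ hr0, mul_comm (Real.exp (-y))]
    exact hxy.trans (mul_le_mul_of_nonneg_right hxr (Real.exp_pos _).le)
  calc _ ≤ (Real.exp (-y)) ^ r := pow_le_pow_left₀ (by positivity) this r
    _ = Real.exp (-(r * y)) := by rw [← Real.exp_nat_mul]; congr 1; ring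
    _ ≤ _ := by rw [Real.exp_le_exp]; nlinarith

/-- Upper tail for the size of the intersection with a fixed set. -/
lemma upper_tail_inter {E : Finset α} {p : ℝ} (h0 : 0 ≤ p) (h1 : p ≤ 1)
    (A : Finset α) (hA : A ⊆ E) (x y : ℝ) (hx : 0 < x) (hy : 0 ≤ y)
    (hxy : Real.exp 1 * A.card * p ≤ x * Real.exp (-y)) :
    pr E p (fun s => x ≤ ((s ∩ A).card : ℝ)) ≤ Real.exp (-(x * y)) := by
  refine le_trans (le_of_eq ?_) (upper_tail h0 h1 A (fun a => {a}) (fun a ha => by simpa using hA ha)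
    1 (fun _ _ => by simp) (fun i _ j _ hij => by simpa using hij) x y hx hy (by simpa using hxy))
  congr 1; funext s
  congr 3; ext a; simp [and_comm]

lemma lower_tail {E : Finset α} {p : ℝ} (h0 : 0 ≤ p) (h1 : p ≤ 1)
    (A : Finset α) (hA : A ⊆ E) :
    pr E p (fun s => ((s ∩ A).card : ℝ) ≤ p * A.card / 8) ≤ Real.exp (-(p * A.card / 4)) := by
  have key : ex E p (fun s => Real.exp (-(Real.log 2 * (s ∩ A).card))) = (1 - p / 2) ^ A.card := by
    rw [← Finset.union_sdiff_of_subset hA, ex_union Finset.disjoint_sdiff]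
    have : ∀ s ⊆ A, ex (E \ A) p (fun t => Real.exp (-(Real.log 2 * ((s ∪ t) ∩ A).card))) =
        Real.exp (-(Real.log 2 * s.card)) := by
      intro s hs
      rw [ex_congr (g := fun _ => Real.exp (-(Real.log 2 * s.card))), ex_const]
      intro t ht
      have : (s ∪ t) ∩ A = s := by
        ext x; simp only [Finset.mem_inter, Finset.mem_union]
        constructor
        · rintro ⟨h | h, h'⟩
          · exact h
          · exact absurd h' (Finset.mem_sdiff.1 (ht h)).2
        · exact fun h => ⟨Or.inl h, hs h⟩
      rw [this]
    rw [ex_congr this]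
    clear this hA
    induction A using Finset.induction_on with
    | empty => simp [ex_empty]
    | insert a A ha ih =>
      rw [ex_insert ha, ih, Finset.card_insert_of_notMem ha, pow_succ]
      have : ex A p (fun s => Real.exp (-(Real.log 2 * (insert a s).card))) =
          1 / 2 * (1 - p / 2) ^ A.card := by
        rw [← ih, ← ex_mul_left]
        refine ex_congr fun s hs => ?_
        rw [Finset.card_insert_of_notMem fun h => ha (hs h)]
        push_cast
        rw [show -(Real.log 2 * ((s.card : ℝ) + 1)) = -Real.log 2 + -(Real.log 2 * s.card) by ring,
          Real.exp_add, Real.exp_neg, Real.exp_log (by norm_num)]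
        ring
      rw [this]; ring
  set x := p * A.card / 8
  have hmk := pr_markov (E := E) h0 h1 (f := fun s => Real.exp (-(Real.log 2 * (s ∩ A).card)))
    (c := Real.exp (-(Real.log 2 * x))) (fun _ _ => (Real.exp_pos _).le) (Real.exp_pos _)
  rw [key] at hmk
  refine (pr_mono h0 h1 fun s _ h => ?_).trans (hmk.trans ?_)
  · rw [Real.exp_le_exp]
    have := Real.log_pos (show (1:ℝ) < 2 by norm_num)
    nlinarith
  · rw [div_le_iff₀ (Real.exp_pos _), ← Real.exp_add]
    have h2 : (1 - p / 2) ^ A.card ≤ Real.exp (-(p / 2 * A.card)) := by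
      rw [show -(p / 2 * A.card) = A.card * (-(p / 2)) by ring, Real.exp_nat_mul]
      exact pow_le_pow_left₀ (by linarith) (by linarith [Real.add_one_le_exp (-(p/2))]) _
    refine h2.trans ?_
    rw [Real.exp_le_exp]
    have hl : Real.log 2 ≤ 1 := by linarith [Real.log_two_lt_d9]
    have : 0 ≤ p * A.card := by positivity
    simp only [x]; nlinarith
end

/-! ### Paths as tuples -/

/-- The `i`-th edge of a path tuple. -/
def pe {V : Type*} {l : ℕ} (x : Fin (l + 1) → V) (i : Fin l) : Sym2 V := s(x i.castSucc, x i.succ)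

/-- Edge set of a path tuple. -/
def pathE {V : Type*} [DecidableEq V] {l : ℕ} (x : Fin (l + 1) → V) : Finset (Sym2 V) :=
  Finset.univ.image (pe x)

lemma pe_injective {V : Type*} {l : ℕ} {x : Fin (l + 1) → V} (hx : Function.Injective x) :
    Function.Injective (pe x) := by
  intro i j h
  unfold pe at h
  rw [Sym2.eq_iff] at h
  rcases h with ⟨h1, _⟩ | ⟨h1, h2⟩
  · exact Fin.castSucc_injective _ (hx h1)
  · have a := congrArg Fin.val (hx h1)
    have b := congrArg Fin.val (hx h2)
    simp at a b; omega

lemma card_pathE {V : Type*} [DecidableEq V] {l : ℕ} {x : Fin (l + 1) → V}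
    (hx : Function.Injective x) : (pathE x).card = l := by
  rw [pathE, Finset.card_image_of_injective _ (pe_injective hx)]; simp

lemma mem_pathE {V : Type*} [DecidableEq V] {l : ℕ} {x : Fin (l + 1) → V} {e : Sym2 V} :
    e ∈ pathE x ↔ ∃ i, pe x i = e := by simp [pathE]

/-- A self-avoiding walk on the integers with unit steps is monotone. -/
lemma walk_mono (l : ℕ) (f : ℕ → ℤ) (hinj : ∀ i ≤ l, ∀ j ≤ l, f i = f j → i = j)
    (hstep : ∀ i < l, f (i + 1) = f i + 1 ∨ f (i + 1) = f i - 1) :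
    (∀ i ≤ l, f i = f 0 + i) ∨ (∀ i ≤ l, f i = f 0 - i) := by
  induction l with
  | zero => left; intro i hi; obtain rfl : i = 0 := by omega
            simp
  | succ l ih =>
    have ih' := ih (fun i hi j hj => hinj i (by omega) j (by omega)) fun i hi => hstep i (by omega)
    have hs := hstep l (by omega)
    rcases Nat.eq_zero_or_pos l with rfl | hl
    · rcases hs with h | h
      · left; intro i hi
        interval_cases i <;> simp [h] <;> simpa using h
      · right; intro i hi
        interval_cases i <;> simp [h] <;> simpa using h
    · have key : ∀ i, i ≤ l + 1 → i ≤ l ∨ i = l + 1 := by intro i hi; omega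
      have hne : f (l + 1) ≠ f (l - 1) := fun h => by
        have := hinj (l + 1) le_rfl (l - 1) (by omega) h; omega
      rcases ih' with h | h
      · left; intro i hi
        rcases key i hi with h' | rfl
        · exact h i h'
        · have a := h l le_rfl
          have b := h (l - 1) (by omega)
          push_cast [Nat.cast_sub hl] at b
          rcases hs with h' | h'
          · push_cast; omega
          · exact absurd (by omega) hne
      · right; intro i hi
        rcases key i hi with h' | rfl
        · exact h i h'
        · have a := h l le_rfl
          have b := h (l - 1) (by omega)
          push_cast [Nat.cast_sub hl] at b
          rcases hs with h' | h'
          · exact absurd (by omega) hne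
          · push_cast; omega

lemma path_eq {V : Type*} [DecidableEq V] {l : ℕ} (hl : 1 ≤ l) {x y : Fin (l + 1) → V}
    (hx : Function.Injective x) (hy : Function.Injective y) (h : pathE y ⊆ pathE x) :
    y = x ∨ y = x ∘ Fin.rev := by
  have h1 : ∀ i : Fin l, ∃ j : Fin l, pe x j = pe y i := fun i =>
    mem_pathE.1 (h (mem_pathE.2 ⟨i, rfl⟩))
  have h2 : ∀ i : Fin (l + 1), ∃ j : Fin (l + 1), y i = x j := by
    intro i
    rcases Fin.eq_castSucc_or_eq_last i with ⟨i', rfl⟩ | rfl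
    · obtain ⟨j, hj⟩ := h1 i'
      unfold pe at hj; rw [Sym2.eq_iff] at hj
      rcases hj with ⟨a, _⟩ | ⟨_, b⟩
      · exact ⟨_, a.symm⟩
      · exact ⟨_, b.symm⟩
    · obtain ⟨j, hj⟩ := h1 ⟨l - 1, by omega⟩
      unfold pe at hj; rw [Sym2.eq_iff] at hj
      have : (Fin.succ ⟨l - 1, by omega⟩ : Fin (l + 1)) = Fin.last l := by
        ext; simp; omega
      rw [this] at hj
      rcases hj with ⟨_, b⟩ | ⟨a, _⟩
      · exact ⟨_, b.symm⟩
      · exact ⟨_, a.symm⟩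
  choose σ hσ using h2
  set f : ℕ → ℤ := fun i => if hi : i < l + 1 then ((σ ⟨i, hi⟩ : ℕ) : ℤ) else 0 with hf
  have hfv : ∀ i : Fin (l + 1), f i = ((σ i : ℕ) : ℤ) := by
    intro i; have := i.2; simp [hf]; intro; omega
  have hσinj : Function.Injective σ := fun i j hij => hy (by rw [hσ, hσ, hij])
  have hw := walk_mono l f (by
    intro i hi j hj hij
    have a := hfv ⟨i, by omega⟩
    have b := hfv ⟨j, by omega⟩
    simp only at a b
    rw [a, b] at hij
    have := hσinj (Fin.ext (by exact_mod_cast hij))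
    exact congrArg Fin.val this) (by
    intro i hi
    obtain ⟨j, hj⟩ := h1 ⟨i, hi⟩
    unfold pe at hj
    rw [hσ, hσ, Sym2.eq_iff] at hj
    have a := hfv ⟨i, by omega⟩
    have b := hfv ⟨i + 1, by omega⟩
    simp only at a b
    rw [a, b]
    rcases hj with ⟨c, d⟩ | ⟨c, d⟩
    · have c := congrArg Fin.val (hx c)
      have d := congrArg Fin.val (hx d)
      simp at c d
      left; rw [← c, ← d]; push_cast; ring
    · have c := congrArg Fin.val (hx c)
      have d := congrArg Fin.val (hx d)
      simp at c d
      right; rw [← c, ← d]; push_cast; ring)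
  have hlt : ∀ i : Fin (l + 1), (σ i : ℕ) ≤ l := fun i => by have := (σ i).2; omega
  rcases hw with hw | hw
  · left; funext i
    rw [hσ]; congr 1
    have a := hw i (by have := i.2; omega)
    have b := hw l le_rfl
    have c := hfv (Fin.last l)
    have d := hfv i
    have e := hfv 0
    have := hlt (Fin.last l)
    ext; simp at *; omega
  · right; funext i
    rw [Function.comp_apply, hσ]; congr 1
    have a := hw i (by have := i.2; omega)
    have b := hw l le_rfl
    have c := hfv (Fin.last l)
    have d := hfv i
    have e := hfv 0
    have := hlt 0
    ext; simp [Fin.val_rev] at *; omega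

/-- Vertices touched by a set of path edges. -/
def touch {l : ℕ} (T : Finset (Fin l)) : Finset (Fin (l + 1)) :=
  T.image Fin.castSucc ∪ T.image Fin.succ

lemma card_touch {l : ℕ} {T : Finset (Fin l)} (hT : T.Nonempty) : T.card + 1 ≤ (touch T).card := by
  have h1 : (T.image Fin.castSucc).card = T.card :=
    Finset.card_image_of_injective _ (Fin.castSucc_injective l)
  have h2 : (T.max' hT).succ ∉ T.image Fin.castSucc := by
    intro h
    obtain ⟨j, hj, hj'⟩ := Finset.mem_image.1 h
    have := Finset.le_max' T j hj
    have h3 := congrArg Fin.val hj'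
    simp at h3
    have h4 : (j : ℕ) ≤ (T.max' hT : ℕ) := this
    omega
  rw [← h1, ← Finset.card_insert_of_notMem h2]
  refine Finset.card_le_card ?_
  rw [Finset.insert_subset_iff]
  exact ⟨Finset.mem_union_right _ (Finset.mem_image_of_mem _ (Finset.max'_mem T hT)),
    Finset.subset_union_left⟩

lemma card_touch_ends {l : ℕ} {T : Finset (Fin l)} (hT : T ≠ Finset.univ)
    (h0 : 0 ∈ touch T) (hl : Fin.last l ∈ touch T) : T.card + 2 ≤ (touch T).card := by
  have h1 : (T.image Fin.castSucc).card = T.card :=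
    Finset.card_image_of_injective _ (Fin.castSucc_injective l)
  have hlast : Fin.last l ∉ T.image Fin.castSucc := by
    intro h
    obtain ⟨j, _, hj'⟩ := Finset.mem_image.1 h
    exact absurd hj' (Fin.castSucc_lt_last j).ne
  have hc : (Tᶜ).Nonempty := by
    rw [Finset.nonempty_iff_ne_empty]
    intro h; exact hT (Finset.compl_eq_empty_iff T |>.1 h)
  set g := (Tᶜ).min' hc with hg
  have hgm : g ∉ T := Finset.mem_compl.1 (Finset.min'_mem _ hc)
  have hlt : ∀ j : Fin l, (j : ℕ) < g → j ∈ T := by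
    intro j hj
    by_contra h
    have := Finset.min'_le _ j (Finset.mem_compl.2 h)
    have : (g : ℕ) ≤ j := this
    omega
  have hg0 : (g : ℕ) ≠ 0 := by
    intro h
    rcases Finset.mem_union.1 h0 with h' | h'
    · obtain ⟨j, hj, hj'⟩ := Finset.mem_image.1 h'
      have := congrArg Fin.val hj'
      simp at this
      have : g = j := Fin.ext (by omega)
      exact hgm (this ▸ hj)
    · obtain ⟨j, hj, hj'⟩ := Finset.mem_image.1 h'
      exact absurd hj' (Fin.succ_ne_zero j)
  have hgc : g.castSucc ∉ T.image Fin.castSucc := by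
    intro h
    obtain ⟨j, hj, hj'⟩ := Finset.mem_image.1 h
    exact hgm (Fin.castSucc_injective _ hj' ▸ hj)
  have hgs : g.castSucc ∈ touch T := by
    refine Finset.mem_union_right _ (Finset.mem_image.2 ⟨⟨g - 1, by omega⟩, hlt _ (by simp; omega), ?_⟩)
    ext; simp; omega
  have hne : g.castSucc ≠ Fin.last l := (Fin.castSucc_lt_last g).ne
  have : (insert g.castSucc (insert (Fin.last l) (T.image Fin.castSucc))).card = T.card + 2 := by
    rw [Finset.card_insert_of_notMem, Finset.card_insert_of_notMem hlast, h1]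
    simp only [Finset.mem_insert, not_or]; exact ⟨hne, hgc⟩
  rw [← this]
  refine Finset.card_le_card ?_
  rw [Finset.insert_subset_iff, Finset.insert_subset_iff]
  exact ⟨hgs, hl, Finset.subset_union_left⟩

/-- Counting tuples with prescribed ends and some internal vertices in `W`. -/
lemma count_tuples {n l : ℕ} (hl : 1 ≤ l) (a b : Fin n) (W : Finset (Fin n)) (I : Finset (Fin (l + 1)))
    (P : Finset (Fin (l + 1) → Fin n))
    (hP : ∀ y ∈ P, y 0 = a ∧ y (Fin.last l) = b ∧ ∀ i ∈ I, y i ∈ W) :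
    P.card ≤ W.card ^ (I \ {0, Fin.last l}).card *
      n ^ (l - 1 - (I \ {0, Fin.last l}).card) := by
  have hne : (0 : Fin (l + 1)) ≠ Fin.last l := by
    intro h; have := congrArg Fin.val h; simp at this; omega
  set Q := Fintype.piFinset (fun i : Fin (l + 1) => if i = 0 then {a} else
    if i = Fin.last l then {b} else if i ∈ I then W else (Finset.univ : Finset (Fin n))) with hQ
  have hsub : P ⊆ Q := by
    intro y hy
    rw [hQ, Fintype.mem_piFinset]
    intro i
    obtain ⟨h1, h2, h3⟩ := hP y hy
    split_ifs with e1 e2 e3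
    · simp [e1, h1]
    · simp [e2, h2]
    · exact h3 i e3
    · simp
  refine (Finset.card_le_card hsub).trans (le_of_eq ?_)
  rw [hQ, Fintype.card_piFinset]
  have hu : (Finset.univ : Finset (Fin (l + 1))) = insert 0 (insert (Fin.last l)
      (Finset.univ \ {0, Fin.last l})) := by
    ext i; simp; tauto
  have hcu : (Finset.univ \ {0, Fin.last l} : Finset (Fin (l + 1))).card = l - 1 := by
    rw [Finset.card_sdiff_of_subset (Finset.subset_univ _), Finset.card_pair hne]; simp
  rw [hu, Finset.prod_insert (by simp [hne]), Finset.prod_insert (by simp)]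
  simp only [if_true, Finset.card_singleton, one_mul, hne.symm, if_false]
  have : ∀ i ∈ (Finset.univ \ {0, Fin.last l} : Finset (Fin (l + 1))),
      (if i = 0 then ({a} : Finset (Fin n)) else
    if i = Fin.last l then {b} else if i ∈ I then W else (Finset.univ : Finset (Fin n))).card =
      if i ∈ I then W.card else n := by
    intro i hi
    simp only [Finset.mem_sdiff, Finset.mem_insert, Finset.mem_singleton, not_or] at hi
    rw [if_neg hi.2.1, if_neg hi.2.2]
    split_ifs <;> simp
  rw [Finset.prod_congr rfl this, Finset.prod_ite, Finset.prod_const, Finset.prod_const]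
  have e1 : Finset.filter (fun i => i ∈ I) (Finset.univ \ {0, Fin.last l} : Finset (Fin (l + 1))) =
      I \ {0, Fin.last l} := by
    ext i; simp; tauto
  have e2 := Finset.card_filter_add_card_filter_not (s := (Finset.univ \ {0, Fin.last l} : Finset (Fin (l + 1))))
    (fun i => i ∈ I)
  rw [e1] at e2 ⊢
  rw [show (Finset.filter (fun i => i ∉ I) (Finset.univ \ {0, Fin.last l} : Finset (Fin (l + 1)))).card
    = l - 1 - (I \ {0, Fin.last l}).card by omega]

/-- Indices of the edges of `y` lying in `J`. -/
def inT {n l : ℕ} (J : Finset (Sym2 (Fin n))) (y : Fin (l + 1) → Fin n) : Finset (Fin l) :=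
  Finset.univ.filter fun i => pe y i ∈ J

lemma card_pathE_sdiff {n l : ℕ} (J : Finset (Sym2 (Fin n))) {y : Fin (l + 1) → Fin n}
    (hy : Function.Injective y) : (pathE y \ J).card = l - (inT J y).card := by
  have h1 : pathE y ∩ J = (inT J y).image (pe y) := by
    ext e; simp only [pathE, inT, Finset.mem_inter, Finset.mem_image, Finset.mem_filter,
      Finset.mem_univ, true_and]
    constructor
    · rintro ⟨⟨i, rfl⟩, h⟩; exact ⟨i, h, rfl⟩
    · rintro ⟨i, h, rfl⟩; exact ⟨⟨i, rfl⟩, h⟩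
  have h2 := Finset.card_sdiff_add_card_inter (pathE y) J
  rw [h1, Finset.card_image_of_injective _ (pe_injective hy), card_pathE hy] at h2
  omega

lemma touch_mem {n l : ℕ} {J : Finset (Sym2 (Fin n))} {W : Finset (Fin n)}
    (hW : ∀ e ∈ J, ∀ v ∈ e, v ∈ W) (y : Fin (l + 1) → Fin n) :
    ∀ i ∈ touch (inT J y), y i ∈ W := by
  intro i hi
  rcases Finset.mem_union.1 hi with h | h
  · obtain ⟨j, hj, rfl⟩ := Finset.mem_image.1 h
    exact hW _ (Finset.mem_filter.1 hj).2 _ (by simp [pe])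
  · obtain ⟨j, hj, rfl⟩ := Finset.mem_image.1 h
    exact hW _ (Finset.mem_filter.1 hj).2 _ (by simp [pe])

set_option maxHeartbeats 1000000 in
lemma overlap_sum {n l : ℕ} {γ : Type*} [DecidableEq γ] (hl : 1 ≤ l) (hn : 1 ≤ n)
    (Z : Finset γ) (e0 e1 : γ → Fin n)
    (J : Finset (Sym2 (Fin n))) (W : Finset (Fin n)) (hW1 : 1 ≤ W.card)
    (hW : ∀ e ∈ J, ∀ v ∈ e, v ∈ W) (P : Finset (γ × (Fin (l + 1) → Fin n)))
    (hP : ∀ q ∈ P, q.1 ∈ Z ∧ Function.Injective q.2 ∧ q.2 0 = e0 q.1 ∧ q.2 (Fin.last l) = e1 q.1)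
    {p : ℝ} (hp : 0 ≤ p) {d d01 L : ℝ}
    (hd0 : ∀ v, ((Z.filter fun c => e0 c = v).card : ℝ) ≤ d)
    (hd1 : ∀ v, ((Z.filter fun c => e1 c = v).card : ℝ) ≤ d)
    (hd01 : ∀ u v, ((Z.filter fun c => e0 c = u ∧ e1 c = v).card : ℝ) ≤ d01)
    (hL : ∀ t, 1 ≤ t → t < l → (n : ℝ) ^ (l - 1 - t) * p ^ (l - t) ≤ L) (hL0 : 0 ≤ L) :
    ∑ q ∈ P with ¬ Disjoint J (pathE q.2) ∧ ¬ pathE q.2 ⊆ J, p ^ (pathE q.2 \ J).card ≤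
      2 ^ l * (W.card : ℝ) ^ (l + 1) * (Z.card / n + 2 * d + d01) * L := by
  have hne : (0 : Fin (l + 1)) ≠ Fin.last l := by
    intro h; have := congrArg Fin.val h; simp at this; omega
  have hn0 : (1 : ℝ) ≤ n := by exact_mod_cast hn
  have hw0 : (1 : ℝ) ≤ W.card := by exact_mod_cast hW1
  have a0 : 0 ≤ d := (Nat.cast_nonneg _).trans (hd0 ⟨0, by omega⟩)
  have a01 : 0 ≤ d01 := (Nat.cast_nonneg _).trans (hd01 ⟨0, by omega⟩ ⟨0, by omega⟩)
  set P' := P.filter fun q => ¬ Disjoint J (pathE q.2) ∧ ¬ pathE q.2 ⊆ J with hP'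
  rw [← Finset.sum_fiberwise P' (fun q => inT J q.2)]
  have hbound : ∀ T : Finset (Fin l), ∑ q ∈ P' with inT J q.2 = T, p ^ (pathE q.2 \ J).card ≤
      (W.card : ℝ) ^ (l + 1) * (Z.card / n + 2 * d + d01) * L := by
    intro T
    rcases Finset.eq_empty_or_nonempty (P'.filter fun q => inT J q.2 = T) with he | ⟨q0, hq0⟩
    · rw [he, Finset.sum_empty]; positivity
    -- properties of T
    obtain ⟨hq0P, hq0T⟩ := Finset.mem_filter.1 hq0
    obtain ⟨hq0P, hnd, hns⟩ := Finset.mem_filter.1 hq0P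
    have hTne : T.Nonempty := by
      rw [Finset.not_disjoint_iff] at hnd
      obtain ⟨e, he, he'⟩ := hnd
      obtain ⟨i, rfl⟩ := mem_pathE.1 he'
      exact ⟨i, by rw [← hq0T]; simp [inT, he]⟩
    have hTu : T ≠ Finset.univ := by
      rintro rfl
      apply hns
      intro e he
      obtain ⟨i, rfl⟩ := mem_pathE.1 he
      have : i ∈ inT J q0.2 := hq0T ▸ Finset.mem_univ i
      exact (Finset.mem_filter.1 this).2
    have ht1 : 1 ≤ T.card := hTne.card_pos
    have htl : T.card < l := by
      obtain ⟨i, hi⟩ : ∃ i, i ∉ T := by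
        by_contra h; push Not at h; exact hTu (Finset.eq_univ_iff_forall.2 h)
      simpa using Finset.card_lt_univ_of_notMem hi
    set I := touch T with hI
    set j := (I \ {0, Fin.last l}).card with hj
    set Z' := Z.filter fun c => (0 ∈ I → e0 c ∈ W) ∧ (Fin.last l ∈ I → e1 c ∈ W) with hZ'
    have hcard : (P'.filter fun q => inT J q.2 = T).card ≤
        Z'.card * (W.card ^ j * n ^ (l - 1 - j)) := by
      have hmap : ∀ q ∈ P'.filter (fun q => inT J q.2 = T), q.1 ∈ Z' := by
        intro q hq
        obtain ⟨hqP, hqT⟩ := Finset.mem_filter.1 hq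
        obtain ⟨hqP, _⟩ := Finset.mem_filter.1 hqP
        obtain ⟨b1, b2, b3, b4⟩ := hP q hqP
        have ht := touch_mem hW q.2
        rw [hqT] at ht
        exact Finset.mem_filter.2 ⟨b1, fun h => b3 ▸ ht _ h, fun h => b4 ▸ ht _ h⟩
      rw [Finset.card_eq_sum_card_fiberwise hmap, ← smul_eq_mul]
      refine Finset.sum_le_card_nsmul _ _ _ fun c hc => ?_
      set Pc := (P'.filter fun q => inT J q.2 = T).filter fun q => q.1 = c
      have hinj : Set.InjOn Prod.snd (Pc : Set (γ × (Fin (l + 1) → Fin n))) := by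
        intro q hq q' hq' h
        have h1 := (Finset.mem_filter.1 hq).2
        have h2 := (Finset.mem_filter.1 hq').2
        exact Prod.ext (h1.trans h2.symm) h
      rw [← Finset.card_image_of_injOn hinj]
      refine count_tuples hl (e0 c) (e1 c) W I _ fun y hy => ?_
      obtain ⟨q, hq, rfl⟩ := Finset.mem_image.1 hy
      obtain ⟨hq, hqc⟩ := Finset.mem_filter.1 hq
      obtain ⟨hqP, hqT⟩ := Finset.mem_filter.1 hq
      obtain ⟨hqP, _⟩ := Finset.mem_filter.1 hqP
      obtain ⟨b1, b2, b3, b4⟩ := hP q hqP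
      have ht := touch_mem hW q.2
      rw [hqT] at ht
      exact ⟨hqc ▸ b3, hqc ▸ b4, ht⟩
    have hsum : ∑ q ∈ P' with inT J q.2 = T, p ^ (pathE q.2 \ J).card =
        ((P'.filter fun q => inT J q.2 = T).card : ℝ) * p ^ (l - T.card) := by
      rw [← nsmul_eq_mul]
      refine Finset.sum_eq_card_nsmul fun q hq => ?_
      obtain ⟨hqP, hqT⟩ := Finset.mem_filter.1 hq
      obtain ⟨hqP, _⟩ := Finset.mem_filter.1 hqP
      rw [card_pathE_sdiff J (hP q hqP).2.1, hqT]
    rw [hsum]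
    have hpw : 0 ≤ p ^ (l - T.card) := by positivity
    have hLT := hL T.card ht1 htl
    have hcard' : ((P'.filter fun q => inT J q.2 = T).card : ℝ) ≤
        Z'.card * ((W.card : ℝ) ^ j * (n : ℝ) ^ (l - 1 - j)) := by exact_mod_cast hcard
    have hjle : j ≤ l - 1 := by
      have h1 : (I \ {0, Fin.last l}) ⊆ Finset.univ \ {0, Fin.last l} :=
        Finset.sdiff_subset_sdiff (Finset.subset_univ _) le_rfl
      have h2 := Finset.card_le_card h1
      rwa [Finset.card_sdiff_of_subset (Finset.subset_univ _), Finset.card_pair hne,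
        Finset.card_univ, Fintype.card_fin] at h2
    -- reduction: suffices a bound on the filtered sum
    have hred : ∀ (A : ℝ), 0 ≤ A → (Z'.card : ℝ) * (W.card : ℝ) ^ j * (n : ℝ) ^ (l - 1 - j) ≤
        (W.card : ℝ) ^ (l + 1) * A * (n : ℝ) ^ (l - 1 - T.card) → A ≤ Z.card / n + 2 * d + d01 →
        ((P'.filter fun q => inT J q.2 = T).card : ℝ) * p ^ (l - T.card) ≤
        (W.card : ℝ) ^ (l + 1) * (Z.card / n + 2 * d + d01) * L := by
      intro A hA h1 h2
      calc _ ≤ (Z'.card * ((W.card : ℝ) ^ j * (n : ℝ) ^ (l - 1 - j))) * p ^ (l - T.card) := by gcongr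
        _ ≤ ((W.card : ℝ) ^ (l + 1) * A * (n : ℝ) ^ (l - 1 - T.card)) * p ^ (l - T.card) := by
            refine mul_le_mul_of_nonneg_right ?_ hpw; linarith
        _ = (W.card : ℝ) ^ (l + 1) * A * ((n : ℝ) ^ (l - 1 - T.card) * p ^ (l - T.card)) := by ring
        _ ≤ (W.card : ℝ) ^ (l + 1) * A * L := by gcongr
        _ ≤ _ := by gcongr
    have hZn : 0 ≤ (Z.card : ℝ) / n := by positivity
    have hcI := card_touch hTne
    rw [← hI] at hcI
    -- generic estimate
    have hgen : ∀ (r : ℕ) (B : ℝ), 0 ≤ B → T.card ≤ j → r ≤ 2 → (Z'.card : ℝ) ≤ (W.card : ℝ) ^ r * B →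
        (Z'.card : ℝ) * (W.card : ℝ) ^ j * (n : ℝ) ^ (l - 1 - j) ≤
        (W.card : ℝ) ^ (l + 1) * B * (n : ℝ) ^ (l - 1 - T.card) := by
      intro r B hB hTj hr hZ
      have e1 : (W.card : ℝ) ^ (r + j) ≤ (W.card : ℝ) ^ (l + 1) := pow_le_pow_right₀ hw0 (by omega)
      have e2 : (n : ℝ) ^ (l - 1 - j) ≤ (n : ℝ) ^ (l - 1 - T.card) :=
        pow_le_pow_right₀ hn0 (by omega)
      calc _ ≤ ((W.card : ℝ) ^ r * B) * (W.card : ℝ) ^ j * (n : ℝ) ^ (l - 1 - T.card) := by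
            gcongr
        _ = (W.card : ℝ) ^ (r + j) * B * (n : ℝ) ^ (l - 1 - T.card) := by rw [pow_add]; ring
        _ ≤ _ := by gcongr
    by_cases c0 : (0 : Fin (l + 1)) ∈ I <;> by_cases c1 : Fin.last l ∈ I
    · -- both
      have hj2 : T.card ≤ j := by
        have h1 := card_touch_ends hTu c0 c1
        rw [← hI] at h1
        have h2 : j = I.card - 2 := by
          rw [hj, Finset.card_sdiff_of_subset (by
            rw [Finset.insert_subset_iff, Finset.singleton_subset_iff]; exact ⟨c0, c1⟩),
            Finset.card_pair hne]
        omega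
      refine hred d01 a01 (hgen 2 d01 a01 hj2 le_rfl ?_) (by linarith)
      have : Z' ⊆ (W ×ˢ W).biUnion fun u => Z.filter fun c => e0 c = u.1 ∧ e1 c = u.2 := by
        intro c hc
        obtain ⟨b1, b2, b3⟩ := Finset.mem_filter.1 hc
        rw [Finset.mem_biUnion]
        exact ⟨(e0 c, e1 c), Finset.mem_product.2 ⟨b2 c0, b3 c1⟩,
          Finset.mem_filter.2 ⟨b1, rfl, rfl⟩⟩
      calc (Z'.card : ℝ) ≤ ∑ u ∈ W ×ˢ W, ((Z.filter fun c => e0 c = u.1 ∧ e1 c = u.2).card : ℝ) := by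
            exact_mod_cast (Finset.card_le_card this).trans Finset.card_biUnion_le
        _ ≤ ∑ u ∈ W ×ˢ W, d01 := Finset.sum_le_sum fun u _ => hd01 _ _
        _ = _ := by rw [Finset.sum_const, Finset.card_product, nsmul_eq_mul]; push_cast; ring
    · have hj2 : T.card ≤ j := by
        have h2 : j = I.card - 1 := by
          rw [hj, show I \ {0, Fin.last l} = I.erase 0 by
            ext i; simp only [Finset.mem_sdiff, Finset.mem_insert, Finset.mem_singleton, not_or,
              Finset.mem_erase]
            constructor
            · rintro ⟨h1, h2, h3⟩; exact ⟨h2, h1⟩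
            · rintro ⟨h1, h2⟩; exact ⟨h2, h1, fun h => c1 (h ▸ h2)⟩]
          exact Finset.card_erase_of_mem c0
        omega
      refine hred d a0 (hgen 1 d a0 hj2 (by norm_num) ?_) (by linarith)
      have : Z' ⊆ W.biUnion fun u => Z.filter fun c => e0 c = u := by
        intro c hc
        obtain ⟨b1, b2, b3⟩ := Finset.mem_filter.1 hc
        rw [Finset.mem_biUnion]
        exact ⟨e0 c, b2 c0, Finset.mem_filter.2 ⟨b1, rfl⟩⟩
      calc (Z'.card : ℝ) ≤ ∑ u ∈ W, ((Z.filter fun c => e0 c = u).card : ℝ) := by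
            exact_mod_cast (Finset.card_le_card this).trans Finset.card_biUnion_le
        _ ≤ ∑ u ∈ W, d := Finset.sum_le_sum fun u _ => hd0 _
        _ = _ := by rw [Finset.sum_const, nsmul_eq_mul]; ring
    · have hj2 : T.card ≤ j := by
        have h2 : j = I.card - 1 := by
          rw [hj, show I \ {0, Fin.last l} = I.erase (Fin.last l) by
            ext i; simp only [Finset.mem_sdiff, Finset.mem_insert, Finset.mem_singleton, not_or,
              Finset.mem_erase]
            constructor
            · rintro ⟨h1, h2, h3⟩; exact ⟨h3, h1⟩
            · rintro ⟨h1, h2⟩; exact ⟨h2, fun h => c0 (h ▸ h2), h1⟩]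
          exact Finset.card_erase_of_mem c1
        omega
      refine hred d a0 (hgen 1 d a0 hj2 (by norm_num) ?_) (by linarith)
      have : Z' ⊆ W.biUnion fun u => Z.filter fun c => e1 c = u := by
        intro c hc
        obtain ⟨b1, b2, b3⟩ := Finset.mem_filter.1 hc
        rw [Finset.mem_biUnion]
        exact ⟨e1 c, b3 c1, Finset.mem_filter.2 ⟨b1, rfl⟩⟩
      calc (Z'.card : ℝ) ≤ ∑ u ∈ W, ((Z.filter fun c => e1 c = u).card : ℝ) := by
            exact_mod_cast (Finset.card_le_card this).trans Finset.card_biUnion_le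
        _ ≤ ∑ u ∈ W, d := Finset.sum_le_sum fun u _ => hd1 _
        _ = _ := by rw [Finset.sum_const, nsmul_eq_mul]; ring
    · have hj2 : j = I.card := by
        rw [hj, show I \ {0, Fin.last l} = I by
          ext i; simp only [Finset.mem_sdiff, Finset.mem_insert, Finset.mem_singleton, not_or]
          constructor
          · rintro ⟨h1, h2, h3⟩; exact h1
          · intro h2; exact ⟨h2, fun h => c0 (h ▸ h2), fun h => c1 (h ▸ h2)⟩]
      refine hred (Z.card / n) hZn ?_ (by linarith)
      have hzz : (Z'.card : ℝ) ≤ Z.card := by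
        exact_mod_cast Finset.card_le_card (Finset.filter_subset _ _)
      have hpp : (n : ℝ) ^ (l - 1 - T.card) = n * (n : ℝ) ^ (l - 1 - T.card - 1) := by
        rw [← pow_succ']; congr 1; omega
      have hn' : (n : ℝ) ≠ 0 := by positivity
      have e1 : (W.card : ℝ) ^ j ≤ (W.card : ℝ) ^ (l + 1) := pow_le_pow_right₀ hw0 (by omega)
      have e2 : (n : ℝ) ^ (l - 1 - j) ≤ (n : ℝ) ^ (l - 1 - T.card - 1) :=
        pow_le_pow_right₀ hn0 (by omega)
      calc _ ≤ (Z.card : ℝ) * (W.card : ℝ) ^ (l + 1) * (n : ℝ) ^ (l - 1 - T.card - 1) := by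
            gcongr
        _ = _ := by rw [hpp]; field_simp
  calc _ ≤ ∑ T : Finset (Fin l), (W.card : ℝ) ^ (l + 1) * (Z.card / n + 2 * d + d01) * L :=
        Finset.sum_le_sum fun T _ => hbound T
    _ = _ := by
        rw [Finset.sum_const, Finset.card_univ, Fintype.card_finset, Fintype.card_fin, nsmul_eq_mul]
        push_cast; ring

/-! ### Counting tuples -/

lemma count_rel {m : ℕ} {V : Type*} [DecidableEq V] (A : Fin m → Finset V) (i j : Fin m) (hij : i ≠ j)
    (f : V → Finset V) (d : ℕ) (hf : ∀ v, (f v).card ≤ d) :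
    ((Fintype.piFinset A).filter fun x => x i ∈ f (x j)).card ≤ d * ∏ t ∈ Finset.univ.erase i, (A t).card := by
  set B := (Fintype.piFinset A).filter fun x => x i ∈ f (x j) with hB
  rcases B.eq_empty_or_nonempty with h | ⟨x0, hx0⟩
  · rw [h]; simp
  have hx0' := Fintype.mem_piFinset.1 (Finset.mem_filter.1 hx0).1
  set φ : (Fin m → V) → (Fin m → V) := fun x => Function.update x i (x0 i) with hφ
  have h1 : (B.image φ).card ≤ ∏ t ∈ Finset.univ.erase i, (A t).card := by
    have : B.image φ ⊆ Fintype.piFinset (Function.update A i {x0 i}) := by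
      intro y hy
      obtain ⟨x, hx, rfl⟩ := Finset.mem_image.1 hy
      have hx' := Fintype.mem_piFinset.1 (Finset.mem_filter.1 hx).1
      rw [Fintype.mem_piFinset]
      intro t
      by_cases ht : t = i
      · subst ht; simp [φ]
      · simpa [φ, ht] using hx' t
    refine (Finset.card_le_card this).trans (le_of_eq ?_)
    rw [Fintype.card_piFinset, ← Finset.mul_prod_erase _ _ (Finset.mem_univ i)]
    simp only [Function.update_self, Finset.card_singleton, one_mul]
    exact Finset.prod_congr rfl fun t ht => by rw [Function.update_of_ne (Finset.ne_of_mem_erase ht)]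
  have h2 : B.card ≤ d * (B.image φ).card := by
    refine Finset.card_le_mul_card_image B d fun y hy => ?_
    obtain ⟨x, hx, rfl⟩ := Finset.mem_image.1 hy
    refine le_trans ?_ (hf (x j))
    refine Finset.card_le_card_of_injOn (fun z => z i) ?_ ?_
    · intro z hz
      obtain ⟨hz, hzx⟩ := Finset.mem_filter.1 hz
      have h3 : z j = x j := by
        have := congrFun hzx j
        simpa [φ, hij.symm] using this
      simpa [h3] using (Finset.mem_filter.1 hz).2
    · intro z hz z' hz' h
      obtain ⟨_, hzx⟩ := Finset.mem_filter.1 hz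
      obtain ⟨_, hzx'⟩ := Finset.mem_filter.1 hz'
      funext t
      by_cases ht : t = i
      · subst ht; exact h
      · have := congrFun (hzx.trans hzx'.symm) t
        simpa [φ, ht] using this
  exact h2.trans (Nat.mul_le_mul_left _ h1)

lemma count_good {m : ℕ} {V : Type*} [DecidableEq V] (A : Fin m → Finset V) (C : Finset (Fin m × Fin m))
    (f : V → Finset V) (d N : ℕ) (hf : ∀ v, (f v).card ≤ d)
    (hC : ∀ c ∈ C, c.1 ≠ c.2 ∧ ∏ t ∈ Finset.univ.erase c.1, (A t).card ≤ N) :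
    ∏ t, (A t).card ≤ ((Fintype.piFinset A).filter fun x => ∀ c ∈ C, x c.1 ∉ f (x c.2)).card +
      C.card * (d * N) := by
  rw [← Fintype.card_piFinset,
    ← Finset.card_filter_add_card_filter_not (s := Fintype.piFinset A) (fun x => ∀ c ∈ C, x c.1 ∉ f (x c.2))]
  gcongr
  have : ((Fintype.piFinset A).filter fun x => ¬ ∀ c ∈ C, x c.1 ∉ f (x c.2)) ⊆
      C.biUnion fun c => (Fintype.piFinset A).filter fun x => x c.1 ∈ f (x c.2) := by
    intro x hx
    obtain ⟨hx, h⟩ := Finset.mem_filter.1 hx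
    push Not at h
    obtain ⟨c, hc, h⟩ := h
    exact Finset.mem_biUnion.2 ⟨c, hc, Finset.mem_filter.2 ⟨hx, h⟩⟩
  refine (Finset.card_le_card this).trans (Finset.card_biUnion_le_card_mul _ _ _ fun c hc => ?_)
  exact (count_rel A c.1 c.2 (hC c hc).1 f d hf).trans (Nat.mul_le_mul_left _ (hC c hc).2)

/-! ### Cycles -/

/-- Edges of the closed tuple. -/
def ce {V : Type*} {k : ℕ} (x : Fin (k + 1) → V) (i : Fin (k + 1)) : Sym2 V := s(x i, x (i + 1))

/-- Edge set of the closed tuple. -/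
def cycE {V : Type*} [DecidableEq V] {k : ℕ} (x : Fin (k + 1) → V) : Finset (Sym2 V) :=
  Finset.univ.image (ce x)

lemma mem_cycE {V : Type*} [DecidableEq V] {k : ℕ} {x : Fin (k + 1) → V} {e : Sym2 V} :
    e ∈ cycE x ↔ ∃ i, ce x i = e := by simp [cycE]

lemma cycE_eq {V : Type*} [DecidableEq V] {k : ℕ} (x : Fin (k + 1) → V) :
    cycE x = insert s(x 0, x (Fin.last k)) (pathE x) := by
  ext e
  rw [mem_cycE, Finset.mem_insert, mem_pathE]
  constructor
  · rintro ⟨i, rfl⟩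
    rcases Fin.eq_castSucc_or_eq_last i with ⟨j, rfl⟩ | rfl
    · right; exact ⟨j, by simp [pe, ce]⟩
    · left; simp [ce, Sym2.eq_swap]
  · rintro (rfl | ⟨j, rfl⟩)
    · exact ⟨Fin.last k, by simp [ce, Sym2.eq_swap]⟩
    · exact ⟨j.castSucc, by simp [pe, ce]⟩

lemma ends_notMem_pathE {V : Type*} [DecidableEq V] {k : ℕ} (hk : 2 ≤ k) {x : Fin (k + 1) → V}
    (hx : Function.Injective x) : s(x 0, x (Fin.last k)) ∉ pathE x := by
  intro h
  obtain ⟨i, hi⟩ := mem_pathE.1 h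
  unfold pe at hi
  rw [Sym2.eq_iff] at hi
  rcases hi with ⟨a, b⟩ | ⟨a, b⟩
  · have a := congrArg Fin.val (hx a); have b := congrArg Fin.val (hx b); simp at a b; omega
  · have a := congrArg Fin.val (hx a); have b := congrArg Fin.val (hx b); simp at a b

lemma card_cycE {V : Type*} [DecidableEq V] {k : ℕ} (hk : 2 ≤ k) {x : Fin (k + 1) → V}
    (hx : Function.Injective x) : (cycE x).card = k + 1 := by
  rw [cycE_eq, Finset.card_insert_of_notMem (ends_notMem_pathE hk hx), card_pathE hx]

lemma ce_injective {V : Type*} [DecidableEq V] {k : ℕ} (hk : 2 ≤ k) {x : Fin (k + 1) → V}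
    (hx : Function.Injective x) : Function.Injective (ce x) := by
  have h := card_cycE hk hx
  unfold cycE at h
  have := Finset.card_image_iff.1 (h.trans (by simp : k + 1 = (Finset.univ : Finset (Fin (k+1))).card))
  intro i j hij
  exact this (by simp) (by simp) hij

open Fin.NatCast Fin.CommRing in
/-- The closure step on cyclic index sets. -/
lemma card_ctouch {k : ℕ} {T : Finset (Fin (k + 1))} (hT : T.Nonempty) (hTu : T ≠ Finset.univ) :
    T.card + 1 ≤ (T ∪ T.image (· + 1)).card := by
  refine Nat.succ_le_of_lt (Finset.card_lt_card ?_)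
  refine ⟨Finset.subset_union_left, fun h => hTu ?_⟩
  obtain ⟨t, ht⟩ := hT
  have h1 : ∀ a ∈ T, a + 1 ∈ T := fun a ha =>
    h (Finset.mem_union_right _ (Finset.mem_image_of_mem _ ha))
  have h2 : ∀ j : ℕ, t + (j : Fin (k + 1)) ∈ T := by
    intro j
    induction j with
    | zero => simpa using ht
    | succ j ih => have := h1 _ ih; rwa [add_assoc, ← Nat.cast_succ] at this
  refine Finset.eq_univ_iff_forall.2 fun i => ?_
  have := h2 (i - t).val
  rwa [Fin.cast_val_eq_self, add_sub_cancel] at this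

/-- Total weight of the cycles meeting `J`. -/
lemma cyc_overlap {n k : ℕ} (hk : 2 ≤ k) (J : Finset (Sym2 (Fin n))) (W : Finset (Fin n))
    (hW : ∀ e ∈ J, ∀ v ∈ e, v ∈ W) (hW1 : 1 ≤ W.card) (P : Finset (Fin (k + 1) → Fin n))
    (hP : ∀ y ∈ P, Function.Injective y) {p : ℝ} (hp : 0 ≤ p) (hnp : 1 ≤ n * p) {Λ : ℝ}
    (hΛ : (n : ℝ) ^ (k - 1) * p ^ k ≤ Λ) (hΛ1 : 1 ≤ Λ) :
    ∑ y ∈ P with ¬ Disjoint J (cycE y), p ^ (cycE y \ J).card ≤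
      2 ^ (k + 1) * (W.card : ℝ) ^ (k + 1) * Λ := by
  have hn : 1 ≤ n := by
    rcases Nat.eq_zero_or_pos n with h | h
    · subst h; simp at hnp; linarith
    · exact h
  have hn0 : (1 : ℝ) ≤ n := by exact_mod_cast hn
  have hw0 : (1 : ℝ) ≤ W.card := by exact_mod_cast hW1
  set P' := P.filter fun y => ¬ Disjoint J (cycE y) with hP'
  set tt : (Fin (k + 1) → Fin n) → Finset (Fin (k + 1)) := fun y => Finset.univ.filter fun i => ce y i ∈ J with htt
  rw [← Finset.sum_fiberwise P' tt]
  have hbound : ∀ T : Finset (Fin (k + 1)), ∑ y ∈ P' with tt y = T, p ^ (cycE y \ J).card ≤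
      (W.card : ℝ) ^ (k + 1) * Λ := by
    intro T
    rcases Finset.eq_empty_or_nonempty (P'.filter fun y => tt y = T) with he | ⟨y0, hy0⟩
    · rw [he, Finset.sum_empty]; positivity
    have hTne : T.Nonempty := by
      obtain ⟨hq, hqT⟩ := Finset.mem_filter.1 hy0
      have hnd := (Finset.mem_filter.1 hq).2
      rw [Finset.not_disjoint_iff] at hnd
      obtain ⟨e, he, he'⟩ := hnd
      obtain ⟨i, rfl⟩ := mem_cycE.1 he'
      exact ⟨i, by rw [← hqT]; simp [htt, he]⟩
    have hwt : ∀ y ∈ P'.filter (fun y => tt y = T), (cycE y \ J).card = k + 1 - T.card := by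
      intro y hy
      obtain ⟨hq, hqT⟩ := Finset.mem_filter.1 hy
      have hinj := ce_injective hk (hP y (Finset.mem_filter.1 hq).1)
      have h1 : cycE y ∩ J = (tt y).image (ce y) := by
        ext e; simp only [cycE, htt, Finset.mem_inter, Finset.mem_image, Finset.mem_filter,
          Finset.mem_univ, true_and]
        constructor
        · rintro ⟨⟨i, rfl⟩, h⟩; exact ⟨i, h, rfl⟩
        · rintro ⟨i, h, rfl⟩; exact ⟨⟨i, rfl⟩, h⟩
      have h2 := Finset.card_sdiff_add_card_inter (cycE y) J
      rw [h1, Finset.card_image_of_injective _ hinj, card_cycE hk (hP y (Finset.mem_filter.1 hq).1), hqT] at h2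
      omega
    set I := T ∪ T.image (· + 1) with hI
    have hcount : ((P'.filter fun y => tt y = T).card : ℝ) ≤ (W.card : ℝ) ^ (k + 1) * n ^ (k + 1 - I.card) := by
      have hsub : (P'.filter fun y => tt y = T) ⊆ Fintype.piFinset fun i => if i ∈ I then W else Finset.univ := by
        intro y hy
        obtain ⟨hq, hqT⟩ := Finset.mem_filter.1 hy
        rw [Fintype.mem_piFinset]
        intro i
        split_ifs with hi
        · rcases Finset.mem_union.1 hi with h | h
          · rw [← hqT] at h
            exact hW _ (Finset.mem_filter.1 h).2 _ (by simp [ce])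
          · obtain ⟨j, hj, rfl⟩ := Finset.mem_image.1 h
            rw [← hqT] at hj
            exact hW _ (Finset.mem_filter.1 hj).2 _ (by simp [ce])
        · simp
      have h1 := Finset.card_le_card hsub
      rw [Fintype.card_piFinset] at h1
      have h2 : ∏ i : Fin (k + 1), (if i ∈ I then W else (Finset.univ : Finset (Fin n))).card =
          W.card ^ I.card * n ^ (k + 1 - I.card) := by
        have : ∀ i : Fin (k + 1), (if i ∈ I then W else (Finset.univ : Finset (Fin n))).card =
          if i ∈ I then W.card else n := by intro i; split_ifs <;> simp
        rw [Finset.prod_congr rfl fun i _ => this i, Finset.prod_ite]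
        simp only [Finset.prod_const, Finset.filter_mem_eq_inter, Finset.univ_inter]
        congr 2
        rw [Finset.filter_not, Finset.filter_mem_eq_inter, Finset.univ_inter, ← Finset.compl_eq_univ_sdiff,
          Finset.card_compl, Fintype.card_fin]
      rw [h2] at h1
      calc ((P'.filter fun y => tt y = T).card : ℝ) ≤ (W.card : ℝ) ^ I.card * n ^ (k + 1 - I.card) := by
            exact_mod_cast h1
        _ ≤ (W.card : ℝ) ^ (k + 1) * n ^ (k + 1 - I.card) := by
            gcongr
            simpa using Finset.card_le_univ I
    rw [Finset.sum_congr rfl fun y hy => by rw [hwt y hy], Finset.sum_const, nsmul_eq_mul]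
    have key : (n : ℝ) ^ (k + 1 - I.card) * p ^ (k + 1 - T.card) ≤ Λ := by
      by_cases hTu : T = Finset.univ
      · have hc : T.card = k + 1 := by simp [hTu]
        have hc' : I.card = k + 1 := by
          have : I = Finset.univ := by simp [hI, hTu]
          simp [this]
        rw [hc, hc']; simpa using hΛ1
      · have hc : T.card + 1 ≤ I.card := card_ctouch hTne hTu
        have ht1 : 1 ≤ T.card := hTne.card_pos
        have htk : I.card ≤ k + 1 := by simpa using Finset.card_le_univ I
        obtain ⟨a, ha⟩ : ∃ a, k = T.card + a := ⟨k - T.card, by omega⟩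
        obtain ⟨b, hb⟩ : ∃ b, T.card = b + 1 := ⟨T.card - 1, by omega⟩
        calc (n : ℝ) ^ (k + 1 - I.card) * p ^ (k + 1 - T.card) ≤ (n : ℝ) ^ a * p ^ (a + 1) := by
              have e1 : k + 1 - T.card = a + 1 := by omega
              rw [e1]; gcongr
              omega
          _ ≤ (n : ℝ) ^ a * p ^ (a + 1) * (n * p) ^ b :=
              le_mul_of_one_le_right (by positivity) (one_le_pow₀ hnp)
          _ = (n : ℝ) ^ (k - 1) * p ^ k := by
              have e1 : k - 1 = a + b := by omega
              have e2 : k = a + 1 + b := by omega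
              rw [e1]; rw [show p ^ k = p ^ (a + 1 + b) by rw [← e2], mul_pow]; ring
          _ ≤ Λ := hΛ
    calc ((P'.filter fun y => tt y = T).card : ℝ) * p ^ (k + 1 - T.card)
        ≤ (W.card : ℝ) ^ (k + 1) * n ^ (k + 1 - I.card) * p ^ (k + 1 - T.card) := by gcongr
      _ ≤ _ := by rw [mul_assoc]; gcongr
  calc _ ≤ ∑ T : Finset (Fin (k + 1)), (W.card : ℝ) ^ (k + 1) * Λ := Finset.sum_le_sum fun T _ => hbound T
    _ = _ := by simp [Finset.sum_const, nsmul_eq_mul]; ring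

/-- The edges of the complete graph. -/
def KE (n : ℕ) : Finset (Sym2 (Fin n)) := Finset.univ.filter fun e => ¬ e.IsDiag

lemma mem_KE {n : ℕ} {a b : Fin n} : s(a, b) ∈ KE n ↔ a ≠ b := by simp [KE]

lemma exists_lt_of_mem_KE {n : ℕ} {e : Sym2 (Fin n)} (he : e ∈ KE n) : ∃ a b, a < b ∧ e = s(a, b) := by
  induction e using Sym2.ind with
  | _ a b =>
    rcases lt_or_gt_of_ne (mem_KE.1 he) with h | h
    · exact ⟨a, b, h, rfl⟩
    · exact ⟨b, a, h, Sym2.eq_swap⟩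

/-- Degree of `v` in the edge set `F`. -/
def deg {n : ℕ} (F : Finset (Sym2 (Fin n))) (v : Fin n) : ℕ := (F.filter fun e => v ∈ e).card

/-- Neighbours. -/
def nb {n : ℕ} (F : Finset (Sym2 (Fin n))) (v : Fin n) : Finset (Fin n) :=
  Finset.univ.filter fun w => s(v, w) ∈ F

lemma mem_nb {n : ℕ} {F : Finset (Sym2 (Fin n))} {v w : Fin n} : w ∈ nb F v ↔ s(v, w) ∈ F := by simp [nb]

lemma card_nb {n : ℕ} (F : Finset (Sym2 (Fin n))) (v : Fin n) : (nb F v).card = deg F v := by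
  refine Finset.card_bij (fun w _ => s(v, w)) ?_ ?_ ?_
  · intro w hw; simpa using mem_nb.1 hw
  · intro a _ b _ h; exact Sym2.congr_right.1 h
  · intro e he
    obtain ⟨h1, h2⟩ := Finset.mem_filter.1 he
    obtain ⟨w, rfl⟩ := Sym2.mem_iff_exists.1 h2
    exact ⟨w, mem_nb.2 h1, rfl⟩

lemma pathE_sub_KE {n l : ℕ} {x : Fin (l + 1) → Fin n} (hx : Function.Injective x) : pathE x ⊆ KE n := by
  intro e he
  obtain ⟨i, rfl⟩ := mem_pathE.1 he
  refine mem_KE.2 fun h => ?_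
  have := congrArg Fin.val (hx h); simp at this

lemma cycE_sub_KE {n k : ℕ} (hk : 1 ≤ k) {x : Fin (k + 1) → Fin n} (hx : Function.Injective x) : cycE x ⊆ KE n := by
  rw [cycE_eq]
  refine Finset.insert_subset (mem_KE.2 fun h => ?_) (pathE_sub_KE hx)
  have := congrArg Fin.val (hx h); simp at this; omega

/-- Bridges of pairs of `F`, with interior in `R`, avoiding `J`. -/
def brid {n : ℕ} (k : ℕ) (F J : Finset (Sym2 (Fin n))) (R : Finset (Fin n)) : Finset (Fin (k + 1) → Fin n) :=
  Finset.univ.filter fun x => Function.Injective x ∧ x 0 < x (Fin.last k) ∧ s(x 0, x (Fin.last k)) ∈ F ∧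
    (∀ i, i ≠ 0 → i ≠ Fin.last k → x i ∈ R) ∧ Disjoint (pathE x) J

lemma mem_brid {n k : ℕ} {F J : Finset (Sym2 (Fin n))} {R : Finset (Fin n)} {x : Fin (k + 1) → Fin n} :
    x ∈ brid k F J R ↔ Function.Injective x ∧ x 0 < x (Fin.last k) ∧ s(x 0, x (Fin.last k)) ∈ F ∧
    (∀ i, i ≠ 0 → i ≠ Fin.last k → x i ∈ R) ∧ Disjoint (pathE x) J := by simp [brid]

lemma card_int {k : ℕ} (hk : 1 ≤ k) :
    ((Finset.univ : Finset (Fin (k + 1))) \ {0, Fin.last k}).card = k - 1 := by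
  rw [Finset.card_sdiff_of_subset (by simp)]
  have : (0 : Fin (k + 1)) ≠ Fin.last k := by
    intro h; have := congrArg Fin.val h; simp at this; omega
  rw [Finset.card_pair this]; simp

lemma prod_ends {k : ℕ} {V : Type*} (a b : V) (R : Finset V) (T : Finset (Fin (k + 1))) :
    ∏ t ∈ T, (if t = 0 then {a} else if t = Fin.last k then {b} else R : Finset V).card =
      R.card ^ (T \ {0, Fin.last k}).card := by
  have : ∀ t : Fin (k + 1), (if t = 0 then {a} else if t = Fin.last k then {b} else R : Finset V).card =
      if t ∈ ({0, Fin.last k} : Finset (Fin (k + 1))) then 1 else R.card := by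
    intro t
    by_cases h : t = 0
    · simp [h]
    · by_cases h' : t = Fin.last k
      · rw [if_neg h, if_pos h', if_pos (by simp [h'])]; simp
      · rw [if_neg h, if_neg h', if_neg (by simp [h, h'])]
  rw [Finset.prod_congr rfl fun t _ => this t, Finset.prod_ite]
  simp only [Finset.prod_const, one_pow, one_mul]
  congr 2
  ext; simp

/-- the path tuples with given ends -/
def ptup {n : ℕ} (k : ℕ) (a b : Fin n) (R : Finset (Fin n)) (J : Finset (Sym2 (Fin n))) : Finset (Fin (k + 1) → Fin n) :=
  Finset.univ.filter fun x => Function.Injective x ∧ x 0 = a ∧ x (Fin.last k) = b ∧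
    (∀ i, i ≠ 0 → i ≠ Fin.last k → x i ∈ R) ∧ Disjoint (pathE x) J

lemma mem_ptup {n k : ℕ} {a b : Fin n} {R : Finset (Fin n)} {J : Finset (Sym2 (Fin n))}
    {x : Fin (k + 1) → Fin n} : x ∈ ptup k a b R J ↔ Function.Injective x ∧ x 0 = a ∧ x (Fin.last k) = b ∧
    (∀ i, i ≠ 0 → i ≠ Fin.last k → x i ∈ R) ∧ Disjoint (pathE x) J := by simp [ptup]

lemma card_ptup_le {n k : ℕ} (hk : 1 ≤ k) (a b : Fin n) (R : Finset (Fin n)) (J : Finset (Sym2 (Fin n))) :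
    (ptup k a b R J).card ≤ n ^ (k - 1) := by
  have hs : ptup k a b R J ⊆ Fintype.piFinset (fun t : Fin (k + 1) => (if t = 0 then {a} else if t = Fin.last k then {b} else Finset.univ : Finset (Fin n))) := by
    intro x hx
    obtain ⟨_, h0, h1, _⟩ := mem_ptup.1 hx
    rw [Fintype.mem_piFinset]
    intro t; split_ifs with h h'
    · simp [h, h0]
    · simp [h', h1]
    · simp
  have := Finset.card_le_card hs
  rw [Fintype.card_piFinset, prod_ends, card_int hk] at this
  simpa using this

lemma card_ptup_ge {n k : ℕ} (hk : 2 ≤ k) {a b : Fin n} (hab : a ≠ b) (R : Finset (Fin n)) (J : Finset (Sym2 (Fin n)))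
    (D : ℕ) (hD : ∀ v, deg J v ≤ D) :
    R.card ^ (k - 1) ≤ (ptup k a b R J).card + (k + 1) ^ 2 * ((D + 1) * n ^ (k - 2)) := by
  have h0l : (0 : Fin (k + 1)) ≠ Fin.last k := by
    intro h; have := congrArg Fin.val h; simp at this; omega
  set A : Fin (k + 1) → Finset (Fin n) := fun t => if t = 0 then {a} else if t = Fin.last k then {b} else R with hA
  set C : Finset (Fin (k + 1) × Fin (k + 1)) := Finset.univ.filter fun c => c.1 ≠ c.2 ∧ c.1 ≠ 0 ∧ c.1 ≠ Fin.last k with hC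
  have hCc : C.card ≤ (k + 1) ^ 2 := by
    refine (Finset.card_le_univ C).trans (le_of_eq ?_); simp [sq]
  set f : Fin n → Finset (Fin n) := fun v => insert v (nb J v) with hf
  have h1 := count_good A C f (D + 1) (n ^ (k - 2))
    (fun v => (Finset.card_insert_le _ _).trans (by rw [card_nb]; exact Nat.add_le_add_right (hD v) 1))
    (fun c hc => by
      have hc := (Finset.mem_filter.1 hc).2
      refine ⟨hc.1, ?_⟩
      rw [hA, prod_ends]
      have e1 : ((Finset.univ.erase c.1) \ {0, Fin.last k}).card = k - 2 := by
        rw [show Finset.univ.erase c.1 \ {0, Fin.last k} = (Finset.univ \ {0, Fin.last k}).erase c.1 by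
          ext; simp, Finset.card_erase_of_mem (by simp [hc.2.1, hc.2.2]), card_int (by omega)]
        omega
      rw [e1]
      exact Nat.pow_le_pow_left (by simpa using Finset.card_le_univ R) _)
  rw [hA, prod_ends, card_int (by omega)] at h1
  refine h1.trans (Nat.add_le_add (Finset.card_le_card ?_) (Nat.mul_le_mul_right _ hCc))
  intro x hx
  obtain ⟨hxA, hxC⟩ := Finset.mem_filter.1 hx
  rw [Fintype.mem_piFinset] at hxA
  have x0 : x 0 = a := by simpa using hxA 0
  have xl : x (Fin.last k) = b := by
    have := hxA (Fin.last k); rw [if_neg h0l.symm, if_pos rfl] at this; simpa using this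
  have xi : ∀ i, i ≠ 0 → i ≠ Fin.last k → x i ∈ R := by
    intro i h h'; have := hxA i; rwa [if_neg h, if_neg h'] at this
  have hc : ∀ i j, i ≠ j → i ≠ 0 → i ≠ Fin.last k → x i ≠ x j ∧ s(x j, x i) ∉ J := by
    intro i j hij h h'
    have := hxC (i, j) (Finset.mem_filter.2 ⟨Finset.mem_univ _, hij, h, h'⟩)
    simp only [hf, Finset.mem_insert, mem_nb, not_or] at this
    exact this
  refine mem_ptup.2 ⟨?_, x0, xl, xi, ?_⟩
  · intro i j h
    by_contra hij
    by_cases hi : i ≠ 0 ∧ i ≠ Fin.last k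
    · exact (hc i j hij hi.1 hi.2).1 h
    by_cases hj : j ≠ 0 ∧ j ≠ Fin.last k
    · exact (hc j i (Ne.symm hij) hj.1 hj.2).1 h.symm
    · have hi' : i = 0 ∨ i = Fin.last k := by tauto
      have hj' : j = 0 ∨ j = Fin.last k := by tauto
      rcases hi' with rfl | rfl <;> rcases hj' with rfl | rfl
      · exact hij rfl
      · exact hab (by rw [← x0, ← xl, h])
      · exact hab (by rw [← x0, ← xl, h])
      · exact hij rfl
  · rw [Finset.disjoint_left]
    intro e he heJ
    obtain ⟨i, rfl⟩ := mem_pathE.1 he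
    unfold pe at heJ
    have hne : i.castSucc ≠ i.succ := by intro h; have := congrArg Fin.val h; simp at this
    by_cases hi : i.castSucc = 0
    · refine (hc i.succ i.castSucc hne.symm (Fin.succ_ne_zero i) ?_).2 heJ
      intro h; have h1 := congrArg Fin.val h; have h2 := congrArg Fin.val hi; simp at h1 h2; omega
    · exact (hc i.castSucc i.succ hne hi (Fin.castSucc_lt_last i).ne).2 (by rwa [Sym2.eq_swap])

lemma card_brid {n k : ℕ} {F J : Finset (Sym2 (Fin n))} {R : Finset (Fin n)} :
    (brid k F J R).card = ∑ e ∈ F, ((brid k F J R).filter fun x => s(x 0, x (Fin.last k)) = e).card :=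
  Finset.card_eq_sum_card_fiberwise fun _ hx => (mem_brid.1 hx).2.2.1

lemma brid_fiber {n k : ℕ} {F J : Finset (Sym2 (Fin n))} {R : Finset (Fin n)} {a b : Fin n} (hab : a < b)
    (h : s(a, b) ∈ F) :
    ((brid k F J R).filter fun x => s(x 0, x (Fin.last k)) = s(a, b)) = ptup k a b R J := by
  ext x
  rw [Finset.mem_filter, mem_brid, mem_ptup]
  constructor
  · rintro ⟨⟨h1, h2, h3, h4, h5⟩, h6⟩
    rw [Sym2.eq_iff] at h6
    rcases h6 with ⟨h6, h7⟩ | ⟨h6, h7⟩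
    · exact ⟨h1, h6, h7, h4, h5⟩
    · rw [h6, h7] at h2; exact absurd h2 hab.not_gt
  · rintro ⟨h1, h2, h3, h4, h5⟩
    rw [h2, h3]
    exact ⟨⟨h1, hab, h, h4, h5⟩, rfl⟩

lemma card_brid_le {n k : ℕ} (hk : 1 ≤ k) {F J : Finset (Sym2 (Fin n))} (hF : F ⊆ KE n) {R : Finset (Fin n)} :
    (brid k F J R).card ≤ F.card * n ^ (k - 1) := by
  rw [card_brid, ← smul_eq_mul]
  refine Finset.sum_le_card_nsmul _ _ _ fun e he => ?_
  obtain ⟨a, b, hab, rfl⟩ := exists_lt_of_mem_KE (hF he)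
  rw [brid_fiber hab he]
  exact card_ptup_le hk a b R J

lemma card_brid_ge {n k : ℕ} (hk : 2 ≤ k) {F J : Finset (Sym2 (Fin n))} (hF : F ⊆ KE n) {R : Finset (Fin n)}
    (D : ℕ) (hD : ∀ v, deg J v ≤ D) :
    F.card * R.card ^ (k - 1) ≤ (brid k F J R).card + F.card * ((k + 1) ^ 2 * ((D + 1) * n ^ (k - 2))) := by
  rw [card_brid, ← smul_eq_mul, ← smul_eq_mul, ← Finset.sum_const, ← Finset.sum_const, ← Finset.sum_add_distrib]
  refine Finset.sum_le_sum fun e he => ?_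
  obtain ⟨a, b, hab, rfl⟩ := exists_lt_of_mem_KE (hF he)
  rw [brid_fiber hab he]
  exact card_ptup_ge hk hab.ne R J D hD

lemma rat_pow_bound {n k : ℕ} (hk : 2 ≤ k) {p : ℝ} (hp : 0 ≤ p) (hnp : 1 ≤ n * p) (t : ℕ) (h1 : 1 ≤ t) (h2 : t < k) :
    (n : ℝ) ^ (k - 1 - t) * p ^ (k - t) ≤ (n : ℝ) ^ (k - 2) * p ^ (k - 1) := by
  obtain ⟨b, rfl⟩ : ∃ b, t = b + 1 := ⟨t - 1, by omega⟩
  obtain ⟨c, rfl⟩ : ∃ c, k = b + 2 + c := ⟨k - b - 2, by omega⟩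
  have e1 : b + 2 + c - 1 - (b + 1) = c := by omega
  have e2 : b + 2 + c - (b + 1) = c + 1 := by omega
  have e3 : b + 2 + c - 2 = c + b := by omega
  have e4 : b + 2 + c - 1 = c + 1 + b := by omega
  rw [e1, e2, e3, e4]
  calc (n : ℝ) ^ c * p ^ (c + 1) ≤ (n : ℝ) ^ c * p ^ (c + 1) * (n * p) ^ b :=
        le_mul_of_one_le_right (by positivity) (one_le_pow₀ hnp)
    _ = _ := by rw [mul_pow]; ring

set_option maxHeartbeats 1000000 in
/-- Janson for bridges. -/
lemma path_janson {n k : ℕ} (hk : 2 ≤ k) {E F J : Finset (Sym2 (Fin n))} {R : Finset (Fin n)}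
    (hE : ∀ x ∈ brid k F J R, pathE x ⊆ E) {p : ℝ} (h0 : 0 ≤ p) (h1 : p ≤ 1) (hnp : 1 ≤ n * p)
    {D w : ℝ} (hD : ∀ v, (deg F v : ℝ) ≤ D) (hw0 : 0 ≤ w) (hw1 : w ≤ 1) :
    pr E p (noneOf (brid k F J R) pathE) ≤ Real.exp (-(w * ((brid k F J R).card * p ^ k)) +
      w ^ 2 * ((brid k F J R).card * p ^ k * (2 ^ k * (k + 1) ^ (k + 1) * (F.card / n + 2 * D + 1) *
        ((n : ℝ) ^ (k - 2) * p ^ (k - 1))))) := by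
  have hn : 1 ≤ n := by
    rcases Nat.eq_zero_or_pos n with h | h
    · subst h; simp at hnp; linarith
    · exact h
  refine (janson h0 h1 (brid k F J R) pathE hE hw0 hw1).trans (Real.exp_le_exp.2 ?_)
  have hcard : ∀ x ∈ brid k F J R, p ^ (pathE x).card = p ^ k := fun x hx => by
    rw [card_pathE (mem_brid.1 hx).1]
  rw [Finset.sum_congr rfl hcard, Finset.sum_const, nsmul_eq_mul]
  gcongr
  rw [mul_assoc, ← nsmul_eq_mul]
  refine Finset.sum_le_card_nsmul _ _ _ fun x hx => ?_
  have hxi := (mem_brid.1 hx).1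
  set Z : Finset (Fin n × Fin n) := Finset.univ.filter fun c => c.1 < c.2 ∧ s(c.1, c.2) ∈ F with hZ
  set P : Finset ((Fin n × Fin n) × (Fin (k + 1) → Fin n)) :=
    (brid k F J R).image fun y => ((y 0, y (Fin.last k)), y) with hP
  set W : Finset (Fin n) := Finset.univ.image x with hWdef
  have hWc : W.card = k + 1 := by rw [hWdef, Finset.card_image_of_injective _ hxi]; simp
  have hinj : Set.InjOn (fun c : Fin n × Fin n => s(c.1, c.2)) (Z : Set (Fin n × Fin n)) := by
    intro c hc c' hc' h
    have a1 := (Finset.mem_filter.1 hc).2.1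
    have a2 := (Finset.mem_filter.1 hc').2.1
    rcases Sym2.eq_iff.1 h with ⟨b1, b2⟩ | ⟨b1, b2⟩
    · exact Prod.ext b1 b2
    · rw [b1, b2] at a1; exact absurd a1 a2.not_gt
  have hZc : (Z.card : ℝ) ≤ F.card := by
    rw [← Finset.card_image_of_injOn hinj]
    exact_mod_cast Finset.card_le_card (by
      intro e he; obtain ⟨c, hc, rfl⟩ := Finset.mem_image.1 he; exact (Finset.mem_filter.1 hc).2.2)
  have hdeg : ∀ (q : Fin n × Fin n → Prop) [DecidablePred q] (v : Fin n), (∀ c ∈ Z, q c → v ∈ s(c.1, c.2)) →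
      ((Z.filter q).card : ℝ) ≤ D := by
    intro q _ v hq
    refine le_trans ?_ (hD v)
    have : Set.InjOn (fun c : Fin n × Fin n => s(c.1, c.2)) (Z.filter q : Set (Fin n × Fin n)) :=
      hinj.mono (by intro c hc; exact (Finset.mem_filter.1 hc).1)
    rw [← Finset.card_image_of_injOn this]
    unfold deg
    norm_cast
    refine Finset.card_le_card fun e he => ?_
    obtain ⟨c, hc, rfl⟩ := Finset.mem_image.1 he
    obtain ⟨hc, hqc⟩ := Finset.mem_filter.1 hc
    exact Finset.mem_filter.2 ⟨(Finset.mem_filter.1 hc).2.2, hq c hc hqc⟩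
  have hov := overlap_sum (by omega : 1 ≤ k) hn Z Prod.fst Prod.snd (pathE x) W (by omega)
    (by
      intro e he v hv
      obtain ⟨i, rfl⟩ := mem_pathE.1 he
      unfold pe at hv
      rw [Sym2.mem_iff] at hv
      rcases hv with rfl | rfl <;> simp [hWdef]) P
    (by
      intro q hq
      obtain ⟨y, hy, rfl⟩ := Finset.mem_image.1 hq
      have hy := mem_brid.1 hy
      exact ⟨Finset.mem_filter.2 ⟨Finset.mem_univ _, hy.2.1, hy.2.2.1⟩, hy.1, rfl, rfl⟩) h0
    (d := D) (d01 := 1) (L := (n : ℝ) ^ (k - 2) * p ^ (k - 1))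
    (fun v => hdeg _ v fun c _ h => by simp [← h]) (fun v => hdeg _ v fun c _ h => by simp [← h])
    (fun u v => by
      have : (Z.filter fun c => c.1 = u ∧ c.2 = v).card ≤ 1 := by
        refine Finset.card_le_one.2 fun c hc c' hc' => ?_
        have a1 := (Finset.mem_filter.1 hc).2
        have a2 := (Finset.mem_filter.1 hc').2
        exact Prod.ext (a1.1.trans a2.1.symm) (a1.2.trans a2.2.symm)
      exact_mod_cast this)
    (rat_pow_bound hk h0 hnp) (by positivity)
  have hD0 : 0 ≤ D := (Nat.cast_nonneg _).trans (hD ⟨0, by omega⟩)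
  rw [hWc] at hov
  push_cast at hov
  have hle : ∑ y ∈ brid k F J R with y ≠ x ∧ ¬ Disjoint (pathE x) (pathE y), p ^ (pathE x ∪ pathE y).card ≤
      p ^ k * ∑ q ∈ P with ¬ Disjoint (pathE x) (pathE q.2) ∧ ¬ pathE q.2 ⊆ pathE x, p ^ (pathE q.2 \ pathE x).card := by
    have e1 : ∑ q ∈ P with ¬ Disjoint (pathE x) (pathE q.2) ∧ ¬ pathE q.2 ⊆ pathE x, p ^ (pathE q.2 \ pathE x).card =
        ∑ y ∈ brid k F J R with ¬ Disjoint (pathE x) (pathE y) ∧ ¬ pathE y ⊆ pathE x, p ^ (pathE y \ pathE x).card := by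
      rw [Finset.sum_filter, Finset.sum_filter, hP, Finset.sum_image]
      intro y _ y' _ h
      exact (Prod.ext_iff.1 h).2
    rw [e1, Finset.mul_sum]
    refine le_trans (Finset.sum_le_sum_of_subset_of_nonneg (t := (brid k F J R).filter fun y => ¬ Disjoint (pathE x) (pathE y) ∧ ¬ pathE y ⊆ pathE x) ?_ ?_) (le_of_eq ?_)
    · intro y hy
      obtain ⟨hy, h2, h3⟩ := Finset.mem_filter.1 hy
      refine Finset.mem_filter.2 ⟨hy, h3, fun h4 => ?_⟩
      rcases path_eq (by omega) hxi (mem_brid.1 hy).1 h4 with h5 | h5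
      · exact h2 h5
      · have a1 := (mem_brid.1 hx).2.1
        have a2 := (mem_brid.1 hy).2.1
        rw [h5] at a2
        simp at a2
        exact absurd a1 a2.not_gt
    · intro y _ _; positivity
    · refine Finset.sum_congr rfl fun y hy => ?_
      rw [← pow_add, ← Finset.union_sdiff_self_eq_union, Finset.card_union_of_disjoint Finset.disjoint_sdiff, card_pathE hxi]
  refine hle.trans (mul_le_mul_of_nonneg_left (hov.trans ?_) (by positivity))
  gcongr

/-- `n^(k-1) p^k`. -/
def lam (n k : ℕ) (p : ℝ) : ℝ := (n : ℝ) ^ (k - 1) * p ^ k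

lemma lam_mul {n k : ℕ} (hk : 2 ≤ k) (p : ℝ) :
    lam n k p = n * p * ((n : ℝ) ^ (k - 2) * p ^ (k - 1)) := by
  unfold lam
  obtain ⟨b, rfl⟩ : ∃ b, k = b + 2 := ⟨k - 2, by omega⟩
  simp only [Nat.add_sub_cancel, show b + 2 - 1 = b + 1 by omega]; ring

/-- the constant -/
def Ck (k : ℕ) : ℝ := 2 ^ k * (k + 1) ^ (k + 1)

lemma Ck_pos (k : ℕ) : 0 < Ck k := by unfold Ck; positivity

lemma bridge_bound {n k : ℕ} (hk : 2 ≤ k) {E F J : Finset (Sym2 (Fin n))} {R : Finset (Fin n)} (hF : F ⊆ KE n)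
    (hE : ∀ x ∈ brid k F J R, pathE x ⊆ E) {p : ℝ} (h0 : 0 ≤ p) (h1 : p ≤ 1) (hnp : 1 ≤ n * p)
    {D L ρ δ : ℝ} {DJ : ℕ} (hD : ∀ v, (deg F v : ℝ) ≤ D) (hDJ : ∀ v, deg J v ≤ DJ)
    (hL0 : 0 ≤ L) (hL : L ≤ lam n k p)
    (hρ : ρ * (n : ℝ) ^ (k - 1) + (k + 1) ^ 2 * ((DJ + 1) * (n : ℝ) ^ (k - 2)) ≤ (R.card : ℝ) ^ (k - 1))
    (hδ : L * (Ck k * (F.card / n + 2 * D + 1)) ≤ δ * (n * p)) :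
    pr E p (noneOf (brid k F J R) pathE) ≤ Real.exp (-(F.card * L * (ρ - δ))) := by
  have hn : 0 < (n : ℝ) := by
    by_contra h
    have : (n : ℝ) = 0 := le_antisymm (not_lt.1 h) (Nat.cast_nonneg _)
    rw [this] at hnp; linarith
  have hp : 0 < p := by
    by_contra h
    have : p = 0 := le_antisymm (not_lt.1 h) h0
    rw [this] at hnp; linarith
  have hl : 0 < lam n k p := by unfold lam; positivity
  refine (path_janson hk hE h0 h1 hnp hD (w := L / lam n k p) (by positivity) ((div_le_one hl).2 hL)).trans
    (Real.exp_le_exp.2 ?_)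
  set N : ℝ := ((brid k F J R).card : ℝ) with hN
  have hN1 : N ≤ F.card * (n : ℝ) ^ (k - 1) := by
    have := card_brid_le (k := k) (by omega) hF (J := J) (R := R); rw [hN]; exact_mod_cast this
  have hN2 : F.card * (R.card : ℝ) ^ (k - 1) ≤ N + F.card * ((k + 1) ^ 2 * ((DJ + 1) * (n : ℝ) ^ (k - 2))) := by
    have := card_brid_ge hk hF (R := R) DJ hDJ; rw [hN]; exact_mod_cast this
  have hN3 : F.card * (ρ * (n : ℝ) ^ (k - 1)) ≤ N := by
    have := mul_le_mul_of_nonneg_left hρ (Nat.cast_nonneg F.card : (0 : ℝ) ≤ F.card)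
    linarith
  have e1 : F.card * L * ρ ≤ L / lam n k p * (N * p ^ k) := by
    have h2 : F.card * ρ * lam n k p ≤ N * p ^ k := by
      have := mul_le_mul_of_nonneg_right hN3 (by positivity : 0 ≤ p ^ k)
      unfold lam; linarith
    calc (F.card : ℝ) * L * ρ = L / lam n k p * (F.card * ρ * lam n k p) := by field_simp
      _ ≤ _ := by gcongr
  have e2 : (L / lam n k p) ^ 2 * (N * p ^ k * (2 ^ k * (k + 1) ^ (k + 1) * (F.card / n + 2 * D + 1) *
        ((n : ℝ) ^ (k - 2) * p ^ (k - 1)))) ≤ F.card * L * δ := by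
    have hD0 : 0 ≤ D := (Nat.cast_nonneg _).trans (hD ⟨0, by exact_mod_cast hn⟩)
    have h3 : N * p ^ k ≤ F.card * lam n k p := by
      have := mul_le_mul_of_nonneg_right hN1 (by positivity : 0 ≤ p ^ k)
      unfold lam; linarith
    have h4 : (n : ℝ) ^ (k - 2) * p ^ (k - 1) = lam n k p / (n * p) := by
      rw [lam_mul hk]; field_simp
    rw [h4]
    calc _ ≤ (L / lam n k p) ^ 2 * (F.card * lam n k p * (2 ^ k * (k + 1) ^ (k + 1) * (F.card / n + 2 * D + 1) *
          (lam n k p / (n * p)))) := by gcongr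
      _ = F.card * L * (L * (Ck k * (F.card / n + 2 * D + 1))) / (n * p) := by unfold Ck; field_simp
      _ ≤ F.card * L * (δ * (n * p)) / (n * p) := by gcongr
      _ = _ := by field_simp
  linarith

/-- Every edge lies in a cycle. -/
def Qs {n : ℕ} (k : ℕ) (s : Finset (Sym2 (Fin n))) : Prop :=
  ∀ e ∈ s, ∃ x : Fin (k + 1) → Fin n, Function.Injective x ∧ cycE x ⊆ s ∧ e ∈ cycE x

lemma sum_ind {ι : Type*} (I : Finset ι) (P : ι → Prop) [DecidablePred P] :
    ∑ x ∈ I, ind (P x) = ((I.filter P).card : ℝ) := by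
  rw [Finset.card_filter]
  push_cast
  refine Finset.sum_congr rfl fun x _ => ?_
  by_cases h : P x <;> simp [ind, h]

lemma ev_log (j : ℕ) (A c ε : ℝ) (hc : 0 < c) (hε : 0 < ε) :
    ∀ᶠ n : ℕ in atTop, A * (Real.log n) ^ j ≤ ε * (n : ℝ) ^ c := by
  have h := (isLittleO_log_rpow_rpow_atTop (j : ℝ) hc)
  have h2 := (h.const_mul_left A).def hε
  have h3 := (tendsto_natCast_atTop_atTop (R := ℝ)).eventually h2
  filter_upwards [h3] with n hn
  rw [Real.rpow_natCast] at hn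
  refine (le_abs_self _).trans ?_
  rw [Real.norm_eq_abs, Real.norm_eq_abs, abs_of_nonneg (Real.rpow_nonneg (Nat.cast_nonneg n) c)] at hn
  exact hn

lemma ev_pow (A c ε : ℝ) (hc : 0 < c) (hε : 0 < ε) :
    ∀ᶠ n : ℕ in atTop, A ≤ ε * (n : ℝ) ^ c := by
  have := ev_log 0 A c ε hc hε
  simpa using this

lemma card_KE (n : ℕ) : (KE n).card = n.choose 2 := by
  have : KE n = (⊤ : SimpleGraph (Fin n)).edgeFinset := by
    ext e; induction e using Sym2.ind with
    | _ a b => simp [mem_KE]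
  rw [this]
  simpa using SimpleGraph.card_edgeFinset_top_eq_card_choose_two (V := Fin n)

lemma card_KE_le (n : ℕ) : ((KE n).card : ℝ) ≤ (n : ℝ) ^ 2 / 2 := by
  rw [card_KE, Nat.cast_choose_two]
  have : (0 : ℝ) ≤ n := Nat.cast_nonneg n
  nlinarith

lemma card_KE_ge {n : ℕ} (hn : 2 ≤ n) : (n : ℝ) ^ 2 / 4 ≤ ((KE n).card : ℝ) := by
  rw [card_KE, Nat.cast_choose_two]
  have : (2 : ℝ) ≤ n := by exact_mod_cast hn
  nlinarith

lemma lam_cyc {n k : ℕ} (hk : 2 ≤ k) (p : ℝ) : (n : ℝ) ^ (k + 1) * p ^ (k + 1) = (n : ℝ) ^ 2 * p * lam n k p := by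
  unfold lam
  obtain ⟨b, rfl⟩ : ∃ b, k = b + 2 := ⟨k - 2, by omega⟩
  simp only [show b + 2 - 1 = b + 1 by omega]; ring

/-- injective tuples -/
def itup (n k : ℕ) : Finset (Fin (k + 1) → Fin n) := Finset.univ.filter Function.Injective

lemma ex_cyc {n k : ℕ} (hk : 2 ≤ k) {p : ℝ} (h0 : 0 ≤ p) :
    ∑ x ∈ itup n k, pr (KE n) p (fun s => cycE x ⊆ s) ≤ (n : ℝ) ^ 2 * p * lam n k p := by
  rw [Finset.sum_congr rfl (g := fun _ => p ^ (k + 1)) fun x hx => by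
    have hx := (Finset.mem_filter.1 hx).2
    rw [pr_superset (cycE_sub_KE (by omega) hx), card_cycE hk hx]]
  rw [Finset.sum_const, nsmul_eq_mul, ← lam_cyc hk]
  gcongr
  have := Finset.card_le_univ (itup n k)
  simp at this
  exact_mod_cast this

lemma P0a_bound {n k : ℕ} (hk : 2 ≤ k) (hn : 2 ≤ n) {p : ℝ} (h0 : 0 ≤ p) (h1 : p ≤ 1) :
    pr (KE n) p (fun s => Qs k s ∧ s.Nonempty) ≤ (n : ℝ) ^ 2 * p * lam n k p ∧
    (0 < p → pr (KE n) p (fun s => Qs k s ∧ s.Nonempty) ≤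
      Real.exp (-((n : ℝ) ^ 2 * p / 16)) + 32 * (k + 1) * lam n k p) := by
  constructor
  · refine le_trans ?_ (ex_cyc hk h0)
    refine le_trans ?_ (pr_exists_le h0 h1 (itup n k) fun x s => cycE x ⊆ s)
    refine pr_mono h0 h1 fun s _ hs => ?_
    obtain ⟨e, he⟩ := hs.2
    obtain ⟨x, hx, hxs, _⟩ := hs.1 e he
    exact ⟨x, by simp [itup, hx], hxs⟩
  · intro hp
    have hn0 : (0 : ℝ) < n := by exact_mod_cast (by omega : 0 < n)
    set X : Finset (Sym2 (Fin n)) → ℝ := fun s => ∑ x ∈ itup n k, ind (cycE x ⊆ s) with hX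
    have hsub : pr (KE n) p (fun s => Qs k s ∧ s.Nonempty) ≤
        pr (KE n) p (fun s => ((s ∩ KE n).card : ℝ) ≤ p * (KE n).card / 8 ∨ p * n ^ 2 / 32 ≤ (k + 1) * X s) := by
      refine pr_mono h0 h1 fun s hs hQ => ?_
      by_cases hc : ((s ∩ KE n).card : ℝ) ≤ p * (KE n).card / 8
      · exact Or.inl hc
      right
      push Not at hc
      rw [Finset.inter_eq_left.2 hs] at hc
      have h3 : (s.card : ℝ) ≤ (k + 1) * X s := by
        have hss : s ⊆ ((itup n k).filter fun x => cycE x ⊆ s).biUnion cycE := by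
          intro e he
          obtain ⟨x, hx, hxs, hex⟩ := hQ.1 e he
          exact Finset.mem_biUnion.2 ⟨x, Finset.mem_filter.2 ⟨by simp [itup, hx], hxs⟩, hex⟩
        have h4 := (Finset.card_le_card hss).trans (Finset.card_biUnion_le_card_mul _ _ (k + 1) fun x hx =>
          (card_cycE hk (Finset.mem_filter.1 (Finset.mem_filter.1 hx).1).2).le)
        have h5 : X s = (((itup n k).filter fun x => cycE x ⊆ s).card : ℝ) := by
          rw [hX]; exact sum_ind _ _
        rw [h5]
        have : (s.card : ℝ) ≤ ((((itup n k).filter fun x => cycE x ⊆ s).card * (k + 1) : ℕ) : ℝ) := by exact_mod_cast h4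
        push_cast at this; linarith
      have := card_KE_ge hn
      nlinarith
    refine hsub.trans ((pr_or_le h0 h1 _ _).trans (add_le_add ?_ ?_))
    · refine (lower_tail h0 h1 (KE n) subset_rfl).trans (Real.exp_le_exp.2 ?_)
      have := card_KE_ge hn
      nlinarith
    · refine (pr_markov h0 h1 (f := fun s => (k + 1) * X s) (fun s _ => ?_) (by positivity)).trans ?_
      · have : 0 ≤ X s := Finset.sum_nonneg fun _ _ => ind_nonneg _
        positivity
      · rw [ex_mul_left, hX, ex_sum]
        have := ex_cyc (n := n) hk h0
        unfold pr at this
        rw [div_le_iff₀ (by positivity)]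
        calc _ ≤ ((k : ℝ) + 1) * ((n : ℝ) ^ 2 * p * lam n k p) := by gcongr
          _ = _ := by ring

theorem P0a (k : ℕ) (hk : 2 ≤ k) (ε : ℝ) (hε : 0 < ε) : ∀ᶠ n : ℕ in atTop, ∀ p : ℝ, 0 ≤ p → p ≤ 1 →
    lam n k p ≤ (n : ℝ) ^ (-(1 / 2) : ℝ) → pr (KE n) p (fun s => Qs k s ∧ s.Nonempty) ≤ ε := by
  filter_upwards [eventually_ge_atTop 2, ev_pow 1 (1/4) ε (by norm_num) hε,
    ev_pow (32 * (k + 1)) (1/2) (ε / 2) (by norm_num) (by positivity),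
    ev_pow (2 * 16 / ε) (1/4) 1 (by norm_num) (by norm_num)] with n hn a1 a2 a3 p h0 h1 hl
  obtain ⟨b1, b2⟩ := P0a_bound hk hn h0 h1
  have hn0 : (0 : ℝ) < n := by exact_mod_cast (by omega : 0 < n)
  have hl0 : 0 ≤ lam n k p := by unfold lam; positivity
  by_cases hc : (n : ℝ) ^ 2 * p ≤ (n : ℝ) ^ (1/4 : ℝ)
  · refine b1.trans ?_
    calc (n : ℝ) ^ 2 * p * lam n k p ≤ (n : ℝ) ^ (1/4 : ℝ) * (n : ℝ) ^ (-(1/2) : ℝ) := by gcongr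
      _ = ((n : ℝ) ^ (1/4 : ℝ))⁻¹ := by
        rw [← Real.rpow_add hn0, ← Real.rpow_neg hn0.le]; norm_num
      _ ≤ ε := by rw [inv_le_comm₀ (by positivity) hε, ← one_div, div_le_iff₀ hε]; linarith
  · push Not at hc
    have hp : 0 < p := by
      rcases h0.lt_or_eq with h | h
      · exact h
      · rw [← h] at hc; have : 0 < (n : ℝ) ^ (1/4 : ℝ) := by positivity
        simp at hc; norm_num at hc this; linarith
    refine (b2 hp).trans ?_
    have c1 : 32 * ((k : ℝ) + 1) * lam n k p ≤ ε / 2 := by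
      calc 32 * ((k : ℝ) + 1) * lam n k p ≤ 32 * ((k : ℝ) + 1) * (n : ℝ) ^ (-(1/2) : ℝ) := by gcongr
        _ ≤ ε / 2 * (n : ℝ) ^ (1/2 : ℝ) * (n : ℝ) ^ (-(1/2) : ℝ) := by gcongr
        _ = ε / 2 := by rw [mul_assoc, ← Real.rpow_add hn0]; norm_num
    have c2 : Real.exp (-((n : ℝ) ^ 2 * p / 16)) ≤ ε / 2 := by
      have d1 : 2 / ε ≤ (n : ℝ) ^ 2 * p / 16 := by
        have : 2 * 16 / ε = 16 * (2 / ε) := by ring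
        linarith
      have d2 : 2 / ε ≤ Real.exp ((n : ℝ) ^ 2 * p / 16) := by
        have := Real.add_one_le_exp ((n : ℝ) ^ 2 * p / 16); linarith
      rw [Real.exp_neg, inv_le_comm₀ (Real.exp_pos _) (by positivity)]
      rwa [inv_div]
    linarith

lemma harris_none {α ι : Type*} [DecidableEq α] [DecidableEq ι] {E : Finset α} {p : ℝ} (h0 : 0 ≤ p) (h1 : p ≤ 1)
    (I : Finset ι) (S : ι → Finset α) (hS : ∀ i ∈ I, S i ⊆ E) :
    ∏ i ∈ I, (1 - p ^ (S i).card) ≤ pr E p (noneOf I S) := by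
  induction I using Finset.induction_on with
  | empty => simp [pr, noneOf, ind, ex_const]
  | insert i I hi ih =>
    rw [Finset.prod_insert hi]
    have h2 := ih fun j hj => hS j (Finset.mem_insert_of_mem hj)
    have h3 : pr E p (fun s => ¬ S i ⊆ s) = 1 - p ^ (S i).card := by
      unfold pr
      simp only [ind_not]
      rw [ex_sub, ex_const]
      congr 1
      exact pr_superset (hS i (Finset.mem_insert_self _ _)) p
    have h4 : pr E p (noneOf (insert i I) S) = ex E p (fun s => ind (¬ S i ⊆ s) * ind (noneOf I S s)) := by
      unfold pr
      refine ex_congr fun s _ => ?_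
      rw [← ind_and]; congr 1; simp [noneOf]
    rw [h4]
    refine le_trans ?_ (harris_anti h0 h1 (fun s t hst => ind_mono fun h hs => h (hs.trans hst)) (noneOf_anti I S))
    change _ ≤ pr E p _ * pr E p _
    rw [h3]
    have : 0 ≤ 1 - p ^ (S i).card := sub_nonneg.2 (pow_le_one₀ h0 h1)
    gcongr

lemma second_moment {α ι : Type*} [DecidableEq α] [DecidableEq ι] {E : Finset α} {p : ℝ} (h0 : 0 ≤ p) (h1 : p ≤ 1)
    (I : Finset ι) (hI : I.Nonempty) (A : ι → Finset α → Prop) {a b : ℝ} (ha : 0 < a)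
    (hlo : ∀ e ∈ I, a ≤ pr E p (A e)) (hb0 : 0 ≤ b)
    (hup : ∀ e ∈ I, ∀ f ∈ I, e ≠ f → pr E p (fun s => A e s ∧ A f s) ≤ b) :
    pr E p (fun s => ∀ e ∈ I, ¬ A e s) ≤ 1 / (I.card * a) + b / a ^ 2 - 1 := by
  set X : Finset α → ℝ := fun s => ∑ e ∈ I, ind (A e s) with hX
  set μ := ex E p X with hμ
  have hc : (0 : ℝ) < I.card := by exact_mod_cast hI.card_pos
  have hμ1 : I.card * a ≤ μ := by
    rw [hμ, hX, ex_sum, ← nsmul_eq_mul]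
    exact Finset.card_nsmul_le_sum _ _ _ hlo
  have hM : 0 < I.card * a := by positivity
  have hμ0 : 0 < μ := hM.trans_le hμ1
  have h2 : ex E p (fun s => X s ^ 2) ≤ μ + I.card ^ 2 * b := by
    have e1 : ex E p (fun s => X s ^ 2) = ∑ e ∈ I, ∑ f ∈ I, pr E p (fun s => A e s ∧ A f s) := by
      have : ∀ s, X s ^ 2 = ∑ e ∈ I, ∑ f ∈ I, ind (A e s ∧ A f s) := by
        intro s
        simp only [hX, sq, Finset.sum_mul_sum, ind_and]
      rw [ex_congr fun s _ => this s, ex_sum]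
      exact Finset.sum_congr rfl fun e _ => ex_sum _ _ _ _
    rw [e1]
    have e2 : ∀ e ∈ I, ∑ f ∈ I, pr E p (fun s => A e s ∧ A f s) ≤ pr E p (A e) + I.card * b := by
      intro e he
      rw [← Finset.add_sum_erase _ _ he]
      refine add_le_add (pr_mono h0 h1 fun s _ h => h.1) ?_
      refine (Finset.sum_le_card_nsmul _ _ b fun f hf => hup e he f (Finset.mem_of_mem_erase hf)
        (Finset.ne_of_mem_erase hf).symm).trans ?_
      rw [nsmul_eq_mul]
      gcongr
      exact Finset.erase_subset _ _
    refine (Finset.sum_le_sum e2).trans (le_of_eq ?_)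
    rw [Finset.sum_add_distrib, Finset.sum_const, nsmul_eq_mul, hμ, hX, ex_sum]
    unfold pr; ring
  have h3 : pr E p (fun s => ∀ e ∈ I, ¬ A e s) * μ ^ 2 ≤ ex E p (fun s => X s ^ 2) - μ ^ 2 := by
    have e1 : ex E p (fun s => X s ^ 2) - μ ^ 2 = ex E p (fun s => (X s - μ) ^ 2) := by
      rw [ex_congr (f := fun s => (X s - μ) ^ 2) (g := fun s => (X s ^ 2 - 2 * μ * X s) + μ ^ 2) fun s _ => by ring,
        ex_add, ex_sub, ex_mul_left, ex_const, ← hμ]; ring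
    rw [e1, pr, ← ex_mul_right]
    refine ex_mono h0 h1 fun s _ => ?_
    by_cases h : ∀ e ∈ I, ¬ A e s
    · rw [ind_true h]
      have : X s = 0 := Finset.sum_eq_zero fun e he => ind_false (h e he)
      rw [this]; linarith [sq_nonneg μ]
    · rw [ind_false h]; nlinarith [sq_nonneg (X s - μ)]
  have h4 : pr E p (fun s => ∀ e ∈ I, ¬ A e s) ≤ (μ + I.card ^ 2 * b - μ ^ 2) / μ ^ 2 := by
    rw [le_div_iff₀ (by positivity)]; linarith
  refine h4.trans ?_
  have h5 : (μ + I.card ^ 2 * b - μ ^ 2) / μ ^ 2 = 1 / μ + I.card ^ 2 * b / μ ^ 2 - 1 := by field_simp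
  rw [h5]
  have h6 : b / a ^ 2 = I.card ^ 2 * b / (I.card * a) ^ 2 := by field_simp
  rw [h6]
  gcongr

lemma lam_eq {n k : ℕ} (hk : 1 ≤ k) (p : ℝ) : n * lam n k p = (n * p) ^ k := by
  unfold lam
  obtain ⟨b, rfl⟩ : ∃ b, k = b + 1 := ⟨k - 1, by omega⟩
  simp only [Nat.add_sub_cancel]; ring

lemma np_ge {n k : ℕ} (hk : 1 ≤ k) (hn : 1 ≤ n) {p : ℝ} (h0 : 0 ≤ p)
    (hl : (n : ℝ) ^ (-(1 / 2) : ℝ) ≤ lam n k p) : (n : ℝ) ^ (1 / (2 * k) : ℝ) ≤ n * p := by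
  have hn0 : (0 : ℝ) < n := by exact_mod_cast hn
  have hk0 : (0 : ℝ) < k := by exact_mod_cast hk
  have h1 : ((n : ℝ) ^ (1 / (2 * k) : ℝ)) ^ k ≤ (n * p) ^ k := by
    rw [← lam_eq hk, ← Real.rpow_natCast, ← Real.rpow_mul hn0.le]
    calc (n : ℝ) ^ (1 / (2 * k) * k : ℝ) = n * (n : ℝ) ^ (-(1 / 2) : ℝ) := by
          nth_rewrite 2 [← Real.rpow_one (n : ℝ)]
          rw [← Real.rpow_add hn0]; congr 1; field_simp; norm_num
      _ ≤ _ := by gcongr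
  exact le_of_pow_le_pow_left₀ (by omega) (by positivity) h1

/-- `e` is an edge without bridge. -/
def unbr {n : ℕ} (k : ℕ) (e : Sym2 (Fin n)) (s : Finset (Sym2 (Fin n))) : Prop :=
  e ∈ s ∧ noneOf (brid k {e} ∅ Finset.univ) pathE s

lemma brid_ne {n k : ℕ} (hk : 2 ≤ k) {e : Sym2 (Fin n)} {J : Finset (Sym2 (Fin n))} {R : Finset (Fin n)}
    {x : Fin (k + 1) → Fin n} (hx : x ∈ brid k {e} J R) : e ∉ pathE x := by
  obtain ⟨h1, _, h2, _⟩ := mem_brid.1 hx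
  rw [Finset.mem_singleton] at h2
  rw [← h2]; exact ends_notMem_pathE hk h1

lemma unbr_lower {n k : ℕ} (hk : 2 ≤ k) {p : ℝ} (h0 : 0 ≤ p) (h1 : p ≤ 1) {e : Sym2 (Fin n)} (he : e ∈ KE n) :
    p * (1 - p ^ k) ^ (n ^ (k - 1)) ≤ pr (KE n) p (unbr k e) := by
  have e1 : pr (KE n) p (unbr k e) = p * pr (KE n \ {e}) p (noneOf (brid k {e} ∅ Finset.univ) pathE) := by
    unfold pr
    have := ex_superset (E := KE n) (T := {e}) (by simpa using he) p (fun s => ind (noneOf (brid k {e} ∅ Finset.univ) pathE s))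
    rw [Finset.card_singleton, pow_one] at this
    rw [ex_congr (f := fun s => ind (unbr k e s)) (g := fun s => ind ({e} ⊆ s) * ind (noneOf (brid k {e} ∅ Finset.univ) pathE s))
      fun s _ => by rw [← ind_and]; simp [unbr], this]
    congr 1
    refine ex_congr fun s _ => ?_
    congr 1
    simp only [noneOf, eq_iff_iff]
    refine forall₂_congr fun x hx => not_congr ⟨fun h f hf => ?_, fun h => h.trans Finset.subset_union_left⟩
    rcases Finset.mem_union.1 (h hf) with h2 | h2
    · exact h2
    · rw [Finset.mem_singleton.1 h2] at hf; exact absurd hf (brid_ne hk hx)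
  rw [e1]
  gcongr
  have hq : 0 ≤ 1 - p ^ k := sub_nonneg.2 (pow_le_one₀ h0 h1)
  have hq1 : 1 - p ^ k ≤ 1 := by linarith [pow_nonneg h0 k]
  refine le_trans ?_ (harris_none h0 h1 _ _ fun x hx f hf => Finset.mem_sdiff.2
    ⟨pathE_sub_KE (mem_brid.1 hx).1 hf, fun h => brid_ne hk hx (by rwa [Finset.mem_singleton.1 h] at hf)⟩)
  rw [Finset.prod_congr rfl fun x hx => by rw [card_pathE (mem_brid.1 hx).1], Finset.prod_const]
  refine pow_le_pow_of_le_one hq hq1 ?_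
  simpa using card_brid_le (k := k) (by omega) (F := {e}) (J := ∅) (R := Finset.univ) (by simpa using he)

lemma deg_le_card {n : ℕ} (F : Finset (Sym2 (Fin n))) (v : Fin n) : deg F v ≤ F.card :=
  Finset.card_filter_le _ _

lemma unbr_pair {n k : ℕ} (hk : 2 ≤ k) {p : ℝ} (h0 : 0 ≤ p) (h1 : p ≤ 1) (hnp : 1 ≤ n * p) {e f : Sym2 (Fin n)} (he : e ∈ KE n)
    (hf : f ∈ KE n) (hef : e ≠ f) :
    pr (KE n) p (fun s => unbr k e s ∧ unbr k f s) ≤ p ^ 2 * Real.exp (-(2 * lam n k p *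
      (1 - 3 * (k + 1) ^ 2 / n - lam n k p * (Ck k * 7) / (n * p)))) := by
  set F : Finset (Sym2 (Fin n)) := {e, f} with hF
  have hFc : F.card = 2 := Finset.card_pair hef
  have hFK : F ⊆ KE n := by intro g hg; rcases (by simpa [hF] using hg : g = e ∨ g = f) with rfl | rfl <;> assumption
  have hn : (1 : ℝ) ≤ n := by
    rcases Nat.eq_zero_or_pos n with h | h
    · subst h; simp at hnp; linarith
    · exact_mod_cast h
  have hp : 0 < p := by
    by_contra h
    have : p = 0 := le_antisymm (not_lt.1 h) h0
    rw [this] at hnp; linarith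
  have s1 : pr (KE n) p (fun s => unbr k e s ∧ unbr k f s) ≤
      ex (KE n) p (fun s => ind (F ⊆ s) * ind (noneOf (brid k F F Finset.univ) pathE s)) := by
    refine ex_mono h0 h1 fun s _ => ?_
    rw [← ind_and]
    refine ind_mono ?_
    rintro ⟨⟨a1, a2⟩, b1, b2⟩
    refine ⟨by intro g hg; rcases (by simpa [hF] using hg : g = e ∨ g = f) with rfl | rfl <;> assumption, ?_⟩
    intro x hx hxs
    obtain ⟨c1, c2, c3, c4, c5⟩ := mem_brid.1 hx
    rcases (by simpa [hF] using c3 : s(x 0, x (Fin.last k)) = e ∨ s(x 0, x (Fin.last k)) = f) with h | h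
    · exact a2 x (mem_brid.2 ⟨c1, c2, by simp [h], c4, by simp⟩) hxs
    · exact b2 x (mem_brid.2 ⟨c1, c2, by simp [h], c4, by simp⟩) hxs
  refine s1.trans ?_
  rw [ex_superset hFK, hFc]
  gcongr
  refine (ex_mono h0 h1 (g := fun s => ind (noneOf (brid k F F Finset.univ) pathE s)) fun s _ =>
    noneOf_anti _ _ Finset.subset_union_left).trans ?_
  have hl : 0 ≤ lam n k p := by unfold lam; positivity
  have := bridge_bound (n := n) hk (E := KE n \ F) (F := F) (J := F) (R := Finset.univ) hFK
    (fun x hx g hg => Finset.mem_sdiff.2 ⟨pathE_sub_KE (mem_brid.1 hx).1 hg,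
      fun h => Finset.disjoint_left.1 (mem_brid.1 hx).2.2.2.2 hg h⟩) h0 h1 hnp (D := 2) (DJ := 2)
    (L := lam n k p) (ρ := 1 - 3 * (k + 1) ^ 2 / n) (δ := lam n k p * (Ck k * 7) / (n * p))
    (fun v => by exact_mod_cast (hFc ▸ deg_le_card F v)) (fun v => hFc ▸ deg_le_card F v) hl le_rfl
    (by
      rw [Finset.card_univ, Fintype.card_fin]
      obtain ⟨b, rfl⟩ : ∃ b, k = b + 2 := ⟨k - 2, by omega⟩
      simp only [Nat.add_sub_cancel, show b + 2 - 1 = b + 1 by omega]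
      have hn' : (n : ℝ) ≠ 0 := by positivity
      rw [pow_succ]; field_simp; push_cast; ring_nf; exact le_rfl)
    (by
      rw [hFc, div_mul_cancel₀ _ (by positivity)]
      have := Ck_pos k
      gcongr
      push_cast
      have : 2 / (n : ℝ) ≤ 2 := div_le_self (by norm_num) hn
      linarith)
  rw [hFc] at this
  exact_mod_cast this

lemma exp_le_one_sub {x : ℝ} (h0 : 0 ≤ x) (h1 : x ≤ 1 / 2) : Real.exp (-x - 2 * x ^ 2) ≤ 1 - x := by
  have h2 : 0 < 1 - x := by linarith
  rw [← Real.le_log_iff_exp_le h2]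
  refine le_trans ?_ (Real.one_sub_inv_le_log_of_pos h2)
  have : (1 - x)⁻¹ ≤ 1 + x + 2 * x ^ 2 := by
    rw [inv_le_iff_one_le_mul₀ h2]; nlinarith [mul_nonneg (sq_nonneg x) (sub_nonneg.2 h1)]
  linarith

/-- reversal of a tuple keeps the path edges. -/
lemma pathE_rev [DecidableEq V] {k : ℕ} (x : Fin (k + 1) → V) : pathE (fun i => x i.rev) = pathE x := by
  ext e
  rw [mem_pathE, mem_pathE]
  constructor
  · rintro ⟨i, rfl⟩
    refine ⟨i.rev, ?_⟩
    simp only [pe, Fin.rev_castSucc, Fin.rev_succ]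
    exact Sym2.eq_swap
  · rintro ⟨i, rfl⟩
    refine ⟨i.rev, ?_⟩
    simp only [pe, Fin.rev_castSucc, Fin.rev_succ, Fin.rev_rev]
    exact Sym2.eq_swap

lemma cycE_rot [DecidableEq V] {k : ℕ} (x : Fin (k + 1) → V) (c : Fin (k + 1)) : cycE (fun i => x (i + c)) = cycE x := by
  ext e
  rw [mem_cycE, mem_cycE]
  constructor
  · rintro ⟨i, rfl⟩
    exact ⟨i + c, by simp only [ce]; rw [add_right_comm]⟩
  · rintro ⟨i, rfl⟩
    refine ⟨i - c, by simp only [ce]; rw [add_right_comm, sub_add_cancel]⟩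

/-- every edge of an oriented cycle can be made the closing edge. -/
lemma cyc_rotate [LinearOrder V] {k : ℕ} (hk : 2 ≤ k) (x : Fin (k + 1) → V) (hx : Function.Injective x) {e : Sym2 V}
    (he : e ∈ cycE x) : ∃ y : Fin (k + 1) → V, Function.Injective y ∧ y 0 < y (Fin.last k) ∧
      s(y 0, y (Fin.last k)) = e ∧ cycE y = cycE x := by
  obtain ⟨i, rfl⟩ := mem_cycE.1 he
  set y : Fin (k + 1) → V := fun j => x (j + (i + 1)) with hy
  have hyi : Function.Injective y := fun a b h => add_right_cancel (hx h)
  have hyc : cycE y = cycE x := cycE_rot x (i + 1)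
  have hlast : y (Fin.last k) = x i := by
    simp only [hy]; congr 1
    rw [add_comm i 1, ← add_assoc, Fin.last_add_one, zero_add]
  have h0 : y 0 = x (i + 1) := by simp [hy]
  have hne : y 0 ≠ y (Fin.last k) := fun h => by
    have := congrArg Fin.val (hyi h); simp at this; omega
  rcases lt_or_gt_of_ne hne with h | h
  · refine ⟨y, hyi, h, ?_, hyc⟩
    rw [hlast, h0, ce]; exact Sym2.eq_swap
  · refine ⟨fun j => y j.rev, fun a b h => Fin.rev_injective (hyi h), by simpa using h, ?_, ?_⟩
    · simp only [Fin.rev_zero, Fin.rev_last, hlast, h0, ce]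
    · rw [cycE_eq, pathE_rev, ← hyc, cycE_eq]
      simp only [Fin.rev_zero, Fin.rev_last]
      rw [Sym2.eq_swap]

lemma Qs_no_unbr {n k : ℕ} (hk : 2 ≤ k) {s : Finset (Sym2 (Fin n))} (h : Qs k s) (hs : s ⊆ KE n) (e : Sym2 (Fin n)) :
    ¬ unbr k e s := by
  rintro ⟨h1, h2⟩
  obtain ⟨x, hx, hxs, hex⟩ := h e h1
  obtain ⟨y, hy, hlt, hye, hyc⟩ := cyc_rotate hk x hx hex
  rw [← hyc, cycE_eq] at hxs
  refine h2 y (mem_brid.2 ⟨hy, hlt, by simp [hye], fun i _ => by simp, by simp⟩) ?_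
  exact (Finset.subset_insert _ _).trans hxs

set_option maxHeartbeats 1000000 in
theorem P0b (k : ℕ) (hk : 2 ≤ k) (ε₀ : ℝ) (hε₀ : 0 < ε₀) (ε : ℝ) (hε : 0 < ε) :
    ∀ᶠ n : ℕ in atTop, ∀ p : ℝ, 0 ≤ p → p ≤ 1 → (n : ℝ) ^ (-(1 / 2) : ℝ) ≤ lam n k p →
    lam n k p ≤ (1 - ε₀) * Real.log ((n : ℝ) ^ 2 * p) → pr (KE n) p (fun s => Qs k s) ≤ ε := by
  have hk0 : (0 : ℝ) < k := by exact_mod_cast (by omega : 0 < k)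
  set η : ℝ := Real.log (1 + ε / 2) / 3 with hη
  have hη0 : 0 < η := by have := Real.log_pos (by linarith : 1 < 1 + ε / 2); positivity
  have hη3 : Real.exp (3 * η) = 1 + ε / 2 := by
    rw [hη, mul_div_cancel₀ _ (by norm_num : (3 : ℝ) ≠ 0), Real.exp_log (by linarith)]
  have hC := Ck_pos k
  filter_upwards [eventually_ge_atTop 2, ev_log 1 4 1 1 (by norm_num) (by norm_num),
    ev_log 2 8 1 η (by norm_num) hη0, ev_log 1 (12 * (k + 1) ^ 2) 1 (η / 2) (by norm_num) (by positivity),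
    ev_log 2 (56 * Ck k) (1 / (2 * k)) (η / 2) (by positivity) (by positivity),
    ev_pow (4 * Real.exp η) ε₀ (ε / 2) hε₀ (by positivity)] with n hn a1 a2 a3 a4 a5 p h0 h1 hl1 hl2
  rw [Real.rpow_one] at a1 a2 a3
  rw [pow_one] at a1 a3
  have hn0 : (0 : ℝ) < n := by exact_mod_cast (by omega : 0 < n)
  have hn1 : (1 : ℝ) ≤ n := by exact_mod_cast (by omega : 1 ≤ n)
  have hnp := np_ge (by omega) (by omega) h0 hl1
  have hnp1 : 1 ≤ n * p := (Real.one_le_rpow hn1 (by positivity)).trans hnp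
  have hp : 0 < p := by
    by_contra h
    have : p = 0 := le_antisymm (not_lt.1 h) h0
    rw [this] at hnp1; linarith
  set Λ := lam n k p with hΛ
  have hΛ0 : 0 < Λ := by rw [hΛ]; unfold lam; positivity
  have hNp : (n : ℝ) ≤ (n : ℝ) ^ 2 * p := by nlinarith
  have hlogNp : 0 ≤ Real.log ((n : ℝ) ^ 2 * p) := Real.log_nonneg (by linarith)
  have hΛlog : Λ ≤ 2 * Real.log n := by
    have : Real.log ((n : ℝ) ^ 2 * p) ≤ 2 * Real.log n := by
      rw [← Real.log_rpow hn0]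
      refine Real.log_le_log (by positivity) ?_
      rw [show (2 : ℝ) = ((2 : ℕ) : ℝ) by norm_num, Real.rpow_natCast]; exact mul_le_of_le_one_right (by positivity) h1
    nlinarith
  have hlog0 : 0 ≤ Real.log n := Real.log_nonneg hn1
  -- lower bound
  have hpk : p ^ k ≤ Λ / n := by
    rw [le_div_iff₀ hn0, hΛ, lam, mul_comm]
    gcongr
    exact le_self_pow₀ hn1 (by omega)
  have hpk2 : p ^ k ≤ 1 / 2 := hpk.trans (by rw [div_le_iff₀ hn0]; linarith)
  have hlow : p * Real.exp (-Λ - η) ≤ p * (1 - p ^ k) ^ (n ^ (k - 1)) := by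
    gcongr
    calc Real.exp (-Λ - η) ≤ Real.exp ((n ^ (k - 1) : ℕ) * (-p ^ k - 2 * (p ^ k) ^ 2)) := by
          refine Real.exp_le_exp.2 ?_
          have e1 : ((n ^ (k - 1) : ℕ) : ℝ) * (-p ^ k - 2 * (p ^ k) ^ 2) = -Λ - 2 * Λ * p ^ k := by
            rw [hΛ, lam]; push_cast; ring
          rw [e1]
          have e2 : 2 * Λ * p ^ k ≤ 2 * Λ * (Λ / n) := by gcongr
          have e3 : 2 * Λ * (Λ / n) ≤ η := by
            rw [← mul_div_assoc, div_le_iff₀ hn0]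
            nlinarith
          linarith
      _ = Real.exp (-p ^ k - 2 * (p ^ k) ^ 2) ^ (n ^ (k - 1)) := by rw [Real.exp_nat_mul]
      _ ≤ _ := by
          gcongr
          exact exp_le_one_sub (by positivity) hpk2
  have hup : p ^ 2 * Real.exp (-(2 * Λ * (1 - 3 * (k + 1) ^ 2 / n - Λ * (Ck k * 7) / (n * p)))) ≤
      p ^ 2 * Real.exp (-(2 * Λ) + η) := by
    gcongr
    have e1 : 2 * Λ * (3 * (k + 1) ^ 2 / n) ≤ η / 2 := by
      rw [← mul_div_assoc, div_le_iff₀ hn0]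
      have : 2 * Λ * (3 * ((k : ℝ) + 1) ^ 2) ≤ 2 * (2 * Real.log n) * (3 * ((k : ℝ) + 1) ^ 2) := by gcongr
      linarith
    have e2 : 2 * Λ * (Λ * (Ck k * 7) / (n * p)) ≤ η / 2 := by
      rw [← mul_div_assoc, div_le_iff₀ (by positivity)]
      calc 2 * Λ * (Λ * (Ck k * 7)) ≤ 2 * (2 * Real.log n) * ((2 * Real.log n) * (Ck k * 7)) := by gcongr
        _ = 56 * Ck k * Real.log n ^ 2 := by ring
        _ ≤ η / 2 * (n : ℝ) ^ (1 / (2 * k) : ℝ) := a4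
        _ ≤ _ := by gcongr
    linarith
  have hcard := card_KE_ge hn
  have hne : (KE n).Nonempty := by
    rw [← Finset.card_pos]
    have : (0 : ℝ) < (KE n).card := lt_of_lt_of_le (by positivity) hcard
    exact_mod_cast this
  have hSM := second_moment h0 h1 (KE n) hne (unbr k) (a := p * Real.exp (-Λ - η)) (b := p ^ 2 * Real.exp (-(2 * Λ) + η))
    (by positivity) (fun e he => hlow.trans (unbr_lower hk h0 h1 he)) (by positivity)
    (fun e he f hf hef => (unbr_pair hk h0 h1 hnp1 he hf hef).trans hup)
  refine (pr_mono h0 h1 fun s hs h e _ => Qs_no_unbr hk h hs e).trans (hSM.trans ?_)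
  have r1 : p ^ 2 * Real.exp (-(2 * Λ) + η) / (p * Real.exp (-Λ - η)) ^ 2 = 1 + ε / 2 := by
    rw [← hη3, div_eq_iff (by positivity), mul_pow, ← Real.exp_nat_mul, mul_comm (Real.exp (3 * η)), mul_assoc, ← Real.exp_add]
    congr 2; push_cast; ring
  rw [r1]
  have r2 : 1 / ((KE n).card * (p * Real.exp (-Λ - η))) ≤ ε / 2 := by
    have hx : Real.exp Λ ≤ (n : ℝ) ^ 2 * p / ((n : ℝ) ^ 2 * p) ^ ε₀ := by
      have : Real.exp Λ ≤ Real.exp ((1 - ε₀) * Real.log ((n : ℝ) ^ 2 * p)) := Real.exp_le_exp.2 hl2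
      refine this.trans (le_of_eq ?_)
      rw [mul_comm, ← Real.rpow_def_of_pos (by positivity), Real.rpow_sub (by positivity), Real.rpow_one]
    have hy : (n : ℝ) ^ ε₀ ≤ ((n : ℝ) ^ 2 * p) ^ ε₀ := by gcongr
    have hz : (n : ℝ) ^ ε₀ * Real.exp Λ ≤ (n : ℝ) ^ 2 * p := by
      rw [le_div_iff₀ (by positivity)] at hx
      calc (n : ℝ) ^ ε₀ * Real.exp Λ ≤ ((n : ℝ) ^ 2 * p) ^ ε₀ * Real.exp Λ := by gcongr
        _ ≤ _ := by linarith
    rw [div_le_iff₀ (by positivity)]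
    have e1 : Real.exp (-Λ - η) = (Real.exp Λ * Real.exp η)⁻¹ := by rw [← Real.exp_add, ← Real.exp_neg]; congr 1; ring
    rw [e1]
    have e3 : 1 * (Real.exp Λ * Real.exp η) ≤ ε / 2 * ((n : ℝ) ^ 2 / 4 * p) := by
      have : 4 * Real.exp η * Real.exp Λ ≤ ε / 2 * (n : ℝ) ^ ε₀ * Real.exp Λ := by gcongr
      have h9 := mul_le_mul_of_nonneg_left hz (by positivity : 0 ≤ ε / 2)
      linarith
    have e4 : ε / 2 * ((n : ℝ) ^ 2 / 4 * p) ≤ ε / 2 * ((KE n).card * p) := by gcongr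
    have e5 := e3.trans e4
    rw [← le_div_iff₀ (by positivity)] at e5
    refine e5.trans (le_of_eq ?_)
    rw [div_eq_mul_inv]; ring
  linarith

/-- `F` is a subset of `s` meeting all `(k+1)`-cycles of `s` evenly. -/
def Perp {n : ℕ} (k : ℕ) (s F : Finset (Sym2 (Fin n))) : Prop :=
  F ⊆ s ∧ ∀ x : Fin (k + 1) → Fin n, Function.Injective x → cycE x ⊆ s → Even (F ∩ cycE x).card

lemma perp_bridge {n k : ℕ} {s F : Finset (Sym2 (Fin n))} (h : Perp k s F) {x : Fin (k + 1) → Fin n}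
    (hx : Function.Injective x) (he : s(x 0, x (Fin.last k)) ∈ F) (hd : Disjoint (pathE x) F) : ¬ pathE x ⊆ s := by
  intro hs
  have h1 := h.2 x hx (by rw [cycE_eq]; exact Finset.insert_subset (h.1 he) hs)
  rw [cycE_eq, Finset.inter_insert_of_mem he, Finset.inter_comm, Finset.disjoint_iff_inter_eq_empty.1 hd] at h1
  simp at h1

/-- growth event -/
def Ev {n : ℕ} (k M : ℕ) : ℕ → Finset (Sym2 (Fin n)) → Finset (Sym2 (Fin n)) → Prop
  | 0, J, s => J ⊆ s ∧ ∃ F ⊆ J, M ≤ F.card ∧ Perp k s F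
  | r + 1, J, s => ∃ x ∈ (itup n k).filter (fun x => ¬ Disjoint J (cycE x)), Ev k M r (J ∪ cycE x) s

lemma deg_le_card' {n : ℕ} (F : Finset (Sym2 (Fin n))) (v : Fin n) : deg F v ≤ F.card := deg_le_card F v

lemma Ev_zero {n k M : ℕ} (hk : 2 ≤ k) {p : ℝ} (h0 : 0 ≤ p) (h1 : p ≤ 1) (hnp : 1 ≤ n * p) {J : Finset (Sym2 (Fin n))}
    (hJ : J ⊆ KE n) {j0 : ℕ} (hj : J.card ≤ j0) {L ρ δ : ℝ} (hL0 : 0 ≤ L) (hL : L ≤ lam n k p) (hρδ : 0 ≤ ρ - δ)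
    (hρ : ρ * (n : ℝ) ^ (k - 1) + (k + 1) ^ 2 * ((j0 + 1) * (n : ℝ) ^ (k - 2)) ≤ (n : ℝ) ^ (k - 1))
    (hδ : L * (Ck k * (j0 / n + 2 * j0 + 1)) ≤ δ * (n * p)) :
    pr (KE n) p (Ev k M 0 J) ≤ p ^ J.card * (2 ^ j0 * Real.exp (-(M * L * (ρ - δ)))) := by
  have hstep : pr (KE n) p (Ev k M 0 J) ≤
      pr (KE n) p (fun s => ∃ F ∈ J.powerset.filter (fun F => M ≤ F.card), (J ⊆ s ∧ noneOf (brid k F J Finset.univ) pathE s)) := by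
    refine pr_mono h0 h1 fun s hs h => ?_
    obtain ⟨hJs, F, hFJ, hM, hP⟩ := h
    refine ⟨F, by simp [hFJ, hM], hJs, fun x hx => ?_⟩
    obtain ⟨a1, _, a2, _, a3⟩ := mem_brid.1 hx
    exact perp_bridge hP a1 a2 (a3.mono_right hFJ)
  refine hstep.trans ((pr_exists_le h0 h1 _ _).trans ?_)
  have hone : ∀ F ∈ J.powerset.filter (fun F => M ≤ F.card),
      pr (KE n) p (fun s => J ⊆ s ∧ noneOf (brid k F J Finset.univ) pathE s) ≤ p ^ J.card * Real.exp (-(M * L * (ρ - δ))) := by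
    intro F hF
    obtain ⟨hFJ, hM⟩ := Finset.mem_filter.1 hF
    rw [Finset.mem_powerset] at hFJ
    unfold pr
    rw [ex_congr (g := fun s => ind (J ⊆ s) * ind (noneOf (brid k F J Finset.univ) pathE s)) (fun s _ => ind_and _ _), ex_superset hJ]
    gcongr
    have hFc : (F.card : ℝ) ≤ j0 := by exact_mod_cast (Finset.card_le_card hFJ).trans hj
    have hb := bridge_bound (E := KE n \ J) (F := F) (J := J) (R := Finset.univ) hk (hFJ.trans hJ)
      (fun x hx => by
        obtain ⟨a1, _, a2, _, a3⟩ := mem_brid.1 hx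
        exact Finset.subset_sdiff.2 ⟨pathE_sub_KE a1, a3⟩) h0 h1 hnp (D := j0) (DJ := j0) (L := L) (ρ := ρ) (δ := δ)
      (fun v => by
        have := deg_le_card' F v
        have : (deg F v : ℝ) ≤ F.card := by exact_mod_cast this
        linarith) (fun v => (deg_le_card' J v).trans hj) hL0 hL (by simpa using hρ) (by
        refine le_trans ?_ hδ
        have := Ck_pos k
        gcongr)
    refine le_trans ?_ (hb.trans ?_)
    · refine ex_mono h0 h1 fun s hs => ind_mono fun h x hx hxs => ?_
      exact h x hx (hxs.trans Finset.subset_union_left)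
    · refine Real.exp_le_exp.2 (neg_le_neg ?_)
      have : (M : ℝ) ≤ F.card := by exact_mod_cast hM
      gcongr
  refine (Finset.sum_le_sum hone).trans ?_
  rw [Finset.sum_const, nsmul_eq_mul]
  have hc : ((J.powerset.filter (fun F => M ≤ F.card)).card : ℝ) ≤ 2 ^ j0 := by
    have : (J.powerset.filter (fun F => M ≤ F.card)).card ≤ 2 ^ j0 := by
      refine (Finset.card_filter_le _ _).trans ?_
      rw [Finset.card_powerset]
      exact Nat.pow_le_pow_right (by norm_num) hj
    exact_mod_cast this
  calc _ ≤ 2 ^ j0 * (p ^ J.card * Real.exp (-(M * L * (ρ - δ)))) := by gcongr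
    _ = _ := by ring

lemma Ev_bound {n k M : ℕ} (hk : 2 ≤ k) {p : ℝ} (h0 : 0 ≤ p) (h1 : p ≤ 1) (hnp : 1 ≤ n * p)
    {j0 : ℕ} {L ρ δ : ℝ} (hL0 : 0 ≤ L) (hL : L ≤ lam n k p) (hρδ : 0 ≤ ρ - δ) (hl1 : 1 ≤ lam n k p)
    (hρ : ρ * (n : ℝ) ^ (k - 1) + (k + 1) ^ 2 * ((j0 + 1) * (n : ℝ) ^ (k - 2)) ≤ (n : ℝ) ^ (k - 1))
    (hδ : L * (Ck k * (j0 / n + 2 * j0 + 1)) ≤ δ * (n * p)) (r : ℕ) :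
    ∀ J : Finset (Sym2 (Fin n)), J ⊆ KE n → J.card + (k + 1) * r ≤ j0 →
      (∃ W : Finset (Fin n), (∀ e ∈ J, ∀ v ∈ e, v ∈ W) ∧ 1 ≤ W.card ∧ W.card + (k + 1) * r ≤ j0) →
    pr (KE n) p (Ev k M r J) ≤ p ^ J.card * ((2 ^ (k + 1) * (j0 : ℝ) ^ (k + 1) * lam n k p) ^ r *
      (2 ^ j0 * Real.exp (-(M * L * (ρ - δ))))) := by
  induction r with
  | zero =>
    intro J hJ hj _
    simpa using Ev_zero hk h0 h1 hnp hJ (by simpa using hj) hL0 hL hρδ hρ hδ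
  | succ r ih =>
    rintro J hJ hj ⟨W, hW, hW1, hWc⟩
    set Y := 2 ^ (k + 1) * (j0 : ℝ) ^ (k + 1) * lam n k p with hY
    set B := (2 : ℝ) ^ j0 * Real.exp (-(M * L * (ρ - δ))) with hB
    have hY0 : 0 ≤ Y := by positivity
    have hB0 : 0 ≤ B := by positivity
    have : pr (KE n) p (Ev k M (r + 1) J) ≤ ∑ x ∈ (itup n k).filter (fun x => ¬ Disjoint J (cycE x)),
        pr (KE n) p (Ev k M r (J ∪ cycE x)) := pr_exists_le h0 h1 _ _
    refine this.trans ?_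
    have hone : ∀ x ∈ (itup n k).filter (fun x => ¬ Disjoint J (cycE x)),
        pr (KE n) p (Ev k M r (J ∪ cycE x)) ≤ p ^ (cycE x \ J).card * (p ^ J.card * (Y ^ r * B)) := by
      intro x hx
      obtain ⟨hx1, hx2⟩ := Finset.mem_filter.1 hx
      have hxi : Function.Injective x := (Finset.mem_filter.1 hx1).2
      refine (ih (J ∪ cycE x) (Finset.union_subset hJ (cycE_sub_KE (by omega) hxi)) ?_ ?_).trans (le_of_eq ?_)
      · have := Finset.card_union_le J (cycE x)
        rw [card_cycE hk hxi] at this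
        rw [Nat.mul_succ] at hj; omega
      · refine ⟨W ∪ Finset.univ.image x, ?_, ?_, ?_⟩
        · intro e he v hv
          rcases Finset.mem_union.1 he with he | he
          · exact Finset.mem_union_left _ (hW e he v hv)
          · obtain ⟨i, rfl⟩ := mem_cycE.1 he
            refine Finset.mem_union_right _ ?_
            simp only [ce, Sym2.mem_iff] at hv
            rcases hv with rfl | rfl <;> simp
        · exact hW1.trans (Finset.card_le_card Finset.subset_union_left)
        · have := Finset.card_union_le W (Finset.univ.image x)
          have h3 : (Finset.univ.image x).card ≤ k + 1 := Finset.card_image_le.trans (by simp)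
          rw [Nat.mul_succ] at hWc; omega
      · have : (J ∪ cycE x).card = (cycE x \ J).card + J.card := by
          rw [Finset.union_comm, ← Finset.card_sdiff_add_card]
        rw [this, pow_add]; ring
    refine (Finset.sum_le_sum hone).trans ?_
    rw [← Finset.sum_mul]
    have hov := cyc_overlap hk J W hW hW1 (itup n k) (fun y hy => (Finset.mem_filter.1 hy).2) h0 hnp (Λ := lam n k p) le_rfl hl1
    have hWj : (W.card : ℝ) ≤ j0 := by exact_mod_cast (by omega : W.card ≤ j0)
    calc _ ≤ Y * (p ^ J.card * (Y ^ r * B)) := by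
          refine mul_le_mul_of_nonneg_right (hov.trans ?_) (by positivity)
          rw [hY]; gcongr
      _ = _ := by ring

/-- deterministic growth -/
lemma grow_aux {n k : ℕ} {s F : Finset (Sym2 (Fin n))} (hP : Perp k s F)
    (hmin : ∀ F', Perp k s F' → F'.Nonempty → F.card ≤ F'.card) (M : ℕ) (hM : M ≤ F.card) (j : ℕ) :
    ∀ J ⊆ s, (F ∩ J).Nonempty → (F \ J).card ≤ j → ∃ r, (F ∩ J).card + r ≤ F.card ∧ Ev k M r J s := by
  induction j with
  | zero =>
    intro J hJ _ hc
    refine ⟨0, by simpa using Finset.card_le_card Finset.inter_subset_left, hJ, F, ?_, hM, hP⟩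
    exact Finset.sdiff_eq_empty_iff_subset.1 (Finset.card_eq_zero.1 (by omega))
  | succ j ih =>
    intro J hJ hne hc
    by_cases hFJ : F ⊆ J
    · exact ⟨0, by simpa using Finset.card_le_card Finset.inter_subset_left, hJ, F, hFJ, hM, hP⟩
    obtain ⟨x, hx, hxs, hx1, hx2⟩ : ∃ x : Fin (k + 1) → Fin n, Function.Injective x ∧ cycE x ⊆ s ∧
        (F ∩ J ∩ cycE x).Nonempty ∧ ((F \ J) ∩ cycE x).Nonempty := by
      by_contra hcon
      push Not at hcon
      have hP' : Perp k s (F ∩ J) := by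
        refine ⟨Finset.inter_subset_left.trans hP.1, fun x hx hxs => ?_⟩
        rcases (F ∩ J ∩ cycE x).eq_empty_or_nonempty with h | h
        · rw [h]; simp
        · have h2 := hcon x hx hxs h
          have h3 : F ∩ J ∩ cycE x = F ∩ cycE x := by
            ext e
            simp only [Finset.mem_inter]
            constructor
            · rintro ⟨⟨a, b⟩, c⟩; exact ⟨a, c⟩
            · rintro ⟨a, c⟩
              refine ⟨⟨a, ?_⟩, c⟩
              by_contra hb
              have : e ∈ (F \ J) ∩ cycE x := by simp [a, hb, c]
              rw [h2] at this; simp at this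
          rw [h3]; exact hP.2 x hx hxs
      have h4 := hmin _ hP' hne
      have h5 : F ∩ J = F := Finset.eq_of_subset_of_card_le Finset.inter_subset_left h4
      exact hFJ (Finset.inter_eq_left.1 h5)
    obtain ⟨f, hf⟩ := hx2
    obtain ⟨hf1, hf2⟩ := Finset.mem_inter.1 hf
    obtain ⟨hf3, hf4⟩ := Finset.mem_sdiff.1 hf1
    have hlt : (F \ (J ∪ cycE x)).card < (F \ J).card := Finset.card_lt_card (by
      rw [Finset.ssubset_iff_of_subset (Finset.sdiff_subset_sdiff le_rfl Finset.subset_union_left)]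
      exact ⟨f, hf1, by simp [hf2]⟩)
    have hlt2 : (F ∩ J).card < (F ∩ (J ∪ cycE x)).card := Finset.card_lt_card (by
      rw [Finset.ssubset_iff_of_subset (Finset.inter_subset_inter le_rfl Finset.subset_union_left)]
      exact ⟨f, by simp [hf3, hf2], by simp [hf4]⟩)
    obtain ⟨r, hr1, hr2⟩ := ih (J ∪ cycE x) (Finset.union_subset hJ hxs)
      (hne.mono (Finset.inter_subset_inter le_rfl Finset.subset_union_left)) (by omega)
    refine ⟨r + 1, by omega, x, ?_, hr2⟩
    obtain ⟨g, hg⟩ := hx1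
    simp only [Finset.mem_inter] at hg
    simp only [Finset.mem_filter, itup, Finset.mem_univ, true_and]
    exact ⟨hx, Finset.not_disjoint_iff.2 ⟨g, hg.1.2, hg.2⟩⟩

lemma Ev_mono {n k M M' : ℕ} (h : M' ≤ M) (r : ℕ) : ∀ J s : Finset (Sym2 (Fin n)), Ev k M r J s → Ev k M' r J s := by
  induction r with
  | zero =>
    rintro J s ⟨h1, F, h2, h3, h4⟩
    exact ⟨h1, F, h2, h.trans h3, h4⟩
  | succ r ih =>
    rintro J s ⟨x, hx, h1⟩
    exact ⟨x, hx, ih _ _ h1⟩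

lemma grow {n k : ℕ} (hk : 2 ≤ k) {s : Finset (Sym2 (Fin n))} (hQ : Qs k s) {x0 : ℝ}
    (h : ∃ F, F.Nonempty ∧ (F.card : ℝ) ≤ x0 ∧ Perp k s F) :
    ∃ r ∈ Finset.range ⌊x0⌋₊, ∃ x ∈ itup n k, Ev k (r + 2) r (cycE x) s := by
  obtain ⟨F0, hF0, hFx, hFP⟩ := h
  obtain ⟨F, hF, hmin⟩ := Finset.exists_min_image (s.powerset.filter (fun F => F.Nonempty ∧ Perp k s F)) Finset.card
    ⟨F0, by simp [hF0, hFP, hFP.1]⟩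
  simp only [Finset.mem_filter, Finset.mem_powerset] at hF hmin
  obtain ⟨hFs, hFne, hFP'⟩ := hF
  have hle : F.card ≤ F0.card := hmin F0 ⟨hFP.1, hF0, hFP⟩
  obtain ⟨e, he⟩ := hFne
  obtain ⟨x, hx, hxs, hex⟩ := hQ e (hFs he)
  have h2 : 2 ≤ (F ∩ cycE x).card := by
    have h3 := hFP'.2 x hx hxs
    have h4 : 0 < (F ∩ cycE x).card := Finset.card_pos.2 ⟨e, by simp [he, hex]⟩
    obtain ⟨t, ht⟩ := h3; omega
  obtain ⟨r, hr1, hr2⟩ := grow_aux hFP' (fun F' h5 h6 => hmin F' ⟨h5.1, h6, h5⟩) F.card le_rfl _ (cycE x) hxs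
    ⟨e, by simp [he, hex]⟩ le_rfl
  refine ⟨r, ?_, x, by simp [itup, hx], Ev_mono (by omega) r _ _ hr2⟩
  rw [Finset.mem_range]
  have : F.card ≤ ⌊x0⌋₊ := Nat.le_floor (le_trans (by exact_mod_cast hle) hFx)
  omega

lemma C_bound {n k : ℕ} (hk : 2 ≤ k) {p : ℝ} (h0 : 0 ≤ p) (h1 : p ≤ 1) (hnp : 1 ≤ n * p)
    {x0 L ρ δ a : ℝ} (hx0 : 1 ≤ x0) (hL0 : 0 ≤ L) (hL : L ≤ lam n k p) (hρδ : 0 ≤ ρ - δ) (hl1 : 1 ≤ lam n k p)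
    (hρ : ρ * (n : ℝ) ^ (k - 1) + (k + 1) ^ 2 * (((k + 1) * x0 + 1) * (n : ℝ) ^ (k - 2)) ≤ (n : ℝ) ^ (k - 1))
    (hδ : L * (Ck k * ((k + 1) * x0 / n + 2 * ((k + 1) * x0) + 1)) ≤ δ * (n * p))
    (hb : 2 ^ (k + 1) * ((k + 1) * x0) ^ (k + 1) * lam n k p * (2 ^ (k + 1) * Real.exp (-(L * (ρ - δ)))) ≤ 1 / 2)
    (ha : (n : ℝ) ^ 2 * p * lam n k p * (2 ^ (k + 1) * Real.exp (-(2 * (L * (ρ - δ))))) ≤ a) :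
    pr (KE n) p (fun s => Qs k s ∧ ∃ F, F.Nonempty ∧ (F.card : ℝ) ≤ x0 ∧ Perp k s F) ≤ 2 * a := by
  have ha0 : 0 ≤ a := le_trans (by positivity) ha
  set b := 2 ^ (k + 1) * ((k + 1) * x0) ^ (k + 1) * lam n k p * (2 ^ (k + 1) * Real.exp (-(L * (ρ - δ)))) with hbd
  have hb0 : 0 ≤ b := by positivity
  have hstep : pr (KE n) p (fun s => Qs k s ∧ ∃ F, F.Nonempty ∧ (F.card : ℝ) ≤ x0 ∧ Perp k s F) ≤
      ∑ r ∈ Finset.range ⌊x0⌋₊, ∑ x ∈ itup n k, pr (KE n) p (Ev k (r + 2) r (cycE x)) := by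
    refine (pr_mono h0 h1 fun s _ h => grow hk h.1 h.2).trans ((pr_exists_le h0 h1 _ _).trans ?_)
    exact Finset.sum_le_sum fun r _ => pr_exists_le h0 h1 _ _
  refine hstep.trans ?_
  have hone : ∀ r ∈ Finset.range ⌊x0⌋₊, ∑ x ∈ itup n k, pr (KE n) p (Ev k (r + 2) r (cycE x)) ≤ a * (1 / 2) ^ r := by
    intro r hr
    have hr' : (r : ℝ) + 1 ≤ x0 := by
      have : r + 1 ≤ ⌊x0⌋₊ := Finset.mem_range.1 hr
      calc (r : ℝ) + 1 = ((r + 1 : ℕ) : ℝ) := by push_cast; ring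
        _ ≤ ⌊x0⌋₊ := by exact_mod_cast this
        _ ≤ x0 := Nat.floor_le (by linarith)
    set j0 : ℕ := (k + 1) * (r + 1) with hj0
    have hj0' : (j0 : ℝ) ≤ (k + 1) * x0 := by
      rw [hj0]; push_cast; gcongr
    have hCk := Ck_pos k
    have hc : ∀ x ∈ itup n k, pr (KE n) p (Ev k (r + 2) r (cycE x)) ≤ p ^ (k + 1) * ((2 ^ (k + 1) * (j0 : ℝ) ^ (k + 1) * lam n k p) ^ r *
      (2 ^ j0 * Real.exp (-(((r + 2 : ℕ) : ℝ) * L * (ρ - δ))))) := by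
      intro x hx
      have hxi : Function.Injective x := (Finset.mem_filter.1 hx).2
      have hb := Ev_bound (M := r + 2) (j0 := j0) hk h0 h1 hnp hL0 hL hρδ hl1
        (by refine le_trans ?_ hρ; gcongr) (by refine le_trans ?_ hδ; gcongr) r (cycE x) (cycE_sub_KE (by omega) hxi)
        (by rw [card_cycE hk hxi, hj0]; ring_nf; omega)
        ⟨Finset.univ.image x, fun e he v hv => by
            obtain ⟨i, rfl⟩ := mem_cycE.1 he
            simp only [ce, Sym2.mem_iff] at hv
            rcases hv with rfl | rfl <;> simp, by
            rw [Finset.card_image_of_injective _ hxi]; simp, by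
            rw [Finset.card_image_of_injective _ hxi, hj0]; simp; ring_nf; omega⟩
      rw [card_cycE hk hxi] at hb
      exact hb
    refine (Finset.sum_le_sum hc).trans ?_
    rw [Finset.sum_const, nsmul_eq_mul]
    have hcard : ((itup n k).card : ℝ) ≤ (n : ℝ) ^ (k + 1) := by
      have : (itup n k).card ≤ n ^ (k + 1) := (Finset.card_filter_le _ _).trans (by simp)
      exact_mod_cast this
    have hlam0 : 0 ≤ lam n k p := by linarith
    calc _ ≤ (n : ℝ) ^ (k + 1) * (p ^ (k + 1) * ((2 ^ (k + 1) * ((k + 1) * x0) ^ (k + 1) * lam n k p) ^ r *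
      (2 ^ j0 * Real.exp (-(((r + 2 : ℕ) : ℝ) * L * (ρ - δ)))))) := by gcongr
      _ = ((n : ℝ) ^ 2 * p * lam n k p * (2 ^ (k + 1) * Real.exp (-(2 * (L * (ρ - δ)))))) * b ^ r := by
        have e1 : Real.exp (-(((r + 2 : ℕ) : ℝ) * L * (ρ - δ))) = Real.exp (-(2 * (L * (ρ - δ)))) * Real.exp (-(L * (ρ - δ))) ^ r := by
          rw [← Real.exp_nat_mul, ← Real.exp_add]; congr 1; push_cast; ring
        rw [e1, ← mul_assoc, lam_cyc hk, hbd, hj0, pow_mul, pow_succ ((2 : ℝ) ^ (k + 1)) r]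
        simp only [mul_pow]; ring
      _ ≤ a * (1 / 2) ^ r := by gcongr
  refine (Finset.sum_le_sum hone).trans ?_
  rw [← Finset.mul_sum]
  have hg : ∑ r ∈ Finset.range ⌊x0⌋₊, (1 / 2 : ℝ) ^ r ≤ 2 := by
    have := geom_sum_Ico_le_of_lt_one (m := 0) (n := ⌊x0⌋₊) (by norm_num : (0 : ℝ) ≤ 1 / 2) (by norm_num)
    rw [← Finset.range_eq_Ico] at this
    norm_num at this ⊢; exact this
  nlinarith

lemma mul_exp_neg_le {c x : ℝ} (hc : 0 < c) : x * Real.exp (-(c * x)) ≤ 1 / c := by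
  have h := Real.add_one_le_exp (c * x)
  rw [Real.exp_neg, ← div_eq_mul_inv, div_le_div_iff₀ (Real.exp_pos _) hc]
  linarith

set_option maxHeartbeats 1000000 in
theorem partC (k : ℕ) (hk : 2 ≤ k) (ε : ℝ) (hε : 0 < ε) (hε2 : ε ≤ 1 / (4 * (k + 1))) (ε1 : ℝ) (hε1 : 0 < ε1) :
    ∀ᶠ n : ℕ in atTop, ∀ p : ℝ, 0 ≤ p → p ≤ 1 → (n : ℝ) ^ (1 / (2 * k) : ℝ) ≤ n * p →
    (7 / 8) * Real.log ((n : ℝ) ^ 2 * p) ≤ lam n k p →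
    pr (KE n) p (fun s => Qs k s ∧ ∃ F, F.Nonempty ∧ (F.card : ℝ) ≤ (n : ℝ) ^ ε ∧ Perp k s F) ≤ ε1 := by
  have hk0 : (0 : ℝ) < k := by exact_mod_cast (by omega : 0 < k)
  have hC := Ck_pos k
  have hεk : ε < 1 / (2 * k) := hε2.trans_lt (by
    rw [div_lt_div_iff₀ (by positivity) (by positivity)]; linarith)
  have hε3 : ε < 1 := hε2.trans_lt (by rw [div_lt_one (by positivity)]; linarith)
  have hε4 : ε * (k + 1) ≤ 1 / 4 := by
    rw [le_div_iff₀ (by positivity)] at hε2; linarith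
  filter_upwards [eventually_ge_atTop 8, ev_pow (16 * (k + 1) ^ 2 * (k + 2)) (1 - ε) 1 (by linarith) (by norm_num),
    ev_log 1 (16 * (2 * (k + 1)) * Ck k * (4 * (k + 1))) (1 / (2 * k) - ε) 1 (by linarith) (by norm_num),
    ev_pow (2 * (2 ^ (k + 1) * (k + 1) ^ (k + 1) * 2 ^ (k + 1) * 3)) (7 / 16 - 1 / 4) 1 (by norm_num) (by norm_num),
    ev_pow (2 * 2 ^ (k + 1)) (3 / 32) (ε1 / 2) (by norm_num) (by positivity)] with n hn a1 a2 a3 a4 p h0 h1 hnp hl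
  have hn0 : (0 : ℝ) < n := by exact_mod_cast (by omega : 0 < n)
  have hn8 : (8 : ℝ) ≤ n := by exact_mod_cast hn
  have hn1 : (1 : ℝ) ≤ n := by linarith
  have hnp1 : 1 ≤ n * p := (Real.one_le_rpow hn1 (by positivity)).trans hnp
  have hp : 0 < p := by
    by_contra h
    have : p = 0 := le_antisymm (not_lt.1 h) h0
    rw [this] at hnp1; linarith
  have hN : (n : ℝ) ≤ (n : ℝ) ^ 2 * p := by nlinarith
  have hlogn : 2 ≤ Real.log n := by
    have : Real.log 8 ≤ Real.log n := Real.log_le_log (by norm_num) hn8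
    have h8 : Real.log 8 = 3 * Real.log 2 := by
      rw [show (8 : ℝ) = 2 ^ 3 by norm_num, Real.log_pow]; norm_num
    have := Real.log_two_gt_d9
    linarith
  have hlogN : Real.log n ≤ Real.log ((n : ℝ) ^ 2 * p) := Real.log_le_log hn0 hN
  set Λ := lam n k p with hΛ
  have hΛ1 : 1 ≤ Λ := by linarith
  set L := min Λ (2 * (k + 1) * Real.log n) with hL
  have hL0 : 0 ≤ L := le_min (by linarith) (by positivity)
  have hLlog : L ≤ 2 * (k + 1) * Real.log n := min_le_right _ _
  set x0 := (n : ℝ) ^ ε with hx0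
  have hx01 : 1 ≤ x0 := Real.one_le_rpow hn1 hε.le
  have hx0n : x0 ≤ n := by
    calc x0 ≤ (n : ℝ) ^ (1 : ℝ) := Real.rpow_le_rpow_of_exponent_le hn1 hε3.le
      _ = n := Real.rpow_one _
  have hx1 : x0 * (n : ℝ) ^ (1 - ε) = n := by rw [hx0, ← Real.rpow_add hn0]; simp
  have hx2 : x0 * (n : ℝ) ^ (1 / (2 * k) - ε) = (n : ℝ) ^ (1 / (2 * k) : ℝ) := by rw [hx0, ← Real.rpow_add hn0]; simp
  have hexpn : ∀ c : ℝ, Real.exp (c * Real.log n) = (n : ℝ) ^ c := fun c => by rw [Real.rpow_def_of_pos hn0, mul_comm]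
  have hlamn : Λ ≤ (n : ℝ) ^ (k - 1 : ℝ) := by
    rw [hΛ, lam, show ((k : ℝ) - 1) = ((k - 1 : ℕ) : ℝ) by rw [Nat.cast_sub (by omega)]; simp, Real.rpow_natCast]
    exact mul_le_of_le_one_right (by positivity) (pow_le_one₀ h0 h1)
  -- decay estimates
  have d1 : Λ * Real.exp (-(L * (7 / 8))) ≤ 3 * (n : ℝ) ^ (-(7 / 16) : ℝ) := by
    rcases min_choice Λ (2 * (k + 1) * Real.log n) with h | h
    · rw [hL, h]
      calc Λ * Real.exp (-(Λ * (7 / 8))) = (Λ * Real.exp (-(3 / 8 * Λ))) * Real.exp (-(1 / 2 * Λ)) := by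
            rw [mul_assoc, ← Real.exp_add]; congr 2; ring
        _ ≤ (1 / (3 / 8)) * Real.exp (-(7 / 16) * Real.log n) := by
            gcongr
            · exact mul_exp_neg_le (by norm_num)
            · linarith
        _ ≤ _ := by rw [hexpn]; gcongr; norm_num
    · rw [hL, h]
      calc Λ * Real.exp (-(2 * (k + 1) * Real.log n * (7 / 8))) ≤ (n : ℝ) ^ (k - 1 : ℝ) * Real.exp ((-(2 * (k + 1) * (7 / 8))) * Real.log n) := by
            gcongr; linarith
        _ = (n : ℝ) ^ ((k - 1 : ℝ) + (-(2 * (k + 1) * (7 / 8)))) := by rw [hexpn, Real.rpow_add hn0]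
        _ ≤ (n : ℝ) ^ (-(7 / 16) : ℝ) := Real.rpow_le_rpow_of_exponent_le hn1 (by linarith)
        _ ≤ _ := by have : 0 ≤ (n : ℝ) ^ (-(7 / 16) : ℝ) := by positivity
                    linarith
  have d2 : (n : ℝ) ^ 2 * p * Λ * Real.exp (-(2 * (L * (7 / 8)))) ≤ 2 * (n : ℝ) ^ (-(3 / 32) : ℝ) := by
    rcases min_choice Λ (2 * (k + 1) * Real.log n) with h | h
    · rw [hL, h]
      calc (n : ℝ) ^ 2 * p * Λ * Real.exp (-(2 * (Λ * (7 / 8)))) = ((n : ℝ) ^ 2 * p * Real.exp (-(5 / 4 * Λ))) * (Λ * Real.exp (-(1 / 2 * Λ))) := by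
            rw [show -(2 * (Λ * (7 / 8))) = -(5 / 4 * Λ) + -(1 / 2 * Λ) by ring, Real.exp_add]; ring
        _ ≤ ((n : ℝ) ^ (-(3 / 32) : ℝ)) * (1 / (1 / 2)) := by
            have hNpos : 0 < (n : ℝ) ^ 2 * p := by positivity
            refine mul_le_mul ?_ (mul_exp_neg_le (by norm_num)) (by positivity) (by positivity)
            calc (n : ℝ) ^ 2 * p * Real.exp (-(5 / 4 * Λ)) = Real.exp (Real.log ((n : ℝ) ^ 2 * p) + -(5 / 4 * Λ)) := by
                  rw [Real.exp_add, Real.exp_log hNpos]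
              _ ≤ Real.exp (-(3 / 32) * Real.log n) := by
                  refine Real.exp_le_exp.2 ?_; linarith
              _ = _ := hexpn _
        _ = _ := by ring
    · rw [hL, h]
      have hN2 : (n : ℝ) ^ 2 * p ≤ (n : ℝ) ^ (2 : ℝ) := by
        rw [show (2 : ℝ) = ((2 : ℕ) : ℝ) by norm_num, Real.rpow_natCast]; exact mul_le_of_le_one_right (by positivity) h1
      calc (n : ℝ) ^ 2 * p * Λ * Real.exp (-(2 * (2 * (k + 1) * Real.log n * (7 / 8)))) ≤
            (n : ℝ) ^ (2 : ℝ) * (n : ℝ) ^ (k - 1 : ℝ) * Real.exp ((-(4 * (k + 1) * (7 / 8))) * Real.log n) := by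
            gcongr; linarith
        _ = (n : ℝ) ^ (2 + (k - 1 : ℝ) + (-(4 * (k + 1) * (7 / 8)))) := by rw [hexpn, Real.rpow_add hn0, Real.rpow_add hn0]
        _ ≤ (n : ℝ) ^ (-(3 / 32) : ℝ) := Real.rpow_le_rpow_of_exponent_le hn1 (by linarith)
        _ ≤ _ := by have : 0 ≤ (n : ℝ) ^ (-(3 / 32) : ℝ) := by positivity
                    linarith
  have key := C_bound (n := n) (p := p) (x0 := x0) (L := L) (ρ := 15 / 16) (δ := 1 / 16) (a := ε1 / 2) hk h0 h1 hnp1 hx01 hL0 (min_le_left _ _) (by norm_num) hΛ1 ?_ ?_ ?_ ?_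
  · linarith
  · have e1 : (n : ℝ) ^ (k - 1) = n * (n : ℝ) ^ (k - 2) := by
      rw [← pow_succ']; congr 1; omega
    rw [e1]
    have e2 : 16 * ((k : ℝ) + 1) ^ 2 * ((k + 1) * x0 + 1) ≤ n := by
      calc 16 * ((k : ℝ) + 1) ^ 2 * ((k + 1) * x0 + 1) ≤ 16 * ((k : ℝ) + 1) ^ 2 * ((k + 1) * x0 + x0) := by gcongr
        _ = x0 * (16 * ((k : ℝ) + 1) ^ 2 * (k + 2)) := by ring
        _ ≤ x0 * (1 * (n : ℝ) ^ (1 - ε)) := by gcongr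
        _ = n := by rw [one_mul, hx1]
    have e3 : 0 ≤ (n : ℝ) ^ (k - 2) := by positivity
    nlinarith [mul_le_mul_of_nonneg_right e2 e3]
  · have e1 : (k + 1) * x0 / n + 2 * ((k + 1) * x0) + 1 ≤ 4 * (k + 1) * x0 := by
      have : (k + 1) * x0 / n ≤ (k + 1) * x0 := div_le_self (by positivity) hn1
      nlinarith
    calc L * (Ck k * ((k + 1) * x0 / n + 2 * ((k + 1) * x0) + 1)) ≤ (2 * (k + 1) * Real.log n) * (Ck k * (4 * (k + 1) * x0)) := by gcongr
      _ = 1 / 16 * (x0 * ((16 * (2 * (k + 1)) * Ck k * (4 * (k + 1))) * Real.log n ^ 1)) := by ring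
      _ ≤ 1 / 16 * (x0 * (1 * (n : ℝ) ^ (1 / (2 * k) - ε))) := by gcongr
      _ = 1 / 16 * (n : ℝ) ^ (1 / (2 * k) : ℝ) := by rw [one_mul, hx2]
      _ ≤ _ := by gcongr
  · rw [show (15 / 16 - 1 / 16 : ℝ) = 7 / 8 by norm_num]
    have e1 : x0 ^ (k + 1) ≤ (n : ℝ) ^ (1 / 4 : ℝ) := by
      rw [hx0, ← Real.rpow_natCast, ← Real.rpow_mul hn0.le]
      exact Real.rpow_le_rpow_of_exponent_le hn1 (by push_cast; exact hε4)
    have e2 : (n : ℝ) ^ (1 / 4 : ℝ) * (n : ℝ) ^ (-(7 / 16) : ℝ) = ((n : ℝ) ^ (7 / 16 - 1 / 4 : ℝ))⁻¹ := by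
      rw [← Real.rpow_add hn0, ← Real.rpow_neg hn0.le]; norm_num
    set Y : ℝ := (n : ℝ) ^ (7 / 16 - 1 / 4 : ℝ) with hYd
    have hY : 0 < Y := by positivity
    calc 2 ^ (k + 1) * ((k + 1) * x0) ^ (k + 1) * Λ * (2 ^ (k + 1) * Real.exp (-(L * (7 / 8))))
        = 2 ^ (k + 1) * ((k : ℝ) + 1) ^ (k + 1) * 2 ^ (k + 1) * x0 ^ (k + 1) * (Λ * Real.exp (-(L * (7 / 8)))) := by
          rw [mul_pow]; ring
      _ ≤ 2 ^ (k + 1) * ((k : ℝ) + 1) ^ (k + 1) * 2 ^ (k + 1) * (n : ℝ) ^ (1 / 4 : ℝ) * (3 * (n : ℝ) ^ (-(7 / 16) : ℝ)) := by gcongr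
      _ = 2 ^ (k + 1) * ((k : ℝ) + 1) ^ (k + 1) * 2 ^ (k + 1) * 3 * ((n : ℝ) ^ (1 / 4 : ℝ) * (n : ℝ) ^ (-(7 / 16) : ℝ)) := by ring
      _ ≤ 1 / 2 := by
          rw [e2, ← div_eq_mul_inv, div_le_iff₀ hY]; linarith
  · rw [show (15 / 16 - 1 / 16 : ℝ) = 7 / 8 by norm_num]
    have hY : 0 < (n : ℝ) ^ (3 / 32 : ℝ) := by positivity
    calc (n : ℝ) ^ 2 * p * Λ * (2 ^ (k + 1) * Real.exp (-(2 * (L * (7 / 8))))) = 2 ^ (k + 1) * ((n : ℝ) ^ 2 * p * Λ * Real.exp (-(2 * (L * (7 / 8))))) := by ring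
      _ ≤ 2 ^ (k + 1) * (2 * (n : ℝ) ^ (-(3 / 32) : ℝ)) := by gcongr
      _ ≤ ε1 / 2 := by
        rw [Real.rpow_neg hn0.le, ← mul_assoc, ← div_eq_mul_inv, div_le_iff₀ hY]; linarith

lemma pm_mul {a b : ℝ} (ha : a = 1 ∨ a = -1) (hb : b = 1 ∨ b = -1) : a * b = 1 ∨ a * b = -1 := by
  rcases ha with rfl | rfl <;> rcases hb with rfl | rfl <;> norm_num

lemma pm_prod {ι : Type*} (I : Finset ι) (f : ι → ℝ) (h : ∀ i, f i = 1 ∨ f i = -1) :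
    ∏ i ∈ I, f i = 1 ∨ ∏ i ∈ I, f i = -1 := by
  classical
  induction I using Finset.induction_on with
  | empty => simp
  | insert a I ha ih => rw [Finset.prod_insert ha]; exact pm_mul (h a) ih

/-- number of functions whose values at two distinct places lie in a relation -/
lemma count_pair {n k : ℕ} (M : Finset (Fin n × Fin n)) (i j : Fin (k + 1)) (hij : i ≠ j) :
    ((Finset.univ.filter (fun x : Fin (k + 1) → Fin n => (x i, x j) ∈ M)).card : ℝ) ≤ M.card * (n : ℝ) ^ (k - 1) := by
  have : (Finset.univ.filter (fun x : Fin (k + 1) → Fin n => (x i, x j) ∈ M)).card ≤ M.card * n ^ (k - 1) := by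
    have h1 : (Finset.univ.filter (fun x : Fin (k + 1) → Fin n => (x i, x j) ∈ M)).card =
        ∑ q ∈ M, (Finset.univ.filter (fun x : Fin (k + 1) → Fin n => (x i, x j) = q)).card := by
      rw [Finset.card_eq_sum_card_fiberwise (f := fun x : Fin (k + 1) → Fin n => (x i, x j)) (t := M)]
      · refine Finset.sum_congr rfl fun q hq => ?_
        congr 1; ext x; simp only [Finset.mem_filter, Finset.mem_univ, true_and]
        constructor
        · rintro ⟨_, h⟩; exact h
        · intro h; exact ⟨h ▸ hq, h⟩
      · intro x hx; simpa using hx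
    rw [h1, ← smul_eq_mul, ← Finset.sum_const]
    refine Finset.sum_le_sum fun q _ => ?_
    have h2 : (Finset.univ.filter (fun x : Fin (k + 1) → Fin n => (x i, x j) = q)) ⊆
        Fintype.piFinset (fun t => if t = i then {q.1} else if t = j then {q.2} else Finset.univ) := by
      intro x hx
      simp only [Finset.mem_filter, Finset.mem_univ, true_and] at hx
      rw [Fintype.mem_piFinset]
      intro t
      by_cases h : t = i
      · subst h; simp [← hx]
      · by_cases h' : t = j
        · subst h'; simp [h, ← hx]
        · simp [h, h']
    refine (Finset.card_le_card h2).trans ?_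
    rw [Fintype.card_piFinset]
    rw [← Finset.mul_prod_erase _ _ (Finset.mem_univ i), ← Finset.mul_prod_erase _ _ (Finset.mem_erase.2 ⟨hij.symm, Finset.mem_univ j⟩)]
    rw [Finset.prod_congr rfl (g := fun _ => n)]
    · rw [Finset.prod_const, Finset.card_erase_of_mem (Finset.mem_erase.2 ⟨hij.symm, Finset.mem_univ j⟩), Finset.card_erase_of_mem (Finset.mem_univ i)]
      simp [hij.symm]
    · intro t ht
      simp only [Finset.mem_erase, Finset.mem_univ, and_true] at ht
      simp [ht.1, ht.2]
  exact_mod_cast this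

lemma pm_disagree {ι : Type*} (I : Finset ι) (f g : ι → ℝ) (hf : ∀ i, f i = 1 ∨ f i = -1) (hg : ∀ i, g i = 1 ∨ g i = -1) :
    ∑ i ∈ I, f i * g i = I.card - 2 * ((I.filter (fun i => f i ≠ g i)).card : ℝ) := by
  rw [← sum_ind, Finset.mul_sum, Finset.card_eq_sum_ones, Nat.cast_sum, ← Finset.sum_sub_distrib]
  refine Finset.sum_congr rfl fun i _ => ?_
  by_cases h : f i = g i
  · rw [ind_false (by simpa using h), h]; rcases hg i with h | h <;> rw [h] <;> norm_num
  · rw [ind_true h]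
    rcases hf i with h1 | h1 <;> rcases hg i with h2 | h2 <;> rw [h1, h2] at h ⊢ <;> first | (exfalso; exact h rfl) | norm_num

/-- Stability: if almost all closed tuples have product one then `σ` is almost a coboundary. -/
lemma stabK {n k : ℕ} (hk : 2 ≤ k) (hke : Even k) (hn : 0 < n) (σ : Fin n → Fin n → ℝ) (hσ : ∀ u v, σ u v = 1 ∨ σ u v = -1)
    {β : ℝ} (hβ : 2 * (k + 2) * β < 1)
    (h : (1 - 2 * β) * (n : ℝ) ^ (k + 1) ≤ ∑ x : Fin (k + 1) → Fin n, ∏ i, σ (x i) (x (i + 1))) :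
    ∃ a : Fin n → ℝ, (∀ v, a v = 1 ∨ a v = -1) ∧
      (((Finset.univ : Finset (Fin n × Fin n)).filter (fun q => σ q.1 q.2 ≠ a q.1 * a q.2)).card : ℝ) ≤ (k + 3) * β * (n : ℝ) ^ 2 := by
  have hn0 : (0 : ℝ) < n := by exact_mod_cast hn
  obtain ⟨j, rfl⟩ : ∃ j, k = j + 2 := ⟨k - 2, by omega⟩
  -- base tuple
  obtain ⟨A, B, hA, hB, hAB⟩ : ∃ A B : Fin n → ℝ, (∀ v, A v = 1 ∨ A v = -1) ∧ (∀ v, B v = 1 ∨ B v = -1) ∧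
      (1 - 2 * β) * (n : ℝ) ^ 2 ≤ ∑ q : Fin n × Fin n, σ q.1 q.2 * (A q.1 * B q.2) := by
    set T : (Fin (j + 1) → Fin n) → ℝ := fun y => ∑ q : Fin n × Fin n,
      ∏ i, σ ((Fin.cons q.1 (Fin.cons q.2 y) : Fin (j + 2 + 1) → Fin n) i) ((Fin.cons q.1 (Fin.cons q.2 y) : Fin (j + 2 + 1) → Fin n) (i + 1)) with hT
    have hsum : ∑ x : Fin (j + 2 + 1) → Fin n, ∏ i, σ (x i) (x (i + 1)) = ∑ y, T y := by
      rw [← (Fin.consEquiv (fun _ => Fin n)).sum_comp, Fintype.sum_prod_type, Finset.sum_comm]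
      rw [← (Fin.consEquiv (n := j + 1) (fun _ => Fin n)).sum_comp, Fintype.sum_prod_type, Finset.sum_comm]
      refine Finset.sum_congr rfl fun y _ => ?_
      simp only [hT]
      rw [Fintype.sum_prod_type, Finset.sum_comm]
      rfl
    obtain ⟨y, hy⟩ : ∃ y, (1 - 2 * β) * (n : ℝ) ^ 2 ≤ T y := by
      by_contra hcon
      push Not at hcon
      have h2 : ∑ y, T y < ∑ y : Fin (j + 1) → Fin n, (1 - 2 * β) * (n : ℝ) ^ 2 :=
        Finset.sum_lt_sum_of_nonempty ⟨fun _ => ⟨0, hn⟩, Finset.mem_univ _⟩ fun y _ => hcon y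
      rw [Finset.sum_const, nsmul_eq_mul] at h2
      rw [hsum] at h
      have h3 : (((Finset.univ : Finset (Fin (j + 1) → Fin n)).card : ℕ) : ℝ) = (n : ℝ) ^ (j + 1) := by simp
      rw [h3] at h2
      have : (1 - 2 * β) * (n : ℝ) ^ (j + 2 + 1) = (n : ℝ) ^ (j + 1) * ((1 - 2 * β) * (n : ℝ) ^ 2) := by ring
      linarith
    refine ⟨fun u => σ (y (Fin.last j)) u, fun v => ∏ i : Fin (j + 1), σ ((Fin.cons v y : Fin (j + 2) → Fin n) i.castSucc) (y i),
      fun v => hσ _ _, fun v => pm_prod _ _ fun i => hσ _ _, hy.trans (le_of_eq ?_)⟩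
    refine Finset.sum_congr rfl fun q _ => ?_
    rw [Fin.prod_univ_castSucc, Fin.prod_univ_succ]
    have e1 : ∀ i : Fin (j + 2), (i.castSucc + 1 : Fin (j + 2 + 1)) = i.succ := fun i => by
      rw [Fin.coeSucc_eq_succ]
    have e2 : (Fin.last (j + 2) : Fin (j + 2 + 1)) + 1 = 0 := Fin.last_add_one _
    simp only [e1, e2]
    have e3 : (Fin.cons q.1 (Fin.cons q.2 y) : Fin (j + 2 + 1) → Fin n) (Fin.last (j + 2)) = y (Fin.last j) := by
      rw [show (Fin.last (j + 2)) = (Fin.last (j)).succ.succ by ext; simp, Fin.cons_succ, Fin.cons_succ]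
    rw [e3]
    simp only [Fin.cons_zero, Fin.cons_succ, Fin.castSucc_zero, ← Fin.succ_castSucc]
    ring
  set M := (Finset.univ : Finset (Fin n × Fin n)).filter (fun q => σ q.1 q.2 ≠ A q.1 * B q.2) with hM
  have hMc : (M.card : ℝ) ≤ β * (n : ℝ) ^ 2 := by
    have := pm_disagree Finset.univ (fun q : Fin n × Fin n => σ q.1 q.2) (fun q => A q.1 * B q.2) (fun q => hσ _ _) (fun q => pm_mul (hA _) (hB _))
    rw [this] at hAB
    simp only [Finset.card_univ, Fintype.card_prod, Fintype.card_fin, Nat.cast_mul] at hAB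
    nlinarith
  -- product function
  set hh : Fin n → ℝ := fun v => A v * B v with hhd
  have hh1 : ∀ v, hh v = 1 ∨ hh v = -1 := fun v => pm_mul (hA v) (hB v)
  have hprod : ∑ x : Fin (j + 2 + 1) → Fin n, ∏ i, hh (x i) = (∑ v, hh v) ^ (j + 2 + 1) := by
    rw [Finset.sum_pow', ← Fintype.piFinset_univ]
  have hdiff : ∑ x : Fin (j + 2 + 1) → Fin n, ∏ i, σ (x i) (x (i + 1)) ≤ ∑ x : Fin (j + 2 + 1) → Fin n, ∏ i, hh (x i) +
      2 * ((j + 2 + 1) * (β * (n : ℝ) ^ (j + 2 + 1))) := by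
    have hpt : ∀ x : Fin (j + 2 + 1) → Fin n, ∏ i, σ (x i) (x (i + 1)) ≤ ∏ i, hh (x i) + 2 * ∑ i, ind ((x i, x (i + 1)) ∈ M) := by
      intro x
      by_cases hx : ∃ i, (x i, x (i + 1)) ∈ M
      · obtain ⟨i, hi⟩ := hx
        have h1 : (1 : ℝ) ≤ ∑ i, ind ((x i, x (i + 1)) ∈ M) := by
          rw [← ind_true hi]
          exact Finset.single_le_sum (f := fun i => ind ((x i, x (i + 1)) ∈ M)) (fun i _ => ind_nonneg _) (Finset.mem_univ i)
        rcases pm_prod Finset.univ (fun i => σ (x i) (x (i + 1))) (fun i => hσ _ _) with h2 | h2 <;>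
        rcases pm_prod Finset.univ (fun i => hh (x i)) (fun i => hh1 _) with h3 | h3 <;> rw [h2, h3] <;> linarith
      · push Not at hx
        have h1 : ∏ i, σ (x i) (x (i + 1)) = ∏ i, hh (x i) := by
          rw [Finset.prod_congr rfl (g := fun i => A (x i) * B (x (i + 1))) fun i _ => by
            have := hx i
            simp only [hM, Finset.mem_filter, Finset.mem_univ, true_and, not_not] at this
            exact this]
          rw [Finset.prod_mul_distrib]
          simp only [hhd]
          rw [Finset.prod_mul_distrib]
          congr 1
          exact Equiv.prod_comp (Equiv.addRight (1 : Fin (j + 2 + 1))) (fun i => B (x i))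
        rw [h1]
        have : (0 : ℝ) ≤ ∑ i, ind ((x i, x (i + 1)) ∈ M) := Finset.sum_nonneg fun i _ => ind_nonneg _
        linarith
    refine (Finset.sum_le_sum fun x _ => hpt x).trans ?_
    rw [Finset.sum_add_distrib, ← Finset.mul_sum, Finset.sum_comm]
    gcongr
    have hone : ∀ i : Fin (j + 2 + 1), ∑ x : Fin (j + 2 + 1) → Fin n, ind ((x i, x (i + 1)) ∈ M) ≤ β * (n : ℝ) ^ (j + 2 + 1) := by
      intro i
      rw [sum_ind]
      refine (count_pair M i (i + 1) (by
        intro h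
        have := congrArg (fun t => t - i) h
        simp at this)).trans ?_
      calc (M.card : ℝ) * (n : ℝ) ^ (j + 2 - 1) ≤ β * (n : ℝ) ^ 2 * (n : ℝ) ^ (j + 2 - 1) := by gcongr
        _ = _ := by rw [show j + 2 - 1 = j + 1 by omega]; ring
    refine (Finset.sum_le_sum fun i _ => hone i).trans ?_
    rw [Finset.sum_const, nsmul_eq_mul]; simp
  rw [hprod] at hdiff
  set Z := ∑ v, hh v with hZ
  have hZn : Z = n - 2 * (((Finset.univ : Finset (Fin n)).filter (fun v => A v ≠ B v)).card : ℝ) := by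
    have := pm_disagree Finset.univ A B hA hB
    simpa using this
  have hZle : Z ≤ n := by
    have : (0 : ℝ) ≤ (((Finset.univ : Finset (Fin n)).filter (fun v => A v ≠ B v)).card : ℝ) := Nat.cast_nonneg _
    linarith
  push_cast at hβ ⊢
  have hk1 : (1 - 2 * ((j : ℝ) + 4) * β) * (n : ℝ) ^ (j + 2 + 1) ≤ Z ^ (j + 2 + 1) := by
    have := h.trans hdiff; nlinarith
  have hodd : Odd (j + 2 + 1) := hke.add_one
  have hZpos : 0 < Z := by
    rw [← hodd.pow_pos_iff]
    refine lt_of_lt_of_le ?_ hk1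
    have : 0 < 1 - 2 * ((j : ℝ) + 4) * β := by linarith
    positivity
  have hZ1 : (1 - 2 * ((j : ℝ) + 4) * β) * n ≤ Z := by
    have h5 : Z ^ (j + 2 + 1) ≤ Z * (n : ℝ) ^ (j + 2) := by
      rw [pow_succ, mul_comm]; gcongr
    have h6 := hk1.trans h5
    rw [pow_succ' (n : ℝ), ← mul_assoc] at h6
    exact le_of_mul_le_mul_right h6 (by positivity)
  set P := (Finset.univ : Finset (Fin n)).filter (fun v => A v ≠ B v) with hP
  have hPc : (P.card : ℝ) ≤ (j + 4) * β * n := by nlinarith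
  refine ⟨A, hA, ?_⟩
  have hsub : (Finset.univ : Finset (Fin n × Fin n)).filter (fun q => σ q.1 q.2 ≠ A q.1 * A q.2) ⊆ M ∪ Finset.univ ×ˢ P := by
    intro q hq
    simp only [Finset.mem_filter, Finset.mem_univ, true_and, Finset.mem_union, hM, Finset.mem_product, hP] at hq ⊢
    by_contra hcon
    push Not at hcon
    exact hq (by rw [hcon.1, hcon.2])
  have hc := Finset.card_le_card hsub
  have hc2 := Finset.card_union_le M (Finset.univ ×ˢ P)
  rw [Finset.card_product, Finset.card_univ, Fintype.card_fin] at hc2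
  have hc3 : (((Finset.univ : Finset (Fin n × Fin n)).filter (fun q => σ q.1 q.2 ≠ A q.1 * A q.2)).card : ℝ) ≤ M.card + n * P.card := by
    exact_mod_cast hc.trans hc2
  nlinarith

/-- `e` crosses the cut given by `A`. -/
def cr {n : ℕ} (A : Finset (Fin n)) (e : Sym2 (Fin n)) : Prop := ∃ u v, e = s(u, v) ∧ u ∈ A ∧ v ∉ A

lemma cr_mk {n : ℕ} {A : Finset (Fin n)} {u v : Fin n} : cr A s(u, v) ↔ ((u ∈ A ∧ v ∉ A) ∨ (v ∈ A ∧ u ∉ A)) := by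
  constructor
  · rintro ⟨a, b, hab, ha, hb⟩
    rcases Sym2.eq_iff.1 hab with ⟨rfl, rfl⟩ | ⟨rfl, rfl⟩
    · exact Or.inl ⟨ha, hb⟩
    · exact Or.inr ⟨ha, hb⟩
  · rintro (⟨a, b⟩ | ⟨a, b⟩)
    · exact ⟨u, v, rfl, a, b⟩
    · exact ⟨v, u, Sym2.eq_swap, a, b⟩

/-- bad odd tuples -/
def BT {n : ℕ} (k : ℕ) (U G : Finset (Sym2 (Fin n))) (R : Finset (Fin n)) : Finset (Fin (k + 1) → Fin n) :=
  Finset.univ.filter fun x => Function.Injective x ∧ (∀ i, x i ∈ R) ∧ (∀ e ∈ cycE x, e ∉ U) ∧ Odd (G ∩ cycE x).card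

def sg {n : ℕ} (G : Finset (Sym2 (Fin n))) (u v : Fin n) : ℝ := if s(u, v) ∈ G then -1 else 1

lemma sg_pm {n : ℕ} (G : Finset (Sym2 (Fin n))) (u v : Fin n) : sg G u v = 1 ∨ sg G u v = -1 := by
  unfold sg; split_ifs <;> simp

lemma prod_sg {n k : ℕ} (hk : 2 ≤ k) (G : Finset (Sym2 (Fin n))) {x : Fin (k + 1) → Fin n} (hx : Function.Injective x) :
    ∏ i, sg G (x i) (x (i + 1)) = (-1) ^ (G ∩ cycE x).card := by
  have h1 : ∏ i, sg G (x i) (x (i + 1)) = ∏ e ∈ cycE x, (if e ∈ G then (-1 : ℝ) else 1) := by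
    rw [cycE, Finset.prod_image (fun a _ b _ h => ce_injective hk hx h)]
    rfl
  rw [h1, Finset.prod_ite, Finset.prod_const_one, mul_one, Finset.prod_const, Finset.filter_mem_eq_inter, Finset.inter_comm]

lemma card_pairs_le {n : ℕ} (U : Finset (Sym2 (Fin n))) :
    ((Finset.univ : Finset (Fin n × Fin n)).filter (fun q => s(q.1, q.2) ∈ U)).card ≤ 2 * U.card := by
  refine Finset.card_le_mul_card_image_of_maps_to (f := fun q : Fin n × Fin n => s(q.1, q.2)) (s := (Finset.univ : Finset (Fin n × Fin n)).filter (fun q => s(q.1, q.2) ∈ U)) (t := U) (fun q hq => (Finset.mem_filter.1 hq).2) 2 ?_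
  intro e he
  induction e using Sym2.ind with
  | _ a b =>
    refine (Finset.card_le_card (t := {(a, b), (b, a)}) ?_).trans Finset.card_le_two
    intro q hq
    simp only [Finset.mem_filter, Finset.mem_univ, true_and] at hq
    rcases Sym2.eq_iff.1 hq.2 with ⟨h1, h2⟩ | ⟨h1, h2⟩
    · simp [← h1, ← h2]
    · simp [← h1, ← h2]

lemma odd_count {n k : ℕ} (hk : 2 ≤ k) (U G : Finset (Sym2 (Fin n))) (S : Finset (Fin n)) :
    ((Finset.univ.filter (fun x : Fin (k + 1) → Fin n => ∏ i, sg G (x i) (x (i + 1)) ≠ 1)).card : ℝ) ≤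
      (BT k U G Sᶜ).card + (k + 1) ^ 2 * (n : ℝ) ^ k + (k + 1) * (S.card * (n : ℝ) ^ k) + (k + 1) * (2 * U.card * (n : ℝ) ^ (k - 1)) := by
  have hsub : Finset.univ.filter (fun x : Fin (k + 1) → Fin n => ∏ i, sg G (x i) (x (i + 1)) ≠ 1) ⊆
      BT k U G Sᶜ ∪ ((Finset.univ : Finset (Fin (k + 1) × Fin (k + 1))).filter (fun q => q.1 ≠ q.2)).biUnion (fun q => Finset.univ.filter fun x : Fin (k + 1) → Fin n => (x q.1, x q.2) ∈ (Finset.univ : Finset (Fin n)).image (fun v => (v, v)))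
      ∪ Finset.univ.biUnion (fun i : Fin (k + 1) => Finset.univ.filter fun x : Fin (k + 1) → Fin n => (x i, x (i + 1)) ∈ S ×ˢ Finset.univ)
      ∪ Finset.univ.biUnion (fun i : Fin (k + 1) => Finset.univ.filter fun x : Fin (k + 1) → Fin n => (x i, x (i + 1)) ∈ (Finset.univ : Finset (Fin n × Fin n)).filter (fun q => s(q.1, q.2) ∈ U)) := by
    intro x hx
    simp only [Finset.mem_filter, Finset.mem_univ, true_and, Finset.mem_union, Finset.mem_biUnion, Finset.mem_image, Finset.mem_product, and_true] at hx ⊢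
    by_contra hcon
    push Not at hcon
    obtain ⟨⟨⟨h1, h2⟩, h3⟩, h4⟩ := hcon
    have hinj : Function.Injective x := by
      intro a b hab
      by_contra hne
      exact h2 (a, b) hne (x a) (by simp [hab])
    apply h1
    simp only [BT, Finset.mem_filter, Finset.mem_univ, true_and, Finset.mem_compl]
    refine ⟨hinj, h3, ?_, ?_⟩
    · intro e he
      obtain ⟨i, rfl⟩ := mem_cycE.1 he
      exact h4 i
    · rw [prod_sg hk G hinj] at hx
      by_contra ho
      exact hx (Even.neg_one_pow (Nat.not_odd_iff_even.1 ho))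
  have hne : ∀ i : Fin (k + 1), i ≠ i + 1 := by
    intro i h
    obtain ⟨j, rfl⟩ : ∃ j, k = j + 1 := ⟨k - 1, by omega⟩
    have := congrArg (fun t => t - i) h
    simp at this
  have h0 := Finset.card_le_card hsub
  have hn1 : (n : ℝ) * (n : ℝ) ^ (k - 1) = (n : ℝ) ^ k := by rw [← pow_succ', show k - 1 + 1 = k by omega]
  have b1 : (((((Finset.univ : Finset (Fin (k + 1) × Fin (k + 1))).filter (fun q => q.1 ≠ q.2)).biUnion (fun q => Finset.univ.filter fun x : Fin (k + 1) → Fin n => (x q.1, x q.2) ∈ (Finset.univ : Finset (Fin n)).image (fun v => (v, v)))).card : ℕ) : ℝ) ≤ (k + 1) ^ 2 * (n : ℝ) ^ k := by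
    refine (Nat.cast_le.2 Finset.card_biUnion_le).trans ?_
    rw [Nat.cast_sum]
    refine (Finset.sum_le_sum (g := fun _ => (n : ℝ) ^ k) fun q hq => ?_).trans ?_
    · refine (count_pair _ q.1 q.2 (by simpa using hq)).trans ?_
      rw [Finset.card_image_of_injective _ (fun a b h => by simpa using h), Finset.card_univ, Fintype.card_fin, hn1]
    · rw [Finset.sum_const, nsmul_eq_mul]
      gcongr
      have : ((Finset.univ : Finset (Fin (k + 1) × Fin (k + 1))).filter (fun q => q.1 ≠ q.2)).card ≤ (k + 1) ^ 2 := by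
        refine (Finset.card_filter_le _ _).trans ?_
        simp [sq]
      exact_mod_cast this
  have b2 : (((Finset.univ.biUnion (fun i : Fin (k + 1) => Finset.univ.filter fun x : Fin (k + 1) → Fin n => (x i, x (i + 1)) ∈ S ×ˢ Finset.univ)).card : ℕ) : ℝ) ≤ (k + 1) * (S.card * (n : ℝ) ^ k) := by
    refine (Nat.cast_le.2 Finset.card_biUnion_le).trans ?_
    rw [Nat.cast_sum]
    refine (Finset.sum_le_sum (g := fun _ => (S.card * (n : ℝ) ^ k)) fun i hq => ?_).trans ?_
    · refine (count_pair _ i (i + 1) (hne i)).trans ?_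
      rw [Finset.card_product, Finset.card_univ, Fintype.card_fin, ← hn1]
      push_cast; linarith
    · rw [Finset.sum_const, nsmul_eq_mul]; simp
  have b3 : (((Finset.univ.biUnion (fun i : Fin (k + 1) => Finset.univ.filter fun x : Fin (k + 1) → Fin n => (x i, x (i + 1)) ∈ (Finset.univ : Finset (Fin n × Fin n)).filter (fun q => s(q.1, q.2) ∈ U))).card : ℕ) : ℝ) ≤ (k + 1) * (2 * U.card * (n : ℝ) ^ (k - 1)) := by
    refine (Nat.cast_le.2 Finset.card_biUnion_le).trans ?_
    rw [Nat.cast_sum]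
    refine (Finset.sum_le_sum (g := fun _ => (2 * U.card * (n : ℝ) ^ (k - 1))) fun i hq => ?_).trans ?_
    · refine (count_pair _ i (i + 1) (hne i)).trans ?_
      gcongr
      exact_mod_cast card_pairs_le U
    · rw [Finset.sum_const, nsmul_eq_mul]; simp
  have h5 : ((Finset.univ.filter (fun x : Fin (k + 1) → Fin n => ∏ i, sg G (x i) (x (i + 1)) ≠ 1)).card : ℝ) ≤ _ :=
    Nat.cast_le.2 (h0.trans ((Finset.card_union_le _ _).trans (Nat.add_le_add_right ((Finset.card_union_le _ _).trans (Nat.add_le_add_right (Finset.card_union_le _ _) _)) _)))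
  push_cast at h5
  linarith

/-- If few tuples are odd then `G` is close to a cut. -/
lemma near_cut {n k : ℕ} (hk : 2 ≤ k) (hke : Even k) (hn : 0 < n) (G : Finset (Sym2 (Fin n))) (hG : G ⊆ KE n) {β : ℝ} (hβ : 2 * (k + 2) * β < 1)
    (h : ((Finset.univ.filter (fun x : Fin (k + 1) → Fin n => ∏ i, sg G (x i) (x (i + 1)) ≠ 1)).card : ℝ) ≤ β * (n : ℝ) ^ (k + 1)) :
    ∃ A : Finset (Fin n), (((KE n).filter (fun e => ¬ (e ∈ G ↔ cr A e))).card : ℝ) ≤ (k + 3) * β * (n : ℝ) ^ 2 := by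
  obtain ⟨a, ha, hM⟩ := stabK hk hke hn (sg G) (sg_pm G) hβ (by
    have := pm_disagree Finset.univ (fun x : Fin (k + 1) → Fin n => ∏ i, sg G (x i) (x (i + 1))) (fun _ => 1) (fun x => pm_prod _ _ fun i => sg_pm _ _ _) (fun _ => Or.inl rfl)
    simp only [mul_one] at this
    rw [this]
    have h2 : (((Finset.univ : Finset (Fin (k + 1) → Fin n)).card : ℕ) : ℝ) = (n : ℝ) ^ (k + 1) := by simp
    rw [h2]; linarith)
  refine ⟨Finset.univ.filter fun v => a v = 1, le_trans ?_ hM⟩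
  refine (Nat.cast_le.2 (Finset.card_le_card (t := ((Finset.univ : Finset (Fin n × Fin n)).filter (fun q => sg G q.1 q.2 ≠ a q.1 * a q.2)).image (fun q => s(q.1, q.2))) ?_)).trans (Nat.cast_le.2 Finset.card_image_le)
  intro e he
  induction e using Sym2.ind with
  | _ u v =>
    rw [Finset.mem_image]
    refine ⟨(u, v), Finset.mem_filter.2 ⟨Finset.mem_univ _, ?_⟩, rfl⟩
    simp only [Finset.mem_filter, Finset.mem_univ, true_and, cr_mk] at he
    intro hc
    simp only [sg] at hc
    apply he.2
    by_cases hg : s(u, v) ∈ G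
    · rw [if_pos hg] at hc
      simp only [hg, true_iff]
      rcases ha u with h1 | h1 <;> rcases ha v with h2 | h2 <;> rw [h1, h2] at hc ⊢ <;> first | (exfalso; norm_num at hc; done) | norm_num
    · rw [if_neg hg] at hc
      simp only [hg, false_iff]
      rcases ha u with h1 | h1 <;> rcases ha v with h2 | h2 <;> rw [h1, h2] at hc ⊢ <;> first | (exfalso; norm_num at hc; done) | norm_num

lemma janson_cyc {n k : ℕ} (hk : 2 ≤ k) {E : Finset (Sym2 (Fin n))} (I : Finset (Fin (k + 1) → Fin n)) (hI : ∀ x ∈ I, Function.Injective x ∧ cycE x ⊆ E)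
    {p : ℝ} (h0 : 0 ≤ p) (h1 : p ≤ 1) (hnp : 1 ≤ n * p) (hl : 1 ≤ lam n k p) {β : ℝ} (hc : β * (n : ℝ) ^ (k + 1) ≤ I.card) :
    pr E p (noneOf I cycE) ≤ Real.exp (-(β * (n ^ 2 * p) / (4 * (2 ^ (k + 1) * (k + 1) ^ (k + 1))))) := by
  set C : ℝ := 2 ^ (k + 1) * (k + 1) ^ (k + 1) with hC
  set Λ := lam n k p with hΛ
  have hC1 : 1 ≤ C := by
    rw [hC, ← mul_pow]; apply one_le_pow₀; have : (0 : ℝ) ≤ k := Nat.cast_nonneg _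
    linarith
  have hCp : 0 < C := by linarith
  have hw1 : 1 / (2 * C * Λ) ≤ 1 := by
    rw [div_le_one (by positivity)]; nlinarith
  refine (janson h0 h1 I cycE (fun x hx => (hI x hx).2) (w := 1 / (2 * C * Λ)) (by positivity) hw1).trans (Real.exp_le_exp.2 ?_)
  have e1 : ∑ i ∈ I, p ^ (cycE i).card = I.card * p ^ (k + 1) := by
    rw [Finset.sum_congr rfl (g := fun _ => p ^ (k + 1)) (fun x hx => by rw [card_cycE hk (hI x hx).1]), Finset.sum_const, nsmul_eq_mul]
  have e2 : ∑ i ∈ I, ∑ j ∈ I with j ≠ i ∧ ¬ Disjoint (cycE i) (cycE j), p ^ (cycE i ∪ cycE j).card ≤ I.card * (p ^ (k + 1) * (C * Λ)) := by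
    rw [← nsmul_eq_mul, ← Finset.sum_const]
    refine Finset.sum_le_sum fun x hx => ?_
    have hW : (Finset.univ.image x).card = k + 1 := by rw [Finset.card_image_of_injective _ (hI x hx).1]; simp
    have := cyc_overlap hk (cycE x) (Finset.univ.image x) (by
      intro e he v hv
      obtain ⟨i, rfl⟩ := mem_cycE.1 he
      rcases Sym2.mem_iff.1 hv with rfl | rfl <;> simp) (by rw [hW]; omega) I (fun y hy => (hI y hy).1) h0 hnp (Λ := Λ) le_rfl hl
    rw [hW] at this
    push_cast at this
    rw [← hC] at this
    refine le_trans ?_ (mul_le_mul_of_nonneg_left this (by positivity))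
    rw [Finset.mul_sum]
    refine (Finset.sum_le_sum_of_subset_of_nonneg (t := I.filter fun j => ¬ Disjoint (cycE x) (cycE j)) ?_ (fun j _ _ => by positivity)).trans (le_of_eq ?_)
    · intro j hj
      simp only [Finset.mem_filter] at hj ⊢
      exact ⟨hj.1, hj.2.2⟩
    · refine Finset.sum_congr rfl fun j _ => ?_
      rw [← pow_add, ← Finset.union_sdiff_self_eq_union, Finset.card_union_of_disjoint Finset.disjoint_sdiff, card_cycE hk (hI x hx).1]
  rw [e1]
  have e3 : (1 / (2 * C * Λ)) ^ 2 * ∑ i ∈ I, ∑ j ∈ I with j ≠ i ∧ ¬ Disjoint (cycE i) (cycE j), p ^ (cycE i ∪ cycE j).card ≤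
      (1 / (2 * C * Λ)) ^ 2 * (I.card * (p ^ (k + 1) * (C * Λ))) := by gcongr
  have e4 : (1 / (2 * C * Λ)) ^ 2 * (I.card * (p ^ (k + 1) * (C * Λ))) = I.card * p ^ (k + 1) / (4 * C * Λ) := by
    field_simp; ring
  have e5 : (1 / (2 * C * Λ)) * (I.card * p ^ (k + 1)) = 2 * (I.card * p ^ (k + 1) / (4 * C * Λ)) := by
    field_simp; ring
  have e6 : β * (n ^ 2 * p) / (4 * C) ≤ I.card * p ^ (k + 1) / (4 * C * Λ) := by
    rw [div_le_div_iff₀ (by positivity) (by positivity)]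
    have : β * (n : ℝ) ^ (k + 1) * p ^ (k + 1) ≤ I.card * p ^ (k + 1) := by gcongr
    rw [mul_assoc, lam_cyc hk p, ← hΛ] at this
    nlinarith
  rw [e5]
  linarith

/-- pairs avoiding `S` -/
def T1 {n : ℕ} (S : Finset (Fin n)) : Finset (Sym2 (Fin n)) := (KE n).filter fun e => ∀ v ∈ e, v ∉ S

def cut {n : ℕ} (s : Finset (Sym2 (Fin n))) (A : Finset (Fin n)) : Finset (Sym2 (Fin n)) := s.filter (cr A)

lemma T1_sub {n : ℕ} (S : Finset (Fin n)) : T1 S ⊆ KE n := Finset.filter_subset _ _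

lemma brid_T1 {n k : ℕ} (hk : 2 ≤ k) {F J : Finset (Sym2 (Fin n))} {S : Finset (Fin n)} {x : Fin (k + 1) → Fin n} (hx : x ∈ brid k F J S) :
    Disjoint (pathE x) (T1 S) := by
  rw [Finset.disjoint_left]
  intro e he hT
  obtain ⟨hinj, -, -, hntr, -⟩ := mem_brid.1 hx
  obtain ⟨i, rfl⟩ := mem_pathE.1 he
  have h2 := (Finset.mem_filter.1 hT).2
  by_cases h0 : i.val = 0
  · refine h2 (x i.succ) (by simp [pe]) (hntr _ ?_ ?_)
    · exact Fin.succ_ne_zero i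
    · intro h; have := congrArg Fin.val h; simp at this; omega
  · refine h2 (x i.castSucc) (by simp [pe]) (hntr _ ?_ ?_)
    · intro h; have := congrArg Fin.val h; simp at this; omega
    · intro h; have := congrArg Fin.val h; simp at this; omega

/-- pairs not bridged -/
def Ub {n : ℕ} (k : ℕ) (S : Finset (Fin n)) (s0 : Finset (Sym2 (Fin n))) : Finset (Sym2 (Fin n)) :=
  (T1 S).filter fun e => noneOf (brid k {e} ∅ S) pathE s0

/-- prediction -/
def Gp {n : ℕ} (k : ℕ) (S : Finset (Fin n)) (s0 F0 : Finset (Sym2 (Fin n))) : Finset (Sym2 (Fin n)) :=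
  (T1 S).filter fun e => ∃ x ∈ brid k {e} ∅ S, pathE x ⊆ s0 ∧ Odd (F0 ∩ pathE x).card

lemma Gp_iff {n k : ℕ} (hk : 2 ≤ k) {S : Finset (Fin n)} {s F : Finset (Sym2 (Fin n))} (hP : Perp k s F) {e : Sym2 (Fin n)}
    (he : e ∈ s) (heT : e ∈ T1 S) (heU : e ∉ Ub k S (s \ T1 S)) : e ∈ Gp k S (s \ T1 S) (F \ T1 S) ↔ e ∈ F := by
  have key : ∀ x ∈ brid k {e} ∅ S, pathE x ⊆ s \ T1 S → (e ∈ F ↔ Odd ((F \ T1 S) ∩ pathE x).card) := by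
    intro x hx hxs
    obtain ⟨hinj, -, hex, hntr, -⟩ := mem_brid.1 hx
    rw [Finset.mem_singleton] at hex
    have hpF : (F \ T1 S) ∩ pathE x = F ∩ pathE x := by
      ext f; simp only [Finset.mem_inter, Finset.mem_sdiff]
      constructor
      · rintro ⟨⟨a, b⟩, c⟩; exact ⟨a, c⟩
      · rintro ⟨a, c⟩; exact ⟨⟨a, (Finset.mem_sdiff.1 (hxs c)).2⟩, c⟩
    rw [hpF]
    have hnot : e ∉ pathE x := by rw [← hex]; exact ends_notMem_pathE hk hinj
    have hev := hP.2 x hinj (by rw [cycE_eq, hex]; exact Finset.insert_subset he (hxs.trans Finset.sdiff_subset))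
    rw [cycE_eq, hex] at hev
    by_cases hF : e ∈ F
    · rw [Finset.inter_insert_of_mem hF, Finset.card_insert_of_notMem (by simp [hnot])] at hev
      simp only [hF, true_iff]
      rw [Nat.even_add_one, Nat.not_even_iff_odd] at hev; exact hev
    · rw [Finset.inter_insert_of_notMem hF] at hev
      simp only [hF, false_iff, Nat.not_odd_iff_even]; exact hev
  have heU2 : ∃ x ∈ brid k {e} ∅ S, pathE x ⊆ s \ T1 S := by
    by_contra hcon
    exact heU (Finset.mem_filter.2 ⟨heT, fun x hx hxs => hcon ⟨x, hx, hxs⟩⟩)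
  obtain ⟨x, hx, hxs⟩ := heU2
  simp only [Gp, Finset.mem_filter, heT, true_and]
  constructor
  · rintro ⟨y, hy, hys, ho⟩; exact (key y hy hys).2 ho
  · intro h; exact ⟨x, hx, hxs, (key x hx hxs).1 h⟩

/-- the exceptional event for exposed second part -/
def E1 {n : ℕ} (k : ℕ) (S : Finset (Fin n)) (U G : Finset (Sym2 (Fin n))) (x : ℝ) (t : Finset (Sym2 (Fin n))) : Prop :=
  noneOf (BT k U G Sᶜ) cycE t ∧ ∀ A : Finset (Fin n), x ≤ ((t ∩ (KE n).filter (fun e => ¬ (e ∈ G ↔ cr A e))).card : ℝ)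

lemma det_A {n k : ℕ} (hk : 2 ≤ k) {S : Finset (Fin n)} {s F : Finset (Sym2 (Fin n))} (hs : s ⊆ KE n) (hP : Perp k s F) {y : ℝ}
    (hA : ∀ A, 4 * y < ((symmDiff F (cut s A)).card : ℝ)) (h1 : ((s \ T1 S).card : ℝ) ≤ y) (h2 : ((s ∩ T1 S ∩ Ub k S (s \ T1 S)).card : ℝ) ≤ y) :
    E1 k S (Ub k S (s \ T1 S)) (Gp k S (s \ T1 S) (F \ T1 S)) (2 * y) (s ∩ T1 S) := by
  set U := Ub k S (s \ T1 S) with hU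
  set G := Gp k S (s \ T1 S) (F \ T1 S) with hG
  constructor
  · intro x hx hxs
    simp only [BT, Finset.mem_filter, Finset.mem_univ, true_and] at hx
    obtain ⟨hinj, -, hxU, hodd⟩ := hx
    have hev := hP.2 x hinj (hxs.trans Finset.inter_subset_left)
    have : G ∩ cycE x = F ∩ cycE x := by
      ext e; simp only [Finset.mem_inter]
      constructor
      · rintro ⟨a, b⟩; have := Finset.mem_inter.1 (hxs b); exact ⟨(Gp_iff hk hP this.1 this.2 (hxU e b)).1 a, b⟩
      · rintro ⟨a, b⟩; have := Finset.mem_inter.1 (hxs b); exact ⟨(Gp_iff hk hP this.1 this.2 (hxU e b)).2 a, b⟩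
    rw [this] at hodd
    exact (Nat.not_even_iff_odd.2 hodd) hev
  · intro A
    have hsub : symmDiff F (cut s A) ⊆ (s \ T1 S) ∪ (s ∩ T1 S ∩ U) ∪ (s ∩ T1 S ∩ (KE n).filter (fun e => ¬ (e ∈ G ↔ cr A e))) := by
      intro e he
      have hes : e ∈ s := by
        rcases Finset.mem_symmDiff.1 he with h | h
        · exact hP.1 h.1
        · exact (Finset.mem_filter.1 h.1).1
      simp only [Finset.mem_union, Finset.mem_sdiff, Finset.mem_inter, Finset.mem_filter]
      by_cases hT : e ∈ T1 S
      · by_cases hu : e ∈ U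
        · left; right; exact ⟨⟨hes, hT⟩, hu⟩
        · right
          refine ⟨⟨hes, hT⟩, hs hes, ?_⟩
          rw [Gp_iff hk hP hes hT hu]
          rcases Finset.mem_symmDiff.1 he with h | h
          · intro hi; exact h.2 (Finset.mem_filter.2 ⟨hes, hi.1 h.1⟩)
          · intro hi; exact h.2 (hi.2 (Finset.mem_filter.1 h.1).2)
      · left; left; exact ⟨hes, hT⟩
    have hc := (Finset.card_le_card hsub).trans ((Finset.card_union_le _ _).trans (Nat.add_le_add_right (Finset.card_union_le _ _) _))
    have hc' : ((symmDiff F (cut s A)).card : ℝ) ≤ (s \ T1 S).card + (s ∩ T1 S ∩ U).card + (s ∩ T1 S ∩ (KE n).filter (fun e => ¬ (e ∈ G ↔ cr A e))).card := by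
      exact_mod_cast hc
    have := hA A
    linarith

lemma exp_two_lt : Real.exp 1 * Real.exp 1 ≤ 8 := by
  have := Real.exp_one_lt_d9
  have h0 := Real.exp_pos 1
  nlinarith

lemma E1_bound {n k : ℕ} (hk : 2 ≤ k) (hke : Even k) (hn : 0 < n) (S : Finset (Fin n)) (U G : Finset (Sym2 (Fin n))) (hG : G ⊆ KE n)
    {p : ℝ} (h0 : 0 ≤ p) (h1 : p ≤ 1) (hnp : 1 ≤ n * p) (hl : 1 ≤ lam n k p) {η β c : ℝ} (hη : 0 < η) (hη1 : η ≤ 1) (hβ : β = η / (16 * (k + 3)))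
    (hc1 : c ≤ β / 4 / (4 * (2 ^ (k + 1) * (k + 1) ^ (k + 1)))) (hc2 : c ≤ η / 2)
    (a1 : (k + 1) ^ 2 ≤ β / 4 * n) (a2 : (k + 1) * (S.card : ℝ) ≤ β / 4 * n) (a3 : (k + 1) * (2 * (U.card : ℝ)) ≤ β / 4 * n ^ 2) :
    pr (T1 S) p (E1 k S U G (η / 2 * (n ^ 2 * p))) ≤ Real.exp (-(c * (n ^ 2 * p))) := by
  have hn0 : (0 : ℝ) < n := by exact_mod_cast hn
  have hp : 0 < p := by
    by_contra h
    have : p = 0 := le_antisymm (not_lt.1 h) h0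
    rw [this] at hnp; linarith
  have hN : 0 < (n : ℝ) ^ 2 * p := by positivity
  have hk0 : (0 : ℝ) ≤ k := Nat.cast_nonneg _
  have hβ0 : 0 < β := by rw [hβ]; positivity
  have hβ2 : β * (16 * (k + 3)) = η := by rw [hβ]; field_simp
  by_cases hB : β / 4 * (n : ℝ) ^ (k + 1) ≤ (BT k U G Sᶜ).card
  · refine (pr_mono h0 h1 (B := noneOf (BT k U G Sᶜ) cycE) fun s _ hs => hs.1).trans ?_
    refine (janson_cyc hk (BT k U G Sᶜ) (fun x hx => ?_) h0 h1 hnp hl hB).trans (Real.exp_le_exp.2 ?_)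
    · simp only [BT, Finset.mem_filter, Finset.mem_univ, true_and, Finset.mem_compl] at hx
      refine ⟨hx.1, fun e he => ?_⟩
      refine Finset.mem_filter.2 ⟨cycE_sub_KE (by omega) hx.1 he, ?_⟩
      intro v hv
      obtain ⟨i, rfl⟩ := mem_cycE.1 he
      rcases Sym2.mem_iff.1 hv with rfl | rfl <;> apply hx.2.1
    · rw [neg_le_neg_iff, mul_div_right_comm]
      exact mul_le_mul_of_nonneg_right hc1 hN.le
  · push Not at hB
    obtain ⟨A, hA⟩ := near_cut hk hke hn G hG (β := β) (by nlinarith) (by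
      refine (odd_count hk U G S).trans ?_
      have b1 : (k + 1) ^ 2 * (n : ℝ) ^ k ≤ β / 4 * (n : ℝ) ^ (k + 1) := by
        rw [pow_succ (n : ℝ) k, mul_comm ((n : ℝ) ^ k), ← mul_assoc]; gcongr
      have b2 : (k + 1) * (S.card * (n : ℝ) ^ k) ≤ β / 4 * (n : ℝ) ^ (k + 1) := by
        rw [pow_succ (n : ℝ) k, mul_comm ((n : ℝ) ^ k), ← mul_assoc, ← mul_assoc]; gcongr
      have b3 : (k + 1) * (2 * U.card * (n : ℝ) ^ (k - 1)) ≤ β / 4 * (n : ℝ) ^ (k + 1) := by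
        have e : (n : ℝ) ^ (k + 1) = n ^ 2 * (n : ℝ) ^ (k - 1) := by rw [← pow_add]; congr 1; omega
        have := mul_le_mul_of_nonneg_right a3 (by positivity : (0 : ℝ) ≤ (n : ℝ) ^ (k - 1))
        rw [e]; linarith
      linarith)
    refine (pr_mono h0 h1 (B := fun t => η / 2 * (n ^ 2 * p) ≤ ((t ∩ ((KE n).filter (fun e => ¬ (e ∈ G ↔ cr A e)) ∩ T1 S)).card : ℝ)) fun s hs h => ?_).trans ?_
    · refine (h.2 A).trans (le_of_eq ?_)
      congr 2
      rw [Finset.inter_comm _ (T1 S), ← Finset.inter_assoc, Finset.inter_eq_left.2 hs]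
    · refine (upper_tail_inter h0 h1 _ Finset.inter_subset_right (η / 2 * (n ^ 2 * p)) 1 (by positivity) (by norm_num) ?_).trans (Real.exp_le_exp.2 ?_)
      · rw [Real.exp_neg, ← div_eq_mul_inv, le_div_iff₀ (Real.exp_pos 1)]
        have hM : ((((KE n).filter (fun e => ¬ (e ∈ G ↔ cr A e)) ∩ T1 S).card : ℕ) : ℝ) ≤ (k + 3) * β * (n : ℝ) ^ 2 :=
          (Nat.cast_le.2 (Finset.card_le_card Finset.inter_subset_left)).trans hA
        calc Real.exp 1 * ((((KE n).filter (fun e => ¬ (e ∈ G ↔ cr A e)) ∩ T1 S).card : ℕ) : ℝ) * p * Real.exp 1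
            = (Real.exp 1 * Real.exp 1) * ((((KE n).filter (fun e => ¬ (e ∈ G ↔ cr A e)) ∩ T1 S).card : ℕ) : ℝ) * p := by ring
          _ ≤ 8 * ((k + 3) * β * (n : ℝ) ^ 2) * p := by gcongr; exact exp_two_lt
          _ = η / 2 * (n ^ 2 * p) := by rw [← hβ2]; ring
      · rw [neg_le_neg_iff, mul_one]; gcongr

def BadA {n : ℕ} (k : ℕ) (y : ℝ) (s : Finset (Sym2 (Fin n))) : Prop :=
  ∃ F, Perp k s F ∧ ∀ A, y < ((symmDiff F (cut s A)).card : ℝ)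

lemma card_T0 {n : ℕ} (S : Finset (Fin n)) : ((KE n \ T1 S).card : ℝ) ≤ S.card * n := by
  have : (KE n \ T1 S).card ≤ (S ×ˢ (Finset.univ : Finset (Fin n))).card := by
    refine (Finset.card_le_card (t := (S ×ˢ (Finset.univ : Finset (Fin n))).image (fun q => s(q.1, q.2))) ?_).trans Finset.card_image_le
    intro e he
    rw [Finset.mem_sdiff] at he
    have : ¬ ∀ v ∈ e, v ∉ S := fun h => he.2 (Finset.mem_filter.2 ⟨he.1, h⟩)
    push Not at this
    obtain ⟨v, hv, hvS⟩ := this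
    obtain ⟨w, rfl⟩ := hv
    exact Finset.mem_image.2 ⟨(v, w), by simp [hvS], rfl⟩
  rw [Finset.card_product, Finset.card_univ, Fintype.card_fin] at this
  exact_mod_cast this

set_option maxHeartbeats 1000000 in
lemma boundA {n k : ℕ} (hk : 2 ≤ k) (hke : Even k) (hn : 0 < n) (S : Finset (Fin n)) (hS : S.Nonempty)
    {p : ℝ} (h0 : 0 ≤ p) (h1 : p ≤ 1) (hnp : 1 ≤ n * p) (hl : 1 ≤ lam n k p) {η β c q υ : ℝ} (hη : 0 < η) (hη1 : η ≤ 1) (hβ : β = η / (16 * (k + 3)))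
    (hc1 : c ≤ β / 4 / (4 * (2 ^ (k + 1) * (k + 1) ^ (k + 1)))) (hc2 : c ≤ η / 2) (hυ : υ = β / (8 * (k + 1)))
    (a1 : (k + 1) ^ 2 ≤ β / 4 * n) (a2 : (k + 1) * (S.card : ℝ) ≤ β / 4 * n) (a4 : 32 * (S.card : ℝ) ≤ η * n) (a5 : 16 * (S.card : ℝ) ≤ c * n)
    (hq00 : 0 ≤ q) (hq : ∀ e ∈ KE n, pr (KE n) p (noneOf (brid k {e} ∅ S) pathE) ≤ q) :
    pr (KE n) p (BadA k (η * (n ^ 2 * p))) ≤ 2 * Real.exp (-(8 * (n * p))) + q / υ + 4 * q / η := by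
  have hn0 : (0 : ℝ) < n := by exact_mod_cast hn
  have hp : 0 < p := by
    by_contra h
    have : p = 0 := le_antisymm (not_lt.1 h) h0
    rw [this] at hnp; linarith
  have hN : 0 < (n : ℝ) ^ 2 * p := by positivity
  have hk0 : (0 : ℝ) ≤ k := Nat.cast_nonneg _
  have hβ0 : 0 < β := by rw [hβ]; positivity
  have hυ0 : 0 < υ := by rw [hυ]; positivity
  have hS1 : (1 : ℝ) ≤ S.card := by exact_mod_cast hS.card_pos
  set x0 : ℝ := 8 * (S.card * n * p) with hx0
  have hx0n : 8 * (n * p) ≤ x0 := by rw [hx0]; nlinarith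
  have hx0pos : 0 < x0 := by positivity
  -- noneOf and restriction
  have hnone : ∀ e s, noneOf (brid k {e} ∅ S) pathE (s \ T1 S) ↔ noneOf (brid k {e} ∅ S) pathE s := by
    intro e s
    constructor
    · intro h x hx hxs
      exact h x hx (fun f hf => Finset.mem_sdiff.2 ⟨hxs hf, Finset.disjoint_left.1 (brid_T1 hk hx) hf⟩)
    · intro h x hx hxs; exact h x hx (hxs.trans Finset.sdiff_subset)
  set P1 : Finset (Sym2 (Fin n)) → Prop := fun s => x0 ≤ ((s ∩ (KE n \ T1 S)).card : ℝ) with hP1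
  set P2 : Finset (Sym2 (Fin n)) → Prop := fun s => υ * n ^ 2 ≤ ((Ub k S (s \ T1 S)).card : ℝ) with hP2
  set P3 : Finset (Sym2 (Fin n)) → Prop := fun s => η / 4 * (n ^ 2 * p) ≤ ((s ∩ T1 S ∩ Ub k S (s \ T1 S)).card : ℝ) with hP3
  set P4 : Finset (Sym2 (Fin n)) → Prop := fun s => ((s \ T1 S).card : ℝ) ≤ x0 ∧ ((Ub k S (s \ T1 S)).card : ℝ) ≤ υ * n ^ 2 ∧
    ∃ F0 ∈ (s \ T1 S).powerset, E1 k S (Ub k S (s \ T1 S)) (Gp k S (s \ T1 S) F0) (η / 2 * (n ^ 2 * p)) (s ∩ T1 S) with hP4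
  have hcover : ∀ s ⊆ KE n, BadA k (η * (n ^ 2 * p)) s → (P1 s ∨ P2 s ∨ P3 s ∨ P4 s) := by
    intro s hs ⟨F, hF, hA⟩
    by_contra hcon
    push Not at hcon
    obtain ⟨n1, n2, n3, n4⟩ := hcon
    simp only [hP1, hP2, hP3, not_le] at n1 n2 n3
    have hsT : s ∩ (KE n \ T1 S) = s \ T1 S := by
      ext e; simp only [Finset.mem_inter, Finset.mem_sdiff]
      exact ⟨fun h => ⟨h.1, h.2.2⟩, fun h => ⟨h.1, hs h.1, h.2⟩⟩
    rw [hsT] at n1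
    apply n4
    refine ⟨n1.le, n2.le, F \ T1 S, Finset.mem_powerset.2 (Finset.sdiff_subset_sdiff hF.1 le_rfl), ?_⟩
    have := det_A hk hs hF (S := S) (y := η / 4 * (n ^ 2 * p)) (fun A => by have := hA A; linarith) (n1.le.trans (by rw [hx0]; nlinarith)) n3.le
    convert this using 1; ring
  have hp1 : pr (KE n) p P1 ≤ Real.exp (-(8 * (n * p))) := by
    refine (upper_tail_inter h0 h1 (KE n \ T1 S) Finset.sdiff_subset x0 1 hx0pos (by norm_num) ?_).trans (Real.exp_le_exp.2 (by linarith))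
    rw [Real.exp_neg, ← div_eq_mul_inv, le_div_iff₀ (Real.exp_pos 1)]
    calc Real.exp 1 * ((KE n \ T1 S).card : ℝ) * p * Real.exp 1 = (Real.exp 1 * Real.exp 1) * ((KE n \ T1 S).card : ℝ) * p := by ring
      _ ≤ 8 * (S.card * n) * p := by gcongr; exacts [exp_two_lt, card_T0 S]
      _ = x0 := by rw [hx0]; ring
  have hUsum : ∀ s, ((Ub k S (s \ T1 S)).card : ℝ) = ∑ e ∈ T1 S, ind (noneOf (brid k {e} ∅ S) pathE s) := by
    intro s
    rw [sum_ind, Ub]; congr 2; ext e; simp only [Finset.mem_filter, hnone]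
  have hTle : ((T1 S).card : ℝ) ≤ n ^ 2 := by
    have h1 := card_KE_le n
    have h2 : ((T1 S).card : ℝ) ≤ (KE n).card := Nat.cast_le.2 (Finset.card_le_card (T1_sub S))
    nlinarith
  have hTq : (T1 S).card * q ≤ n ^ 2 * q := by gcongr
  have hp2 : pr (KE n) p P2 ≤ q / υ := by
    refine (pr_markov h0 h1 (f := fun s => ((Ub k S (s \ T1 S)).card : ℝ)) (fun s _ => Nat.cast_nonneg _) (by positivity)).trans ?_
    rw [ex_congr (g := fun s => ∑ e ∈ T1 S, ind (noneOf (brid k {e} ∅ S) pathE s)) (fun s _ => hUsum s), ex_sum]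
    rw [div_le_div_iff₀ (by positivity) hυ0]
    have : ∑ e ∈ T1 S, ex (KE n) p (fun s => ind (noneOf (brid k {e} ∅ S) pathE s)) ≤ (T1 S).card * q := by
      rw [← nsmul_eq_mul, ← Finset.sum_const]
      exact Finset.sum_le_sum fun e he => hq e (T1_sub S he)
    nlinarith
  have hp3 : pr (KE n) p P3 ≤ 4 * q / η := by
    refine (pr_markov h0 h1 (f := fun s => ((s ∩ T1 S ∩ Ub k S (s \ T1 S)).card : ℝ)) (fun s _ => Nat.cast_nonneg _) (by positivity)).trans ?_
    have hsum : ∀ s, ((s ∩ T1 S ∩ Ub k S (s \ T1 S)).card : ℝ) = ∑ e ∈ T1 S, ind ({e} ⊆ s) * ind (noneOf (brid k {e} ∅ S) pathE s) := by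
      intro s
      simp_rw [← ind_and]
      rw [sum_ind, Ub]; congr 2; ext e; simp only [Finset.mem_inter, Finset.mem_filter, hnone, Finset.singleton_subset_iff]; tauto
    rw [ex_congr (g := fun s => ∑ e ∈ T1 S, ind ({e} ⊆ s) * ind (noneOf (brid k {e} ∅ S) pathE s)) (fun s _ => hsum s), ex_sum]
    rw [div_le_div_iff₀ (by positivity) hη]
    have : ∑ e ∈ T1 S, ex (KE n) p (fun s => ind ({e} ⊆ s) * ind (noneOf (brid k {e} ∅ S) pathE s)) ≤ (T1 S).card * (p * q) := by
      rw [← nsmul_eq_mul, ← Finset.sum_const]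
      refine Finset.sum_le_sum fun e he => ?_
      refine (harris_mono_anti h0 h1 (superset_mono {e}) (noneOf_anti _ _)).trans ?_
      have h3 := pr_superset (E := KE n) (T := {e}) (by simpa using T1_sub S he) p
      rw [Finset.card_singleton, pow_one] at h3
      rw [pr] at h3
      rw [h3]
      gcongr
      exact hq e (T1_sub S he)
    have h7 := mul_le_mul_of_nonneg_right hTq h0
    have h8 := mul_le_mul_of_nonneg_right (this.trans (by linarith : (T1 S).card * (p * q) ≤ n ^ 2 * q * p)) hη.le
    linarith
  have hp4 : pr (KE n) p P4 ≤ Real.exp (-(8 * (n * p))) := by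
    rw [pr, ex_split (T1_sub S)]
    refine ex_le_const h0 h1 fun s0 hs0 => ?_
    have hd : ∀ t ⊆ T1 S, (s0 ∪ t) \ T1 S = s0 ∧ (s0 ∪ t) ∩ T1 S = t := by
      intro t ht
      have hs : ∀ e ∈ s0, e ∉ T1 S := fun e he => (Finset.mem_sdiff.1 (hs0 he)).2
      constructor
      · ext e; simp only [Finset.mem_sdiff, Finset.mem_union]
        exact ⟨fun h => h.1.resolve_right fun h' => h.2 (ht h'), fun h => ⟨Or.inl h, hs e h⟩⟩
      · ext e; simp only [Finset.mem_inter, Finset.mem_union]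
        exact ⟨fun h => h.1.resolve_left fun h' => hs e h' h.2, fun h => ⟨Or.inr h, ht h⟩⟩
    by_cases hgood : (s0.card : ℝ) ≤ x0 ∧ ((Ub k S s0).card : ℝ) ≤ υ * n ^ 2
    · have e1 : ex (T1 S) p (fun t => ind (P4 (s0 ∪ t))) ≤ pr (T1 S) p (fun t => ∃ F0 ∈ s0.powerset, E1 k S (Ub k S s0) (Gp k S s0 F0) (η / 2 * (n ^ 2 * p)) t) := by
        refine ex_mono h0 h1 fun t ht => ind_mono fun h => ?_
        obtain ⟨-, -, h⟩ := h
        rw [(hd t ht).1, (hd t ht).2] at h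
        exact h
      refine e1.trans ((pr_exists_le h0 h1 _ _).trans ?_)
      refine (Finset.sum_le_sum (g := fun _ => Real.exp (-(c * (n ^ 2 * p)))) fun F0 _ => ?_).trans ?_
      · refine E1_bound hk hke hn S _ _ ((Finset.filter_subset _ _).trans (T1_sub S)) h0 h1 hnp hl hη hη1 hβ hc1 hc2 a1 a2 ?_
        have : υ * (8 * (k + 1)) = β := by rw [hυ]; field_simp
        nlinarith [hgood.2]
      · rw [Finset.sum_const, nsmul_eq_mul, Finset.card_powerset]
        push_cast
        have h2 : (2 : ℝ) ^ s0.card ≤ Real.exp x0 := by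
          calc (2 : ℝ) ^ s0.card ≤ (Real.exp 1) ^ s0.card := by
                gcongr; have := Real.add_one_le_exp (1 : ℝ); linarith
            _ = Real.exp s0.card := by rw [← Real.exp_nat_mul, mul_one]
            _ ≤ _ := Real.exp_le_exp.2 hgood.1
        calc (2 : ℝ) ^ s0.card * Real.exp (-(c * (n ^ 2 * p))) ≤ Real.exp x0 * Real.exp (-(c * (n ^ 2 * p))) := by gcongr
          _ = Real.exp (x0 - c * (n ^ 2 * p)) := by rw [← Real.exp_add]; rfl
          _ ≤ _ := Real.exp_le_exp.2 (by
            have : 2 * x0 ≤ c * (n ^ 2 * p) := by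
              have := mul_le_mul_of_nonneg_right a5 (by positivity : 0 ≤ n * p)
              rw [hx0]; linarith
            linarith)
    · refine (ex_mono h0 h1 (g := fun _ => 0) fun t ht => ?_).trans (by rw [ex_const]; positivity)
      rw [ind_false]
      intro h
      apply hgood
      have h2 := And.intro h.1 h.2.1
      rw [(hd t ht).1] at h2
      exact h2
  refine (pr_mono h0 h1 hcover).trans ?_
  refine (pr_or_le h0 h1 _ _).trans ?_
  have h5 := pr_or_le (E := KE n) h0 h1 P2 (fun s => P3 s ∨ P4 s)
  have h6 := pr_or_le (E := KE n) h0 h1 P3 P4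
  linarith

set_option maxHeartbeats 1000000 in
theorem partA (k : ℕ) (hk : 2 ≤ k) (hke : Even k) (η : ℝ) (hη : 0 < η) (hη1 : η ≤ 1) (ε1 : ℝ) (hε1 : 0 < ε1) :
    ∀ᶠ n : ℕ in atTop, ∀ p : ℝ, 0 ≤ p → p ≤ 1 → (n : ℝ) ^ (1 / (2 * k) : ℝ) ≤ n * p →
    (7 / 8) * Real.log ((n : ℝ) ^ 2 * p) ≤ lam n k p →
    pr (KE n) p (BadA k (η * (n ^ 2 * p))) ≤ ε1 := by
  have hk0 : (0 : ℝ) < k := by exact_mod_cast (by omega : 0 < k)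
  have hCk := Ck_pos k
  obtain ⟨β, hβ⟩ : ∃ β : ℝ, β = η / (16 * (k + 3)) := ⟨_, rfl⟩
  have hβ0 : 0 < β := by rw [hβ]; positivity
  have hβη : β ≤ η := by
    rw [hβ]; apply div_le_self hη.le; linarith
  obtain ⟨υ, hυ⟩ : ∃ υ : ℝ, υ = β / (8 * (k + 1)) := ⟨_, rfl⟩
  have hυ0 : 0 < υ := by rw [hυ]; positivity
  set C : ℝ := 2 ^ (k + 1) * (k + 1) ^ (k + 1) with hC
  have hC1 : 1 ≤ C := by
    rw [hC, ← mul_pow]; apply one_le_pow₀; linarith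
  obtain ⟨c, hc⟩ : ∃ c : ℝ, c = β / 4 / (4 * C) := ⟨_, rfl⟩
  have hc0 : 0 < c := by rw [hc]; positivity
  have hcη : c ≤ η / 2 := by
    rw [hc]
    calc β / 4 / (4 * C) ≤ β / 4 := div_le_self (by positivity) (by linarith)
      _ ≤ η / 2 := by linarith
  obtain ⟨ϑ, hϑ0, hϑ1, hϑ2, hϑ3⟩ : ∃ ϑ : ℝ, 0 < ϑ ∧ (k + 1) * (2 * ϑ) ≤ β / 4 ∧ 32 * (2 * ϑ) ≤ η ∧ 16 * (2 * ϑ) ≤ c := by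
    refine ⟨min (β / (8 * (k + 1))) (min (η / 64) (c / 32)), by positivity, ?_, ?_, ?_⟩
    · have := min_le_left (β / (8 * (k + 1))) (min (η / 64) (c / 32))
      rw [le_div_iff₀ (by positivity)] at this; linarith
    · have := (min_le_right (β / (8 * (k + 1))) (min (η / 64) (c / 32))).trans (min_le_left _ _); linarith
    · have := (min_le_right (β / (8 * (k + 1))) (min (η / 64) (c / 32))).trans (min_le_right _ _); linarith
  set ρ : ℝ := ϑ ^ (k - 1) / 2 with hρ
  have hρ0 : 0 < ρ := by positivity
  filter_upwards [eventually_ge_atTop 8, ev_pow (1 / ϑ) 1 1 (by norm_num) (by norm_num), ev_pow ((k + 1) ^ 2) 1 (β / 4) (by norm_num) (by positivity),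
    ev_pow ((k + 1) ^ 2) 1 ρ (by norm_num) hρ0, ev_log 1 (4 * Ck k) (1 / (2 * k)) (ρ / 2) (by positivity) (by positivity),
    ev_pow 4 (1 / (2 * k)) ε1 (by positivity) hε1, ev_pow (2 * (1 / υ + 4 / η)) (7 / 16 * ρ) ε1 (by positivity) hε1] with n hn b1 b2 b3 b4 b5 b6 p h0 h1 hnp hl
  rw [Real.rpow_one] at b1 b2 b3
  rw [pow_one] at b4
  have hn0 : (0 : ℝ) < n := by exact_mod_cast (by omega : 0 < n)
  have hn8 : (8 : ℝ) ≤ n := by exact_mod_cast hn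
  have hn1 : (1 : ℝ) ≤ n := by linarith
  have hnp1 : 1 ≤ n * p := (Real.one_le_rpow hn1 (by positivity)).trans hnp
  have hN : (n : ℝ) ≤ (n : ℝ) ^ 2 * p := by nlinarith
  have hlogn : 2 ≤ Real.log n := by
    have : Real.log 8 ≤ Real.log n := Real.log_le_log (by norm_num) hn8
    have h8 : Real.log 8 = 3 * Real.log 2 := by
      rw [show (8 : ℝ) = 2 ^ 3 by norm_num, Real.log_pow]; norm_num
    have := Real.log_two_gt_d9
    linarith
  have hlogN : Real.log n ≤ Real.log ((n : ℝ) ^ 2 * p) := Real.log_le_log hn0 hN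
  have hϑn : 1 ≤ ϑ * n := by rw [div_le_iff₀ hϑ0] at b1; linarith
  obtain ⟨S, -, hS⟩ := Finset.exists_subset_card_eq (s := (Finset.univ : Finset (Fin n))) (n := ⌈ϑ * n⌉₊) (by
    rw [Finset.card_univ, Fintype.card_fin]
    refine Nat.ceil_le.2 ?_
    have : ϑ ≤ 1 := by linarith
    nlinarith)
  have hSge : ϑ * n ≤ S.card := by rw [hS]; exact Nat.le_ceil _
  have hSle : (S.card : ℝ) ≤ 2 * ϑ * n := by
    rw [hS]; have := (Nat.ceil_lt_add_one (by positivity : 0 ≤ ϑ * n)).le; linarith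
  have hSne : S.Nonempty := by
    rw [← Finset.card_pos]; have : (0 : ℝ) < S.card := by linarith
    exact_mod_cast this
  set q := Real.exp (-(7 / 16 * ρ * Real.log n)) with hq
  have hmain := boundA hk hke (by omega) S hSne h0 h1 hnp1 (by linarith) hη hη1 hβ (c := c) (q := q) hc.le hcη hυ b2 (by nlinarith) (by nlinarith) (by nlinarith) (Real.exp_pos _).le (by
    intro e he
    have := bridge_bound hk (E := KE n) (F := {e}) (J := ∅) (R := S) (by simpa using he) (fun x hx => pathE_sub_KE (mem_brid.1 hx).1) h0 h1 hnp1
      (D := 1) (L := 7 / 8 * Real.log n) (ρ := ρ) (δ := ρ / 2) (DJ := 0) (fun v => by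
        have := Finset.card_filter_le ({e} : Finset (Sym2 (Fin n))) (fun e => v ∈ e)
        rw [Finset.card_singleton] at this
        exact_mod_cast this) (fun v => by simp [deg]) (by positivity) (by linarith) (by
        have h3 : (ϑ * n) ^ (k - 1) ≤ (S.card : ℝ) ^ (k - 1) := by gcongr
        refine le_trans ?_ h3
        rw [mul_pow]
        have h4 : (n : ℝ) ^ (k - 1) = n * (n : ℝ) ^ (k - 2) := by rw [← pow_succ']; congr 1; omega
        have h5 := mul_le_mul_of_nonneg_right b3 (by positivity : (0 : ℝ) ≤ (n : ℝ) ^ (k - 2))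
        have h6 : ϑ ^ (k - 1) = 2 * ρ := by rw [hρ]; ring
        rw [h6, h4]
        push_cast
        linarith) (by
        rw [Finset.card_singleton]
        have h3 : ((1 : ℕ) : ℝ) / n + 2 * 1 + 1 ≤ 4 := by
          have : ((1 : ℕ) : ℝ) / n ≤ 1 := by rw [div_le_one hn0]; simpa using hn1
          linarith
        calc 7 / 8 * Real.log n * (Ck k * (((1 : ℕ) : ℝ) / n + 2 * 1 + 1)) ≤ 1 * Real.log n * (Ck k * 4) := by gcongr; norm_num
          _ ≤ ρ / 2 * (n : ℝ) ^ (1 / (2 * k) : ℝ) := by linarith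
          _ ≤ _ := by gcongr)
    refine this.trans (Real.exp_le_exp.2 ?_)
    rw [Finset.card_singleton]; push_cast; linarith)
  refine hmain.trans ?_
  have hq2 : q * (n : ℝ) ^ (7 / 16 * ρ) = 1 := by
    rw [hq, Real.rpow_def_of_pos hn0, ← Real.exp_add, ← Real.exp_zero]; congr 1; ring
  have hx : 0 < (n : ℝ) ^ (7 / 16 * ρ) := by positivity
  have h3 : q / υ + 4 * q / η ≤ ε1 / 2 := by
    have : q * (2 * (1 / υ + 4 / η)) ≤ q * (ε1 * (n : ℝ) ^ (7 / 16 * ρ)) := mul_le_mul_of_nonneg_left b6 (Real.exp_pos _).le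
    have e : q / υ + 4 * q / η = q * (1 / υ + 4 / η) := by ring
    rw [e]
    nlinarith
  have h4 : 2 * Real.exp (-(8 * (n * p))) ≤ ε1 / 2 := by
    have h5 : (0 : ℝ) < (n : ℝ) ^ (1 / (2 * k) : ℝ) := by positivity
    have h6 : Real.exp (-(8 * (n * p))) ≤ ((n : ℝ) ^ (1 / (2 * k) : ℝ))⁻¹ := by
      rw [Real.exp_neg]
      apply inv_anti₀ h5
      have := Real.add_one_le_exp (8 * (n * p)); nlinarith
    have h7 : 4 * ((n : ℝ) ^ (1 / (2 * k) : ℝ))⁻¹ ≤ ε1 := by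
      rw [← div_eq_mul_inv, div_le_iff₀ h5]; exact b5
    linarith
  linarith

/-- typical graphs -/
def Typ {n : ℕ} (p : ℝ) (s : Finset (Sym2 (Fin n))) : Prop :=
  (∀ v, (n : ℝ) * p / 16 ≤ deg s v) ∧ (∀ v, (deg s v : ℝ) ≤ 16 * (n * p)) ∧
  (∀ v v', v ≠ v' → ((nb s v ∩ nb s v').card : ℝ) ≤ 16 * (n * p ^ 2 + Real.log n)) ∧
  ∀ W : Finset (Fin n), ((s.filter fun e => ∀ v ∈ e, v ∈ W).card : ℝ) ≤ 8 * (W.card * (W.card * p + Real.log n))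

lemma card_star {n : ℕ} (v : Fin n) : ((KE n).filter fun e => v ∈ e).card = n - 1 := by
  have : (KE n).filter (fun e => v ∈ e) = (Finset.univ.erase v).image (fun w => s(v, w)) := by
    ext e
    simp only [Finset.mem_filter, Finset.mem_image, Finset.mem_erase, Finset.mem_univ, and_true]
    constructor
    · rintro ⟨h1, h2⟩
      obtain ⟨w, rfl⟩ := Sym2.mem_iff_exists.1 h2
      exact ⟨w, (mem_KE.1 h1).symm, rfl⟩
    · rintro ⟨w, h1, rfl⟩
      exact ⟨mem_KE.2 h1.symm, by simp⟩
  rw [this, Finset.card_image_of_injective]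
  · simp
  · intro a b h
    rcases Sym2.eq_iff.1 h with ⟨_, h⟩ | ⟨h1, h2⟩
    · exact h
    · exact h2.trans h1

lemma deg_eq_inter {n : ℕ} {s : Finset (Sym2 (Fin n))} (hs : s ⊆ KE n) (v : Fin n) :
    deg s v = (s ∩ (KE n).filter fun e => v ∈ e).card := by
  unfold deg; congr 1; ext e; simp only [Finset.mem_filter, Finset.mem_inter]
  exact ⟨fun h => ⟨h.1, hs h.1, h.2⟩, fun h => ⟨h.1, h.2.2⟩⟩

lemma typ_deg_lo {n : ℕ} (hn : 2 ≤ n) {p : ℝ} (h0 : 0 ≤ p) (h1 : p ≤ 1) :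
    pr (KE n) p (fun s => ∃ v, ¬ (n : ℝ) * p / 16 ≤ deg s v) ≤ n * Real.exp (-(n * p / 8)) := by
  have hn2 : (2 : ℝ) ≤ n := by exact_mod_cast hn
  have h := pr_exists_le (E := KE n) h0 h1 (Finset.univ : Finset (Fin n)) (fun v s => ¬ (n : ℝ) * p / 16 ≤ deg s v)
  refine (pr_mono h0 h1 (fun s _ hs => ?_)).trans (h.trans ?_)
  · obtain ⟨v, hv⟩ := hs; exact ⟨v, Finset.mem_univ _, hv⟩
  refine (Finset.sum_le_card_nsmul _ _ (Real.exp (-(n * p / 8))) fun v _ => ?_).trans (by simp)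
  have hl := lower_tail h0 h1 ((KE n).filter fun e => v ∈ e) (Finset.filter_subset _ (KE n))
  rw [card_star, Nat.cast_sub (by omega)] at hl
  push_cast at hl
  refine (pr_mono h0 h1 (fun s hs hv => ?_)).trans (hl.trans (Real.exp_le_exp.2 (by nlinarith)))
  rw [deg_eq_inter hs] at hv
  push Not at hv
  nlinarith

lemma exp_one_mul_le {a x : ℝ} (h : 8 * a ≤ x) (ha : 0 ≤ a) : Real.exp 1 * a ≤ x * Real.exp (-1) := by
  rw [Real.exp_neg, ← div_eq_mul_inv, le_div_iff₀ (Real.exp_pos 1)]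
  have := exp_two_lt
  nlinarith

lemma typ_deg_hi {n : ℕ} (hn : 2 ≤ n) {p : ℝ} (h0 : 0 < p) (h1 : p ≤ 1) :
    pr (KE n) p (fun s => ∃ v, ¬ (deg s v : ℝ) ≤ 16 * (n * p)) ≤ n * Real.exp (-(16 * (n * p))) := by
  have hn2 : (2 : ℝ) ≤ n := by exact_mod_cast hn
  have h := pr_exists_le (E := KE n) h0.le h1 (Finset.univ : Finset (Fin n)) (fun v s => ¬ (deg s v : ℝ) ≤ 16 * (n * p))
  refine (pr_mono h0.le h1 (fun s _ hs => ?_)).trans (h.trans ?_)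
  · obtain ⟨v, hv⟩ := hs; exact ⟨v, Finset.mem_univ _, hv⟩
  refine (Finset.sum_le_card_nsmul _ _ (Real.exp (-(16 * (n * p)))) fun v _ => ?_).trans (by simp)
  have hl := upper_tail_inter h0.le h1 ((KE n).filter fun e => v ∈ e) (Finset.filter_subset _ (KE n)) (16 * (n * p)) 1 (by positivity) zero_le_one
    (by
      rw [card_star, Nat.cast_sub (by omega), mul_assoc]
      push_cast
      exact exp_one_mul_le (by nlinarith) (by nlinarith))
  rw [mul_one] at hl
  refine (pr_mono h0.le h1 (fun s hs hv => ?_)).trans hl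
  rw [deg_eq_inter hs] at hv
  push Not at hv
  exact hv.le

lemma typ_codeg {n : ℕ} (hn : 2 ≤ n) {p : ℝ} (h0 : 0 < p) (h1 : p ≤ 1) :
    pr (KE n) p (fun s => ∃ v v', v ≠ v' ∧ ¬ ((nb s v ∩ nb s v').card : ℝ) ≤ 16 * (n * p ^ 2 + Real.log n)) ≤ n ^ 2 * Real.exp (-(16 * Real.log n)) := by
  have hn2 : (2 : ℝ) ≤ n := by exact_mod_cast hn
  have hlog : 0 ≤ Real.log n := Real.log_nonneg (by linarith)
  have h := pr_exists_le (E := KE n) h0.le h1 ((Finset.univ : Finset (Fin n × Fin n)).filter fun c => c.1 ≠ c.2)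
    (fun c s => ¬ ((nb s c.1 ∩ nb s c.2).card : ℝ) ≤ 16 * (n * p ^ 2 + Real.log n))
  refine (pr_mono h0.le h1 (fun s _ hs => ?_)).trans (h.trans ?_)
  · obtain ⟨v, v', hv, hv'⟩ := hs; exact ⟨(v, v'), by simpa using hv, hv'⟩
  refine (Finset.sum_le_card_nsmul _ _ (Real.exp (-(16 * Real.log n))) fun c hc => ?_).trans ?_
  · obtain ⟨v, v'⟩ := c
    have hvv : v ≠ v' := by simpa using hc
    have hl := upper_tail h0.le h1 ((Finset.univ : Finset (Fin n)).filter fun w => w ≠ v ∧ w ≠ v') (fun w => {s(v, w), s(v', w)})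
      (E := KE n) (by
        intro w hw
        obtain ⟨h1, h2⟩ := (Finset.mem_filter.1 hw).2
        intro e he
        rcases Finset.mem_insert.1 he with rfl | he
        · exact mem_KE.2 h1.symm
        · rw [Finset.mem_singleton.1 he]; exact mem_KE.2 h2.symm) 2 (by
        intro w hw
        obtain ⟨h1, h2⟩ := (Finset.mem_filter.1 hw).2
        rw [Finset.card_pair]
        intro h
        rcases Sym2.eq_iff.1 h with ⟨a, -⟩ | ⟨a, b⟩
        · exact hvv a
        · exact h2 b) (by
        intro i hi j hj hij
        obtain ⟨i1, i2⟩ := (Finset.mem_filter.1 hi).2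
        obtain ⟨j1, j2⟩ := (Finset.mem_filter.1 hj).2
        simp only [Finset.disjoint_insert_left, Finset.disjoint_singleton_left, Finset.mem_insert, Finset.mem_singleton, not_or, Sym2.eq_iff]
        refine ⟨⟨?_, ?_⟩, ?_, ?_⟩ <;> refine ⟨?_, ?_⟩ <;> rintro ⟨a, b⟩ <;> first | exact hij b | exact i1 b | exact i2 b)
      (16 * (n * p ^ 2 + Real.log n)) 1 (by positivity) zero_le_one (by
        rw [mul_assoc]
        refine exp_one_mul_le ?_ (by positivity)
        have : (((Finset.univ : Finset (Fin n)).filter fun w => w ≠ v ∧ w ≠ v').card : ℝ) ≤ n := by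
          exact_mod_cast (Finset.card_filter_le _ _).trans (by simp)
        have := mul_le_mul_of_nonneg_right this (sq_nonneg p)
        nlinarith [mul_nonneg (Nat.cast_nonneg (α := ℝ) n) (sq_nonneg p)])
    refine (pr_mono h0.le h1 (fun s hs hv => ?_)).trans (hl.trans (Real.exp_le_exp.2 (by
      have : (0 : ℝ) ≤ n * p ^ 2 := by positivity
      linarith)))
    push Not at hv
    refine hv.le.trans ?_
    norm_cast
    refine Finset.card_le_card fun w hw => ?_
    simp only [Finset.mem_inter, mem_nb] at hw
    simp only [Finset.mem_filter, Finset.mem_univ, true_and, Finset.insert_subset_iff, Finset.singleton_subset_iff]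
    exact ⟨⟨(mem_KE.1 (hs hw.1)).symm, (mem_KE.1 (hs hw.2)).symm⟩, hw⟩
  · rw [nsmul_eq_mul]
    gcongr
    have : (((Finset.univ : Finset (Fin n × Fin n)).filter fun c => c.1 ≠ c.2).card) ≤ n ^ 2 :=
      (Finset.card_filter_le _ _).trans (by simp [sq])
    exact_mod_cast this

lemma card_inside {n : ℕ} (W : Finset (Fin n)) : (((KE n).filter fun e => ∀ v ∈ e, v ∈ W).card : ℝ) ≤ W.card ^ 2 := by
  have : ((KE n).filter fun e => ∀ v ∈ e, v ∈ W) ⊆ (W ×ˢ W).image fun c => s(c.1, c.2) := by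
    intro e he
    obtain ⟨h1, h2⟩ := Finset.mem_filter.1 he
    induction e with
    | _ a b => exact Finset.mem_image.2 ⟨(a, b), Finset.mem_product.2 ⟨h2 a (by simp), h2 b (by simp)⟩, rfl⟩
  have h2 := (Finset.card_le_card this).trans Finset.card_image_le
  rw [Finset.card_product, ← sq] at h2
  exact_mod_cast h2

lemma typ_inside {n : ℕ} (hn : 2 ≤ n) {p : ℝ} (h0 : 0 < p) (h1 : p ≤ 1) :
    pr (KE n) p (fun s => ∃ W : Finset (Fin n), ¬ ((s.filter fun e => ∀ v ∈ e, v ∈ W).card : ℝ) ≤ 8 * (W.card * (W.card * p + Real.log n)))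
      ≤ 3 * Real.exp (-(7 * Real.log n)) := by
  have hn2 : (2 : ℝ) ≤ n := by exact_mod_cast hn
  have hlog : 0 < Real.log n := Real.log_pos (by linarith)
  have h := pr_exists_le (E := KE n) h0.le h1 ((Finset.univ : Finset (Fin n)).powerset.filter fun W => W.Nonempty)
    (fun W s => ¬ ((s.filter fun e => ∀ v ∈ e, v ∈ W).card : ℝ) ≤ 8 * (W.card * (W.card * p + Real.log n)))
  refine (pr_mono h0.le h1 (fun s hs hW => ?_)).trans (h.trans ?_)
  · obtain ⟨W, hW⟩ := hW
    refine ⟨W, by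
      simp only [Finset.powerset_univ, Finset.mem_filter, Finset.mem_univ, true_and]
      by_contra hne
      rw [Finset.not_nonempty_iff_eq_empty] at hne
      subst hne
      apply hW
      have : (s.filter fun e => ∀ v ∈ e, v ∈ (∅ : Finset (Fin n))) = ∅ := by
        ext e
        induction e with
        | _ a b =>
          simp only [Finset.mem_filter, Finset.notMem_empty, iff_false, not_and]
          intro _ h; exact h a (by simp)
      rw [this]; simp, hW⟩
  have hone : ∀ W ∈ (Finset.univ : Finset (Fin n)).powerset.filter (fun W => W.Nonempty),
      pr (KE n) p (fun s => ¬ ((s.filter fun e => ∀ v ∈ e, v ∈ W).card : ℝ) ≤ 8 * (W.card * (W.card * p + Real.log n))) ≤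
        Real.exp (-(7 * Real.log n)) * (1 / (n : ℝ)) ^ W.card := by
    intro W hW
    have hWn := (Finset.mem_filter.1 hW).2
    have hW1 : (1 : ℝ) ≤ W.card := by exact_mod_cast hWn.card_pos
    have hl := upper_tail_inter h0.le h1 ((KE n).filter fun e => ∀ v ∈ e, v ∈ W) (Finset.filter_subset _ (KE n))
      (8 * (W.card * (W.card * p + Real.log n))) 1 (by positivity) zero_le_one (by
        rw [mul_assoc]
        refine exp_one_mul_le ?_ (by positivity)
        have := mul_le_mul_of_nonneg_right (card_inside W) h0.le
        nlinarith)
    refine (pr_mono h0.le h1 (fun s hs hv => ?_)).trans (hl.trans ?_)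
    · push Not at hv
      refine hv.le.trans ?_
      norm_cast
      refine Finset.card_le_card fun e he => ?_
      obtain ⟨a, b⟩ := Finset.mem_filter.1 he
      exact Finset.mem_inter.2 ⟨a, Finset.mem_filter.2 ⟨hs a, b⟩⟩
    · rw [one_div, ← Real.exp_log (by positivity : (0:ℝ) < (n:ℝ)⁻¹), ← Real.exp_nat_mul, ← Real.exp_add, Real.log_inv]
      refine Real.exp_le_exp.2 ?_
      have : 0 ≤ (W.card : ℝ) * (W.card * p) := by positivity
      nlinarith
  refine (Finset.sum_le_sum hone).trans ?_
  rw [← Finset.mul_sum, mul_comm (3 : ℝ)]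
  gcongr
  refine (Finset.sum_le_sum_of_subset_of_nonneg (Finset.filter_subset _ _) (fun _ _ _ => by positivity)).trans ?_
  have := Finset.sum_pow_mul_eq_add_pow (1 / (n : ℝ)) 1 (Finset.univ : Finset (Fin n))
  simp only [one_pow, mul_one, Finset.card_univ, Fintype.card_fin] at this
  rw [this]
  calc (1 / (n : ℝ) + 1) ^ n ≤ (Real.exp (1 / n)) ^ n := by gcongr; exact Real.add_one_le_exp _
    _ = Real.exp 1 := by rw [← Real.exp_nat_mul]; congr 1; field_simp
    _ ≤ 3 := by have := Real.exp_one_lt_d9; linarith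

theorem typ (c : ℝ) (hc : 0 < c) (ε1 : ℝ) (hε1 : 0 < ε1) : ∀ᶠ n : ℕ in atTop, ∀ p : ℝ, 0 ≤ p → p ≤ 1 → (n : ℝ) ^ c ≤ n * p →
    pr (KE n) p (fun s => ¬ Typ p s) ≤ ε1 := by
  filter_upwards [eventually_ge_atTop 2, ev_log 1 16 c 1 hc one_pos, ev_pow 6 1 ε1 one_pos hε1] with n hn hl hpw p h0 h1 hnp
  have hn2 : (2 : ℝ) ≤ n := by exact_mod_cast hn
  have hn0 : (0 : ℝ) < n := by linarith
  have hp : 0 < p := by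
    by_contra h
    have : p = 0 := le_antisymm (not_lt.1 h) h0
    rw [this] at hnp
    have : (0 : ℝ) < (n : ℝ) ^ c := by positivity
    linarith
  have hlog : 0 < Real.log n := Real.log_pos (by linarith)
  rw [pow_one, one_mul] at hl
  rw [Real.rpow_one] at hpw
  have hinv : ∀ j : ℕ, 2 ≤ j → ∀ y : ℝ, j * Real.log n ≤ y → Real.exp (-y) ≤ (1 / n) ^ 2 := by
    intro j hj y hy
    rw [one_div, ← Real.exp_log (by positivity : (0:ℝ) < (n:ℝ)⁻¹), ← Real.exp_nat_mul, Real.log_inv]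
    refine Real.exp_le_exp.2 ?_
    have : (2 : ℝ) ≤ j := by exact_mod_cast hj
    push_cast
    nlinarith
  have a1 := typ_deg_lo hn h0 h1
  have a2 := typ_deg_hi hn hp h1
  have a3 := typ_codeg hn hp h1
  have a4 := typ_inside hn hp h1
  have b1 := hinv 2 le_rfl (n * p / 8) (by push_cast; linarith)
  have b2 := hinv 2 le_rfl (16 * (n * p)) (by push_cast; linarith)
  have b4 := hinv 2 le_rfl (7 * Real.log n) (by push_cast; linarith)
  have b3 : (n : ℝ) ^ 2 * Real.exp (-(16 * Real.log n)) ≤ (1 / n) ^ 2 := by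
    have : (n : ℝ) ^ 2 = Real.exp (2 * Real.log n) := by
      rw [mul_comm, Real.exp_mul, Real.exp_log hn0]; norm_num
    rw [this, ← Real.exp_add]
    have := hinv 14 (by norm_num) (14 * Real.log n) (by simp)
    refine le_trans (le_of_eq ?_) this
    congr 1; ring
  have hmono : pr (KE n) p (fun s => ¬ Typ p s) ≤ pr (KE n) p (fun s => (∃ v, ¬ (n : ℝ) * p / 16 ≤ deg s v) ∨ (∃ v, ¬ (deg s v : ℝ) ≤ 16 * (n * p)) ∨
      (∃ v v', v ≠ v' ∧ ¬ ((nb s v ∩ nb s v').card : ℝ) ≤ 16 * (n * p ^ 2 + Real.log n)) ∨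
      (∃ W : Finset (Fin n), ¬ ((s.filter fun e => ∀ v ∈ e, v ∈ W).card : ℝ) ≤ 8 * (W.card * (W.card * p + Real.log n)))) := by
    refine pr_mono h0 h1 fun s hs h => ?_
    by_contra hcon
    rw [not_or, not_or, not_or] at hcon
    obtain ⟨c1, c2, c3, c4⟩ := hcon
    apply h
    refine ⟨fun v => by_contra fun h => c1 ⟨v, h⟩, fun v => by_contra fun h => c2 ⟨v, h⟩, fun v v' hv => by_contra fun h => c3 ⟨v, v', hv, h⟩,
      fun W => by_contra fun h => c4 ⟨W, h⟩⟩
  refine hmono.trans ?_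
  have d1 := pr_or_le (E := KE n) h0 h1 (fun s => ∃ v, ¬ (n : ℝ) * p / 16 ≤ deg s v) (fun s => (∃ v, ¬ (deg s v : ℝ) ≤ 16 * (n * p)) ∨
      (∃ v v', v ≠ v' ∧ ¬ ((nb s v ∩ nb s v').card : ℝ) ≤ 16 * (n * p ^ 2 + Real.log n)) ∨
      (∃ W : Finset (Fin n), ¬ ((s.filter fun e => ∀ v ∈ e, v ∈ W).card : ℝ) ≤ 8 * (W.card * (W.card * p + Real.log n))))
  have d2 := pr_or_le (E := KE n) h0 h1 (fun s => (∃ v, ¬ (deg s v : ℝ) ≤ 16 * (n * p))) (fun s =>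
      (∃ v v', v ≠ v' ∧ ¬ ((nb s v ∩ nb s v').card : ℝ) ≤ 16 * (n * p ^ 2 + Real.log n)) ∨
      (∃ W : Finset (Fin n), ¬ ((s.filter fun e => ∀ v ∈ e, v ∈ W).card : ℝ) ≤ 8 * (W.card * (W.card * p + Real.log n))))
  have d3 := pr_or_le (E := KE n) h0 h1 (fun s => (∃ v v', v ≠ v' ∧ ¬ ((nb s v ∩ nb s v').card : ℝ) ≤ 16 * (n * p ^ 2 + Real.log n)))
    (fun s => (∃ W : Finset (Fin n), ¬ ((s.filter fun e => ∀ v ∈ e, v ∈ W).card : ℝ) ≤ 8 * (W.card * (W.card * p + Real.log n))))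
  have e1 : (n : ℝ) * Real.exp (-(n * p / 8)) ≤ 1 / n := by
    calc (n : ℝ) * Real.exp (-(n * p / 8)) ≤ n * (1 / n) ^ 2 := by gcongr
      _ = 1 / n := by field_simp
  have e2 : (n : ℝ) * Real.exp (-(16 * (n * p))) ≤ 1 / n := by
    calc (n : ℝ) * Real.exp (-(16 * (n * p))) ≤ n * (1 / n) ^ 2 := by gcongr
      _ = 1 / n := by field_simp
  have e3 : (1 / (n : ℝ)) ^ 2 ≤ 1 / n := by
    rw [sq]; exact mul_le_of_le_one_left (by positivity) (by rw [div_le_one hn0]; linarith)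
  have e4 : 6 * (1 / (n : ℝ)) ≤ ε1 := by rw [mul_one_div, div_le_iff₀ hn0]; exact hpw
  linarith

lemma count_U {n : ℕ} (hn : 1 ≤ n) (u0 : ℝ) :
    (((Finset.univ : Finset (Finset (Fin n))).filter fun U => (U.card : ℝ) ≤ u0).card : ℝ) ≤ 3 * Real.exp (u0 * Real.log n) := by
  have hn0 : (0 : ℝ) < n := by exact_mod_cast hn
  have hlog : 0 ≤ Real.log n := Real.log_nonneg (by exact_mod_cast hn)
  have h1 : (((Finset.univ : Finset (Finset (Fin n))).filter fun U => (U.card : ℝ) ≤ u0).card : ℝ) ≤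
      ∑ U ∈ (Finset.univ : Finset (Fin n)).powerset, Real.exp (u0 * Real.log n) * (1 / (n : ℝ)) ^ U.card := by
    rw [Finset.card_eq_sum_ones]
    push_cast
    refine (Finset.sum_le_sum (g := fun U => Real.exp (u0 * Real.log n) * (1 / (n : ℝ)) ^ U.card) fun U hU => ?_).trans
      (Finset.sum_le_sum_of_subset_of_nonneg (by simp) (fun _ _ _ => by positivity))
    have hU := (Finset.mem_filter.1 hU).2
    rw [one_div, ← Real.exp_log (by positivity : (0:ℝ) < (n:ℝ)⁻¹), ← Real.exp_nat_mul, ← Real.exp_add, Real.log_inv]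
    refine Real.one_le_exp ?_
    nlinarith
  refine h1.trans ?_
  rw [← Finset.mul_sum, mul_comm (3 : ℝ)]
  gcongr
  have := Finset.sum_pow_mul_eq_add_pow (1 / (n : ℝ)) 1 (Finset.univ : Finset (Fin n))
  simp only [one_pow, mul_one, Finset.card_univ, Fintype.card_fin] at this
  rw [this]
  calc (1 / (n : ℝ) + 1) ^ n ≤ (Real.exp (1 / n)) ^ n := by gcongr; exact Real.add_one_le_exp _
    _ = Real.exp 1 := by rw [← Real.exp_nat_mul]; congr 1; field_simp
    _ ≤ 3 := by have := Real.exp_one_lt_d9; linarith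

lemma compl_pow {n k : ℕ} (hk : 2 ≤ k) (hn : 1 ≤ n) (U : Finset (Fin n)) {u0 D ρ : ℝ} (hU : (U.card : ℝ) ≤ u0) (hD : 0 ≤ D)
    (hρ : ρ + k * (u0 / n) + (k + 1) ^ 2 * ((D + 1) / n) ≤ 1) :
    ρ * (n : ℝ) ^ (k - 1) + (k + 1) ^ 2 * ((D + 1) * (n : ℝ) ^ (k - 2)) ≤ ((Uᶜ).card : ℝ) ^ (k - 1) := by
  have hn0 : (0 : ℝ) < n := by exact_mod_cast hn
  obtain ⟨j, rfl⟩ : ∃ j, k = j + 2 := ⟨k - 2, by omega⟩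
  have hc : ((Uᶜ).card : ℝ) = n * (1 - U.card / n) := by
    rw [Finset.card_compl, Fintype.card_fin, Nat.cast_sub (by simpa using Finset.card_le_univ U)]
    field_simp
  have hle : (U.card : ℝ) / n ≤ 1 := by
    rw [div_le_one hn0]; exact_mod_cast (by simpa using Finset.card_le_univ U)
  have hb := one_add_mul_le_pow (a := -((U.card : ℝ) / n)) (by linarith) (j + 1)
  have hx : (U.card : ℝ) / n ≤ u0 / n := by gcongr
  have hx0 : 0 ≤ (U.card : ℝ) / n := by positivity
  rw [hc, mul_pow]
  have e1 : j + 2 - 1 = j + 1 := rfl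
  have e2 : j + 2 - 2 = j := rfl
  rw [e1, e2]
  have e3 : (D + 1) * (n : ℝ) ^ j = (D + 1) / n * (n : ℝ) ^ (j + 1) := by rw [pow_succ]; field_simp
  rw [e3]
  push_cast at hρ hb ⊢
  have h3 : ρ + (j + 2 + 1) ^ 2 * ((D + 1) / n) ≤ (1 - U.card / n) ^ (j + 1) := by
    rw [sub_eq_add_neg]
    have hj : (0 : ℝ) ≤ j := Nat.cast_nonneg _
    nlinarith
  have := mul_le_mul_of_nonneg_left h3 (by positivity : (0 : ℝ) ≤ (n : ℝ) ^ (j + 1))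
  linarith

/-- admissible low-degree sets -/
def B1set {n : ℕ} (U : Finset (Fin n)) (D0 a m : ℝ) : Finset (Finset (Sym2 (Fin n))) :=
  (T1 U).powerset.filter fun F => (∀ v, (deg F v : ℝ) ≤ D0) ∧ a ≤ F.card ∧ (F.card : ℝ) ≤ m

def B1ev {n : ℕ} (k : ℕ) (u0 D0 a m : ℝ) (s : Finset (Sym2 (Fin n))) : Prop :=
  ∃ U ∈ (Finset.univ : Finset (Finset (Fin n))).filter (fun U => (U.card : ℝ) ≤ u0), ∃ F ∈ B1set U D0 a m,
    F ⊆ s ∧ noneOf (brid k F F Uᶜ) pathE s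

lemma B1_bound {n k : ℕ} (hk : 2 ≤ k) (hn : 1 ≤ n) {p : ℝ} (h0 : 0 ≤ p) (h1 : p ≤ 1) (hnp : 1 ≤ n * p)
    {u0 D0 a m L ρ δ : ℝ} (hL0 : 0 ≤ L) (hL : L ≤ lam n k p) (hD0 : 0 ≤ D0) (ha : 0 < a)
    (hρ : ρ + k * (u0 / n) + (k + 1) ^ 2 * ((D0 + 1) / n) ≤ 1)
    (hδ : L * (Ck k * (m / n + 2 * D0 + 1)) ≤ δ * (n * p))
    (hsum : n ^ 2 * p * Real.exp 3 ≤ a * Real.exp (L * (ρ - δ))) :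
    pr (KE n) p (B1ev k u0 D0 a m) ≤ 3 * Real.exp (u0 * Real.log n) * ((n ^ 2 + 1) * Real.exp (-(2 * a))) := by
  have hn0 : (0 : ℝ) < n := by exact_mod_cast hn
  refine (pr_exists_le h0 h1 _ _).trans ?_
  refine (Finset.sum_le_card_nsmul _ _ ((n ^ 2 + 1) * Real.exp (-(2 * a))) fun U hU => ?_).trans ?_
  swap
  · rw [nsmul_eq_mul]
    gcongr
    exact count_U hn u0
  have hU := (Finset.mem_filter.1 hU).2
  refine (pr_exists_le h0 h1 _ _).trans ?_
  set q : ℝ := p * Real.exp (-(L * (ρ - δ))) with hq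
  have hq0 : 0 ≤ q := by positivity
  have hone : ∀ F ∈ B1set U D0 a m, pr (KE n) p (fun s => F ⊆ s ∧ noneOf (brid k F F Uᶜ) pathE s) ≤ q ^ F.card := by
    intro F hF
    obtain ⟨hFT, hd, ha, hm⟩ := Finset.mem_filter.1 hF
    have hFK : F ⊆ KE n := (Finset.mem_powerset.1 hFT).trans (T1_sub U)
    unfold pr
    rw [ex_congr (g := fun s => ind (F ⊆ s) * ind (noneOf (brid k F F Uᶜ) pathE s)) (fun s _ => ind_and _ _), ex_superset hFK, hq, mul_pow,
      ← Real.exp_nat_mul]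
    gcongr
    have hb := bridge_bound (E := KE n \ F) (F := F) (J := F) (R := Uᶜ) hk hFK
      (fun x hx => by
        obtain ⟨a1, _, a2, _, a3⟩ := mem_brid.1 hx
        exact Finset.subset_sdiff.2 ⟨pathE_sub_KE a1, a3⟩) h0 h1 hnp (D := D0) (DJ := ⌊D0⌋₊) (L := L) (ρ := ρ) (δ := δ)
      hd (fun v => Nat.le_floor (hd v)) hL0 hL (by
        refine le_trans ?_ (compl_pow hk hn U hU hD0 hρ)
        have := Nat.floor_le hD0
        gcongr) (by
        refine le_trans ?_ hδ
        have := Ck_pos k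
        gcongr)
    refine le_trans ?_ (hb.trans ?_)
    · refine ex_mono h0 h1 fun s hs => ind_mono fun h x hx hxs => ?_
      exact h x hx (hxs.trans Finset.subset_union_left)
    · refine Real.exp_le_exp.2 (le_of_eq (by ring))
  refine (Finset.sum_le_sum hone).trans ?_
  have hKE := card_KE_le n
  have hsub : B1set U D0 a m ⊆ (Finset.range ((KE n).card + 1)).biUnion fun r => ((KE n).powersetCard r).filter fun F => a ≤ F.card := by
    intro F hF
    obtain ⟨hFT, hd, ha, hm⟩ := Finset.mem_filter.1 hF
    have hFK : F ⊆ KE n := (Finset.mem_powerset.1 hFT).trans (T1_sub U)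
    refine Finset.mem_biUnion.2 ⟨F.card, Finset.mem_range.2 (Nat.lt_succ_of_le (Finset.card_le_card hFK)), ?_⟩
    exact Finset.mem_filter.2 ⟨Finset.mem_powersetCard.2 ⟨hFK, rfl⟩, ha⟩
  refine (Finset.sum_le_sum_of_subset_of_nonneg hsub (fun _ _ _ => by positivity)).trans ?_
  rw [Finset.sum_biUnion (by
    intro r _ r' _ hrr
    refine Finset.disjoint_left.2 fun F hF hF' => hrr ?_
    rw [← (Finset.mem_powersetCard.1 (Finset.mem_filter.1 hF).1).2, ← (Finset.mem_powersetCard.1 (Finset.mem_filter.1 hF').1).2])]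
  refine (Finset.sum_le_card_nsmul _ _ (Real.exp (-(2 * a))) fun r hr => ?_).trans ?_
  · by_cases har : a ≤ r
    · have hr0 : (0 : ℝ) < r := ha.trans_le har
      have hr1 : 1 ≤ r := by exact_mod_cast hr0
      have e1 : ∑ F ∈ ((KE n).powersetCard r).filter (fun F => a ≤ F.card), q ^ F.card ≤ (KE n).card.choose r * q ^ r := by
        refine (Finset.sum_le_sum_of_subset_of_nonneg (Finset.filter_subset _ _) (fun _ _ _ => by positivity)).trans (le_of_eq ?_)
        rw [Finset.sum_congr rfl (g := fun _ => q ^ r) (fun F hF => by rw [(Finset.mem_powersetCard.1 hF).2]), Finset.sum_const, Finset.card_powersetCard,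
          nsmul_eq_mul]
      refine e1.trans ((choose_mul_pow_le _ r hr1 q hq0).trans ?_)
      have e2 : Real.exp 1 * (KE n).card * q / r ≤ Real.exp (-2) := by
        rw [div_le_iff₀ hr0]
        have h2 : Real.exp 1 * (KE n).card * q ≤ Real.exp 1 * n ^ 2 * q := by
          gcongr; nlinarith [sq_nonneg (n : ℝ)]
        have h3 : Real.exp 1 * n ^ 2 * q = Real.exp (-2) * (n ^ 2 * p * Real.exp 3) * Real.exp (-(L * (ρ - δ))) := by
          have : Real.exp 1 = Real.exp (-2) * Real.exp 3 := by rw [← Real.exp_add]; norm_num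
          rw [hq, this]; ring
        have h4 : Real.exp (-2) * (n ^ 2 * p * Real.exp 3) * Real.exp (-(L * (ρ - δ))) ≤
            Real.exp (-2) * (a * Real.exp (L * (ρ - δ))) * Real.exp (-(L * (ρ - δ))) := by gcongr
        have h5 : Real.exp (-2) * (a * Real.exp (L * (ρ - δ))) * Real.exp (-(L * (ρ - δ))) = Real.exp (-2) * a := by
          rw [Real.exp_neg (L * (ρ - δ))]
          have := Real.exp_pos (L * (ρ - δ))
          field_simp
        have h6 : Real.exp (-2) * a ≤ Real.exp (-2) * r := by gcongr
        linarith
      calc _ ≤ (Real.exp (-2)) ^ r := by gcongr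
        _ = Real.exp (-(2 * r)) := by rw [← Real.exp_nat_mul]; congr 1; ring
        _ ≤ _ := Real.exp_le_exp.2 (by linarith)
    · rw [Finset.sum_eq_zero]
      · positivity
      · intro F hF
        obtain ⟨h1, h2⟩ := Finset.mem_filter.1 hF
        rw [(Finset.mem_powersetCard.1 h1).2] at h2
        exact absurd h2 har
  · rw [nsmul_eq_mul, Finset.card_range]
    push_cast
    gcongr
    nlinarith [sq_nonneg (n : ℝ)]

/-- paths from `B` to `a` inside `R` avoiding `J` -/
def wtup {n : ℕ} (l : ℕ) (a : Fin n) (B R : Finset (Fin n)) (J : Finset (Sym2 (Fin n))) : Finset (Fin (l + 1) → Fin n) :=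
  Finset.univ.filter fun x => Function.Injective x ∧ x 0 ∈ B ∧ x (Fin.last l) = a ∧ (∀ t, x t ∈ R) ∧ Disjoint (pathE x) J

lemma mem_wtup {n l : ℕ} {a : Fin n} {B R : Finset (Fin n)} {J : Finset (Sym2 (Fin n))} {x : Fin (l + 1) → Fin n} :
    x ∈ wtup l a B R J ↔ Function.Injective x ∧ x 0 ∈ B ∧ x (Fin.last l) = a ∧ (∀ t, x t ∈ R) ∧ Disjoint (pathE x) J := by
  simp [wtup]

lemma prod_wends {n l : ℕ} (hl : 1 ≤ l) (a : Fin n) (B R : Finset (Fin n)) :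
    ∏ t : Fin (l + 1), (if t = Fin.last l then {a} else if t = 0 then B else R : Finset (Fin n)).card = B.card * R.card ^ (l - 1) := by
  have h0l : (0 : Fin (l + 1)) ≠ Fin.last l := by
    intro h; have := congrArg Fin.val h; simp at this; omega
  rw [← Finset.mul_prod_erase _ _ (Finset.mem_univ (Fin.last l)), ← Finset.mul_prod_erase (Finset.univ.erase (Fin.last l)) _ (Finset.mem_erase.2 ⟨h0l, Finset.mem_univ _⟩)]
  rw [if_pos rfl, if_neg h0l, if_pos rfl]
  rw [Finset.prod_congr rfl (g := fun _ => R.card) (fun t ht => by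
    simp only [Finset.mem_erase] at ht
    rw [if_neg ht.2.1, if_neg ht.1]), Finset.prod_const, Finset.card_erase_of_mem (by simp [h0l]), Finset.card_erase_of_mem (by simp)]
  simp

lemma card_wtup_ge {n l : ℕ} (hl : 1 ≤ l) {a : Fin n} {B R : Finset (Fin n)} (haR : a ∈ R) (hBR : B ⊆ R) (J : Finset (Sym2 (Fin n)))
    (D : ℕ) (hD : ∀ v, deg J v ≤ D) :
    B.card * R.card ^ (l - 1) ≤ (wtup l a B R J).card + (l + 1) ^ 2 * ((D + 1) * n ^ (l - 1)) := by
  have h0l : (0 : Fin (l + 1)) ≠ Fin.last l := by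
    intro h; have := congrArg Fin.val h; simp at this; omega
  set A : Fin (l + 1) → Finset (Fin n) := fun t => if t = Fin.last l then {a} else if t = 0 then B else R with hA
  have hAn : ∀ t, (A t).card ≤ n := fun t => by simpa using Finset.card_le_univ (A t)
  set C : Finset (Fin (l + 1) × Fin (l + 1)) := Finset.univ.filter fun c => c.1 ≠ c.2 ∧ c.1 ≠ Fin.last l with hC
  have hCc : C.card ≤ (l + 1) ^ 2 := by
    refine (Finset.card_le_univ C).trans (le_of_eq ?_); simp [sq]
  set f : Fin n → Finset (Fin n) := fun v => insert v (nb J v) with hf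
  have h1 := count_good A C f (D + 1) (n ^ (l - 1))
    (fun v => (Finset.card_insert_le _ _).trans (by rw [card_nb]; exact Nat.add_le_add_right (hD v) 1))
    (fun c hc => by
      have hc := (Finset.mem_filter.1 hc).2
      refine ⟨hc.1, ?_⟩
      have hmem : Fin.last l ∈ (Finset.univ.erase c.1) := Finset.mem_erase.2 ⟨hc.2.symm, Finset.mem_univ _⟩
      rw [← Finset.mul_prod_erase _ _ hmem]
      have : (A (Fin.last l)).card = 1 := by rw [hA]; simp
      rw [this, one_mul]
      refine (Finset.prod_le_pow_card _ _ _ fun t _ => hAn t).trans (le_of_eq ?_)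
      rw [Finset.card_erase_of_mem hmem, Finset.card_erase_of_mem (Finset.mem_univ _)]
      simp)
  rw [hA, prod_wends hl] at h1
  refine h1.trans (Nat.add_le_add (Finset.card_le_card ?_) (Nat.mul_le_mul_right _ hCc))
  intro x hx
  obtain ⟨hxA, hxC⟩ := Finset.mem_filter.1 hx
  rw [Fintype.mem_piFinset] at hxA
  have xl : x (Fin.last l) = a := by simpa using hxA (Fin.last l)
  have x0 : x 0 ∈ B := by
    have := hxA 0; rwa [if_neg h0l, if_pos rfl] at this
  have xi : ∀ i, x i ∈ R := by
    intro i
    by_cases h : i = Fin.last l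
    · rw [h, xl]; exact haR
    by_cases h' : i = 0
    · rw [h']; exact hBR x0
    have := hxA i; rwa [if_neg h, if_neg h'] at this
  have hc : ∀ i j, i ≠ j → i ≠ Fin.last l → x i ≠ x j ∧ s(x j, x i) ∉ J := by
    intro i j hij h
    have := hxC (i, j) (Finset.mem_filter.2 ⟨Finset.mem_univ _, hij, h⟩)
    simp only [hf, Finset.mem_insert, mem_nb, not_or] at this
    exact this
  refine mem_wtup.2 ⟨?_, x0, xl, xi, ?_⟩
  · intro i j h
    by_contra hij
    by_cases hi : i = Fin.last l
    · exact (hc j i (Ne.symm hij) (fun hj => hij (hi.trans hj.symm))).1 h.symm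
    · exact (hc i j hij hi).1 h
  · rw [Finset.disjoint_left]
    intro e he heJ
    obtain ⟨i, rfl⟩ := mem_pathE.1 he
    unfold pe at heJ
    have hne : i.castSucc ≠ i.succ := by intro h; have := congrArg Fin.val h; simp at this
    exact (hc i.castSucc i.succ hne (Fin.castSucc_lt_last i).ne).2 (by rwa [Sym2.eq_swap])

lemma card_wtup_le {n l : ℕ} (hl : 1 ≤ l) {a : Fin n} {B R : Finset (Fin n)} (J : Finset (Sym2 (Fin n))) :
    (wtup l a B R J).card ≤ B.card * n ^ (l - 1) := by
  have h0l : (0 : Fin (l + 1)) ≠ Fin.last l := by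
    intro h; have := congrArg Fin.val h; simp at this; omega
  have h2 := prod_wends hl a B (Finset.univ : Finset (Fin n))
  rw [Finset.card_univ, Fintype.card_fin, ← Fintype.card_piFinset] at h2
  rw [← h2]
  refine Finset.card_le_card fun x hx => ?_
  obtain ⟨_, h3, h4, _⟩ := mem_wtup.1 hx
  rw [Fintype.mem_piFinset]
  intro t
  by_cases h : t = Fin.last l
  · rw [if_pos h, h, h4]; simp
  by_cases h' : t = 0
  · rw [if_neg h, if_pos h', h']; exact h3
  · rw [if_neg h, if_neg h']; simp

def wit {n : ℕ} (l : ℕ) (A B : Fin n → Finset (Fin n)) (R : Finset (Fin n)) (J : Finset (Sym2 (Fin n))) : Finset (Fin n × (Fin (l + 1) → Fin n)) :=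
  Finset.univ.filter fun q => Function.Injective q.2 ∧ q.2 0 ∈ B q.1 ∧ q.2 (Fin.last l) ∈ A q.1 ∧ (∀ t, q.2 t ∈ R) ∧ Disjoint (pathE q.2) J

lemma mem_wit {n l : ℕ} {A B : Fin n → Finset (Fin n)} {R : Finset (Fin n)} {J : Finset (Sym2 (Fin n))} {q : Fin n × (Fin (l + 1) → Fin n)} :
    q ∈ wit l A B R J ↔ Function.Injective q.2 ∧ q.2 0 ∈ B q.1 ∧ q.2 (Fin.last l) ∈ A q.1 ∧ (∀ t, q.2 t ∈ R) ∧ Disjoint (pathE q.2) J := by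
  simp [wit]

lemma sum_wit {n l : ℕ} (A B : Fin n → Finset (Fin n)) (R : Finset (Fin n)) (J : Finset (Sym2 (Fin n))) (f : Fin n × (Fin (l + 1) → Fin n) → ℝ) :
    ∑ q ∈ wit l A B R J, f q = ∑ v, ∑ a ∈ A v, ∑ x ∈ wtup l a (B v) R J, f (v, x) := by
  have h1 : wit l A B R J = (Finset.univ : Finset (Fin n)).biUnion fun v => (A v).biUnion fun a => (wtup l a (B v) R J).image fun x => (v, x) := by
    ext ⟨v, x⟩
    simp only [mem_wit, Finset.mem_biUnion, Finset.mem_univ, true_and, Finset.mem_image, mem_wtup, Prod.mk.injEq]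
    constructor
    · rintro ⟨h1, h2, h3, h4⟩
      exact ⟨v, _, h3, x, ⟨h1, h2, rfl, h4⟩, rfl, rfl⟩
    · rintro ⟨v', a, ha, x', ⟨h1, h2, h3, h4⟩, rfl, rfl⟩
      exact ⟨h1, h2, h3 ▸ ha, h4⟩
  rw [h1, Finset.sum_biUnion]
  · refine Finset.sum_congr rfl fun v _ => ?_
    rw [Finset.sum_biUnion]
    · refine Finset.sum_congr rfl fun a _ => ?_
      rw [Finset.sum_image]
      intro x _ y _ h
      exact (Prod.ext_iff.1 h).2
    · intro a _ a' _ haa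
      refine Finset.disjoint_left.2 fun q hq hq' => haa ?_
      obtain ⟨x, hx, rfl⟩ := Finset.mem_image.1 hq
      obtain ⟨y, hy, h⟩ := Finset.mem_image.1 hq'
      have hxy : y = x := (Prod.ext_iff.1 h).2
      rw [hxy] at hy
      exact (mem_wtup.1 hx).2.2.1.symm.trans (mem_wtup.1 hy).2.2.1
  · intro v _ v' _ hvv
    refine Finset.disjoint_left.2 fun q hq hq' => hvv ?_
    simp only [Finset.mem_biUnion, Finset.mem_image] at hq hq'
    obtain ⟨_, _, x, _, rfl⟩ := hq
    obtain ⟨_, _, y, _, h⟩ := hq'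
    exact (Prod.ext_iff.1 h).1.symm

/-- the configuration needed for the Janson estimate -/
structure Cfg {n : ℕ} (A B : Fin n → Finset (Fin n)) (R : Finset (Fin n)) (b0 Δ r cd : ℝ) : Prop where
  dis : ∀ v, Disjoint (A v) (B v)
  AR : ∀ v, A v ⊆ R
  BR : ∀ v, B v ⊆ R
  Bge : ∀ v, (A v).Nonempty → b0 ≤ (B v).card
  Ale : ∀ v, ((A v).card : ℝ) ≤ Δ
  Ble : ∀ v, ((B v).card : ℝ) ≤ Δ
  yle : ∀ y, (((Finset.univ : Finset (Fin n)).filter fun v => y ∈ A v ∪ B v).card : ℝ) ≤ r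
  cod : ∀ v v', v ≠ v' → (((A v ∪ B v) ∩ (A v' ∪ B v')).card : ℝ) ≤ cd

lemma wit_ov1 {n l : ℕ} (hl : 1 ≤ l) (hn : 1 ≤ n) {A B : Fin n → Finset (Fin n)} {R : Finset (Fin n)} {b0 Δ r cd : ℝ} (hΔ : 0 ≤ Δ)
    (h : Cfg A B R b0 Δ r cd) (J : Finset (Sym2 (Fin n))) {p Lo : ℝ} (hp : 0 ≤ p)
    (hL : ∀ t, 1 ≤ t → t < l → (n : ℝ) ^ (l - 1 - t) * p ^ (l - t) ≤ Lo) (hL0 : 0 ≤ Lo) {x : Fin (l + 1) → Fin n} (hx : Function.Injective x) :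
    ∑ q ∈ wit l A B R J with ¬ Disjoint (pathE x) (pathE q.2) ∧ ¬ pathE q.2 ⊆ pathE x, p ^ (pathE q.2 \ pathE x).card ≤
      2 ^ l * (l + 1) ^ (l + 1) * (Δ * (∑ v, ((A v).card : ℝ)) / n + 2 * (r * Δ) + r) * Lo := by
  have hr : 0 ≤ r := (Nat.cast_nonneg _).trans (h.yle ⟨0, hn⟩)
  set Z : Finset (Fin n × Fin n × Fin n) := Finset.univ.filter fun c => c.2.1 ∈ B c.1 ∧ c.2.2 ∈ A c.1 with hZ
  set P : Finset ((Fin n × Fin n × Fin n) × (Fin (l + 1) → Fin n)) := (wit l A B R J).image fun q => ((q.1, q.2 0, q.2 (Fin.last l)), q.2) with hP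
  set W : Finset (Fin n) := Finset.univ.image x with hWdef
  have hWc : W.card = l + 1 := by rw [hWdef, Finset.card_image_of_injective _ hx]; simp
  have hZc : (Z.card : ℝ) ≤ Δ * ∑ v, ((A v).card : ℝ) := by
    have e : Z = (Finset.univ : Finset (Fin n)).biUnion fun v => (B v ×ˢ A v).image fun c => (v, c) := by
      ext ⟨v, b, a⟩
      simp only [hZ, Finset.mem_filter, Finset.mem_univ, true_and, Finset.mem_biUnion, Finset.mem_image, Finset.mem_product, Prod.mk.injEq]
      constructor
      · intro h; exact ⟨v, (b, a), h, rfl, rfl⟩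
      · rintro ⟨v', ⟨b', a'⟩, h, rfl, h2⟩
        obtain ⟨rfl, rfl⟩ := h2
        exact h
    rw [e, Finset.mul_sum]
    refine (Nat.cast_le.2 Finset.card_biUnion_le).trans ?_
    push_cast
    refine Finset.sum_le_sum fun v _ => ?_
    have h3 : (((B v ×ˢ A v).image fun c => (v, c)).card : ℝ) ≤ (B v).card * (A v).card := by
      exact_mod_cast Finset.card_image_le.trans (by rw [Finset.card_product])
    exact h3.trans (mul_le_mul_of_nonneg_right (h.Ble v) (by positivity))
  have hfib : ∀ (q : Fin n × Fin n × Fin n → Prop) [DecidablePred q] (y : Fin n) (T : Fin n → Finset (Fin n)) (g : Fin n × Fin n × Fin n → Fin n),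
      (∀ v, ((T v).card : ℝ) ≤ Δ) → (∀ c ∈ Z, q c → y ∈ A c.1 ∪ B c.1 ∧ g c ∈ T c.1) →
      (∀ c ∈ Z, ∀ c' ∈ Z, q c → q c' → c.1 = c'.1 → g c = g c' → c = c') → ((Z.filter q).card : ℝ) ≤ r * Δ := by
    intro q _ y T g hT h2 hinj
    have h3 : (Z.filter q).card ≤ (((Finset.univ : Finset (Fin n)).filter fun v => y ∈ A v ∪ B v).biUnion fun v => (T v).image fun w => (v, w)).card := by
      refine Finset.card_le_card_of_injOn (fun c => (c.1, g c)) ?_ ?_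
      · intro c hc
        obtain ⟨hc1, hc2⟩ := Finset.mem_filter.1 hc
        have := h2 c hc1 hc2
        simp only [Finset.coe_biUnion, Set.mem_iUnion, Finset.coe_image, Set.mem_image]
        refine ⟨c.1, by simpa using this.1, g c, this.2, rfl⟩
      · intro c hc c' hc' he
        obtain ⟨hc1, hc2⟩ := Finset.mem_filter.1 hc
        obtain ⟨hc1', hc2'⟩ := Finset.mem_filter.1 hc'
        exact hinj c hc1 c' hc1' hc2 hc2' (Prod.ext_iff.1 he).1 (Prod.ext_iff.1 he).2
    refine (Nat.cast_le.2 (h3.trans Finset.card_biUnion_le)).trans ?_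
    push_cast
    refine (Finset.sum_le_card_nsmul _ _ Δ fun v _ => ?_).trans ?_
    · exact (Nat.cast_le.2 Finset.card_image_le).trans (hT v)
    · rw [nsmul_eq_mul]; exact mul_le_mul_of_nonneg_right (h.yle y) hΔ
  have hov := overlap_sum hl hn Z (fun c => c.2.1) (fun c => c.2.2) (pathE x) W (by omega)
    (by
      intro e he v hv
      obtain ⟨i, rfl⟩ := mem_pathE.1 he
      unfold pe at hv
      rw [Sym2.mem_iff] at hv
      rcases hv with rfl | rfl <;> simp [hWdef]) P
    (by
      intro q hq
      obtain ⟨y, hy, rfl⟩ := Finset.mem_image.1 hq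
      have hy := mem_wit.1 hy
      exact ⟨Finset.mem_filter.2 ⟨Finset.mem_univ _, hy.2.1, hy.2.2.1⟩, hy.1, rfl, rfl⟩) hp
    (d := r * Δ) (d01 := r) (L := Lo)
    (fun y => hfib _ y A (fun c => c.2.2) h.Ale (fun c hc hq => by
        have := (Finset.mem_filter.1 hc).2
        exact ⟨Finset.mem_union_right _ (hq ▸ this.1), this.2⟩)
      (fun c _ c' _ h1 h2 h3 h4 => Prod.ext h3 (Prod.ext (h1.trans h2.symm) h4)))
    (fun y => hfib _ y B (fun c => c.2.1) h.Ble (fun c hc hq => by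
        have := (Finset.mem_filter.1 hc).2
        exact ⟨Finset.mem_union_left _ (hq ▸ this.2), this.1⟩)
      (fun c _ c' _ h1 h2 h3 h4 => Prod.ext h3 (Prod.ext h4 (h1.trans h2.symm))))
    (fun u v => by
      refine le_trans ?_ (h.yle u)
      norm_cast
      refine Finset.card_le_card_of_injOn (fun c => c.1) ?_ ?_
      · intro c hc
        obtain ⟨hc1, hc2⟩ := Finset.mem_filter.1 hc
        have := (Finset.mem_filter.1 hc1).2
        simp only [Finset.coe_filter, Finset.mem_univ, true_and, Set.mem_setOf_eq]
        exact Finset.mem_union_right _ (hc2.1 ▸ this.1)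
      · intro c hc c' hc' he
        obtain ⟨hc1, hc2⟩ := Finset.mem_filter.1 hc
        obtain ⟨hc1', hc2'⟩ := Finset.mem_filter.1 hc'
        exact Prod.ext he (Prod.ext (hc2.1.trans hc2'.1.symm) (hc2.2.trans hc2'.2.symm)))
    hL hL0
  rw [hWc] at hov
  push_cast at hov
  have e1 : ∑ q ∈ P with ¬ Disjoint (pathE x) (pathE q.2) ∧ ¬ pathE q.2 ⊆ pathE x, p ^ (pathE q.2 \ pathE x).card =
        ∑ q ∈ wit l A B R J with ¬ Disjoint (pathE x) (pathE q.2) ∧ ¬ pathE q.2 ⊆ pathE x, p ^ (pathE q.2 \ pathE x).card := by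
    rw [Finset.sum_filter, Finset.sum_filter, hP, Finset.sum_image]
    intro y _ y' _ h
    exact Prod.ext (Prod.ext_iff.1 (Prod.ext_iff.1 h).1).1 (Prod.ext_iff.1 h).2
  rw [← e1]
  refine hov.trans ?_
  gcongr

lemma wit_ov2 {n l : ℕ} (hl : 1 ≤ l) (hn : 1 ≤ n) {A B : Fin n → Finset (Fin n)} {R : Finset (Fin n)} {b0 Δ r cd : ℝ} (hcd : 0 ≤ cd)
    (h : Cfg A B R b0 Δ r cd) (J : Finset (Sym2 (Fin n))) :
    ∑ i ∈ wit l A B R J, (((wit l A B R J).filter fun j => j ≠ i ∧ pathE j.2 ⊆ pathE i.2).card : ℝ) ≤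
      2 * ((∑ v, ((A v).card : ℝ)) * (r * (cd * (n : ℝ) ^ (l - 1)))) := by
  have hone : ∀ i ∈ wit l A B R J, (((wit l A B R J).filter fun j => j ≠ i ∧ pathE j.2 ⊆ pathE i.2).card : ℝ) ≤
      2 * ∑ v' ∈ (Finset.univ : Finset (Fin n)).filter (fun v' => v' ≠ i.1 ∧ i.2 (Fin.last l) ∈ A v' ∪ B v'), (if i.2 0 ∈ A v' ∪ B v' then 1 else 0 : ℝ) := by
    rintro ⟨v, x⟩ hi
    have hi' := mem_wit.1 hi
    rw [← Finset.sum_filter, Finset.filter_filter, Finset.sum_const, nsmul_eq_mul, mul_one, mul_comm]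
    set V' := (Finset.univ : Finset (Fin n)).filter fun v' => (v' ≠ v ∧ x (Fin.last l) ∈ A v' ∪ B v') ∧ x 0 ∈ A v' ∪ B v' with hV
    have hsub : (wit l A B R J).filter (fun j => j ≠ (v, x) ∧ pathE j.2 ⊆ pathE x) ⊆ V' ×ˢ {x, x ∘ Fin.rev} := by
      rintro ⟨v', y⟩ hj
      obtain ⟨hj0, hne, hsub⟩ := Finset.mem_filter.1 hj
      clear hj
      have hj := mem_wit.1 hj0
      clear hj0
      rcases path_eq hl hi'.1 hj.1 hsub with hy | hy
      · simp only at hy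
        subst hy
        refine Finset.mem_product.2 ⟨Finset.mem_filter.2 ⟨Finset.mem_univ _, ⟨?_, Finset.mem_union_left _ hj.2.2.1⟩, Finset.mem_union_right _ hj.2.1⟩, by simp⟩
        rintro rfl; exact hne rfl
      · simp only at hy
        subst hy
        have e1 : x (Fin.last l) ∈ B v' := by have := hj.2.1; simpa using this
        have e2 : x 0 ∈ A v' := by have := hj.2.2.1; simpa using this
        refine Finset.mem_product.2 ⟨Finset.mem_filter.2 ⟨Finset.mem_univ _, ⟨?_, Finset.mem_union_right _ e1⟩, Finset.mem_union_left _ e2⟩, by simp⟩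
        rintro rfl
        exact Finset.disjoint_left.1 (h.dis v') e2 hi'.2.1
    have h9 := Finset.card_le_card hsub
    rw [Finset.card_product] at h9
    have h8 : V'.card * ({x, x ∘ Fin.rev} : Finset (Fin (l + 1) → Fin n)).card ≤ V'.card * 2 := Nat.mul_le_mul_left _ Finset.card_le_two
    exact_mod_cast h9.trans h8
  refine (Finset.sum_le_sum hone).trans ?_
  rw [← Finset.mul_sum, sum_wit, Finset.sum_mul]
  gcongr with v _
  rw [← nsmul_eq_mul]
  refine Finset.sum_le_card_nsmul _ _ _ fun a ha => ?_
  have e1 : ∑ x ∈ wtup l a (B v) R J, ∑ v' ∈ (Finset.univ : Finset (Fin n)).filter (fun v' => v' ≠ v ∧ x (Fin.last l) ∈ A v' ∪ B v'),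
      (if x 0 ∈ A v' ∪ B v' then 1 else 0 : ℝ) =
      ∑ v' ∈ (Finset.univ : Finset (Fin n)).filter (fun v' => v' ≠ v ∧ a ∈ A v' ∪ B v'), ∑ x ∈ wtup l a (B v) R J, (if x 0 ∈ A v' ∪ B v' then 1 else 0 : ℝ) := by
    rw [Finset.sum_comm]
    refine Finset.sum_congr rfl fun x hx => ?_
    rw [(mem_wtup.1 hx).2.2.1]
  simp only
  rw [e1]
  refine (Finset.sum_le_card_nsmul _ _ (cd * (n : ℝ) ^ (l - 1)) fun v' hv' => ?_).trans ?_
  · have hv' := (Finset.mem_filter.1 hv').2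
    rw [← Finset.sum_filter, Finset.sum_const, nsmul_eq_mul, mul_one]
    have e2 : (wtup l a (B v) R J).filter (fun x => x 0 ∈ A v' ∪ B v') ⊆ wtup l a (B v ∩ (A v' ∪ B v')) R J := by
      intro x hx
      obtain ⟨hx, h2⟩ := Finset.mem_filter.1 hx
      have hx := mem_wtup.1 hx
      exact mem_wtup.2 ⟨hx.1, Finset.mem_inter.2 ⟨hx.2.1, h2⟩, hx.2.2⟩
    have e3 := (Finset.card_le_card e2).trans (card_wtup_le hl J)
    have e4 : ((B v ∩ (A v' ∪ B v')).card : ℝ) ≤ cd := by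
      refine le_trans ?_ (h.cod v v' hv'.1.symm)
      norm_cast
      exact Finset.card_le_card (Finset.inter_subset_inter Finset.subset_union_right le_rfl)
    calc _ ≤ ((B v ∩ (A v' ∪ B v')).card : ℝ) * (n : ℝ) ^ (l - 1) := by exact_mod_cast e3
      _ ≤ _ := by gcongr
  · rw [nsmul_eq_mul]
    gcongr
    refine le_trans ?_ (h.yle a)
    norm_cast
    refine Finset.card_le_card fun v' hv' => ?_
    have := (Finset.mem_filter.1 hv').2.2
    simpa using this

lemma lam_succ {n l : ℕ} (hl : 1 ≤ l) (p : ℝ) : lam n (l + 1) p = (n * p) * ((n : ℝ) ^ (l - 1) * p ^ l) := by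
  obtain ⟨j, rfl⟩ : ∃ j, l = j + 1 := ⟨l - 1, by omega⟩
  unfold lam
  simp only [Nat.add_sub_cancel]
  ring

lemma card_wit_ge {n l : ℕ} (hl : 1 ≤ l) {A B : Fin n → Finset (Fin n)} {R : Finset (Fin n)} {b0 Δ r cd c : ℝ}
    (h : Cfg A B R b0 Δ r cd) (J : Finset (Sym2 (Fin n))) {D : ℝ} (hD0 : 0 ≤ D) (hD : ∀ v, (deg J v : ℝ) ≤ D)
    (hc : c + (l + 1) ^ 2 * ((D + 1) * (n : ℝ) ^ (l - 1)) ≤ b0 * (R.card : ℝ) ^ (l - 1)) :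
    (∑ v, ((A v).card : ℝ)) * c ≤ (wit l A B R J).card := by
  have h1 := sum_wit (l := l) A B R J (fun _ => 1)
  simp only [Finset.sum_const, nsmul_eq_mul, mul_one] at h1
  rw [h1, Finset.sum_mul]
  refine Finset.sum_le_sum fun v _ => ?_
  rw [← nsmul_eq_mul]
  refine Finset.card_nsmul_le_sum _ _ _ fun a ha => ?_
  have h2 := card_wtup_ge hl (h.AR v ha) (h.BR v) J ⌊D⌋₊ (fun v => Nat.le_floor (hD v))
  have h3 : ((B v).card : ℝ) * (R.card : ℝ) ^ (l - 1) ≤ (wtup l a (B v) R J).card + (l + 1) ^ 2 * ((⌊D⌋₊ + 1) * (n : ℝ) ^ (l - 1)) := by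
    exact_mod_cast h2
  have h4 : b0 * (R.card : ℝ) ^ (l - 1) ≤ (B v).card * (R.card : ℝ) ^ (l - 1) := by
    gcongr; exact h.Bge v ⟨a, ha⟩
  have h5 : (l + 1 : ℝ) ^ 2 * ((⌊D⌋₊ + 1) * (n : ℝ) ^ (l - 1)) ≤ (l + 1) ^ 2 * ((D + 1) * (n : ℝ) ^ (l - 1)) := by
    have := Nat.floor_le hD0
    gcongr
  linarith

set_option maxHeartbeats 1000000 in
lemma wit_janson {n l : ℕ} (hl : 1 ≤ l) {E : Finset (Sym2 (Fin n))} {A B : Fin n → Finset (Fin n)} {R : Finset (Fin n)} {r cd : ℝ} {p : ℝ} (h0 : 0 ≤ p) (h1 : p ≤ 1)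
    (hnp : 1 ≤ n * p) (h : Cfg A B R (n * p / 64) (16 * (n * p)) r cd) (hcd : 0 ≤ cd) (J : Finset (Sym2 (Fin n))) {D : ℝ} (hD0 : 0 ≤ D) (hD : ∀ v, (deg J v : ℝ) ≤ D)
    (hR : n * p / 128 * (n : ℝ) ^ (l - 1) + (l + 1) ^ 2 * ((D + 1) * (n : ℝ) ^ (l - 1)) ≤ n * p / 64 * (R.card : ℝ) ^ (l - 1))
    (hE : ∀ q ∈ wit l A B R J, pathE q.2 ⊆ E) {L : ℝ} (hL0 : 0 ≤ L) (hL : L ≤ lam n (l + 1) p)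
    (ha1 : 2 ^ l * (l + 1) ^ (l + 1) * (16 * ((∑ v, ((A v).card : ℝ)) / (n ^ 2 * p)) + 33 * (r / (n * p))) * L ≤ 1 / 4)
    (ha2 : 2048 * (r * cd * L) ≤ lam n (l + 1) p * (n * p)) :
    pr E p (noneOf (wit l A B R J) (fun q => pathE q.2)) ≤ Real.exp (-((∑ v, ((A v).card : ℝ)) * L / 512)) := by
  have hn0 : 0 < (n : ℝ) := by
    by_contra h
    have : (n : ℝ) = 0 := le_antisymm (not_lt.1 h) (Nat.cast_nonneg _)
    rw [this] at hnp; linarith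
  have hn : 1 ≤ n := by exact_mod_cast hn0
  have hp : 0 < p := by
    by_contra h
    have : p = 0 := le_antisymm (not_lt.1 h) h0
    rw [this] at hnp; linarith
  have hr : 0 ≤ r := (Nat.cast_nonneg _).trans (h.yle ⟨0, hn⟩)
  set a : ℝ := ∑ v, ((A v).card : ℝ) with ha
  have ha0 : 0 ≤ a := Finset.sum_nonneg fun _ _ => Nat.cast_nonneg _
  set Λ := lam n (l + 1) p with hΛ
  have hΛ0 : 0 < Λ := by rw [hΛ]; unfold lam; positivity
  set C : ℝ := 2 ^ l * (l + 1) ^ (l + 1) with hC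
  have hC0 : 0 < C := by rw [hC]; positivity
  set Q : ℝ := (n : ℝ) ^ (l - 1) * p ^ l with hQ
  have hQ0 : 0 < Q := by positivity
  have hΛQ : Λ = (n * p) * Q := lam_succ hl p
  set Lo : ℝ := Λ / (n * p) ^ 2 with hLo
  have hLob : ∀ t, 1 ≤ t → t < l → (n : ℝ) ^ (l - 1 - t) * p ^ (l - t) ≤ Lo := by
    intro t ht1 ht2
    refine (rat_pow_bound (by omega) h0 hnp t ht1 ht2).trans (le_of_eq ?_)
    rw [hLo, hΛQ, hQ]
    obtain ⟨j, rfl⟩ : ∃ j, l = j + 2 := ⟨l - 2, by omega⟩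
    have e1 : j + 2 - 2 = j := rfl
    have e2 : j + 2 - 1 = j + 1 := rfl
    rw [e1, e2]
    field_simp
    ring
  refine (janson h0 h1 (wit l A B R J) (fun q => pathE q.2) hE (w := L / Λ) (by positivity) ((div_le_one hΛ0).2 hL)).trans (Real.exp_le_exp.2 ?_)
  set N : ℝ := ((wit l A B R J).card : ℝ) with hN
  have hN1 : a * (n * p / 128 * (n : ℝ) ^ (l - 1)) ≤ N := card_wit_ge hl h J hD0 hD hR
  have hcard : ∀ q ∈ wit l A B R J, p ^ (pathE q.2).card = p ^ l := fun q hq => by rw [card_pathE (mem_wit.1 hq).1]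
  rw [Finset.sum_congr rfl hcard, Finset.sum_const, nsmul_eq_mul]
  set X : ℝ := C * (16 * (n * p) * a / n + 2 * (r * (16 * (n * p))) + r) * Lo with hX
  have hsum : ∑ i ∈ wit l A B R J, ∑ j ∈ wit l A B R J with j ≠ i ∧ ¬ Disjoint (pathE i.2) (pathE j.2), p ^ (pathE i.2 ∪ pathE j.2).card ≤
      N * (p ^ l * X) + p ^ l * (2 * (a * (r * (cd * (n : ℝ) ^ (l - 1))))) := by
    have h5 := mul_le_mul_of_nonneg_left (wit_ov2 hl hn hcd h J) (by positivity : 0 ≤ p ^ l)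
    refine le_trans ?_ (add_le_add le_rfl h5)
    rw [hN, ← nsmul_eq_mul, ← Finset.sum_const, Finset.mul_sum, ← Finset.sum_add_distrib]
    refine Finset.sum_le_sum fun i hi => ?_
    have hii := (mem_wit.1 hi).1
    have hov := wit_ov1 hl hn (by positivity) h J h0 hLob (by positivity) hii
    have h6 : p ^ l * (((wit l A B R J).filter fun j => j ≠ i ∧ pathE j.2 ⊆ pathE i.2).card : ℝ) =
        ∑ j ∈ wit l A B R J with j ≠ i ∧ pathE j.2 ⊆ pathE i.2, p ^ (pathE i.2 ∪ pathE j.2).card := by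
      rw [Finset.sum_congr rfl (g := fun _ => p ^ l) (fun j hj => by
        rw [Finset.union_eq_left.2 (Finset.mem_filter.1 hj).2.2, card_pathE hii]), Finset.sum_const, nsmul_eq_mul, mul_comm]
    have h7 : ∑ q ∈ wit l A B R J with ¬ Disjoint (pathE i.2) (pathE q.2) ∧ ¬ pathE q.2 ⊆ pathE i.2, p ^ (pathE i.2 ∪ pathE q.2).card ≤ p ^ l * X := by
      refine le_trans (le_of_eq ?_) (mul_le_mul_of_nonneg_left hov (by positivity))
      rw [Finset.mul_sum]
      refine Finset.sum_congr rfl fun y hy => ?_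
      rw [← pow_add, ← Finset.union_sdiff_self_eq_union, Finset.card_union_of_disjoint Finset.disjoint_sdiff, card_pathE hii]
    rw [h6]
    refine le_trans ?_ (add_le_add h7 le_rfl)
    rw [← Finset.sum_union]
    · refine Finset.sum_le_sum_of_subset_of_nonneg ?_ (fun _ _ _ => by positivity)
      intro j hj
      obtain ⟨hj, h2, h3⟩ := Finset.mem_filter.1 hj
      by_cases hs : pathE j.2 ⊆ pathE i.2
      · exact Finset.mem_union_right _ (Finset.mem_filter.2 ⟨hj, h2, hs⟩)
      · exact Finset.mem_union_left _ (Finset.mem_filter.2 ⟨hj, h3, hs⟩)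
    · refine Finset.disjoint_left.2 fun j hj hj' => ?_
      exact (Finset.mem_filter.1 hj).2.2 (Finset.mem_filter.1 hj').2.2
  have hXb : L * X ≤ Λ / 4 := by
    have e1 : L * X = (C * (16 * (a / (n ^ 2 * p)) + 32 * (r / (n * p)) + r / (n * p) ^ 2) * L) * Λ := by
      rw [hX, hLo]; field_simp; ring
    have e2 : r / (n * p) ^ 2 ≤ r / (n * p) := by
      gcongr; nlinarith
    have e3 : C * (16 * (a / (n ^ 2 * p)) + 32 * (r / (n * p)) + r / (n * p) ^ 2) * L ≤ 1 / 4 := by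
      have e4 : 16 * (a / (n ^ 2 * p)) + 32 * (r / (n * p)) + r / (n * p) ^ 2 ≤ 16 * (a / (n ^ 2 * p)) + 33 * (r / (n * p)) := by linarith
      exact le_trans (mul_le_mul_of_nonneg_right (mul_le_mul_of_nonneg_left e4 hC0.le) hL0) ha1
    rw [e1]
    nlinarith
  have hM : a * Λ / 128 ≤ N * p ^ l := by
    have := mul_le_mul_of_nonneg_right hN1 (by positivity : 0 ≤ p ^ l)
    rw [hΛQ, hQ]; linarith
  have f1 : (L / Λ) ^ 2 * ∑ i ∈ wit l A B R J, ∑ j ∈ wit l A B R J with j ≠ i ∧ ¬ Disjoint (pathE i.2) (pathE j.2), p ^ (pathE i.2 ∪ pathE j.2).card ≤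
     (L / Λ) ^ 2 * (N * (p ^ l * X) + p ^ l * (2 * (a * (r * (cd * (n : ℝ) ^ (l - 1)))))) := by gcongr
  have f2 : (L / Λ) ^ 2 * (N * (p ^ l * X) + p ^ l * (2 * (a * (r * (cd * (n : ℝ) ^ (l - 1)))))) =
      (L / Λ) * (N * p ^ l) * (L * X / Λ) + a * L * (2 * (r * cd * L) / (Λ * (n * p))) := by
    have : p ^ l * (2 * (a * (r * (cd * (n : ℝ) ^ (l - 1))))) = 2 * a * r * cd * Λ / (n * p) := by
      rw [hΛQ, hQ, eq_div_iff (by positivity)]; ring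
    rw [this]
    have hy : 0 < (n : ℝ) * p := by positivity
    clear_value Λ X N a
    clear f1 hsum hXb hM hN1 hcard h ha1 ha2 hR hE this hLob hLo hΛQ hX
    generalize (n : ℝ) * p = y at *
    generalize p ^ l = z
    have hΛ1 := hΛ0.ne'
    have hy1 := hy.ne'
    clear * - hΛ1 hy1
    field_simp
  have f3 : L * X / Λ ≤ 1 / 4 := by rw [div_le_iff₀ hΛ0]; linarith
  have f4 : 2 * (r * cd * L) / (Λ * (n * p)) ≤ 1 / 1024 := by
    rw [div_le_iff₀ (by positivity)]; linarith
  have f5 : (L / Λ) * (N * p ^ l) * (L * X / Λ) ≤ (L / Λ) * (N * p ^ l) * (1 / 4) := mul_le_mul_of_nonneg_left f3 (by positivity)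
  have f6 : a * L * (2 * (r * cd * L) / (Λ * (n * p))) ≤ a * L * (1 / 1024) := mul_le_mul_of_nonneg_left f4 (mul_nonneg ha0 hL0)
  have f7 : a * L / 128 ≤ (L / Λ) * (N * p ^ l) := by
    calc a * L / 128 = L / Λ * (a * Λ / 128) := by field_simp
      _ ≤ _ := mul_le_mul_of_nonneg_left hM (by positivity)
  have f8 : 0 ≤ a * L := mul_nonneg ha0 hL0
  linarith

lemma handshake {n : ℕ} (F : Finset (Sym2 (Fin n))) : ∑ v, deg F v ≤ 2 * F.card := by
  have h := Finset.sum_card_bipartiteAbove_eq_sum_card_bipartiteBelow (s := (Finset.univ : Finset (Fin n))) (t := F) (fun v e => v ∈ e)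
  have e1 : ∑ v, deg F v = ∑ e ∈ F, (Finset.bipartiteBelow (fun v e => v ∈ e) (Finset.univ : Finset (Fin n)) e).card := h
  rw [e1, mul_comm, ← smul_eq_mul]
  refine Finset.sum_le_card_nsmul _ _ _ fun e _ => ?_
  induction e with
  | _ a b =>
    refine (Finset.card_le_card (t := {a, b}) fun v hv => ?_).trans Finset.card_le_two
    simpa [Finset.bipartiteBelow] using hv

lemma insum {n : ℕ} (s : Finset (Sym2 (Fin n))) (W : Finset (Fin n)) :
    ∑ v ∈ W, (nb s v ∩ W).card ≤ 2 * (s.filter fun e => ∀ v ∈ e, v ∈ W).card := by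
  refine le_trans ?_ (handshake _)
  refine le_trans (Finset.sum_le_sum fun v hv => ?_) (Finset.sum_le_sum_of_subset (Finset.subset_univ W))
  rw [← card_nb]
  refine Finset.card_le_card fun w hw => ?_
  obtain ⟨h1, h2⟩ := Finset.mem_inter.1 hw
  rw [mem_nb] at h1 ⊢
  simp only [Finset.mem_filter, h1, true_and, Sym2.mem_iff]
  rintro x (rfl | rfl) <;> assumption

def Yof {n : ℕ} (U : Finset (Fin n)) (r : ℝ) (H : Finset (Sym2 (Fin n))) : Finset (Fin n) := (Uᶜ).filter fun y => r < ((nb H y ∩ U).card : ℝ)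

def Aof {n : ℕ} (U : Finset (Fin n)) (X : Finset (Sym2 (Fin n))) (v : Fin n) : Finset (Fin n) := if v ∈ U then nb X v \ U else ∅

def Bof {n : ℕ} (U : Finset (Fin n)) (r : ℝ) (H X : Finset (Sym2 (Fin n))) (v : Fin n) : Finset (Fin n) :=
  if v ∈ U ∧ (Aof U X v).Nonempty then ((nb H v \ U) \ Yof U r H) \ Aof U X v else ∅

/-- the second bad event, with the set `U` of high degree vertices exposed -/
def B2ev {n : ℕ} (l : ℕ) (p u0 D0 c r m : ℝ) (s : Finset (Sym2 (Fin n))) : Prop :=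
  ∃ U ∈ (Finset.univ : Finset (Finset (Fin n))).filter (fun U => (U.card : ℝ) ≤ u0), ∃ F1 ∈ B1set U D0 0 c,
    F1 ⊆ s ∧ ∃ X ⊆ s \ T1 U, (X.card : ℝ) ≤ m ∧ ((s \ T1 U).card : ℝ) ≤ 16 * (n * p) * u0 ∧ m / 2 ≤ ∑ v, ((Aof U X v).card : ℝ) ∧
      ∑ v, ((Aof U X v).card : ℝ) ≤ m ∧
      Cfg (Aof U X) (Bof U r (s \ T1 U) X) Uᶜ (n * p / 64) (16 * (n * p)) r (16 * (n * p ^ 2 + Real.log n)) ∧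
      noneOf (wit l (Aof U X) (Bof U r (s \ T1 U) X) Uᶜ F1) (fun q => pathE q.2) s

lemma nb_sdiff {n : ℕ} (s : Finset (Sym2 (Fin n))) {U : Finset (Fin n)} {v : Fin n} (hv : v ∈ U) : nb (s \ T1 U) v = nb s v := by
  ext w
  simp only [mem_nb, Finset.mem_sdiff, T1, Finset.mem_filter, not_and]
  refine ⟨fun h => h.1, fun h => ⟨h, fun _ h2 => h2 v (by simp) hv⟩⟩

lemma nb_sdiff' {n : ℕ} (s : Finset (Sym2 (Fin n))) {U : Finset (Fin n)} (y : Fin n) : nb (s \ T1 U) y ∩ U = nb s y ∩ U := by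
  ext w
  simp only [Finset.mem_inter, mem_nb, Finset.mem_sdiff, T1, Finset.mem_filter, not_and]
  refine ⟨fun h => ⟨h.1.1, h.2⟩, fun h => ⟨⟨h.1, fun _ h2 => h2 w (by simp) h.2⟩, h.2⟩⟩

lemma touch_card {n : ℕ} {s : Finset (Sym2 (Fin n))} {U : Finset (Fin n)} {Δ : ℝ} (h : ∀ v, (deg s v : ℝ) ≤ Δ) :
    ((s.filter fun e => ∃ v ∈ U, v ∈ e).card : ℝ) ≤ U.card * Δ := by
  have h1 : (s.filter fun e => ∃ v ∈ U, v ∈ e) ⊆ U.biUnion fun v => s.filter fun e => v ∈ e := by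
    intro e he
    obtain ⟨h1, v, h2, h3⟩ := Finset.mem_filter.1 he
    exact Finset.mem_biUnion.2 ⟨v, h2, Finset.mem_filter.2 ⟨h1, h3⟩⟩
  refine (Nat.cast_le.2 ((Finset.card_le_card h1).trans Finset.card_biUnion_le)).trans ?_
  push_cast
  rw [← nsmul_eq_mul]
  exact Finset.sum_le_card_nsmul _ _ _ fun v _ => h v

/-- the total size of the sets `Aof` when all edges cross -/
lemma sum_Aof {n : ℕ} {U : Finset (Fin n)} {X : Finset (Sym2 (Fin n))} (h : ∀ e ∈ X, ∃ u w, u ∈ U ∧ w ∉ U ∧ e = s(u, w)) :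
    ∑ v, (Aof U X v).card = X.card := by
  rw [← Finset.card_sigma]
  refine Finset.card_bij (fun q _ => s(q.1, q.2)) ?_ ?_ ?_
  · rintro ⟨v, w⟩ hq
    have hw := (Finset.mem_sigma.1 hq).2
    unfold Aof at hw
    split_ifs at hw with hv
    · exact mem_nb.1 (Finset.mem_sdiff.1 hw).1
    · simp at hw
  · rintro ⟨v, w⟩ hq ⟨v', w'⟩ hq' he
    have hw := (Finset.mem_sigma.1 hq).2
    have hw' := (Finset.mem_sigma.1 hq').2
    unfold Aof at hw hw'
    split_ifs at hw with hv
    · split_ifs at hw' with hv'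
      · simp only [Finset.mem_sdiff] at hw hw'
        rcases Sym2.eq_iff.1 he with ⟨h1, h2⟩ | ⟨h1, h2⟩
        · simp only at h1 h2; rw [h1, h2]
        · simp only at h1 h2 hv; exact absurd (h1 ▸ hv) hw'.2
      · simp at hw'
    · simp at hw
  · intro e he
    obtain ⟨u, w, hu, hw, rfl⟩ := h e he
    refine ⟨⟨u, w⟩, Finset.mem_sigma.2 ⟨Finset.mem_univ _, ?_⟩, rfl⟩
    simp only [Aof, hu, if_true, Finset.mem_sdiff, mem_nb]
    exact ⟨he, hw⟩

/-- a witness closes up to a cycle with exactly one edge in `F` -/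
lemma wit_none {n l : ℕ} {s F F1 : Finset (Sym2 (Fin n))} {U : Finset (Fin n)} (hP : Perp (l + 1) s F) (hs : s ⊆ KE n) (hF1 : F ∩ T1 U ⊆ F1)
    {A B : Fin n → Finset (Fin n)} (hA : ∀ v, ∀ w ∈ A v, s(v, w) ∈ F) (hB : ∀ v, ∀ w ∈ B v, s(v, w) ∈ s ∧ s(v, w) ∉ F) (hU : ∀ v, (A v).Nonempty → v ∈ U) :
    noneOf (wit l A B Uᶜ F1) (fun q => pathE q.2) s := by
  rintro ⟨v, x⟩ hq hsub
  obtain ⟨hx, h0, hl, hR, hd⟩ := mem_wit.1 hq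
  simp only at hx h0 hl hR hd hsub
  have hvU : v ∈ U := hU v ⟨_, hl⟩
  have hz : pathE (Fin.cons v x : Fin (l + 1 + 1) → Fin n) = insert s(v, x 0) (pathE x) := by
    ext e
    simp only [mem_pathE, Finset.mem_insert, pe]
    rw [Fin.exists_fin_succ]
    simp only [Fin.cons_succ, Fin.castSucc_zero, Fin.cons_zero, ← Fin.succ_castSucc]
    rw [eq_comm (a := s(v, x 0))]
  refine perp_bridge hP (x := (Fin.cons v x : Fin (l + 1 + 1) → Fin n)) ?_ ?_ ?_ ?_
  · refine Fin.cons_injective_iff.2 ⟨?_, hx⟩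
    rintro ⟨t, rfl⟩
    exact (Finset.mem_compl.1 (hR t)) hvU
  · have : Fin.last (l + 1) = (Fin.last l).succ := rfl
    rw [this, Fin.cons_succ, Fin.cons_zero]
    exact hA v _ hl
  · rw [hz, Finset.disjoint_left]
    intro e he heF
    rcases Finset.mem_insert.1 he with rfl | he
    · exact (hB v _ h0).2 heF
    · refine Finset.disjoint_left.1 hd he (hF1 (Finset.mem_inter.2 ⟨heF, ?_⟩))
      refine Finset.mem_filter.2 ⟨hs (hsub he), ?_⟩
      obtain ⟨i, rfl⟩ := mem_pathE.1 he
      intro w hw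
      rcases Sym2.mem_iff.1 hw with rfl | rfl <;> exact Finset.mem_compl.1 (hR _)
  · rw [hz]
    exact Finset.insert_subset (hB v _ h0).1 hsub

lemma mem_Aof {n : ℕ} {U : Finset (Fin n)} {X : Finset (Sym2 (Fin n))} {v w : Fin n} : w ∈ Aof U X v ↔ v ∈ U ∧ w ∉ U ∧ s(v, w) ∈ X := by
  unfold Aof; split_ifs with h
  · simp [h, mem_nb, and_comm]
  · simp [h]

lemma mem_Bof {n : ℕ} {U : Finset (Fin n)} {r : ℝ} {H X : Finset (Sym2 (Fin n))} {v w : Fin n} :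
    w ∈ Bof U r H X v ↔ v ∈ U ∧ (Aof U X v).Nonempty ∧ s(v, w) ∈ H ∧ w ∉ U ∧ w ∉ Yof U r H ∧ w ∉ Aof U X v := by
  unfold Bof; split_ifs with h
  · simp only [h.1, h.2, Finset.mem_sdiff, mem_nb, true_and]; tauto
  · rw [not_and] at h
    constructor
    · intro h; simp at h
    · intro h'; exact absurd h'.2.1 (h h'.1)

set_option maxHeartbeats 1000000 in
lemma B2_cover {n l : ℕ} {s F : Finset (Sym2 (Fin n))} {p : ℝ} (hs : s ⊆ KE n) (hP : Perp (l + 1) s F) (hT : Typ p s) (h0 : 0 ≤ p) (hnp : 0 < n * p)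
    (hn : 1 ≤ n) (hdeg : ∀ v, 2 * deg F v ≤ deg s v) {D0 r m u0 c : ℝ} (hm : (F.card : ℝ) = m) (hD0 : 0 < D0) (hr : 0 < r) (hu0 : 2 * m ≤ u0 * D0)
    (hX1 : 2 * u0 * p + Real.log n ≤ r / 512) (hX2 : (2 * u0 * p + Real.log n) * u0 ≤ m / 2 ^ 19) {U : Finset (Fin n)}
    (hU : U = Finset.univ.filter fun v => D0 ≤ (deg F v : ℝ)) (hF1 : ((F ∩ T1 U).card : ℝ) ≤ c) (hc : c ≤ m / 8) : B2ev l p u0 D0 c r m s := by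
  have hlog : 0 ≤ Real.log n := Real.log_nonneg (by exact_mod_cast hn)
  obtain ⟨hT1, hT2, hT3, hT4⟩ := hT
  have hFs := hP.1
  have hm0 : 0 ≤ m := by rw [← hm]; positivity
  have hUu : (U.card : ℝ) ≤ u0 := by
    refine le_of_mul_le_mul_right (le_trans ?_ hu0) hD0
    have h1 : (U.card : ℝ) * D0 ≤ ∑ v ∈ U, (deg F v : ℝ) := by
      rw [← nsmul_eq_mul]
      refine Finset.card_nsmul_le_sum _ _ _ fun v hv => ?_
      rw [hU] at hv; exact (Finset.mem_filter.1 hv).2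
    have h2 : ∑ v ∈ U, (deg F v : ℝ) ≤ ∑ v, (deg F v : ℝ) := Finset.sum_le_sum_of_subset_of_nonneg (Finset.subset_univ _) (fun _ _ _ => by positivity)
    have h3 : ∑ v, (deg F v : ℝ) ≤ 2 * F.card := by exact_mod_cast handshake F
    rw [hm] at h3; linarith
  set x : ℝ := 2 * u0 * p + Real.log n with hx
  have hu00 : 0 ≤ u0 := (Nat.cast_nonneg _).trans hUu
  have hx0 : 0 ≤ x := by positivity
  set u : ℝ := (U.card : ℝ) with hu
  have hux : u * x ≤ m / 2 ^ 19 := le_trans (by rw [mul_comm]; gcongr) hX2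
  -- edges inside `U ∪ Y'`
  have hin : ∀ Y' : Finset (Fin n), (Y'.card : ℝ) ≤ u → ((s.filter fun e => ∀ v ∈ e, v ∈ U ∪ Y').card : ℝ) ≤ 16 * (u * x) := by
    intro Y' hY'
    refine (hT4 (U ∪ Y')).trans ?_
    have h1 : ((U ∪ Y').card : ℝ) ≤ 2 * u := by
      have : ((U ∪ Y').card : ℝ) ≤ U.card + Y'.card := by exact_mod_cast Finset.card_union_le _ _
      linarith
    have h2 : ((U ∪ Y').card : ℝ) * p + Real.log n ≤ x := by
      rw [hx]; gcongr; linarith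
    calc 8 * (((U ∪ Y').card : ℝ) * (((U ∪ Y').card : ℝ) * p + Real.log n)) ≤ 8 * ((2 * u) * x) := by gcongr
      _ = _ := by ring
  set Y := Yof U r s with hY
  have hsub : ∀ Y' ⊆ Y, (Y'.card : ℝ) ≤ u → Y'.card * r ≤ 32 * (u * x) := by
    intro Y' hY' hc
    have h1 : (Y'.card : ℝ) * r ≤ ∑ y ∈ Y', ((nb s y ∩ U).card : ℝ) := by
      rw [← nsmul_eq_mul]
      exact Finset.card_nsmul_le_sum _ _ _ fun y hy => (Finset.mem_filter.1 (hY' hy)).2.le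
    have h2 : ∑ y ∈ Y', ((nb s y ∩ U).card : ℝ) ≤ ∑ y ∈ U ∪ Y', ((nb s y ∩ (U ∪ Y')).card : ℝ) := by
      refine (Finset.sum_le_sum fun y _ => ?_).trans (Finset.sum_le_sum_of_subset_of_nonneg Finset.subset_union_right (fun _ _ _ => by positivity))
      exact_mod_cast Finset.card_le_card (Finset.inter_subset_inter_left Finset.subset_union_left)
    have h3 : ∑ y ∈ U ∪ Y', ((nb s y ∩ (U ∪ Y')).card : ℝ) ≤ 2 * ((s.filter fun e => ∀ v ∈ e, v ∈ U ∪ Y').card : ℝ) := by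
      exact_mod_cast insum s (U ∪ Y')
    have := hin Y' hc
    linarith
  have hYu : (Y.card : ℝ) ≤ u := by
    by_contra hcon
    push Not at hcon
    have hcon' : U.card ≤ Y.card := by rw [hu] at hcon; exact_mod_cast hcon.le
    obtain ⟨Y', hY', hYc⟩ := Finset.exists_subset_card_eq hcon'
    have h1 := hsub Y' hY' (by rw [hYc])
    rw [hYc] at h1
    rcases Nat.eq_zero_or_pos U.card with h | h
    · rw [hu, h] at hcon
      have : Y.Nonempty := Finset.card_pos.1 (by exact_mod_cast hcon)
      obtain ⟨y, hy⟩ := this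
      have := (Finset.mem_filter.1 hy).2
      rw [Finset.card_eq_zero.1 h] at this
      simp at this
      linarith
    · have hu' : 0 < u := by rw [hu]; exact_mod_cast h
      have : r ≤ 32 * x := le_of_mul_le_mul_left (by rw [← hu] at h1; linarith) hu'
      linarith
  have hW := hin Y hYu
  set W := U ∪ Y with hWd
  set Ub := U.filter (fun v => (n : ℝ) * p / 64 < ((nb s v ∩ W).card : ℝ)) with hUb
  have hUbc : (Ub.card : ℝ) * (n * p) ≤ 2048 * (u * x) := by
    have h1 : (Ub.card : ℝ) * (n * p / 64) ≤ ∑ v ∈ Ub, ((nb s v ∩ W).card : ℝ) := by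
      rw [← nsmul_eq_mul]
      exact Finset.card_nsmul_le_sum _ _ _ fun y hy => (Finset.mem_filter.1 hy).2.le
    have h2 : ∑ v ∈ Ub, ((nb s v ∩ W).card : ℝ) ≤ ∑ v ∈ W, ((nb s v ∩ W).card : ℝ) :=
      Finset.sum_le_sum_of_subset_of_nonneg ((Finset.filter_subset _ _).trans Finset.subset_union_left) (fun _ _ _ => by positivity)
    have h3 : ∑ y ∈ W, ((nb s y ∩ W).card : ℝ) ≤ 2 * ((s.filter fun e => ∀ v ∈ e, v ∈ W).card : ℝ) := by
      exact_mod_cast insum s W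
    linarith
  set X := F.filter (fun e => ∃ v w, e = s(v, w) ∧ v ∈ U ∧ v ∉ Ub ∧ w ∉ W) with hXd
  have hXF : X ⊆ F := Finset.filter_subset _ _
  have hcov : F ⊆ (F ∩ T1 U) ∪ (s.filter fun e => ∀ v ∈ e, v ∈ W) ∪ (s.filter fun e => ∃ v ∈ Ub, v ∈ e) ∪ X := by
    have key : ∀ a b : Fin n, s(a, b) ∈ F → a ∈ U → s(a, b) ∈ (F ∩ T1 U) ∪ (s.filter fun e => ∀ v ∈ e, v ∈ W) ∪ (s.filter fun e => ∃ v ∈ Ub, v ∈ e) ∪ X := by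
      intro a b he ha
      by_cases hb : b ∈ W
      · refine Finset.mem_union_left _ (Finset.mem_union_left _ (Finset.mem_union_right _ (Finset.mem_filter.2 ⟨hFs he, ?_⟩)))
        intro v hv
        rcases Sym2.mem_iff.1 hv with rfl | rfl
        · exact Finset.mem_union_left _ ha
        · exact hb
      by_cases hab : a ∈ Ub
      · exact Finset.mem_union_left _ (Finset.mem_union_right _ (Finset.mem_filter.2 ⟨hFs he, a, hab, by simp⟩))
      · exact Finset.mem_union_right _ (Finset.mem_filter.2 ⟨he, a, b, rfl, ha, hab, hb⟩)
    intro e he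
    induction e with
    | _ a b =>
      by_cases ha : a ∈ U
      · exact key a b he ha
      by_cases hb : b ∈ U
      · rw [Sym2.eq_swap] at he ⊢; exact key b a he hb
      refine Finset.mem_union_left _ (Finset.mem_union_left _ (Finset.mem_union_left _ (Finset.mem_inter.2 ⟨he, Finset.mem_filter.2 ⟨hs (hFs he), ?_⟩⟩)))
      intro v hv
      rcases Sym2.mem_iff.1 hv with rfl | rfl <;> assumption
  have hXc : m / 2 ≤ X.card := by
    have h1 : F.card ≤ (F ∩ T1 U).card + (s.filter fun e => ∀ v ∈ e, v ∈ W).card + (s.filter fun e => ∃ v ∈ Ub, v ∈ e).card + X.card := by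
      refine (Finset.card_le_card hcov).trans ((Finset.card_union_le _ _).trans ?_)
      gcongr
      refine (Finset.card_union_le _ _).trans ?_
      gcongr
      exact Finset.card_union_le _ _
    have h2 : (F.card : ℝ) ≤ (F ∩ T1 U).card + (s.filter fun e => ∀ v ∈ e, v ∈ W).card + (s.filter fun e => ∃ v ∈ Ub, v ∈ e).card + X.card := by
      exact_mod_cast h1
    have h3 := touch_card (U := Ub) hT2
    norm_num at hux
    rw [hm] at h2
    linarith
  have hXm : (X.card : ℝ) ≤ m := by rw [← hm]; exact_mod_cast Finset.card_le_card hXF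
  have hcross : ∀ e ∈ X, ∃ u w, u ∈ U ∧ w ∉ U ∧ e = s(u, w) := by
    intro e he
    obtain ⟨_, v, w, h1, h2, _, h3⟩ := Finset.mem_filter.1 he
    exact ⟨v, w, h2, fun h => h3 (Finset.mem_union_left _ h), h1⟩
  have hsumA : ∑ v, ((Aof U X v).card : ℝ) = X.card := by exact_mod_cast sum_Aof hcross
  have hYH : Yof U r (s \ T1 U) = Y := by
    rw [hY]; unfold Yof; simp only [nb_sdiff']
  have hXmem : ∀ v w, v ∈ U → w ∉ U → s(v, w) ∈ X → v ∉ Ub ∧ w ∉ W := by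
    intro v w hv hw he
    obtain ⟨_, v', w', h1, h2, h3, h4⟩ := Finset.mem_filter.1 he
    rcases Sym2.eq_iff.1 h1 with ⟨rfl, rfl⟩ | ⟨rfl, rfl⟩
    · exact ⟨h3, h4⟩
    · exact absurd h2 hw
  have hAs : ∀ v, Aof U X v ⊆ nb s v := fun v w hw => mem_nb.2 (hFs (hXF (mem_Aof.1 hw).2.2))
  have hBs : ∀ v, Bof U r (s \ T1 U) X v ⊆ nb s v := fun v w hw => mem_nb.2 (Finset.mem_sdiff.1 (mem_Bof.1 hw).2.2.1).1
  have hAB : ∀ v, Aof U X v ∪ Bof U r (s \ T1 U) X v ⊆ nb s v := fun v => Finset.union_subset (hAs v) (hBs v)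
  have hABU : ∀ v w, w ∈ Aof U X v ∪ Bof U r (s \ T1 U) X v → v ∈ U ∧ w ∉ U ∧ w ∉ Y := by
    intro v w hw
    rcases Finset.mem_union.1 hw with hw | hw
    · obtain ⟨h1, h2, h3⟩ := mem_Aof.1 hw
      exact ⟨h1, h2, fun h => (hXmem v w h1 h2 h3).2 (Finset.mem_union_right _ h)⟩
    · obtain ⟨h1, _, _, h2, h3, _⟩ := mem_Bof.1 hw
      exact ⟨h1, h2, hYH ▸ h3⟩
  refine ⟨U, Finset.mem_filter.2 ⟨Finset.mem_univ _, hUu⟩, F ∩ T1 U, Finset.mem_filter.2 ⟨Finset.mem_powerset.2 Finset.inter_subset_right, ?_, by positivity, hF1⟩,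
    Finset.inter_subset_left.trans hFs, X, ?_, hXm, ?_, by rw [hsumA]; exact hXc, by rw [hsumA]; exact hXm, ?_, ?_⟩
  · intro v
    by_cases hv : v ∈ U
    · have : deg (F ∩ T1 U) v = 0 := by
        refine Finset.card_eq_zero.2 (Finset.filter_eq_empty_iff.2 fun e he hve => ?_)
        exact (Finset.mem_filter.1 (Finset.mem_inter.1 he).2).2 v hve hv
      rw [this]; simpa using hD0.le
    · have h1 : deg (F ∩ T1 U) v ≤ deg F v := Finset.card_le_card (Finset.filter_subset_filter _ Finset.inter_subset_left)
      have h2 : ¬ D0 ≤ (deg F v : ℝ) := fun h => hv (by rw [hU]; exact Finset.mem_filter.2 ⟨Finset.mem_univ _, h⟩)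
      have h3 : (deg (F ∩ T1 U) v : ℝ) ≤ deg F v := by exact_mod_cast h1
      linarith
  · intro e he
    refine Finset.mem_sdiff.2 ⟨hFs (hXF he), fun hT => ?_⟩
    obtain ⟨a, b, ha, _, rfl⟩ := hcross e he
    exact (Finset.mem_filter.1 hT).2 a (by simp) ha
  · have h1 : s \ T1 U ⊆ s.filter fun e => ∃ v ∈ U, v ∈ e := by
      intro e he
      obtain ⟨h1, h2⟩ := Finset.mem_sdiff.1 he
      refine Finset.mem_filter.2 ⟨h1, ?_⟩
      by_contra hcon
      push Not at hcon
      exact h2 (Finset.mem_filter.2 ⟨hs h1, fun v hv hvU => hcon v hvU hv⟩)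
    have h2 : ((s \ T1 U).card : ℝ) ≤ (s.filter fun e => ∃ v ∈ U, v ∈ e).card := by exact_mod_cast Finset.card_le_card h1
    refine h2.trans ((touch_card (U := U) hT2).trans ?_)
    rw [mul_comm]; gcongr
  · have hdle : ∀ v (S : Finset (Fin n)), S ⊆ nb s v → (S.card : ℝ) ≤ 16 * (n * p) := fun v S hS =>
      le_trans (by rw [← card_nb]; exact_mod_cast Finset.card_le_card hS) (hT2 v)
    refine ⟨fun v => ?_, fun v w hw => Finset.mem_compl.2 (mem_Aof.1 hw).2.1, fun v w hw => Finset.mem_compl.2 (mem_Bof.1 hw).2.2.2.1,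
      fun v hv => ?_, fun v => hdle v _ (hAs v), fun v => hdle v _ (hBs v), fun y => ?_, fun v v' hvv => ?_⟩
    · exact Finset.disjoint_left.2 fun w hw hw' => (mem_Bof.1 hw').2.2.2.2.2 hw
    · obtain ⟨w, hw⟩ := hv
      obtain ⟨h1, h2, h3⟩ := mem_Aof.1 hw
      have hvb := (hXmem v w h1 h2 h3).1
      have h4 : ((nb s v ∩ W).card : ℝ) ≤ n * p / 64 := by
        by_contra hcon
        push Not at hcon
        exact hvb (Finset.mem_filter.2 ⟨h1, hcon⟩)
      have h5 : nb s v ⊆ (nb s v ∩ W) ∪ nb F v ∪ Bof U r (s \ T1 U) X v := by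
        intro z hz
        by_cases hzW : z ∈ W
        · exact Finset.mem_union_left _ (Finset.mem_union_left _ (Finset.mem_inter.2 ⟨hz, hzW⟩))
        by_cases hzA : z ∈ Aof U X v
        · exact Finset.mem_union_left _ (Finset.mem_union_right _ (mem_nb.2 (hXF (mem_Aof.1 hzA).2.2)))
        · refine Finset.mem_union_right _ (mem_Bof.2 ⟨h1, ⟨w, hw⟩, ?_, fun h => hzW (Finset.mem_union_left _ h),
            by rw [hYH]; exact fun h => hzW (Finset.mem_union_right _ h), hzA⟩)
          rw [← mem_nb, nb_sdiff s h1]; exact hz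
      have h6 : deg s v ≤ (nb s v ∩ W).card + deg F v + (Bof U r (s \ T1 U) X v).card := by
        rw [← card_nb, ← card_nb]
        refine (Finset.card_le_card h5).trans ((Finset.card_union_le _ _).trans ?_)
        gcongr
        exact Finset.card_union_le _ _
      have h7 : (deg s v : ℝ) ≤ (nb s v ∩ W).card + deg F v + (Bof U r (s \ T1 U) X v).card := by exact_mod_cast h6
      have h8 : 2 * (deg F v : ℝ) ≤ deg s v := by exact_mod_cast hdeg v
      have h9 := hT1 v
      linarith
    · by_cases hy : y ∈ U ∨ y ∈ Y
      · rw [Finset.card_eq_zero.2]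
        · simpa using hr.le
        · refine Finset.filter_eq_empty_iff.2 fun v _ h => ?_
          obtain ⟨_, h1, h2⟩ := hABU v y h
          exact hy.elim h1 h2
      · push Not at hy
        have h1 : ((nb s y ∩ U).card : ℝ) ≤ r := by
          by_contra hcon
          push Not at hcon
          exact hy.2 (Finset.mem_filter.2 ⟨Finset.mem_compl.2 hy.1, hcon⟩)
        refine le_trans ?_ h1
        refine Nat.cast_le.2 (Finset.card_le_card fun v hv => ?_)
        have hv := (Finset.mem_filter.1 hv).2
        refine Finset.mem_inter.2 ⟨mem_nb.2 ?_, (hABU v y hv).1⟩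
        rw [Sym2.eq_swap]; exact mem_nb.1 (hAB v hv)
    · refine le_trans ?_ (hT3 v v' hvv)
      exact_mod_cast Finset.card_le_card (Finset.inter_subset_inter (hAB v) (hAB v'))
  · refine wit_none hP hs le_rfl (fun v w hw => hXF (mem_Aof.1 hw).2.2) (fun v w hw => ⟨mem_nb.1 (hBs v hw), fun hF => ?_⟩) (fun v ⟨w, hw⟩ => (mem_Aof.1 hw).1)
    obtain ⟨h1, ⟨z, hz⟩, _, h2, h3, h4⟩ := mem_Bof.1 hw
    obtain ⟨g1, g2, g3⟩ := mem_Aof.1 hz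
    refine h4 (mem_Aof.2 ⟨h1, h2, Finset.mem_filter.2 ⟨hF, v, w, rfl, h1, (hXmem v z g1 g2 g3).1, ?_⟩⟩)
    rw [hWd, Finset.mem_union]; rintro (h | h)
    · exact h2 h
    · exact h3 (hYH ▸ h)

lemma sum_small {γ : Type*} [DecidableEq γ] (E : Finset γ) {M q x : ℝ} (hq : 0 ≤ q) (hx : 0 < x) (hx1 : x ≤ 1) :
    ∑ S ∈ E.powerset.filter (fun S => (S.card : ℝ) ≤ M), q ^ S.card ≤ Real.exp (M * (-Real.log x) + q * x * E.card) := by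
  have hlog : Real.log x ≤ 0 := Real.log_nonpos hx.le hx1
  calc ∑ S ∈ E.powerset.filter (fun S => (S.card : ℝ) ≤ M), q ^ S.card
      ≤ ∑ S ∈ E.powerset, Real.exp (M * (-Real.log x)) * (q * x) ^ S.card := by
        refine (Finset.sum_le_sum fun S hS => ?_).trans (Finset.sum_le_sum_of_subset_of_nonneg (Finset.filter_subset _ _) (fun _ _ _ => by positivity))
        have hS := (Finset.mem_filter.1 hS).2
        have : 1 ≤ Real.exp (M * (-Real.log x)) * x ^ S.card := by
          conv_rhs => rw [← Real.exp_log hx]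
          rw [← Real.exp_nat_mul, ← Real.exp_add, Real.log_exp]
          refine Real.one_le_exp ?_
          nlinarith
        rw [mul_pow]
        calc q ^ S.card = 1 * q ^ S.card := (one_mul _).symm
          _ ≤ (Real.exp (M * (-Real.log x)) * x ^ S.card) * q ^ S.card := by gcongr
          _ = _ := by ring
    _ = Real.exp (M * (-Real.log x)) * (q * x + 1) ^ E.card := by
        rw [← Finset.mul_sum]
        congr 1
        have := Finset.sum_pow_mul_eq_add_pow (q * x) 1 E
        simpa using this
    _ ≤ Real.exp (M * (-Real.log x)) * (Real.exp (q * x)) ^ E.card := by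
        gcongr; exact Real.add_one_le_exp _
    _ = _ := by rw [← Real.exp_nat_mul, ← Real.exp_add]; congr 1; ring

set_option maxHeartbeats 1000000 in
lemma B2_bound {n l : ℕ} (hl : 1 ≤ l) (hn : 1 ≤ n) {p : ℝ} (h0 : 0 ≤ p) (h1 : p ≤ 1) (hnp : 1 ≤ n * p)
    {u0 D0 c r m L x y : ℝ} (hL0 : 0 ≤ L) (hL : L ≤ lam n (l + 1) p) (hD0 : 0 ≤ D0)
    (hu : l * (u0 / n) ≤ 1 / 4) (hD : (l + 1) ^ 2 * (D0 + 1) ≤ n * p / 256)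
    (ha1 : 2 ^ l * (l + 1) ^ (l + 1) * (16 * (m / (n ^ 2 * p)) + 33 * (r / (n * p))) * L ≤ 1 / 4)
    (ha2 : 2048 * (r * (16 * (n * p ^ 2 + Real.log n)) * L) ≤ lam n (l + 1) p * (n * p))
    (hx : 0 < x) (hx1 : x ≤ 1) (hy : 0 < y) (hy1 : y ≤ 1) (hu0 : 0 ≤ u0) :
    pr (KE n) p (B2ev l p u0 D0 c r m) ≤ 3 * Real.exp (u0 * Real.log n) *
      (Real.exp (c * (-Real.log x) + p * x * n ^ 2) * (Real.exp (m * (-Real.log y) + y * (16 * (n * p) * u0)) * Real.exp (-(m * L / 1024)))) := by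
  have hn0 : (0 : ℝ) < n := by exact_mod_cast hn
  have hlog : 0 ≤ Real.log n := Real.log_nonneg (by exact_mod_cast hn)
  refine (pr_exists_le h0 h1 _ _).trans ?_
  refine (Finset.sum_le_card_nsmul _ _ (Real.exp (c * (-Real.log x) + p * x * n ^ 2) *
    (Real.exp (m * (-Real.log y) + y * (16 * (n * p) * u0)) * Real.exp (-(m * L / 1024)))) fun U hU => ?_).trans ?_
  swap
  · rw [nsmul_eq_mul]
    gcongr
    exact count_U hn u0
  have hU := (Finset.mem_filter.1 hU).2
  rw [pr, ex_split (T1_sub U)]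
  refine ex_le_const h0 h1 fun s0 hs0 => ?_
  have hd : ∀ t ⊆ T1 U, (s0 ∪ t) \ T1 U = s0 := by
    intro t ht
    have hs : ∀ e ∈ s0, e ∉ T1 U := fun e he => (Finset.mem_sdiff.1 (hs0 he)).2
    ext e; simp only [Finset.mem_sdiff, Finset.mem_union]
    exact ⟨fun h => h.1.resolve_right fun h' => h.2 (ht h'), fun h => ⟨Or.inl h, hs e h⟩⟩
  set Xs := s0.powerset.filter (fun X => (X.card : ℝ) ≤ m ∧ (s0.card : ℝ) ≤ 16 * (n * p) * u0 ∧ m / 2 ≤ ∑ v, ((Aof U X v).card : ℝ) ∧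
      ∑ v, ((Aof U X v).card : ℝ) ≤ m ∧
      Cfg (Aof U X) (Bof U r s0 X) Uᶜ (n * p / 64) (16 * (n * p)) r (16 * (n * p ^ 2 + Real.log n))) with hXs
  have e1 : ex (T1 U) p (fun t => ind (∃ F1 ∈ B1set U D0 0 c,
    F1 ⊆ s0 ∪ t ∧ ∃ X ⊆ (s0 ∪ t) \ T1 U, (X.card : ℝ) ≤ m ∧ (((s0 ∪ t) \ T1 U).card : ℝ) ≤ 16 * (n * p) * u0 ∧ m / 2 ≤ ∑ v, ((Aof U X v).card : ℝ) ∧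
      ∑ v, ((Aof U X v).card : ℝ) ≤ m ∧
      Cfg (Aof U X) (Bof U r ((s0 ∪ t) \ T1 U) X) Uᶜ (n * p / 64) (16 * (n * p)) r (16 * (n * p ^ 2 + Real.log n)) ∧
      noneOf (wit l (Aof U X) (Bof U r ((s0 ∪ t) \ T1 U) X) Uᶜ F1) (fun q => pathE q.2) (s0 ∪ t))) ≤
      pr (T1 U) p (fun t => ∃ F1 ∈ B1set U D0 0 c, ∃ X ∈ Xs, F1 ⊆ t ∧ noneOf (wit l (Aof U X) (Bof U r s0 X) Uᶜ F1) (fun q => pathE q.2) t) := by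
    refine ex_mono h0 h1 fun t ht => ind_mono fun h => ?_
    rw [hd t ht] at h
    obtain ⟨F1, hF1, hF1t, X, hX, b1, b2, b3, b4, b5, b6⟩ := h
    refine ⟨F1, hF1, X, Finset.mem_filter.2 ⟨Finset.mem_powerset.2 hX, b1, b2, b3, b4, b5⟩, ?_, ?_⟩
    · intro e he
      refine (Finset.mem_union.1 (hF1t he)).resolve_left fun h => (Finset.mem_sdiff.1 (hs0 h)).2 ?_
      exact Finset.mem_powerset.1 (Finset.mem_filter.1 hF1).1 he
    · exact fun q hq hqt => b6 q hq (hqt.trans Finset.subset_union_right)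
  refine e1.trans ((pr_exists_le h0 h1 _ _).trans ?_)
  have hone : ∀ F1 ∈ B1set U D0 0 c, ∀ X ∈ Xs,
      pr (T1 U) p (fun t => F1 ⊆ t ∧ noneOf (wit l (Aof U X) (Bof U r s0 X) Uᶜ F1) (fun q => pathE q.2) t) ≤ p ^ F1.card * Real.exp (-(m * L / 1024)) := by
    intro F1 hF1 X hX
    obtain ⟨hFT, hdF, -, -⟩ := Finset.mem_filter.1 hF1
    have hFT := Finset.mem_powerset.1 hFT
    obtain ⟨hXs0, b1, b2, b3, b4, b5⟩ := Finset.mem_filter.1 hX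
    unfold pr
    rw [ex_congr (g := fun s => ind (F1 ⊆ s) * ind (noneOf (wit l (Aof U X) (Bof U r s0 X) Uᶜ F1) (fun q => pathE q.2) s)) (fun s _ => ind_and _ _), ex_superset hFT]
    gcongr
    have hb := wit_janson (E := T1 U \ F1) hl h0 h1 hnp b5 (by positivity) F1 hD0 hdF ?_ ?_ hL0 hL ?_ ha2
    · refine le_trans ?_ (hb.trans (Real.exp_le_exp.2 ?_))
      · refine ex_mono h0 h1 fun s hs => ind_mono fun h q hq hqs => ?_
        exact h q hq (hqs.trans Finset.subset_union_left)
      · nlinarith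
    · have hc : ((Uᶜ).card : ℝ) = n * (1 + -(U.card / n)) := by
        rw [Finset.card_compl, Fintype.card_fin, Nat.cast_sub (by simpa using Finset.card_le_univ U)]
        field_simp; ring
      have hUn : (U.card : ℝ) / n ≤ 1 := by
        rw [div_le_one hn0]; exact_mod_cast (by simpa using Finset.card_le_univ U : U.card ≤ n)
      have hber := one_add_mul_le_pow (a := -((U.card : ℝ) / n)) (by linarith) (l - 1)
      have h3 : ((l - 1 : ℕ) : ℝ) * (U.card / n) ≤ 1 / 4 := by
        refine le_trans ?_ hu
        gcongr
        exact_mod_cast (by omega : l - 1 ≤ l)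
      have h4 : 3 / 4 ≤ (1 + -((U.card : ℝ) / n)) ^ (l - 1) := by linarith
      rw [hc, mul_pow]
      have h5 : 0 < (n : ℝ) ^ (l - 1) := by positivity
      have h6 : (n : ℝ) * p / 128 + (l + 1) ^ 2 * (D0 + 1) ≤ n * p / 64 * (1 + -((U.card : ℝ) / n)) ^ (l - 1) := by nlinarith
      have h7 := mul_le_mul_of_nonneg_left h6 h5.le
      linarith
    · intro q hq
      obtain ⟨q1, q2, q3, q4, q5⟩ := mem_wit.1 hq
      refine Finset.subset_sdiff.2 ⟨fun e he => Finset.mem_filter.2 ⟨pathE_sub_KE q1 he, ?_⟩, q5⟩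
      obtain ⟨i, rfl⟩ := mem_pathE.1 he
      intro w hw
      rcases Sym2.mem_iff.1 hw with rfl | rfl <;> exact Finset.mem_compl.1 (q4 _)
    · refine le_trans ?_ ha1
      gcongr
  refine (Finset.sum_le_sum (g := fun F1 => p ^ F1.card * (Xs.card * Real.exp (-(m * L / 1024)))) fun F1 hF1 => ?_).trans ?_
  · refine (pr_exists_le h0 h1 _ _).trans ((Finset.sum_le_card_nsmul _ _ _ (hone F1 hF1)).trans (le_of_eq ?_))
    rw [nsmul_eq_mul]; ring
  rw [← Finset.sum_mul]
  have hF : ∑ F1 ∈ B1set U D0 0 c, p ^ F1.card ≤ Real.exp (c * (-Real.log x) + p * x * n ^ 2) := by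
    have hk : ((KE n).card : ℝ) ≤ n ^ 2 := by have := card_KE_le n; nlinarith [sq_nonneg (n : ℝ)]
    refine le_trans ?_ ((sum_small (KE n) h0 hx hx1).trans (Real.exp_le_exp.2 (add_le_add le_rfl (mul_le_mul_of_nonneg_left hk (by positivity)))))
    refine Finset.sum_le_sum_of_subset_of_nonneg (fun F1 hF1 => ?_) (fun _ _ _ => by positivity)
    obtain ⟨hFT, -, -, hc⟩ := Finset.mem_filter.1 hF1
    exact Finset.mem_filter.2 ⟨Finset.mem_powerset.2 ((Finset.mem_powerset.1 hFT).trans (T1_sub U)), hc⟩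
  have hXc : (Xs.card : ℝ) ≤ Real.exp (m * (-Real.log y) + y * (16 * (n * p) * u0)) := by
    rcases Xs.eq_empty_or_nonempty with h | ⟨X, hX⟩
    · rw [h]; simp; positivity
    · have hc := (Finset.mem_filter.1 hX).2.2.1
      have h2 := sum_small s0 (M := m) zero_le_one hy hy1
      refine le_trans ?_ (h2.trans (Real.exp_le_exp.2 ?_))
      · simp only [one_pow, Finset.sum_const, nsmul_eq_mul, mul_one]
        refine Nat.cast_le.2 (Finset.card_le_card fun X hX => ?_)
        obtain ⟨h1, h2, -⟩ := Finset.mem_filter.1 hX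
        exact Finset.mem_filter.2 ⟨h1, h2⟩
      · rw [one_mul]; gcongr
  gcongr

/-- numerical requirements on the constants -/
structure Par (l : ℕ) (ε δ' δ'' σ : ℝ) : Prop where
  he : 0 < ε
  he1 : ε ≤ 1 / 12
  hd : 0 < δ'
  hd2 : 0 < δ''
  hs : 0 < σ
  s1 : (l + 1) * (2 * σ / δ') ≤ ε / 96
  s2 : (l + 2) ^ 2 * σ ≤ ε / 96
  s3 : Ck (l + 1) * σ ≤ ε / 192
  s4 : 16384 * σ ≤ δ'
  s5 : 4 * σ / δ' + σ ≤ δ'' / 512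
  s6 : 8 * σ / δ' ^ 2 + 2 * σ / δ' ≤ 1 / 2 ^ 19
  s7 : (l + 1) ^ 2 * σ ≤ 1 / 512
  s8 : 2 ^ l * (l + 1) ^ (l + 1) * (16 * σ) ≤ 1 / 8
  d1 : Ck (l + 1) * (2 * δ') ≤ ε / 96
  d2 : (l + 2) ^ 2 * δ' ≤ ε / 96
  d3 : (l + 1) ^ 2 * δ' ≤ 1 / 512
  d4 : 2 ^ l * (l + 1) ^ (l + 1) * (33 * δ'') ≤ 1 / 8
  d5 : 98304 * δ'' ≤ 1

structure Siz (n l : ℕ) (p ε δ' σ Λ : ℝ) : Prop where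
  h1 : 1 ≤ Λ
  hθ : Real.exp (-Λ) * ((1 + ε / 4) * Λ) ^ 2 ≤ σ
  hlog : 1 ≤ Real.log n
  hnp : (1 + ε / 4) * Λ * Real.log n ≤ σ * (n * p)
  hL : (1 + ε / 4) * Λ ≤ lam n (l + 1) p
  hlam : n * p ^ 2 + Real.log n ≤ 3 * lam n (l + 1) p
  hΛ1 : Real.exp 3 ≤ 1 / 8192 * Real.exp (ε * Λ / 8)
  hΛ2 : 4 + Real.log (32 * ((1 + ε / 4) * Λ) / δ') ≤ 7 * ((1 + ε / 4) * Λ) / 8192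

def D0f (n : ℕ) (p ε δ' Λ : ℝ) : ℝ := δ' * (n * p) / ((1 + ε / 4) * Λ)
def u0f (n : ℕ) (ε δ' Λ : ℝ) : ℝ := 2 * n * (Real.exp (-Λ) * ((1 + ε / 4) * Λ)) / δ'

lemma siz_basic {n l : ℕ} {p ε δ' δ'' σ Λ : ℝ} (h0 : 0 ≤ p) (h1 : p ≤ 1) (P : Par l ε δ' δ'' σ) (S : Siz n l p ε δ' σ Λ) :
    1 ≤ n ∧ 1 ≤ n * p ∧ 1 ≤ (1 + ε / 4) * Λ ∧ 1 ≤ σ * (n * p) ∧ (1 + ε / 4) * Λ ≤ σ * (n * p) ∧ Real.exp (-Λ) * ((1 + ε / 4) * Λ) ≤ σ ∧ σ ≤ 1 := by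
  have hL1 : 1 ≤ (1 + ε / 4) * Λ := by nlinarith [S.h1, P.he]
  have hLy : (1 + ε / 4) * Λ ≤ σ * (n * p) := le_trans (by nlinarith [S.hlog]) S.hnp
  have hn : 1 ≤ n := by
    by_contra h
    have : n = 0 := by omega
    have h2 := S.hlog
    rw [this] at h2; simp at h2; linarith
  have hσ1 : σ ≤ 1 := by
    have h1 := P.s7
    have h2 : (1 : ℝ) ≤ (l + 1) ^ 2 := by
      have : (0 : ℝ) ≤ l := Nat.cast_nonneg _
      nlinarith
    have := P.hs
    nlinarith
  have hy : 0 ≤ (n : ℝ) * p := by positivity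
  refine ⟨hn, ?_, hL1, hL1.trans hLy, hLy, le_trans ?_ S.hθ, hσ1⟩
  · nlinarith
  · have := Real.exp_pos (-Λ)
    rw [sq]
    have h3 : (1 + ε / 4) * Λ ≤ (1 + ε / 4) * Λ * ((1 + ε / 4) * Λ) := by nlinarith
    gcongr

set_option maxHeartbeats 1000000 in
lemma B1_step {n l : ℕ} (hl : 1 ≤ l) {p ε δ' δ'' σ Λ m : ℝ} (h0 : 0 ≤ p) (h1 : p ≤ 1) (P : Par l ε δ' δ'' σ) (S : Siz n l p ε δ' σ Λ)
    (hm : m = n * (n * p) * Real.exp (-Λ)) :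
    u0f n ε δ' Λ * Real.log n ≤ m / 8192 ∧
    pr (KE n) p (B1ev (l + 1) (u0f n ε δ' Λ) (D0f n p ε δ' Λ) (1 / 8192 * m) m) ≤ 3 * (n ^ 2 + 1) * Real.exp (-(m / 8192)) := by
  obtain ⟨hn, hnp, hL1, hy1, hLy, hEL, hσ1⟩ := siz_basic h0 h1 P S
  have hn0 : (0 : ℝ) < n := by exact_mod_cast hn
  obtain ⟨h1Λ, hθ, hlog, hLlog, hLlam, hlam, hΛ1, hΛ2⟩ := S
  obtain ⟨he, he1, hd, hd2, hs, s1, s2, s3, s4, s5, s6, s7, s8, d1, d2, d3, d4, d5⟩ := P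
  have hE := Real.exp_pos (-Λ)
  set L : ℝ := (1 + ε / 4) * Λ with hLdef
  set D0 := D0f n p ε δ' Λ with hD0
  set u0 := u0f n ε δ' Λ with hu0
  have hD0y : L * D0 = δ' * (n * p) := by
    rw [hD0, D0f, ← hLdef]; field_simp
  have hD0p : 0 < D0 := by rw [hD0, D0f, ← hLdef]; positivity
  have hD0le : D0 ≤ δ' * (n * p) := by nlinarith
  have hu0n : u0 / n ≤ 2 * σ / δ' := by
    have : u0 / n = 2 * (Real.exp (-Λ) * L) / δ' := by rw [hu0, u0f, ← hLdef]; field_simp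
    rw [this]; gcongr
  have hm0 : 0 < m := by rw [hm]; positivity
  have hulog : u0 * Real.log n ≤ m / 8192 := by
    have e1 : u0 * Real.log n = 2 * n * Real.exp (-Λ) / δ' * (L * Real.log n) := by rw [hu0, u0f, ← hLdef]; field_simp
    rw [e1]
    calc 2 * n * Real.exp (-Λ) / δ' * (L * Real.log n) ≤ 2 * n * Real.exp (-Λ) / δ' * (σ * (n * p)) := by gcongr
      _ = m * (2 * σ / δ') := by rw [hm]; field_simp
      _ ≤ m * (1 / 8192) := mul_le_mul_of_nonneg_left (by rw [div_le_iff₀ hd]; linarith) hm0.le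
      _ = _ := by ring
  refine ⟨hulog, ?_⟩
  have hCk := Ck_pos (l + 1)
  have hb := B1_bound (k := l + 1) (by omega) hn h0 h1 hnp (u0 := u0) (D0 := D0) (a := 1 / 8192 * m) (m := m) (L := L) (ρ := 1 - ε / 32) (δ := ε / 32)
    (by positivity) hLlam hD0p.le (by positivity) ?_ ?_ ?_
  · refine hb.trans ?_
    have e2 : 3 * Real.exp (u0 * Real.log n) * (((n : ℝ) ^ 2 + 1) * Real.exp (-(2 * (1 / 8192 * m)))) =
       3 * ((n : ℝ) ^ 2 + 1) * Real.exp (u0 * Real.log n + -(2 * (1 / 8192 * m))) := by rw [Real.exp_add]; ring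
    rw [e2]
    gcongr
    linarith
  · push_cast
    have e1 : (D0 + 1) / n ≤ δ' + σ := by
      rw [div_le_iff₀ hn0]
      have : (n : ℝ) * p ≤ n := by nlinarith
      nlinarith
    have e2 : ((l : ℝ) + 1) * (u0 / n) ≤ (l + 1) * (2 * σ / δ') := by gcongr
    have e3 : ((l : ℝ) + 1 + 1) ^ 2 * ((D0 + 1) / n) ≤ (l + 2) ^ 2 * (δ' + σ) := by
      have : (l : ℝ) + 1 + 1 = l + 2 := by ring
      rw [this]; gcongr
    linarith
  · have e1 : L * (m / n) ≤ σ * (n * p) := by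
      have : L * (m / n) = (Real.exp (-Λ) * L) * (n * p) := by rw [hm]; field_simp
      rw [this]; gcongr
    calc L * (Ck (l + 1) * (m / n + 2 * D0 + 1)) = Ck (l + 1) * (L * (m / n) + 2 * (L * D0) + L) := by ring
      _ ≤ Ck (l + 1) * (σ * (n * p) + 2 * (δ' * (n * p)) + σ * (n * p)) := by rw [hD0y]; gcongr
      _ = (2 * (Ck (l + 1) * σ) + Ck (l + 1) * (2 * δ')) * (n * p) := by ring
      _ ≤ ε / 32 * (n * p) := by gcongr; linarith
  · have e1 : ε * Λ / 8 ≤ -Λ + L * (1 - ε / 32 - ε / 32) := by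
      rw [hLdef]
      have : 0 ≤ ε * Λ := by positivity
      nlinarith
    calc (n : ℝ) ^ 2 * p * Real.exp 3 ≤ n ^ 2 * p * (1 / 8192 * Real.exp (ε * Λ / 8)) := by gcongr
      _ ≤ n ^ 2 * p * (1 / 8192 * Real.exp (-Λ + L * (1 - ε / 32 - ε / 32))) := by gcongr
      _ = _ := by rw [Real.exp_add, hm]; ring

set_option maxHeartbeats 1000000 in
lemma B2_step {n l : ℕ} (hl : 1 ≤ l) {p ε δ' δ'' σ Λ m : ℝ} (h0 : 0 ≤ p) (h1 : p ≤ 1) (P : Par l ε δ' δ'' σ) (S : Siz n l p ε δ' σ Λ)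
    (hm : m = n * (n * p) * Real.exp (-Λ)) :
    pr (KE n) p (B2ev l p (u0f n ε δ' Λ) (D0f n p ε δ' Λ) (1 / 8192 * m) (δ'' * (n * p) / ((1 + ε / 4) * Λ)) m) ≤ 3 * Real.exp (-m) := by
  obtain ⟨hn, hnp, hL1, hy1, hLy, hEL, hσ1⟩ := siz_basic h0 h1 P S
  have hulog := (B1_step hl h0 h1 P S hm).1
  have hn0 : (0 : ℝ) < n := by exact_mod_cast hn
  obtain ⟨h1Λ, hθ, hlog, hLlog, hLlam, hlam, hΛ1, hΛ2⟩ := S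
  obtain ⟨he, he1, hd, hd2, hs, s1, s2, s3, s4, s5, s6, s7, s8, d1, d2, d3, d4, d5⟩ := P
  have hE := Real.exp_pos (-Λ)
  have hE1 : Real.exp (-Λ) ≤ 1 := Real.exp_le_one_iff.2 (by linarith)
  have hΛL : Λ ≤ (1 + ε / 4) * Λ := by nlinarith
  set L : ℝ := (1 + ε / 4) * Λ with hLdef
  set D0 := D0f n p ε δ' Λ with hD0
  set u0 := u0f n ε δ' Λ with hu0
  have hD0y : L * D0 = δ' * (n * p) := by
    rw [hD0, D0f, ← hLdef]; field_simp
  have hD0p : 0 < D0 := by rw [hD0, D0f, ← hLdef]; positivity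
  have hD0le : D0 ≤ δ' * (n * p) := by nlinarith
  have hu0p : 0 < u0 := by rw [hu0, u0f, ← hLdef]; positivity
  have hu0n : u0 / n ≤ 2 * σ / δ' := by
    have : u0 / n = 2 * (Real.exp (-Λ) * L) / δ' := by rw [hu0, u0f, ← hLdef]; field_simp
    rw [this]; gcongr
  have hm0 : 0 < m := by rw [hm]; positivity
  have hp : 0 < p := by
    by_contra h
    have : p = 0 := le_antisymm (not_lt.1 h) h0
    rw [this] at hnp; linarith
  have hL0 : 0 < L := by linarith
  have hd3 : δ' ≤ 1 := by
    have h2 : (1 : ℝ) ≤ (l + 1) ^ 2 := by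
      have : (0 : ℝ) ≤ l := Nat.cast_nonneg _
      nlinarith
    nlinarith
  have hb := B2_bound hl hn h0 h1 hnp (u0 := u0) (D0 := D0) (c := 1 / 8192 * m) (r := δ'' * (n * p) / L) (m := m) (L := L) (x := Real.exp (-Λ)) (y := δ' / (32 * L))
    hL0.le hLlam hD0p.le ?_ ?_ ?_ ?_ hE hE1 (by positivity) ?_ hu0p.le
  · refine hb.trans ?_
    have e1 : p * Real.exp (-Λ) * n ^ 2 = m := by rw [hm]; ring
    have e2 : δ' / (32 * L) * (16 * (n * p) * u0) = m := by rw [hm, hu0, u0f, ← hLdef]; field_simp; norm_num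
    have e3 : -Real.log (δ' / (32 * L)) = Real.log (32 * L / δ') := by rw [← Real.log_inv, inv_div]
    rw [e1, e2, e3, Real.log_exp, ← Real.exp_add, ← Real.exp_add, mul_assoc, ← Real.exp_add]
    gcongr
    have e4 : m * Λ ≤ m * L := by gcongr
    have e5 := mul_le_mul_of_nonneg_left hΛ2 hm0.le
    linarith
  · have : (l : ℝ) * (u0 / n) ≤ (l + 1) * (2 * σ / δ') := by gcongr; linarith
    linarith
  · have e1 : D0 + 1 ≤ (δ' + σ) * (n * p) := by linarith
    calc ((l : ℝ) + 1) ^ 2 * (D0 + 1) ≤ (l + 1) ^ 2 * ((δ' + σ) * (n * p)) := by gcongr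
      _ = ((l + 1) ^ 2 * δ' + (l + 1) ^ 2 * σ) * (n * p) := by ring
      _ ≤ (1 / 256) * (n * p) := by gcongr; linarith
      _ = _ := by ring
  · have e1 : m / (n ^ 2 * p) = Real.exp (-Λ) := by rw [hm]; field_simp
    have e2 : δ'' * (n * p) / L / (n * p) = δ'' / L := by field_simp
    rw [e1, e2]
    have e3 : (2 : ℝ) ^ l * (l + 1) ^ (l + 1) * (16 * Real.exp (-Λ) + 33 * (δ'' / L)) * L = 2 ^ l * (l + 1) ^ (l + 1) * (16 * (Real.exp (-Λ) * L)) + 2 ^ l * (l + 1) ^ (l + 1) * (33 * δ'') := by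
      field_simp
    have e4 : (2 : ℝ) ^ l * (l + 1) ^ (l + 1) * (16 * (Real.exp (-Λ) * L)) ≤ 2 ^ l * (l + 1) ^ (l + 1) * (16 * σ) := by gcongr
    rw [e3]; linarith
  · have e1 : 2048 * (δ'' * (n * p) / L * (16 * (n * p ^ 2 + Real.log n)) * L) = 32768 * δ'' * (n * p ^ 2 + Real.log n) * (n * p) := by field_simp; ring
    rw [e1]
    gcongr
    have : 0 ≤ lam n (l + 1) p := by linarith
    nlinarith
  · rw [div_le_one (by positivity)]; linarith

set_option maxHeartbeats 1000000 in
lemma B_cover {n l : ℕ} (hl : 1 ≤ l) {p ε δ' δ'' σ Λ m : ℝ} (h0 : 0 ≤ p) (h1 : p ≤ 1) (P : Par l ε δ' δ'' σ) (S : Siz n l p ε δ' σ Λ)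
    (hm : m = n * (n * p) * Real.exp (-Λ)) {s F : Finset (Sym2 (Fin n))} (hs : s ⊆ KE n) (hP : Perp (l + 1) s F) (hT : Typ p s)
    (hdeg : ∀ v, 2 * deg F v ≤ deg s v) (hF : (F.card : ℝ) = m) :
    B1ev (l + 1) (u0f n ε δ' Λ) (D0f n p ε δ' Λ) (1 / 8192 * m) m s ∨
    B2ev l p (u0f n ε δ' Λ) (D0f n p ε δ' Λ) (1 / 8192 * m) (δ'' * (n * p) / ((1 + ε / 4) * Λ)) m s := by
  obtain ⟨hn, hnp, hL1, hy1, hLy, hEL, hσ1⟩ := siz_basic h0 h1 P S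
  have hn0 : (0 : ℝ) < n := by exact_mod_cast hn
  obtain ⟨h1Λ, hθ, hlog, hLlog, hLlam, hlam, hΛ1, hΛ2⟩ := S
  obtain ⟨he, he1, hd, hd2, hs', s1, s2, s3, s4, s5, s6, s7, s8, d1, d2, d3, d4, d5⟩ := P
  have hE := Real.exp_pos (-Λ)
  set L : ℝ := (1 + ε / 4) * Λ with hLdef
  set D0 := D0f n p ε δ' Λ with hD0
  set u0 := u0f n ε δ' Λ with hu0
  have hL0 : 0 < L := by linarith
  have hD0p : 0 < D0 := by rw [hD0, D0f, ← hLdef]; positivity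
  have hm0 : 0 < m := by rw [hm]; positivity
  have hud : u0 * D0 = 2 * m := by rw [hD0, D0f, hu0, u0f, ← hLdef, hm]; field_simp
  have hy0 : 0 < (n : ℝ) * p := by linarith
  have hp0 : 0 < p := by
    by_contra h
    rw [le_antisymm (not_lt.1 h) h0] at hy0
    simp at hy0
  set x : ℝ := 2 * u0 * p + Real.log n with hx
  have hxL : x * L ≤ (4 * σ / δ' + σ) * (n * p) := by
    have e1 : 2 * u0 * p * L = 4 * (Real.exp (-Λ) * L ^ 2) / δ' * (n * p) := by rw [hu0, u0f, ← hLdef]; field_simp; ring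
    have e2 : 4 * (Real.exp (-Λ) * L ^ 2) / δ' * (n * p) ≤ 4 * σ / δ' * (n * p) := by gcongr
    rw [hx]; linarith
  set U : Finset (Fin n) := Finset.univ.filter fun v => D0 ≤ (deg F v : ℝ) with hU
  by_cases hc : 1 / 8192 * m ≤ ((F ∩ T1 U).card : ℝ)
  · left
    have hUu : (U.card : ℝ) ≤ u0 := by
      refine le_of_mul_le_mul_right (le_trans ?_ hud.ge) hD0p
      have h1 : (U.card : ℝ) * D0 ≤ ∑ v ∈ U, (deg F v : ℝ) := by
        rw [← nsmul_eq_mul]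
        exact Finset.card_nsmul_le_sum _ _ _ fun v hv => (Finset.mem_filter.1 hv).2
      have h2 : ∑ v ∈ U, (deg F v : ℝ) ≤ ∑ v, (deg F v : ℝ) := Finset.sum_le_sum_of_subset_of_nonneg (Finset.subset_univ _) (fun _ _ _ => by positivity)
      have h3 : ∑ v, (deg F v : ℝ) ≤ 2 * F.card := by exact_mod_cast handshake F
      rw [hF] at h3; linarith
    refine ⟨U, Finset.mem_filter.2 ⟨Finset.mem_univ _, hUu⟩, F ∩ T1 U, Finset.mem_filter.2 ⟨Finset.mem_powerset.2 Finset.inter_subset_right, ?_, hc, ?_⟩,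
      Finset.inter_subset_left.trans hP.1, ?_⟩
    · intro v
      by_cases hv : v ∈ U
      · have : deg (F ∩ T1 U) v = 0 := by
          refine Finset.card_eq_zero.2 (Finset.filter_eq_empty_iff.2 fun e he hve => ?_)
          exact (Finset.mem_filter.1 (Finset.mem_inter.1 he).2).2 v hve hv
        rw [this]; simpa using hD0p.le
      · have h1 : deg (F ∩ T1 U) v ≤ deg F v := Finset.card_le_card (Finset.filter_subset_filter _ Finset.inter_subset_left)
        have h2 : ¬ D0 ≤ (deg F v : ℝ) := fun h => hv (Finset.mem_filter.2 ⟨Finset.mem_univ _, h⟩)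
        have h3 : (deg (F ∩ T1 U) v : ℝ) ≤ deg F v := by exact_mod_cast h1
        linarith
    · rw [← hF]; exact_mod_cast Finset.card_le_card Finset.inter_subset_left
    · intro x hx hxs
      obtain ⟨x1, -, x2, x3, x4⟩ := mem_brid.1 hx
      have hend := (Finset.mem_filter.1 (Finset.mem_inter.1 x2).2).2
      have hall : ∀ i, x i ∉ U := by
        intro i
        by_cases hi0 : i = 0
        · rw [hi0]; exact hend _ (by simp)
        by_cases hil : i = Fin.last (l + 1)
        · rw [hil]; exact hend _ (by simp)
        · exact Finset.mem_compl.1 (x3 i hi0 hil)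
      refine perp_bridge hP x1 (Finset.mem_inter.1 x2).1 (Finset.disjoint_left.2 fun e he heF => ?_) hxs
      refine Finset.disjoint_left.1 x4 he (Finset.mem_inter.2 ⟨heF, Finset.mem_filter.2 ⟨hs (hxs he), ?_⟩⟩)
      obtain ⟨i, rfl⟩ := mem_pathE.1 he
      intro w hw
      rcases Sym2.mem_iff.1 hw with rfl | rfl <;> exact hall _
  · right
    push Not at hc
    refine B2_cover hs hP hT h0 hy0 hn hdeg hF hD0p (by positivity) hud.ge ?_ ?_ hU hc.le (by linarith)
    · rw [div_div, le_div_iff₀ (by positivity), ← hx]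
      have : (4 * σ / δ' + σ) * (n * p) ≤ δ'' / 512 * (n * p) := by gcongr
      linarith
    · rw [← hx]
      have e1 : x * u0 = x * L * (2 * m / (δ' * (n * p))) := by rw [hu0, u0f, ← hLdef, hm]; field_simp
      rw [e1]
      calc x * L * (2 * m / (δ' * (n * p))) ≤ (4 * σ / δ' + σ) * (n * p) * (2 * m / (δ' * (n * p))) := by gcongr
        _ = m * (8 * σ / δ' ^ 2 + 2 * σ / δ') := by field_simp; ring
        _ ≤ m * (1 / 2 ^ 19) := mul_le_mul_of_nonneg_left s6 hm0.le
        _ = _ := by ring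


lemma ev_small (A B : ℝ) (hB : 0 < B) : ∀ᶠ x in 𝓝[>] (0 : ℝ), A * x ≤ B := by
  have h : Tendsto (fun x : ℝ => A * x) (𝓝[>] 0) (𝓝 0) := by
    have : Tendsto (fun x : ℝ => A * x) (𝓝 0) (𝓝 (A * 0)) := tendsto_id.const_mul A
    rw [mul_zero] at this
    exact this.mono_left nhdsWithin_le_nhds
  exact (h.eventually (gt_mem_nhds hB)).mono fun x hx => hx.le

lemma par_exists (l : ℕ) {ε : ℝ} (he : 0 < ε) (he1 : ε ≤ 1 / 12) : ∃ δ' δ'' σ, Par l ε δ' δ'' σ := by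
  obtain ⟨δ', ⟨a1, a2, a3⟩, a4⟩ := (((ev_small (Ck (l + 1) * 2) (ε / 96) (by positivity)).and
    ((ev_small ((l + 2) ^ 2) (ε / 96) (by positivity)).and (ev_small ((l + 1) ^ 2) (1 / 512) (by norm_num)))).and
    self_mem_nhdsWithin).exists
  obtain ⟨δ'', ⟨b1, b2⟩, b4⟩ := (((ev_small (2 ^ l * (l + 1) ^ (l + 1) * 33) (1 / 8) (by norm_num)).and
    (ev_small 98304 1 (by norm_num))).and self_mem_nhdsWithin).exists
  have hd : 0 < δ' := a4
  have hd2 : 0 < δ'' := b4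
  obtain ⟨σ, ⟨c1, c2, c3, c4, c5, c6, c7, c8⟩, c9⟩ := (((ev_small ((l + 1) * (2 / δ')) (ε / 96) (by positivity)).and
    ((ev_small ((l + 2) ^ 2) (ε / 96) (by positivity)).and ((ev_small (Ck (l + 1)) (ε / 192) (by positivity)).and
    ((ev_small 16384 δ' hd).and ((ev_small (4 / δ' + 1) (δ'' / 512) (by positivity)).and
    ((ev_small (8 / δ' ^ 2 + 2 / δ') (1 / 2 ^ 19) (by positivity)).and ((ev_small ((l + 1) ^ 2) (1 / 512) (by norm_num)).and
    (ev_small (2 ^ l * (l + 1) ^ (l + 1) * 16) (1 / 8) (by norm_num))))))))).and self_mem_nhdsWithin).exists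
  have e : ∀ a b : ℝ, a * σ / b = a / b * σ := fun a b => by ring
  exact ⟨δ', δ'', σ, he, he1, hd, hd2, c9, by rw [e]; linarith, c2, c3, c4, by rw [e]; linarith, by rw [e, e]; linarith, c7, by linarith,
    by linarith, a2, a3, by linarith, b2⟩

lemma Lam0_exists {ε δ' σ : ℝ} (he : 0 < ε) (he1 : ε ≤ 1 / 12) (hd : 0 < δ') (hs : 0 < σ) : ∃ Λ0 : ℝ, 0 < Λ0 ∧ ∀ Λ, Λ0 ≤ Λ → 1 ≤ Λ ∧
    Real.exp (-Λ) * ((1 + ε / 4) * Λ) ^ 2 ≤ σ ∧ Real.exp 3 ≤ 1 / 8192 * Real.exp (ε * Λ / 8) ∧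
    4 + Real.log (32 * ((1 + ε / 4) * Λ) / δ') ≤ 7 * ((1 + ε / 4) * Λ) / 8192 := by
  have h1 : ∀ᶠ Λ : ℝ in atTop, Λ ^ 2 * Real.exp (-Λ) < σ / 4 :=
    (Real.tendsto_pow_mul_exp_neg_atTop_nhds_zero 2).eventually (gt_mem_nhds (by positivity))
  have h2 : ∀ᶠ Λ : ℝ in atTop, Real.exp 3 * 8192 ≤ Real.exp (ε * Λ / 8) := by
    have : Tendsto (fun Λ : ℝ => Real.exp (ε * Λ / 8)) atTop atTop := by
      refine Real.tendsto_exp_atTop.comp ?_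
      have := tendsto_id.const_mul_atTop (show (0 : ℝ) < ε / 8 by positivity)
      exact this.congr fun x => by simp; ring
    exact this.eventually_ge_atTop _
  have h3 : ∀ᶠ Λ : ℝ in atTop, ‖Real.log Λ‖ ≤ 1 / 8192 * ‖Λ‖ := Real.isLittleO_log_id_atTop.def (by norm_num)
  obtain ⟨Λ0, hΛ⟩ := eventually_atTop.1 (((eventually_ge_atTop (1 : ℝ)).and (h1.and (h2.and h3))).and
    (eventually_ge_atTop ((4 + Real.log (32 * 2 / δ')) * 8192)))
  refine ⟨max Λ0 1, by positivity, fun Λ hh => ?_⟩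
  obtain ⟨⟨a1, a2, a3, a4⟩, a5⟩ := hΛ Λ ((le_max_left _ _).trans hh)
  have h0 : 0 < Λ := by linarith
  refine ⟨a1, ?_, by linarith, ?_⟩
  · have : ((1 + ε / 4) * Λ) ^ 2 ≤ (2 * Λ) ^ 2 := by gcongr; linarith
    have := mul_le_mul_of_nonneg_left this (Real.exp_pos (-Λ)).le
    nlinarith
  · have b1 : Real.log (32 * ((1 + ε / 4) * Λ) / δ') ≤ Real.log (32 * 2 / δ' * Λ) := by
      apply Real.log_le_log (by positivity)
      have : 32 * ((1 + ε / 4) * Λ) / δ' = 32 * (1 + ε / 4) / δ' * Λ := by ring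
      rw [this]; gcongr; linarith
    rw [Real.log_mul (by positivity) h0.ne'] at b1
    rw [Real.norm_eq_abs, Real.norm_eq_abs, abs_of_pos h0] at a4
    have := le_abs_self (Real.log Λ)
    nlinarith

set_option maxHeartbeats 1000000 in
theorem partB (l : ℕ) (hl : 1 ≤ l) {ε : ℝ} (he : 0 < ε) (he1 : ε ≤ 1 / 12) : ∃ η : ℝ, 0 < η ∧ η ≤ 1 ∧ ∀ ε1 : ℝ, 0 < ε1 →
    ∀ᶠ n : ℕ in atTop, ∀ p : ℝ, 0 ≤ p → p ≤ 1 → (n : ℝ) ^ (1 / (2 * (l + 1 : ℕ)) : ℝ) ≤ n * p →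
    (1 - ε / 4) * Real.log (n ^ 2 * p) ≤ lam n (l + 1) p →
    pr (KE n) p (fun s => ∃ F, Perp (l + 1) s F ∧ (n : ℝ) ^ ε ≤ F.card ∧ (F.card : ℝ) ≤ η * (n ^ 2 * p) ∧ ∀ v, 2 * deg F v ≤ deg s v) ≤ ε1 := by
  obtain ⟨δ', δ'', σ, P⟩ := par_exists l he he1
  obtain ⟨Λ0, hΛ0, hΛ⟩ := Lam0_exists he he1 P.hd P.hs
  refine ⟨Real.exp (-Λ0), Real.exp_pos _, Real.exp_le_one_iff.2 (by linarith), fun ε1 hε1 => ?_⟩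
  have hc : (0 : ℝ) < 1 / (2 * (l + 1 : ℕ)) := by positivity
  filter_upwards [eventually_ge_atTop 3, typ _ hc (ε1 / 2) (by positivity), ev_log 2 2 _ σ hc P.hs,
    ev_log 1 4 ε (1 / 16384) he (by norm_num), ev_pow (Real.log (36 / ε1)) ε (1 / 16384) he (by norm_num)] with n hn hT hlog2 hl4 hpw p h0 h1 hnp hlam
  have hn3 : (3 : ℝ) ≤ n := by exact_mod_cast hn
  have hn0 : (0 : ℝ) < n := by linarith
  have hlog1 : 1 ≤ Real.log n := by
    rw [Real.le_log_iff_exp_le hn0]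
    exact (Real.exp_one_lt_d9.le.trans (by norm_num)).trans hn3
  have hnp1 : 1 ≤ (n : ℝ) * p := (Real.one_le_rpow (by linarith) hc.le).trans hnp
  have hp0 : 0 < p := by
    by_contra h
    rw [le_antisymm (not_lt.1 h) h0] at hnp1
    norm_num at hnp1
  have hN : (0 : ℝ) < n ^ 2 * p := by positivity
  have hNn : (n : ℝ) ≤ n ^ 2 * p := by nlinarith
  have hlogN : Real.log n ≤ Real.log (n ^ 2 * p) := Real.log_le_log hn0 hNn
  have hlogN2 : Real.log (n ^ 2 * p) ≤ 2 * Real.log n := by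
    rw [Real.log_mul (by positivity) hp0.ne', Real.log_pow]
    have := Real.log_nonpos h0 h1
    push_cast; linarith
  set LN := Real.log (n ^ 2 * p) with hLN
  have hlam2 : n * p ^ 2 + Real.log n ≤ 3 * lam n (l + 1) p := by
    have e : lam n (l + 1) p = n * p ^ 2 * (n * p) ^ (l - 1) := by
      obtain ⟨b, rfl⟩ : ∃ b, l = b + 1 := ⟨l - 1, by omega⟩
      unfold lam
      simp only [Nat.add_sub_cancel]; ring
    have : n * p ^ 2 * 1 ≤ n * p ^ 2 * (n * p) ^ (l - 1) := by
      gcongr; exact one_le_pow₀ hnp1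
    rw [← e] at this
    nlinarith
  set I : Finset ℕ := (Finset.range (n ^ 2 + 1)).filter fun m => (n : ℝ) ^ ε ≤ m ∧ (m : ℝ) ≤ Real.exp (-Λ0) * (n ^ 2 * p) with hI
  have hne1 : 1 ≤ (n : ℝ) ^ ε := Real.one_le_rpow (by linarith) he.le
  have key : ∀ m ∈ I, pr (KE n) p (fun s => Typ p s ∧ ∃ F, Perp (l + 1) s F ∧ F.card = m ∧ ∀ v, 2 * deg F v ≤ deg s v) ≤
      9 * n ^ 2 * Real.exp (-((n : ℝ) ^ ε / 8192)) := by
    intro m hm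
    obtain ⟨-, hm1, hm2⟩ := Finset.mem_filter.1 hm
    have hm0 : (0 : ℝ) < m := by linarith
    set Λ := LN - Real.log m with hΛd
    have hm3 : (m : ℝ) = n * (n * p) * Real.exp (-Λ) := by
      rw [hΛd, neg_sub, Real.exp_sub, Real.exp_log hm0, hLN, Real.exp_log hN]; field_simp
    have hΛΛ : Λ0 ≤ Λ := by
      have := Real.log_le_log hm0 hm2
      rw [Real.log_mul (Real.exp_pos _).ne' hN.ne', Real.log_exp, ← hLN] at this
      linarith
    have hΛ2 : Λ ≤ (1 - ε / 2) * LN := by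
      have := Real.log_le_log (by positivity) hm1
      rw [Real.log_rpow hn0] at this
      have : ε * (LN / 2) ≤ ε * Real.log n := by gcongr; linarith
      linarith
    obtain ⟨g1, g2, g3, g4⟩ := hΛ Λ hΛΛ
    have hL : (1 + ε / 4) * Λ ≤ (1 - ε / 4) * LN := by
      have : (1 + ε / 4) * Λ ≤ (1 + ε / 4) * ((1 - ε / 2) * LN) := by gcongr
      have h2 : 0 ≤ ε ^ 2 / 8 * LN := by have : 0 ≤ LN := by linarith
                                         positivity
      linarith
    have S : Siz n l p ε δ' σ Λ := by
      refine ⟨g1, g2, hlog1, ?_, hL.trans hlam, hlam2, g3, g4⟩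
      have h2 : (1 + ε / 4) * Λ ≤ 2 * Real.log n := by nlinarith
      calc (1 + ε / 4) * Λ * Real.log n ≤ 2 * Real.log n * Real.log n := mul_le_mul_of_nonneg_right h2 (by linarith)
        _ = 2 * Real.log n ^ 2 := by ring
        _ ≤ _ := hlog2.trans (mul_le_mul_of_nonneg_left hnp P.hs.le)
    have b1 := (B1_step hl h0 h1 P S hm3).2
    have b2 := B2_step hl h0 h1 P S hm3
    refine (pr_mono h0 h1 (B := fun s => B1ev (l + 1) (u0f n ε δ' Λ) (D0f n p ε δ' Λ) (1 / 8192 * m) m s ∨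
      B2ev l p (u0f n ε δ' Λ) (D0f n p ε δ' Λ) (1 / 8192 * m) (δ'' * (n * p) / ((1 + ε / 4) * Λ)) m s) ?_).trans ((pr_or_le h0 h1 _ _).trans ?_)
    · rintro s hs ⟨hTs, F, hP, hF, hdeg⟩
      exact B_cover hl h0 h1 P S hm3 hs hP hTs hdeg (by rw [hF])
    · have c1 : Real.exp (-((m : ℝ) / 8192)) ≤ Real.exp (-((n : ℝ) ^ ε / 8192)) := Real.exp_le_exp.2 (by linarith)
      have c2 : Real.exp (-(m : ℝ)) ≤ Real.exp (-((n : ℝ) ^ ε / 8192)) := Real.exp_le_exp.2 (by linarith)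
      have c3 : 3 * ((n : ℝ) ^ 2 + 1) * Real.exp (-((m : ℝ) / 8192)) ≤ 3 * (n ^ 2 + 1) * Real.exp (-((n : ℝ) ^ ε / 8192)) :=
        mul_le_mul_of_nonneg_left c1 (by positivity)
      have c4 : (6 + 3 * (n : ℝ) ^ 2) * Real.exp (-((n : ℝ) ^ ε / 8192)) ≤ 9 * n ^ 2 * Real.exp (-((n : ℝ) ^ ε / 8192)) :=
        mul_le_mul_of_nonneg_right (by nlinarith) (Real.exp_pos _).le
      linarith
  have hsum : pr (KE n) p (fun s => ∃ m ∈ I, Typ p s ∧ ∃ F, Perp (l + 1) s F ∧ F.card = m ∧ ∀ v, 2 * deg F v ≤ deg s v) ≤ ε1 / 2 := by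
    refine (pr_exists_le h0 h1 I _).trans ((Finset.sum_le_sum key).trans ?_)
    rw [Finset.sum_const, nsmul_eq_mul]
    have hc1 : (I.card : ℝ) ≤ 2 * n ^ 2 := by
      have : I.card ≤ n ^ 2 + 1 := (Finset.card_filter_le _ _).trans (by simp)
      have : (I.card : ℝ) ≤ n ^ 2 + 1 := by exact_mod_cast this
      nlinarith
    have hx : Real.exp (-((n : ℝ) ^ ε / 8192)) ≤ ε1 / 36 / n ^ 4 := by
      rw [← Real.log_le_log_iff (Real.exp_pos _) (by positivity), Real.log_exp, Real.log_div (by positivity) (by positivity), Real.log_pow]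
      have : Real.log (ε1 / 36) = - Real.log (36 / ε1) := by rw [← Real.log_inv, inv_div]
      rw [this]; push_cast
      simp only [pow_one] at hl4
      linarith
    calc (I.card : ℝ) * (9 * n ^ 2 * Real.exp (-((n : ℝ) ^ ε / 8192))) ≤ 2 * n ^ 2 * (9 * n ^ 2 * (ε1 / 36 / n ^ 4)) := by
          refine mul_le_mul hc1 (mul_le_mul_of_nonneg_left hx (by positivity)) (by positivity) (by positivity)
      _ = ε1 / 2 := by field_simp; norm_num
  refine (pr_mono h0 h1 (B := fun s => (¬ Typ p s) ∨ ∃ m ∈ I, Typ p s ∧ ∃ F, Perp (l + 1) s F ∧ F.card = m ∧ ∀ v, 2 * deg F v ≤ deg s v) ?_).trans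
    ((pr_or_le h0 h1 _ _).trans ?_)
  · rintro s hs ⟨F, hP, hF1, hF2, hdeg⟩
    by_cases hTs : Typ p s
    · refine Or.inr ⟨F.card, Finset.mem_filter.2 ⟨Finset.mem_range.2 ?_, hF1, hF2⟩, hTs, F, hP, rfl, hdeg⟩
      have h3 : (F.card : ℝ) ≤ (KE n).card := by exact_mod_cast Finset.card_le_card (hP.1.trans hs)
      have h4 := card_KE_le n
      have h5 : (F.card : ℝ) ≤ (n ^ 2 : ℕ) := by push_cast; nlinarith
      have h6 : F.card ≤ n ^ 2 := by exact_mod_cast h5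
      omega
    · exact Or.inl hTs
  · have := hT p h0 h1 hnp
    linarith


lemma setVec_mem {s : Set (Sym2 V)} {e : Sym2 V} (h : e ∈ s) : setVec s e = 1 := by simp [setVec, h]
lemma setVec_notMem {s : Set (Sym2 V)} {e : Sym2 V} (h : e ∉ s) : setVec s e = 0 := by simp [setVec, h]

lemma even_inter {n : ℕ} (F X : Finset (Sym2 (Fin n))) : Even (F ∩ X).card ↔ ∑ e ∈ X, setVec (F : Set (Sym2 (Fin n))) e = 0 := by
  have : ∑ e ∈ X, setVec (F : Set (Sym2 (Fin n))) e = ((F ∩ X).card : ZMod 2) := by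
    rw [Finset.inter_comm]
    simp only [setVec, Finset.sum_boole, Finset.mem_coe]
    congr 2
  rw [this, ZMod.natCast_eq_zero_iff_even]

lemma setVec_symm {n : ℕ} (F C : Finset (Sym2 (Fin n))) (e : Sym2 (Fin n)) :
    setVec (↑(symmDiff F C) : Set (Sym2 (Fin n))) e = setVec (F : Set (Sym2 (Fin n))) e + setVec (C : Set (Sym2 (Fin n))) e := by
  by_cases h1 : e ∈ F <;> by_cases h2 : e ∈ C <;> simp [setVec, Set.mem_symmDiff, h1, h2] <;> decide

/-- indicator of `A` in `ZMod 2` -/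
def az {n : ℕ} (A : Finset (Fin n)) (u : Fin n) : ZMod 2 := if u ∈ A then 1 else 0

lemma setVec_cut {n : ℕ} {s : Finset (Sym2 (Fin n))} {A : Finset (Fin n)} {u v : Fin n} (h : s(u, v) ∈ s) :
    setVec (cut s A : Set (Sym2 (Fin n))) s(u, v) = az A u + az A v := by
  have : s(u, v) ∈ cut s A ↔ ((u ∈ A ∧ v ∉ A) ∨ (v ∈ A ∧ u ∉ A)) := by rw [cut, Finset.mem_filter, cr_mk]; tauto
  by_cases h1 : u ∈ A <;> by_cases h2 : v ∈ A <;> simp [setVec, this, az, h1, h2] <;> decide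

lemma sum_cyc {k : ℕ} (f : Fin (k + 1) → ZMod 2) : ∑ i, (f i + f (i + 1)) = 0 := by
  rw [Finset.sum_add_distrib]
  have : ∑ i, f (i + 1) = ∑ i, f i := Equiv.sum_comp (Equiv.addRight (1 : Fin (k + 1))) f
  rw [this, ← two_mul]
  have : (2 : ZMod 2) = 0 := by decide
  rw [this, zero_mul]

lemma sum_cycE {n k : ℕ} (hk : 2 ≤ k) {x : Fin (k + 1) → Fin n} (hx : Function.Injective x) {M : Type*} [AddCommMonoid M] (f : Sym2 (Fin n) → M) :
    ∑ e ∈ cycE x, f e = ∑ i, f (ce x i) := by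
  rw [cycE, Finset.sum_image fun i _ j _ h => ce_injective hk hx h]

lemma perp_cut {n k : ℕ} (hk : 2 ≤ k) {s F : Finset (Sym2 (Fin n))} (hP : Perp k s F) (A : Finset (Fin n)) : Perp k s (symmDiff F (cut s A)) := by
  refine ⟨fun e he => ?_, fun x hx hxs => ?_⟩
  · rcases Finset.mem_symmDiff.1 he with h | h
    · exact hP.1 h.1
    · exact (Finset.mem_filter.1 h.1).1
  · rw [even_inter]
    simp only [setVec_symm]
    rw [Finset.sum_add_distrib, (even_inter _ _).1 (hP.2 x hx hxs), zero_add, sum_cycE hk hx]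
    rw [Finset.sum_congr rfl fun i _ => show setVec (cut s A : Set (Sym2 (Fin n))) (ce x i) = az A (x i) + az A (x (i + 1)) from
      setVec_cut (hxs (mem_cycE.2 ⟨i, rfl⟩))]
    exact sum_cyc fun i => az A (x i)

lemma cut_symm {n : ℕ} {s : Finset (Sym2 (Fin n))} (A B : Finset (Fin n)) : symmDiff (cut s A) (cut s B) = cut s (symmDiff A B) := by
  ext e
  induction e using Sym2.ind with
  | _ u v =>
    simp only [Finset.mem_symmDiff, cut, Finset.mem_filter, cr_mk]
    tauto

lemma reduce {n k : ℕ} (hk : 2 ≤ k) {s F : Finset (Sym2 (Fin n))} (hs : s ⊆ KE n) (hP : Perp k s F) (hF : ∀ A, F ≠ cut s A) :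
    ∃ F', Perp k s F' ∧ F'.Nonempty ∧ (∀ A, F'.card ≤ (symmDiff F' (cut s A)).card) ∧ ∀ v, 2 * deg F' v ≤ deg s v := by
  obtain ⟨A0, -, hA0⟩ := Finset.exists_min_image (Finset.univ : Finset (Finset (Fin n))) (fun A => (symmDiff F (cut s A)).card) ⟨∅, Finset.mem_univ _⟩
  have hP' := perp_cut hk hP A0
  set F' := symmDiff F (cut s A0) with hF'
  have hmin : ∀ A, F'.card ≤ (symmDiff F' (cut s A)).card := by
    intro A
    rw [hF', symmDiff_assoc, cut_symm]
    exact hA0 _ (Finset.mem_univ _)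
  refine ⟨F', hP', ?_, hmin, fun v => ?_⟩
  · rw [Finset.nonempty_iff_ne_empty]
    intro h
    exact hF A0 (symmDiff_eq_bot.1 h)
  · have h := hmin {v}
    have hc : cut s {v} = s.filter fun e => v ∈ e := by
      refine Finset.filter_congr fun e he => ?_
      have hd := hs he
      induction e using Sym2.ind with
      | _ a b =>
        rw [mem_KE] at hd
        rw [cr_mk]; simp only [Finset.mem_singleton, Sym2.mem_iff]
        constructor
        · rintro (⟨h, -⟩ | ⟨h, -⟩) <;> simp [h]
        · rintro (rfl | rfl)
          · exact Or.inl ⟨rfl, hd.symm⟩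
          · exact Or.inr ⟨rfl, hd⟩
    have e1 : (symmDiff F' (cut s {v})).card = (F' \ cut s {v}).card + (cut s {v} \ F').card :=
      Finset.card_union_of_disjoint disjoint_sdiff_sdiff
    have e2 := Finset.card_sdiff_add_card_inter F' (cut s {v})
    have e3 := Finset.card_sdiff_add_card_inter (cut s {v}) F'
    have e4 : (F' ∩ cut s {v}).card = deg F' v := by
      rw [hc, deg]; congr 1; ext e; simp only [Finset.mem_inter, Finset.mem_filter]
      exact ⟨fun h => ⟨h.1, h.2.2⟩, fun h => ⟨h.1, hP'.1 h.1, h.2⟩⟩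
    have e5 : (cut s {v}).card = deg s v := by rw [hc, deg]
    rw [Finset.inter_comm] at e3
    omega

/-- The bad event. -/
def Bad {n : ℕ} (k : ℕ) (s : Finset (Sym2 (Fin n))) : Prop := Qs k s ∧ ∃ F, Perp k s F ∧ ∀ A, F ≠ cut s A

theorem bad_main (l : ℕ) (hl : 1 ≤ l) (hke : Even (l + 1)) (ε1 : ℝ) (hε1 : 0 < ε1) : ∀ᶠ n : ℕ in atTop, ∀ p : ℝ, 0 ≤ p → p ≤ 1 →
    pr (KE n) p (Bad (l + 1)) ≤ ε1 := by
  have hl1 : (1 : ℝ) ≤ l := by exact_mod_cast hl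
  set ε : ℝ := 1 / (4 * ((l + 1 : ℕ) + 1)) with hε
  have he : 0 < ε := by positivity
  have he1 : ε ≤ 1 / 12 := by
    rw [hε]; apply one_div_le_one_div_of_le (by norm_num); push_cast; linarith
  obtain ⟨η, hη, hη1, hB⟩ := partB l hl he he1
  filter_upwards [eventually_ge_atTop 1, P0a (l + 1) (by omega) ε1 hε1, P0b (l + 1) (by omega) (ε / 4) (by positivity) ε1 hε1,
    partC (l + 1) (by omega) ε he le_rfl (ε1 / 3) (by positivity), partA (l + 1) (by omega) hke η hη hη1 (ε1 / 3) (by positivity),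
    hB (ε1 / 3) (by positivity)] with n hn hPa hPb hC hA hBn p h0 h1
  have hn1 : (1 : ℝ) ≤ n := by exact_mod_cast hn
  rcases le_total (lam n (l + 1) p) ((n : ℝ) ^ (-(1 / 2) : ℝ)) with hc | hc
  · refine (pr_mono h0 h1 ?_).trans (hPa p h0 h1 hc)
    rintro s - ⟨hQ, F, hP, hF⟩
    refine ⟨hQ, Finset.nonempty_iff_ne_empty.2 ?_⟩
    rintro rfl
    exact hF ∅ (by rw [Finset.subset_empty.1 hP.1]; simp [cut])
  rcases le_total (lam n (l + 1) p) ((1 - ε / 4) * Real.log ((n : ℝ) ^ 2 * p)) with hd | hd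
  · exact (pr_mono h0 h1 fun s _ h => h.1).trans (hPb p h0 h1 hc hd)
  have hnp := np_ge (by omega) hn h0 hc
  have hlog : 0 ≤ Real.log ((n : ℝ) ^ 2 * p) := by
    apply Real.log_nonneg
    have : (1 : ℝ) ≤ n * p := (Real.one_le_rpow hn1 (by positivity)).trans hnp
    nlinarith
  have h78 : (7 / 8) * Real.log ((n : ℝ) ^ 2 * p) ≤ lam n (l + 1) p := by nlinarith
  have hC := hC p h0 h1 hnp h78
  have hA := hA p h0 h1 hnp h78
  have hBn := hBn p h0 h1 hnp hd
  refine (pr_mono h0 h1 (B := fun s => (Qs (l + 1) s ∧ ∃ F, F.Nonempty ∧ (F.card : ℝ) ≤ (n : ℝ) ^ ε ∧ Perp (l + 1) s F) ∨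
    (BadA (l + 1) (η * (n ^ 2 * p)) s ∨ (∃ F, Perp (l + 1) s F ∧ (n : ℝ) ^ ε ≤ F.card ∧ (F.card : ℝ) ≤ η * (n ^ 2 * p) ∧
      ∀ v, 2 * deg F v ≤ deg s v))) ?_).trans ((pr_or_le h0 h1 _ _).trans ?_)
  · rintro s hs ⟨hQ, F0, hP0, hF0⟩
    obtain ⟨F, hP, hne, hmin, hdeg⟩ := reduce (by omega) hs hP0 hF0
    by_cases hBad : BadA (l + 1) (η * (n ^ 2 * p)) s
    · exact Or.inr (Or.inl hBad)
    rcases le_total (F.card : ℝ) ((n : ℝ) ^ ε) with hs1 | hs1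
    · exact Or.inl ⟨hQ, F, hne, hs1, hP⟩
    · refine Or.inr (Or.inr ⟨F, hP, hs1, ?_, hdeg⟩)
      by_contra hlt
      push Not at hlt
      exact hBad ⟨F, hP, fun A => hlt.trans_le (by exact_mod_cast hmin A)⟩
  · have := pr_or_le h0 h1 (E := KE n) (BadA (l + 1) (η * (n ^ 2 * p))) (fun s => ∃ F, Perp (l + 1) s F ∧ (n : ℝ) ^ ε ≤ F.card ∧ (F.card : ℝ) ≤ η * (n ^ 2 * p) ∧
      ∀ v, 2 * deg F v ≤ deg s v)
    linarith


lemma cyc_adj {n k : ℕ} (hk : 2 ≤ k) {x : Fin (k + 1) → Fin n} (hx : Function.Injective x) (i j : Fin (k + 1)) :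
    s(x i, x j) ∈ cycE x ↔ (cycleGraph (k + 1)).Adj i j := by
  obtain ⟨b, rfl⟩ : ∃ b, k = b + 1 := ⟨k - 1, by omega⟩
  rw [cycleGraph_adj, mem_cycE]
  constructor
  · rintro ⟨a, ha⟩
    rcases Sym2.eq_iff.1 ha with ⟨h1, h2⟩ | ⟨h1, h2⟩
    · right; rw [← hx h1, ← hx h2]; simp
    · left; rw [← hx h1, ← hx h2]; simp
  · rintro (h | h)
    · exact ⟨j, by rw [ce, ← h, add_sub_cancel, Sym2.eq_swap]⟩
    · exact ⟨i, by rw [ce, ← h, add_sub_cancel]⟩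

lemma copy_to {n k : ℕ} (hk : 2 ≤ k) {G : SimpleGraph (Fin n)} {K : G.Subgraph} (f : cycleGraph (k + 1) ≃g K.coe) :
    ∃ x : Fin (k + 1) → Fin n, Function.Injective x ∧ K.edgeSet = ↑(cycE x) := by
  have hx : Function.Injective fun i => (f i : Fin n) := fun i j h => f.injective (Subtype.ext h)
  refine ⟨_, hx, ?_⟩
  ext e
  induction e using Sym2.ind with
  | _ a b =>
    rw [Subgraph.mem_edgeSet, Finset.mem_coe]
    have key : ∀ i j, s((f i : Fin n), (f j : Fin n)) ∈ cycE (fun i => (f i : Fin n)) ↔ K.Adj (f i) (f j) := fun i j => by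
      rw [cyc_adj hk hx i j, ← f.map_adj_iff]; rfl
    constructor
    · intro h
      have := (key (f.symm ⟨a, h.fst_mem⟩) (f.symm ⟨b, h.snd_mem⟩)).2 (by simpa using h)
      simpa using this
    · intro h
      obtain ⟨i, hi⟩ := mem_cycE.1 h
      have h2 := (key i (i + 1)).1 (mem_cycE.2 ⟨i, rfl⟩)
      rcases Sym2.eq_iff.1 hi with ⟨rfl, rfl⟩ | ⟨rfl, rfl⟩
      · exact h2
      · exact h2.symm

lemma copy_from {n k : ℕ} (hk : 2 ≤ k) {s : Finset (Sym2 (Fin n))} {x : Fin (k + 1) → Fin n} (hx : Function.Injective x) (hxs : cycE x ⊆ s) :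
    ∃ K : (fromEdgeSet (s : Set (Sym2 (Fin n)))).Subgraph, Nonempty (cycleGraph (k + 1) ≃g K.coe) ∧ K.edgeSet = ↑(cycE x) := by
  refine ⟨⟨Set.range x, fun a b => s(a, b) ∈ cycE x, ?_, ?_, ⟨fun a b h => by rwa [Sym2.eq_swap]⟩⟩, ⟨⟨Equiv.ofInjective x hx, ?_⟩⟩, ?_⟩
  · intro a b h
    exact (fromEdgeSet_adj _).2 ⟨hxs h, mem_KE.1 (cycE_sub_KE (by omega) hx h)⟩
  · intro a b h
    obtain ⟨i, hi⟩ := mem_cycE.1 h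
    rcases Sym2.eq_iff.1 hi with ⟨rfl, rfl⟩ | ⟨rfl, rfl⟩
    · exact ⟨i, rfl⟩
    · exact ⟨i + 1, rfl⟩
  · intro i j
    exact cyc_adj hk hx i j
  · ext e
    induction e using Sym2.ind with
    | _ a b => rfl

lemma cyc_euler (k : ℕ) (hk : 2 ≤ k) : IsEulerianGraph (cycleGraph (k + 1)) := by
  obtain ⟨b, rfl⟩ : ∃ b, k = b + 2 := ⟨k - 2, by omega⟩
  intro v
  rw [Nat.card_eq_fintype_card, card_neighborSet_eq_degree]
  have := cycleGraph_degree_three_le (v := v)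
  have h2 : (cycleGraph (b + 2 + 1)).degree v = 2 := by convert this
  rw [h2]; decide

lemma cyc_ecount (k : ℕ) (hk : 2 ≤ k) : eCount (cycleGraph (k + 1)) = k + 1 := by
  have : (cycleGraph (k + 1)).edgeSet = ↑(cycE (id : Fin (k + 1) → Fin (k + 1))) := by
    ext e
    induction e using Sym2.ind with
    | _ a b => rw [mem_edgeSet, Finset.mem_coe]; exact (cyc_adj hk Function.injective_id a b).symm
  rw [eCount, this, Nat.card_coe_set_eq, Set.ncard_coe_finset, card_cycE hk Function.injective_id]

lemma parity_edge {n : ℕ} {a b : Fin n} (h : a ≠ b) (v : Fin n) :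
    parityMap v (setVec {s(a, b)}) = (if v = a then 1 else 0) + (if v = b then 1 else 0) := by
  change ∑ w ∈ Finset.univ.erase v, setVec {s(a, b)} s(v, w) = _
  by_cases h1 : v = a
  · subst h1
    rw [Finset.sum_eq_single b]
    · simp [setVec, h]
    · intro w _ hw
      refine setVec_notMem fun hh => ?_
      rcases Sym2.eq_iff.1 hh with ⟨-, e⟩ | ⟨e, e2⟩
      · exact hw e
      · exact h e
    · intro hh; simp [h.symm] at hh
  by_cases h2 : v = b
  · subst h2
    rw [Finset.sum_eq_single a]
    · simp [setVec, h1]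
    · intro w _ hw
      refine setVec_notMem fun hh => ?_
      rcases Sym2.eq_iff.1 hh with ⟨e, -⟩ | ⟨-, e2⟩
      · exact h1 e
      · exact hw e2
    · intro hh; simp [h] at hh
  · rw [Finset.sum_eq_zero]
    · simp [h1, h2]
    · intro w _
      refine setVec_notMem fun hh => ?_
      rcases Sym2.eq_iff.1 hh with ⟨e, -⟩ | ⟨e, -⟩
      · exact h1 e
      · exact h2 e

lemma setVec_finset {n : ℕ} (X : Finset (Sym2 (Fin n))) : setVec (X : Set (Sym2 (Fin n))) = ∑ e ∈ X, setVec {e} := by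
  ext a
  rw [Finset.sum_apply]
  simp [setVec]

lemma hSpace_le {n k : ℕ} (hk : 2 ≤ k) (G : SimpleGraph (Fin n)) : hSpace (cycleGraph (k + 1)) G ≤ cycleSpace G := by
  refine Submodule.span_le.2 ?_
  rintro f ⟨K, ⟨g⟩, rfl⟩
  obtain ⟨x, hx, hK⟩ := copy_to hk g
  have hsub : ∀ e ∈ cycE x, e ∈ G.edgeSet := fun e he => K.edgeSet_subset (by rw [hK]; exact he)
  rw [hK, setVec_finset]
  refine ⟨Submodule.sum_mem _ fun e he => Submodule.subset_span ⟨e, hsub e he, rfl⟩, ?_⟩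
  simp only [SetLike.mem_coe, Submodule.mem_iInf, LinearMap.mem_ker]
  intro v
  rw [map_sum, sum_cycE hk hx]
  have : ∀ i, x i ≠ x (i + 1) := fun i => mem_KE.1 (cycE_sub_KE (by omega) hx (mem_cycE.2 ⟨i, rfl⟩))
  refine (Finset.sum_congr rfl fun i _ => parity_edge (this i) v).trans ?_
  exact sum_cyc fun i => if v = x i then (1 : ZMod 2) else 0

lemma notT_perp {n k : ℕ} (hk : 2 ≤ k) (hke : Even k) {s : Finset (Sym2 (Fin n))} (hs : s ⊆ KE n)
    (h : ¬ memT (cycleGraph (k + 1)) (fromEdgeSet (s : Set (Sym2 (Fin n))))) : ∃ F, Perp k s F ∧ ∀ A, F ≠ cut s A := by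
  set G := fromEdgeSet (s : Set (Sym2 (Fin n))) with hG
  have hE : ∀ e, e ∈ G.edgeSet ↔ e ∈ s := by
    intro e
    rw [hG, edgeSet_fromEdgeSet]
    simp only [Set.mem_diff, Finset.mem_coe]
    exact ⟨fun h => h.1, fun h => ⟨h, by have := hs h; simpa [KE] using this⟩⟩
  rw [memT, wSpace, if_pos (cyc_euler k hk), if_pos (by rw [cyc_ecount k hk]; exact hke.add_one)] at h
  obtain ⟨c, hc, hc2⟩ := Set.not_subset.1 fun h' => h (le_antisymm (hSpace_le hk G) h')
  obtain ⟨φ, hφ, hker⟩ := Submodule.exists_le_ker_of_notMem hc2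
  set F : Finset (Sym2 (Fin n)) := s.filter fun e => φ (setVec {e}) = 1 with hF
  have hz : ∀ a : ZMod 2, a ≠ 1 → a = 0 := by decide
  have hval : ∀ e ∈ s, φ (setVec {e}) = setVec (F : Set (Sym2 (Fin n))) e := by
    intro e he
    by_cases h1 : φ (setVec {e}) = 1
    · rw [h1, setVec_mem]; exact Finset.mem_filter.2 ⟨he, h1⟩
    · rw [hz _ h1, setVec_notMem]; exact fun hh => h1 (Finset.mem_filter.1 hh).2
  refine ⟨F, ⟨Finset.filter_subset _ _, fun x hx hxs => ?_⟩, fun A hA => hφ ?_⟩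
  · rw [even_inter, ← Finset.sum_congr rfl fun e he => hval e (hxs he), ← map_sum, ← setVec_finset]
    obtain ⟨K, hK, hKe⟩ := copy_from hk hx hxs
    exact hker (Submodule.subset_span ⟨K, hK, by rw [hKe]⟩)
  · have heq : Set.EqOn φ (∑ v ∈ A, parityMap v : EdgeVec (Fin n) →ₗ[ZMod 2] ZMod 2) {f | ∃ e ∈ G.edgeSet, f = setVec {e}} := by
      rintro f ⟨e, he, rfl⟩
      have he := (hE e).1 he
      rw [hval e he, hA, LinearMap.sum_apply]
      have hd := hs he
      induction e using Sym2.ind with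
      | _ a b =>
        rw [setVec_cut he, Finset.sum_congr rfl fun v _ => parity_edge (mem_KE.1 hd) v, Finset.sum_add_distrib]
        simp [az]
    rw [LinearMap.eqOn_span' heq hc.1, LinearMap.sum_apply]
    refine Finset.sum_eq_zero fun v _ => ?_
    have := hc.2
    simp only [SetLike.mem_coe, Submodule.mem_iInf, LinearMap.mem_ker] at this
    exact this v

lemma Q_Qs {n k : ℕ} (hk : 2 ≤ k) {s : Finset (Sym2 (Fin n))} (hs : s ⊆ KE n)
    (h : memQ (cycleGraph (k + 1)) (fromEdgeSet (s : Set (Sym2 (Fin n))))) : Qs k s := by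
  intro e he
  have hd := hs he
  have he' : e ∈ (fromEdgeSet (s : Set (Sym2 (Fin n)))).edgeSet := by
    rw [edgeSet_fromEdgeSet]; exact ⟨he, by simpa [KE] using hd⟩
  obtain ⟨K, ⟨g⟩, hK⟩ := h e he'
  obtain ⟨x, hx, hKx⟩ := copy_to hk g
  refine ⟨x, hx, fun a ha => ?_, by rw [hKx] at hK; exact hK⟩
  have := K.edgeSet_subset (show a ∈ K.edgeSet by rw [hKx]; exact ha)
  rw [edgeSet_fromEdgeSet] at this
  exact this.1

lemma erProb_eq (n : ℕ) (p : ℝ) (A : Set (SimpleGraph (Fin n))) :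
    erProb n p A = pr (KE n) p (fun s => fromEdgeSet (s : Set (Sym2 (Fin n))) ∈ A) := by
  have : KE n = (⊤ : SimpleGraph (Fin n)).edgeFinset := by
    ext e; induction e using Sym2.ind with
    | _ a b => simp [mem_KE]
  rw [erProb, pr, ex, this]
  refine Finset.sum_congr (by congr!) fun s _ => ?_
  split_ifs with h
  · rw [ind_true h, mul_one]
  · rw [ind_false h, mul_zero]

/-- Theorem 1.2: for every fixed odd cycle `H`,
`max_p P(G_{n,p} ∈ Q_H ∖ T_H) → 0`. -/
theorem stmt1 (κ : ℕ) (hκodd : Odd κ) (hκ3 : 3 ≤ κ)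
    (p : ℕ → ℝ) (hp : ∀ n, p n ∈ Set.Icc (0 : ℝ) 1) :
    Filter.Tendsto
      (fun n => erProb n (p n)
        {G | memQ (SimpleGraph.cycleGraph κ) G ∧ ¬ memT (SimpleGraph.cycleGraph κ) G})
      Filter.atTop (nhds 0) := by
  obtain ⟨l, rfl⟩ : ∃ l, κ = l + 1 + 1 := ⟨κ - 2, by omega⟩
  have hke : Even (l + 1) := by
    rcases hκodd with ⟨m, hm⟩
    exact ⟨m, by omega⟩
  rw [Metric.tendsto_atTop]
  intro ε hε
  obtain ⟨N, hN⟩ := eventually_atTop.1 (bad_main l (by omega) hke (ε / 2) (by positivity))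
  refine ⟨N, fun n hn => ?_⟩
  obtain ⟨h0, h1⟩ := hp n
  rw [erProb_eq, Real.dist_eq, sub_zero, abs_of_nonneg (pr_nonneg h0 h1 _)]
  refine lt_of_le_of_lt ((pr_mono h0 h1 ?_).trans (hN n hn (p n) h0 h1)) (by linarith)
  rintro s hs ⟨hQ, hT⟩
  exact ⟨Q_Qs (by omega) hs hQ, notT_perp (by omega) hke hs hT⟩

end RG
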